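/- Assume Hypotheses 1–3. For every x ∈ 𝕏, y ∈ ℝ, integers l ≥ 1, m ≥ 1, and every function g : 𝕏^{l+m} × [0,∞) → [0,∞) such that z ↦ g(x₁,…,x_{l+m},z) is continuous for each tuple and such that for some ε > 0, max over tuples of sup_{z≥0} g(x₁,…,x_{l+m},z)·(1+z)^{2+ε} is finite, one has lim_{n→∞} n^{3/2}·𝔼_x( g(X₁,…,X_l, X_{n−m+1},…,X_n, y+S_n) ; τ_y > n ) = (2/(√(2π)σ³)) · ∫₀^{∞} ∑_{x*∈𝕏} 𝔼_{x,x*}( g(X₁,…,X_l, X*_m,…,X*₁, z) · V(X_l, y+S_l) · V*(X*_m, z+S*_m) ; τ_y > l , τ*_z > m ) ν(x*) dz. -/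

import Mathlib

open Finset Filter Real Topology MeasureTheory

namespace CLLT

variable {X : Type*}

/-- Product of the transition weights along a path. -/
noncomputable def wt (P : X → X → ℝ) : X → List X → ℝ
  | _, [] => 1
  | x, y :: ys => P x y * wt P y ys

/-- Extension of a finite path `X₁, …, Xₙ` to a trajectory `ℕ → X` with `X₀ = x`
(values beyond time `n` are irrelevant and set to `x`). -/
def pathExt (x : X) {n : ℕ} (path : Fin n → X) : ℕ → X := fun k =>
  if h : 1 ≤ k ∧ k ≤ n then path ⟨k - 1, by omega⟩ else x

/-- Expectation `𝔼_x (F (X₀, X₁, …))` of a functional of the first `n` steps of the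
Markov chain with transition kernel `P` started at `X₀ = x`. -/
noncomputable def Ex [Fintype X] (P : X → X → ℝ) (x : X) (n : ℕ)
    (F : (ℕ → X) → ℝ) : ℝ :=
  ∑ path : Fin n → X, wt P x (List.ofFn path) * F (pathExt x path)

open Classical in
/-- Real-valued indicator of a proposition. -/
noncomputable def ind (p : Prop) : ℝ := if p then 1 else 0

/-- Partial sum `S_k = f(X₁) + ⋯ + f(X_k)` along a trajectory. -/
noncomputable def Spath (f : X → ℝ) (ω : ℕ → X) (k : ℕ) : ℝ :=
  ∑ i ∈ Finset.Icc 1 k, f (ω i)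

/-- The event `τ_y > n`, i.e. `y + S_k > 0` for all `k = 1, …, n`. -/
def survives (f : X → ℝ) (y : ℝ) (n : ℕ) (ω : ℕ → X) : Prop :=
  ∀ k ∈ Finset.Icc 1 n, 0 < y + Spath f ω k

/-- `n`-step transition kernel. -/
noncomputable def kpow [Fintype X] [DecidableEq X] (P : X → X → ℝ) : ℕ → X → X → ℝ
  | 0 => fun x x' => if x = x' then 1 else 0
  | n + 1 => fun x x' => ∑ y, P x y * kpow P n y x'

/-- Transition operator acting on functions. -/
noncomputable def Pop [Fintype X] (P : X → X → ℝ) (g : X → ℝ) (x : X) : ℝ :=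
  ∑ x', P x x' * g x'

/-- Asymptotic variance `σ² = ν(f²) + 2 ∑_{n ≥ 1} ν(f ⬝ Pⁿ f)`. -/
noncomputable def sigma2 [Fintype X] (P : X → X → ℝ) (ν f : X → ℝ) : ℝ :=
  (∑ x, f x ^ 2 * ν x) + 2 * ∑' n : ℕ, ∑ x, f x * ((Pop P)^[n + 1] f) x * ν x

/-- Hypothesis 1 (primitivity). -/
def Primitive [Fintype X] [DecidableEq X] (P : X → X → ℝ) : Prop :=
  ∃ k₀ : ℕ, 1 ≤ k₀ ∧ ∀ x x', 0 < kpow P k₀ x x'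

/-- Hypothesis 3 (non-lattice condition). -/
def NonLattice [Fintype X] (P : X → X → ℝ) (f : X → ℝ) : Prop :=
  ∀ θ a : ℝ, ∃ (n : ℕ) (g : Fin (n + 1) → X),
    (0 < ∏ i : Fin (n + 1), P (g i) (g (i + 1))) ∧
    ∀ m : ℤ, (∑ i, f (g i)) - (n + 1 : ℝ) * θ ≠ a * (m : ℝ)

/-- `P` is a stochastic matrix and `ν` is a positive invariant probability for it. -/
structure IsStochastic [Fintype X] (P : X → X → ℝ) (ν : X → ℝ) : Prop where
  nonneg : ∀ x x', 0 ≤ P x x'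
  rowSum : ∀ x, ∑ x', P x x' = 1
  nuPos : ∀ x, 0 < ν x
  nuSum : ∑ x, ν x = 1
  nuInv : ∀ x', ∑ x, ν x * P x x' = ν x'

/-- Dual kernel `P*(x, x') = ν(x') P(x', x) / ν(x)`. -/
noncomputable def dualK (P : X → X → ℝ) (ν : X → ℝ) (x x' : X) : ℝ :=
  ν x' * P x' x / ν x

/-- Sup norm of a function on a finite set. -/
noncomputable def supN [Fintype X] [Nonempty X] (ψ : X → ℝ) : ℝ := ⨆ x, |ψ x|

/-- Rayleigh density `φ₊(t) = t e^{-t²/2} 𝟙_{t ≥ 0}`. -/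
noncomputable def rayleigh (t : ℝ) : ℝ := if 0 ≤ t then t * Real.exp (-t ^ 2 / 2) else 0

/-- Centred normal density with standard deviation `s`. -/
noncomputable def gauss (s u : ℝ) : ℝ :=
  Real.exp (-u ^ 2 / (2 * s ^ 2)) / (s * Real.sqrt (2 * π))

/-- Perturbed transition operator `P_t`, as a complex matrix. -/
noncomputable def Pmat [Fintype X] (P : X → X → ℝ) (f : X → ℝ) (t : ℝ) : Matrix X X ℂ :=
  Matrix.of fun x x' => (P x x' : ℂ) * Complex.exp (Complex.I * (t : ℂ) * (f x' : ℂ))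

/-- A complex matrix viewed as a continuous linear operator on `X → ℂ`
(equipped with the sup norm). -/
noncomputable def toCLM [Fintype X] (M : Matrix X X ℂ) : (X → ℂ) →L[ℂ] (X → ℂ) :=
  LinearMap.toContinuousLinearMap M.mulVecLin

/-- Fourier transform `ĥ(t) = ∫ e^{-i t u} h(u) du`. -/
noncomputable def FT (h : ℝ → ℝ) (t : ℝ) : ℂ :=
  ∫ u : ℝ, Complex.exp (-(Complex.I * (t : ℂ) * (u : ℂ))) * (h u : ℂ)

/-- Convolution `(g ∗ k)(u) = ∫ g(v) k(u - v) dv`. -/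
noncomputable def convR (g k : ℝ → ℝ) (u : ℝ) : ℝ := ∫ v : ℝ, g v * k (u - v)

/-- Stone's kernel `κ`. -/
noncomputable def kapp (u : ℝ) : ℝ :=
  if u = 0 then 1 / (2 * π) else (Real.sin (u / 2) / (u / 2)) ^ 2 / (2 * π)

/-- Scaled kernel `κ_δ(u) = κ(u/δ)/δ`. -/
noncomputable def kappD (δ u : ℝ) : ℝ := kapp (u / δ) / δ

/-- Upper regularisation `h̄_ε(u) = sup_{v ∈ [u-ε, u+ε]} h(v)`. -/
noncomputable def upReg (h : ℝ → ℝ) (ε u : ℝ) : ℝ := sSup (h '' Set.Icc (u - ε) (u + ε))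

/-- Lower regularisation `ẖ_ε(u) = inf_{v ∈ [u-ε, u+ε]} h(v)`. -/
noncomputable def loReg (h : ℝ → ℝ) (ε u : ℝ) : ℝ := sInf (h '' Set.Icc (u - ε) (u + ε))

/-- The class `𝓗_ε`: non-negative, locally bounded, with `h`, `h̄_ε`, `ẖ_ε`
measurable and Lebesgue integrable. -/
def MemH (ε : ℝ) (h : ℝ → ℝ) : Prop :=
  (∀ u, 0 ≤ h u) ∧ (∀ K : Set ℝ, IsCompact K → BddAbove (h '' K)) ∧
  Measurable h ∧ Measurable (upReg h ε) ∧ Measurable (loReg h ε) ∧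
  Integrable h ∧ Integrable (upReg h ε) ∧ Integrable (loReg h ε)

set_option linter.unusedSectionVars false

/-! Operators -/

/-- Free transition operator on functions of (state, position). -/
noncomputable def Uop [Fintype X] (P : X → X → ℝ) (f : X → ℝ) (φ : X → ℝ → ℝ) : X → ℝ → ℝ :=
  fun x y => ∑ x', P x x' * φ x' (y + f x')

/-- Restriction to positive positions. -/
noncomputable def chi (φ : X → ℝ → ℝ) : X → ℝ → ℝ := fun x y => if 0 < y then φ x y else 0

/-- Operator killed after the step. -/
noncomputable def Kop [Fintype X] (P : X → X → ℝ) (f : X → ℝ) (φ : X → ℝ → ℝ) : X → ℝ → ℝ :=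
  Uop P f (chi φ)

/-- Operator killed before the step. -/
noncomputable def Lop [Fintype X] (P : X → X → ℝ) (f : X → ℝ) (φ : X → ℝ → ℝ) : X → ℝ → ℝ :=
  chi (Uop P f φ)

/-- Standing hypotheses. -/
structure Good [Fintype X] [DecidableEq X] (P : X → X → ℝ) (ν f : X → ℝ) : Prop where
  st : IsStochastic P ν
  pr : Primitive P
  cen : ∑ x, f x * ν x = 0
  nl : NonLattice P f

section basic
variable [Fintype X] {P : X → X → ℝ} {f : X → ℝ}

lemma Uop_add (φ ψ : X → ℝ → ℝ) : Uop P f (φ + ψ) = Uop P f φ + Uop P f ψ := by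
  funext x y; simp [Uop, mul_add, Finset.sum_add_distrib]

lemma Uop_smul (c : ℝ) (φ : X → ℝ → ℝ) : Uop P f (c • φ) = c • Uop P f φ := by
  funext x y; simp [Uop, Finset.mul_sum, mul_left_comm]

lemma chi_add (φ ψ : X → ℝ → ℝ) : chi (φ + ψ) = chi φ + chi ψ := by
  funext x y; simp only [chi, Pi.add_apply]; split_ifs <;> simp

lemma chi_smul (c : ℝ) (φ : X → ℝ → ℝ) : chi (c • φ) = c • chi φ := by
  funext x y; simp only [chi, Pi.smul_apply, smul_eq_mul]; split_ifs <;> simp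

lemma chi_chi (φ : X → ℝ → ℝ) : chi (chi φ) = chi φ := by
  funext x y; simp only [chi]; split_ifs <;> rfl

/-- Iterated operator as linear maps. -/
noncomputable def UL (P : X → X → ℝ) (f : X → ℝ) : (X → ℝ → ℝ) →ₗ[ℝ] (X → ℝ → ℝ) where
  toFun := Uop P f
  map_add' := Uop_add
  map_smul' := Uop_smul

noncomputable def KL (P : X → X → ℝ) (f : X → ℝ) : (X → ℝ → ℝ) →ₗ[ℝ] (X → ℝ → ℝ) where
  toFun := Kop P f
  map_add' := fun φ ψ => by simp only [Kop, chi_add, Uop_add]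
  map_smul' := fun φ ψ => by simp only [Kop, chi_smul, Uop_smul, RingHom.id_apply]

noncomputable def LL (P : X → X → ℝ) (f : X → ℝ) : (X → ℝ → ℝ) →ₗ[ℝ] (X → ℝ → ℝ) where
  toFun := Lop P f
  map_add' := fun φ ψ => by simp only [Lop, chi_add, Uop_add]
  map_smul' := fun φ ψ => by simp only [Lop, chi_smul, Uop_smul, RingHom.id_apply]

lemma UL_apply (φ : X → ℝ → ℝ) (x : X) (y : ℝ) :
    UL P f φ x y = ∑ x', P x x' * φ x' (y + f x') := rfl
lemma KL_apply (φ : X → ℝ → ℝ) (x : X) (y : ℝ) :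
    KL P f φ x y = ∑ x', P x x' * (if 0 < y + f x' then φ x' (y + f x') else 0) := rfl
lemma LL_apply (φ : X → ℝ → ℝ) (x : X) (y : ℝ) :
    LL P f φ x y = if 0 < y then ∑ x', P x x' * φ x' (y + f x') else 0 := rfl

lemma KL_eq (φ : X → ℝ → ℝ) : KL P f φ = UL P f (chi φ) := rfl
lemma LL_eq (φ : X → ℝ → ℝ) : LL P f φ = chi (UL P f φ) := rfl

lemma KL_chi (φ : X → ℝ → ℝ) : KL P f (chi φ) = KL P f φ := by
  rw [KL_eq, KL_eq, chi_chi]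

lemma KL_pow_succ (n : ℕ) (φ : X → ℝ → ℝ) : (KL P f ^ (n + 1)) φ = KL P f ((KL P f ^ n) φ) := by
  rw [pow_succ']; rfl
lemma KL_pow_succ' (n : ℕ) (φ : X → ℝ → ℝ) : (KL P f ^ (n + 1)) φ = (KL P f ^ n) (KL P f φ) := by
  rw [pow_succ]; rfl
lemma UL_pow_succ (n : ℕ) (φ : X → ℝ → ℝ) : (UL P f ^ (n + 1)) φ = UL P f ((UL P f ^ n) φ) := by
  rw [pow_succ']; rfl
lemma UL_pow_succ' (n : ℕ) (φ : X → ℝ → ℝ) : (UL P f ^ (n + 1)) φ = (UL P f ^ n) (UL P f φ) := by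
  rw [pow_succ]; rfl
lemma LL_pow_succ' (n : ℕ) (φ : X → ℝ → ℝ) : (LL P f ^ (n + 1)) φ = (LL P f ^ n) (LL P f φ) := by
  rw [pow_succ]; rfl
lemma LL_pow_succ (n : ℕ) (φ : X → ℝ → ℝ) : (LL P f ^ (n + 1)) φ = LL P f ((LL P f ^ n) φ) := by
  rw [pow_succ']; rfl
lemma KL_pow_add (m n : ℕ) (φ : X → ℝ → ℝ) :
    (KL P f ^ (m + n)) φ = (KL P f ^ m) ((KL P f ^ n) φ) := by
  rw [pow_add]; rfl
lemma UL_pow_add (m n : ℕ) (φ : X → ℝ → ℝ) :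
    (UL P f ^ (m + n)) φ = (UL P f ^ m) ((UL P f ^ n) φ) := by
  rw [pow_add]; rfl

/-- `χ Kⁿ φ = Lⁿ φ` if `χ φ = φ`. -/
lemma chi_KL_pow (n : ℕ) (φ : X → ℝ → ℝ) (h : chi φ = φ) :
    chi ((KL P f ^ n) φ) = (LL P f ^ n) φ := by
  induction n with
  | zero => simpa using h
  | succ n ih => rw [KL_pow_succ, LL_pow_succ, ← ih, KL_eq, LL_eq]

/-- `K^{k+m} φ = K^k L^m φ` for `k ≥ 1`, `χ φ = φ`. -/
lemma KL_pow_LL (k m : ℕ) (hk : 1 ≤ k) (φ : X → ℝ → ℝ) (h : chi φ = φ) :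
    (KL P f ^ (k + m)) φ = (KL P f ^ k) ((LL P f ^ m) φ) := by
  obtain ⟨k, rfl⟩ : ∃ j, k = j + 1 := ⟨k - 1, by omega⟩
  rw [KL_pow_add, KL_pow_succ', KL_pow_succ', ← KL_chi, chi_KL_pow _ _ h]


/-- Monotonicity of the killed operator, comparing on positive positions only. -/
lemma KL_mono (hP : ∀ x x', 0 ≤ P x x') {φ ψ : X → ℝ → ℝ} (h : ∀ x y, 0 < y → φ x y ≤ ψ x y) (x : X) (y : ℝ) :
    KL P f φ x y ≤ KL P f ψ x y := by
  rw [KL_apply, KL_apply]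
  refine Finset.sum_le_sum fun x' _ => mul_le_mul_of_nonneg_left ?_ (hP _ _)
  split_ifs with hh
  · exact h _ _ hh
  · exact le_rfl

lemma KL_pow_mono (hP : ∀ x x', 0 ≤ P x x') {φ ψ : X → ℝ → ℝ} (h : ∀ x y, 0 < y → φ x y ≤ ψ x y) (n : ℕ) (x : X) (y : ℝ)
    (hy : 0 < y) : (KL P f ^ n) φ x y ≤ (KL P f ^ n) ψ x y := by
  induction n generalizing x y with
  | zero => exact h _ _ hy
  | succ n ih =>
    rw [KL_pow_succ, KL_pow_succ]
    exact KL_mono hP (fun x y hy => ih x y hy) x y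

lemma UL_mono (hP : ∀ x x', 0 ≤ P x x') {φ ψ : X → ℝ → ℝ} (h : ∀ x y, φ x y ≤ ψ x y) (x : X) (y : ℝ) :
    UL P f φ x y ≤ UL P f ψ x y := by
  rw [UL_apply, UL_apply]
  exact Finset.sum_le_sum fun x' _ => mul_le_mul_of_nonneg_left (h _ _) (hP _ _)

lemma UL_pow_mono (hP : ∀ x x', 0 ≤ P x x') {φ ψ : X → ℝ → ℝ} (h : ∀ x y, φ x y ≤ ψ x y) (n : ℕ) (x : X) (y : ℝ) :
    (UL P f ^ n) φ x y ≤ (UL P f ^ n) ψ x y := by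
  induction n generalizing x y with
  | zero => exact h _ _
  | succ n ih =>
    rw [UL_pow_succ, UL_pow_succ]
    exact UL_mono hP (fun x y => ih x y) x y

lemma UL_pow_nonneg (hP : ∀ x x', 0 ≤ P x x') {φ : X → ℝ → ℝ} (h : ∀ x y, 0 ≤ φ x y) (n : ℕ) (x : X) (y : ℝ) :
    0 ≤ (UL P f ^ n) φ x y := by
  have := UL_pow_mono (f := f) hP (φ := 0) (ψ := φ) h n x y
  simpa using this

lemma KL_pow_nonneg (hP : ∀ x x', 0 ≤ P x x') {φ : X → ℝ → ℝ} (h : ∀ x y, 0 < y → 0 ≤ φ x y) (n : ℕ) (x : X) (y : ℝ)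
    (hy : 0 < y) : 0 ≤ (KL P f ^ n) φ x y := by
  have := KL_pow_mono (f := f) hP (φ := 0) (ψ := φ) h n x y hy
  simpa using this

/-- `K^n φ` only depends on `φ` on positive positions. -/
lemma KL_pow_congr (hP : ∀ x x', 0 ≤ P x x') {φ ψ : X → ℝ → ℝ} (h : ∀ x y, 0 < y → φ x y = ψ x y) (n : ℕ) (x : X) (y : ℝ)
    (hy : 0 < y) : (KL P f ^ n) φ x y = (KL P f ^ n) ψ x y :=
  le_antisymm (KL_pow_mono hP (fun x y hy => (h x y hy).le) n x y hy)
    (KL_pow_mono hP (fun x y hy => (h x y hy).ge) n x y hy)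

lemma KL_pow_le_UL_pow (hP : ∀ x x', 0 ≤ P x x') {φ : X → ℝ → ℝ} (h : ∀ x y, 0 ≤ φ x y) (n : ℕ) (x : X) (y : ℝ) :
    (KL P f ^ n) φ x y ≤ (UL P f ^ n) φ x y := by
  induction n generalizing x y with
  | zero => exact le_rfl
  | succ n ih =>
    rw [KL_pow_succ, UL_pow_succ, KL_apply, UL_apply]
    refine Finset.sum_le_sum fun x' _ => mul_le_mul_of_nonneg_left ?_ (hP _ _)
    split_ifs with hh
    · exact ih _ _
    · exact UL_pow_nonneg hP h n _ _

lemma KL_pow_abs_le (hP : ∀ x x', 0 ≤ P x x') {φ ψ : X → ℝ → ℝ} (h : ∀ x y, 0 < y → |φ x y| ≤ ψ x y) (n : ℕ) (x : X) (y : ℝ)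
    (hy : 0 < y) : |(KL P f ^ n) φ x y| ≤ (KL P f ^ n) ψ x y := by
  rw [abs_le]
  constructor
  · have := KL_pow_mono (f := f) hP (φ := -ψ) (ψ := φ)
      (fun x y hy => (abs_le.1 (h x y hy)).1) n x y hy
    simpa using this
  · exact KL_pow_mono hP (fun x y hy => (abs_le.1 (h x y hy)).2) n x y hy

end basic

/-- Survival probability. -/
noncomputable def sv [Fintype X] (P : X → X → ℝ) (f : X → ℝ) (n : ℕ) (x : X) (y : ℝ) : ℝ :=
  (KL P f ^ n) (fun _ _ => 1) x y

section sv
variable [Fintype X] {P : X → X → ℝ} {f : X → ℝ}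

lemma sv_zero (x : X) (y : ℝ) : sv P f 0 x y = 1 := rfl
lemma sv_succ (n : ℕ) (x : X) (y : ℝ) :
    sv P f (n + 1) x y = ∑ x', P x x' * (if 0 < y + f x' then sv P f n x' (y + f x') else 0) := by
  unfold sv; rw [KL_pow_succ, KL_apply]


lemma sv_nonneg (hP : ∀ x x', 0 ≤ P x x') (n : ℕ) (x : X) (y : ℝ) : 0 ≤ sv P f n x y := by
  induction n generalizing x y with
  | zero => simp [sv_zero]
  | succ n ih =>
    rw [sv_succ]
    refine Finset.sum_nonneg fun x' _ => mul_nonneg (hP _ _) ?_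
    split_ifs
    · exact ih _ _
    · exact le_rfl

lemma sv_mono_y (hP : ∀ x x', 0 ≤ P x x') (n : ℕ) (x : X) {y y' : ℝ} (h : y ≤ y') : sv P f n x y ≤ sv P f n x y' := by
  induction n generalizing x y y' with
  | zero => simp [sv_zero]
  | succ n ih =>
    rw [sv_succ, sv_succ]
    refine Finset.sum_le_sum fun x' _ => mul_le_mul_of_nonneg_left ?_ (hP _ _)
    split_ifs with h1 h2
    · exact ih _ (by linarith)
    · linarith
    · exact sv_nonneg hP _ _ _
    · exact le_rfl

lemma sv_le_one (hP : ∀ x x', 0 ≤ P x x') (h1 : ∀ x, ∑ x', P x x' = 1) (n : ℕ) (x : X) (y : ℝ) : sv P f n x y ≤ 1 := by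
  induction n generalizing x y with
  | zero => simp [sv_zero]
  | succ n ih =>
    rw [sv_succ, ← h1 x]
    refine Finset.sum_le_sum fun x' _ => ?_
    refine (mul_le_mul_of_nonneg_left ?_ (hP _ _)).trans (mul_one _).le
    split_ifs
    · exact ih _ _
    · exact zero_le_one

lemma sv_succ_le (hP : ∀ x x', 0 ≤ P x x') (h1 : ∀ x, ∑ x', P x x' = 1) (n : ℕ) (x : X) (y : ℝ) : sv P f (n + 1) x y ≤ sv P f n x y := by
  induction n generalizing x y with
  | zero => exact sv_le_one hP h1 _ _ _
  | succ n ih =>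
    rw [sv_succ, sv_succ n]
    refine Finset.sum_le_sum fun x' _ => mul_le_mul_of_nonneg_left ?_ (hP _ _)
    split_ifs
    · exact ih _ _
    · exact le_rfl

/-- `|Kⁿ φ| ≤ C · survival` if `|φ| ≤ C` on positive positions. -/
lemma KL_pow_le_sv (hP : ∀ x x', 0 ≤ P x x') {φ : X → ℝ → ℝ} {C : ℝ} (h : ∀ x y, 0 < y → |φ x y| ≤ C)
    (n : ℕ) (x : X) (y : ℝ) (hy : 0 < y) : |(KL P f ^ n) φ x y| ≤ C * sv P f n x y := by
  refine (KL_pow_abs_le hP (ψ := C • (fun _ _ => (1 : ℝ))) (by simpa using h) n x y hy).trans ?_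
  rw [map_smul]; rfl

lemma UL_pow_const (hP : ∀ x x', 0 ≤ P x x') (h1 : ∀ x, ∑ x', P x x' = 1) (c : ℝ) (n : ℕ) : (UL P f ^ n) (fun _ _ => c) = fun _ _ => c := by
  induction n with
  | zero => rfl
  | succ n ih => rw [UL_pow_succ, ih]; funext x y; rw [UL_apply, ← Finset.sum_mul, h1, one_mul]

lemma UL_pow_abs_le (hP : ∀ x x', 0 ≤ P x x') (h1 : ∀ x, ∑ x', P x x' = 1) {φ : X → ℝ → ℝ} {C : ℝ} (h : ∀ x y, |φ x y| ≤ C)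
    (n : ℕ) (x : X) (y : ℝ) : |(UL P f ^ n) φ x y| ≤ C := by
  rw [abs_le]
  constructor
  · have := UL_pow_mono (f := f) hP (φ := fun _ _ => -C) (ψ := φ)
      (fun x y => (abs_le.1 (h x y)).1) n x y
    rwa [UL_pow_const hP h1] at this
  · have := UL_pow_mono (f := f) hP (φ := φ) (ψ := fun _ _ => C)
      (fun x y => (abs_le.1 (h x y)).2) n x y
    rwa [UL_pow_const hP h1] at this

end sv

set_option linter.unusedSectionVars false

/-! Poisson equation, variance -/

lemma decay_of_step (u : ℕ → ℝ) (hu0 : ∀ n, 0 ≤ u n) (hu : ∀ n, u (n + 1) ≤ u n) (N : ℕ)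
    (hN : 1 ≤ N) (c : ℝ) (hc : 0 ≤ c) (h : ∀ n, u (n + N) ≤ exp (-c) * u n) (n : ℕ) :
    u n ≤ exp c * exp (-c * n / N) * u 0 := by
  have hanti : Antitone u := antitone_nat_of_succ_le hu
  have hNpos : (0 : ℝ) < N := by exact_mod_cast hN
  induction n using Nat.strong_induction_on with
  | _ n ih =>
    by_cases hn : n < N
    · have h1 : u n ≤ u 0 := hanti (Nat.zero_le _)
      have h2 : 1 ≤ exp c * exp (-c * n / N) := by
        rw [← exp_add, one_le_exp_iff]
        have : (n : ℝ) / N ≤ 1 := by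
          rw [div_le_one hNpos]; exact_mod_cast hn.le
        have h3 : c * (n / N) ≤ c := by nlinarith
        have h4 : -c * n / N = -(c * (n / N)) := by ring
        rw [h4]; linarith
      nlinarith [hu0 0]
    · push Not at hn
      obtain ⟨k, rfl⟩ : ∃ k, n = k + N := ⟨n - N, by omega⟩
      have h1 := ih k (by omega)
      refine (h k).trans ?_
      calc exp (-c) * u k ≤ exp (-c) * (exp c * exp (-c * k / N) * u 0) := by gcongr
        _ = exp c * exp (-c * (k + N : ℕ) / N) * u 0 := by
          have : -c * ((k + N : ℕ) : ℝ) / N = -c + -c * k / N := by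
            push_cast; field_simp; ring
          rw [this, exp_add]; ring

section poisson
variable [Fintype X] [DecidableEq X] [Nonempty X] {P : X → X → ℝ} {ν f : X → ℝ}

lemma Pop_iter_eq (n : ℕ) (g : X → ℝ) (x : X) :
    ((Pop P)^[n] g) x = ∑ x', kpow P n x x' * g x' := by
  induction n generalizing x with
  | zero => simp [kpow]
  | succ n ih =>
    rw [Function.iterate_succ_apply', Pop]
    simp only [ih, kpow, Finset.sum_mul, Finset.mul_sum]
    rw [Finset.sum_comm]
    simp only [mul_assoc]

lemma kpow_nonneg (hS : IsStochastic P ν) (n : ℕ) (x x' : X) : 0 ≤ kpow P n x x' := by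
  induction n generalizing x with
  | zero => simp only [kpow]; split_ifs <;> norm_num
  | succ n ih => exact Finset.sum_nonneg fun y _ => mul_nonneg (hS.nonneg _ _) (ih _)

lemma kpow_sum (hS : IsStochastic P ν) (n : ℕ) (x : X) : ∑ x', kpow P n x x' = 1 := by
  induction n generalizing x with
  | zero => simp [kpow]
  | succ n ih =>
    simp only [kpow]
    rw [Finset.sum_comm]
    simp only [← Finset.mul_sum, ih, mul_one, hS.rowSum]

lemma nu_Pop (hS : IsStochastic P ν) (g : X → ℝ) : ∑ x, Pop P g x * ν x = ∑ x, g x * ν x := by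
  simp only [Pop, Finset.sum_mul]
  rw [Finset.sum_comm]
  refine Finset.sum_congr rfl fun x' _ => ?_
  rw [← hS.nuInv x', Finset.mul_sum]
  exact Finset.sum_congr rfl fun x _ => by ring

lemma nu_Pop_iter (hS : IsStochastic P ν) (n : ℕ) (g : X → ℝ) :
    ∑ x, ((Pop P)^[n] g) x * ν x = ∑ x, g x * ν x := by
  induction n with
  | zero => rfl
  | succ n ih => rw [Function.iterate_succ_apply', nu_Pop hS, ih]

lemma Pop_norm_le (hS : IsStochastic P ν) (g : X → ℝ) : ‖Pop P g‖ ≤ ‖g‖ := by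
  rw [pi_norm_le_iff_of_nonneg (norm_nonneg _)]
  intro x
  calc ‖Pop P g x‖ ≤ ∑ x', ‖P x x' * g x'‖ := norm_sum_le _ _
    _ ≤ ∑ x', P x x' * ‖g‖ := by
      refine Finset.sum_le_sum fun x' _ => ?_
      rw [norm_mul, Real.norm_of_nonneg (hS.nonneg _ _)]
      exact mul_le_mul_of_nonneg_left (norm_le_pi_norm g x') (hS.nonneg _ _)
    _ = ‖g‖ := by rw [← Finset.sum_mul, hS.rowSum, one_mul]

/-- Geometric ergodicity. -/
lemma ergodic (hS : IsStochastic P ν) (hp : Primitive P) :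
    ∃ C ρ : ℝ, 0 ≤ C ∧ 0 ≤ ρ ∧ ρ < 1 ∧ ∀ g : X → ℝ, ∑ x, g x * ν x = 0 →
      ∀ n, ‖(Pop P)^[n] g‖ ≤ C * ρ ^ n * ‖g‖ := by
  obtain ⟨k, hk, hpos⟩ := hp
  obtain ⟨p, hp, hpmin⟩ : ∃ p : ℝ, 0 < p ∧ ∀ x x', p ≤ kpow P k x x' := by
    obtain ⟨q, hq⟩ := Finite.exists_min (fun z : X × X => kpow P k z.1 z.2)
    exact ⟨_, hpos q.1 q.2, fun x x' => hq (x, x')⟩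
  have hstep : ∀ g : X → ℝ, ∑ x, g x * ν x = 0 → ‖(Pop P)^[k] g‖ ≤ exp (-p) * ‖g‖ := by
    intro g hg
    have hν1 : ∀ x, ν x ≤ 1 := fun x => by
      rw [← hS.nuSum]
      exact Finset.single_le_sum (f := ν) (fun i _ => (hS.nuPos i).le) (Finset.mem_univ x)
    have h1 : ‖(Pop P)^[k] g‖ ≤ (1 - p) * ‖g‖ := by
      have hge : ∀ x x', 0 ≤ kpow P k x x' - p * ν x' := fun x x' => by
        have := hpmin x x'
        have := hν1 x'
        nlinarith
      have hsum : ∀ x, ∑ x', (kpow P k x x' - p * ν x') = 1 - p := fun x => by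
        rw [Finset.sum_sub_distrib, kpow_sum hS, ← Finset.mul_sum, hS.nuSum, mul_one]
      have h1p : 0 ≤ 1 - p := by
        obtain ⟨x⟩ := ‹Nonempty X›
        rw [← hsum x]; exact Finset.sum_nonneg fun _ _ => hge _ _
      rw [pi_norm_le_iff_of_nonneg (mul_nonneg h1p (norm_nonneg _))]
      intro x
      have e : ((Pop P)^[k] g) x = ∑ x', (kpow P k x x' - p * ν x') * g x' := by
        rw [Pop_iter_eq]
        simp only [sub_mul, Finset.sum_sub_distrib, mul_assoc, ← Finset.mul_sum]
        have : ∑ x, ν x * g x = 0 := by rw [← hg]; exact Finset.sum_congr rfl fun x _ => by ring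
        rw [this]; ring
      rw [e]
      calc _ ≤ ∑ x', ‖(kpow P k x x' - p * ν x') * g x'‖ := norm_sum_le _ _
        _ ≤ ∑ x', (kpow P k x x' - p * ν x') * ‖g‖ := by
          refine Finset.sum_le_sum fun x' _ => ?_
          rw [norm_mul, Real.norm_of_nonneg (hge _ _)]
          exact mul_le_mul_of_nonneg_left (norm_le_pi_norm g x') (hge _ _)
        _ = _ := by rw [← Finset.sum_mul, hsum]
    refine h1.trans (mul_le_mul_of_nonneg_right ?_ (norm_nonneg _))
    have := Real.add_one_le_exp (-p); linarith
  refine ⟨exp p, exp (-p / k), (exp_pos _).le, (exp_pos _).le, ?_, ?_⟩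
  · rw [exp_lt_one_iff]
    have : (0 : ℝ) < k := by exact_mod_cast hk
    exact div_neg_of_neg_of_pos (by linarith) this
  · intro g hg n
    have := decay_of_step (fun n => ‖(Pop P)^[n] g‖) (fun n => norm_nonneg _)
      (fun n => by rw [Function.iterate_succ_apply']; exact Pop_norm_le hS _) k hk p hp.le
      (fun n => by
        rw [add_comm, Function.iterate_add_apply]
        exact hstep _ (by rw [nu_Pop_iter hS, hg])) n
    refine this.trans (le_of_eq ?_)
    simp only [Function.iterate_zero, id]
    rw [← Real.exp_nat_mul]
    congr 3; ring

lemma summable_Pop_iter (hS : IsStochastic P ν) (hp : Primitive P) (g : X → ℝ)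
    (hg : ∑ x, g x * ν x = 0) : Summable (fun n => (Pop P)^[n] g) := by
  obtain ⟨C, ρ, hC, h0, h1, h⟩ := ergodic (ν := ν) hS hp
  refine Summable.of_norm_bounded (g := fun n => C * ρ ^ n * ‖g‖) ?_ (h g hg)
  exact ((summable_geometric_of_lt_one h0 h1).mul_left C).mul_right _

lemma Pop_continuous : Continuous (Pop P) := by
  unfold Pop; fun_prop

/-- Solution of the Poisson equation. -/
lemma poisson_solve (hS : IsStochastic P ν) (hp : Primitive P) (g : X → ℝ)
    (hg : ∑ x, g x * ν x = 0) : (∑' n, (Pop P)^[n] g) = g + Pop P (∑' n, (Pop P)^[n] g) := by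
  have hs := summable_Pop_iter hS hp g hg
  have h1 := hs.tsum_eq_zero_add
  let A : (X → ℝ) →+ (X → ℝ) :=
    { toFun := Pop P
      map_zero' := by funext x; simp [Pop]
      map_add' := fun a b => by funext x; simp [Pop, mul_add, Finset.sum_add_distrib] }
  have h2 : Pop P (∑' n, (Pop P)^[n] g) = ∑' n, (Pop P)^[n + 1] g := by
    simp only [Function.iterate_succ_apply']
    exact hs.map_tsum A Pop_continuous
  rw [h2]
  exact h1

/-- The corrector. -/
lemma exists_corrector (hG : Good P ν f) :
    ∃ r : X → ℝ, (∀ x, ∑ x', P x x' * (f x' + r x') = r x) ∧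
      sigma2 P ν f = ∑ x, (f x ^ 2 + 2 * (f x * r x)) * ν x := by
  have hs := summable_Pop_iter hG.st hG.pr f hG.cen
  have hp := poisson_solve hG.st hG.pr f hG.cen
  set T := ∑' n, (Pop P)^[n] f with hT
  refine ⟨Pop P T, fun x => ?_, ?_⟩
  · conv_rhs => rw [hp]
    rfl
  · have h1 := hs.tsum_eq_zero_add
    have h2 : Pop P T = ∑' n, (Pop P)^[n + 1] f := by
      rw [← hT] at h1
      rw [hp] at h1
      simpa using h1
    have hs' : Summable (fun n => (Pop P)^[n + 1] f) := (summable_nat_add_iff 1).2 hs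
    unfold sigma2
    have h3 : ∑' n : ℕ, ∑ x, f x * ((Pop P)^[n + 1] f) x * ν x = ∑ x, f x * Pop P T x * ν x := by
      rw [Summable.tsum_finsetSum]
      · refine Finset.sum_congr rfl fun x _ => ?_
        rw [tsum_mul_right, tsum_mul_left, h2, tsum_apply hs']
      · intro x _
        exact ((Pi.summable.1 hs' x).mul_left _).mul_right _
    rw [h3, Finset.mul_sum, ← Finset.sum_add_distrib]
    exact Finset.sum_congr rfl fun x _ => by ring

lemma sigma2_pos (hG : Good P ν f) : 0 < sigma2 P ν f := by
  obtain ⟨r, hr, hs⟩ := exists_corrector hG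
  have key : sigma2 P ν f = ∑ x, ∑ x', ν x * P x x' * (f x' + r x' - r x) ^ 2 := by
    have e1 : ∀ x, ∑ x', ν x * P x x' * (f x' + r x' - r x) ^ 2 =
        Pop P (fun x' => (f x' + r x') ^ 2) x * ν x - r x ^ 2 * ν x := by
      intro x
      have : ∀ x', ν x * P x x' * (f x' + r x' - r x) ^ 2 =
          P x x' * (f x' + r x') ^ 2 * ν x - 2 * r x * ν x * (P x x' * (f x' + r x'))
            + ν x * r x ^ 2 * P x x' := fun x' => by ring
      simp only [this, Finset.sum_add_distrib, Finset.sum_sub_distrib, ← Finset.mul_sum, hr,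
        hG.st.rowSum, Pop, ← Finset.sum_mul]
      ring
    simp only [e1]
    rw [Finset.sum_sub_distrib, nu_Pop hG.st, hs, ← Finset.sum_sub_distrib]
    exact Finset.sum_congr rfl fun x _ => by ring
  have hnn : ∀ x x', 0 ≤ ν x * P x x' * (f x' + r x' - r x) ^ 2 := fun x x' =>
    mul_nonneg (mul_nonneg (hG.st.nuPos x).le (hG.st.nonneg _ _)) (sq_nonneg _)
  have h0 : 0 ≤ sigma2 P ν f := by
    rw [key]; exact Finset.sum_nonneg fun x _ => Finset.sum_nonneg fun x' _ => hnn _ _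
  rcases h0.lt_or_eq with h | h
  · exact h
  exfalso
  rw [key, eq_comm, Finset.sum_eq_zero_iff_of_nonneg
    (fun x _ => Finset.sum_nonneg fun x' _ => hnn _ _)] at h
  have hz : ∀ x x', 0 < P x x' → f x' = r x - r x' := by
    intro x x' hpos
    have h1 := h x (Finset.mem_univ _)
    rw [Finset.sum_eq_zero_iff_of_nonneg (fun x' _ => hnn _ _)] at h1
    have h2 := h1 x' (Finset.mem_univ _)
    have h3 := hG.st.nuPos x
    rcases mul_eq_zero.1 h2 with h4 | h4
    · exact absurd h4 (mul_pos h3 hpos).ne'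
    · have := pow_eq_zero_iff (two_ne_zero) |>.1 h4
      linarith
  obtain ⟨n, g, hg, hne⟩ := hG.nl 0 0
  apply hne 0
  have hp : ∀ i, 0 < P (g i) (g (i + 1)) := by
    intro i
    refine lt_of_le_of_ne (hG.st.nonneg _ _) fun h0 => hg.ne' ?_
    exact Finset.prod_eq_zero (Finset.mem_univ i) h0.symm
  have h5 : ∑ i, f (g i) = ∑ i, f (g (i + 1)) :=
    (Equiv.sum_comp (Equiv.addRight (1 : Fin (n + 1))) (fun i => f (g i))).symm
  have h6 : ∑ i, r (g i) = ∑ i, r (g (i + 1)) :=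
    (Equiv.sum_comp (Equiv.addRight (1 : Fin (n + 1))) (fun i => r (g i))).symm
  have h7 : ∑ i, f (g (i + 1)) = 0 := by
    rw [Finset.sum_congr rfl (fun i _ => hz _ _ (hp i)), Finset.sum_sub_distrib, h6, sub_self]
  rw [h5, h7]; simp

/-- Both correctors. -/
lemma exists_correctors (hG : Good P ν f) :
    ∃ r q : X → ℝ, (∀ x, ∑ x', P x x' * (f x' + r x') = r x) ∧
      (∀ x, ∑ x', P x x' * (f x' ^ 2 / 2 + f x' * r x' + q x') = q x + sigma2 P ν f / 2) := by
  obtain ⟨r, hr, hs⟩ := exists_corrector hG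
  set s := sigma2 P ν f with hsdef
  set w : X → ℝ := fun x => f x ^ 2 / 2 + f x * r x with hw
  set g : X → ℝ := fun x => Pop P w x - s / 2 with hg
  have hcen : ∑ x, g x * ν x = 0 := by
    simp only [hg, sub_mul, Finset.sum_sub_distrib]
    rw [nu_Pop hG.st, ← Finset.mul_sum, hG.st.nuSum, hs, mul_one, Finset.sum_div, sub_eq_zero]
    exact Finset.sum_congr rfl fun x _ => by simp only [hw]; ring
  have hq := poisson_solve hG.st hG.pr g hcen
  set q := ∑' n, (Pop P)^[n] g
  refine ⟨r, q, hr, fun x => ?_⟩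
  have := congrFun hq x
  simp only [Pi.add_apply, hg, Pop, hw] at this
  simp only [mul_add, Finset.sum_add_distrib] at this ⊢
  linarith

end poisson

set_option linter.unusedSectionVars false

/-! Taylor expansions -/

lemma taylor_exp2 (z : ℂ) : ‖Complex.exp z - (1 + z + z ^ 2 / 2)‖ ≤ ‖z‖ ^ 3 * exp ‖z‖ := by
  have := Complex.norm_exp_sub_sum_le_norm_mul_exp z 3
  simpa [Finset.sum_range_succ, Nat.factorial] using this

lemma taylor_exp1 (z : ℂ) : ‖Complex.exp z - (1 + z)‖ ≤ ‖z‖ ^ 2 * exp ‖z‖ := by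
  have := Complex.norm_exp_sub_sum_le_norm_mul_exp z 2
  simpa [Finset.sum_range_succ, Nat.factorial] using this

lemma taylor_exp0 (z : ℂ) : ‖Complex.exp z - 1‖ ≤ ‖z‖ * exp ‖z‖ := by
  have := Complex.norm_exp_sub_sum_le_norm_mul_exp z 1
  simpa [Finset.sum_range_succ, Nat.factorial] using this

/-- The approximate eigenfunction. -/
noncomputable def vv (r q : X → ℝ) (s : ℝ) (x : X) : ℂ :=
  1 + Complex.I * s * r x - (s : ℂ) ^ 2 * q x

lemma pow_abs_le {s : ℝ} (hs : |s| ≤ 1) (m n : ℕ) (h : m ≤ n) : |s| ^ n ≤ |s| ^ m :=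
  pow_le_pow_of_le_one (abs_nonneg _) hs h

lemma norm_vv_aux {B s R Q : ℝ} (hR : |R| ≤ B) (hQ : |Q| ≤ B) (hs : |s| ≤ 1) :
    ‖(1 + Complex.I * s * R - (s : ℂ) ^ 2 * Q : ℂ) - 1‖ ≤ 2 * B * |s| := by
  have e : (1 + Complex.I * s * R - (s : ℂ) ^ 2 * Q : ℂ) - 1
      = Complex.I * s * R - (s : ℂ) ^ 2 * Q := by ring
  rw [e]
  refine (norm_sub_le _ _).trans ?_
  simp only [norm_mul, Complex.norm_I, Complex.norm_real, norm_pow, Real.norm_eq_abs, one_mul]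
  have hB : 0 ≤ B := (abs_nonneg _).trans hR
  have h2 : |s| ^ 2 ≤ |s| := by simpa using pow_abs_le hs 1 2 (by norm_num)
  have h3 : |s| * |R| ≤ |s| * B := by gcongr
  have h4 : |s| ^ 2 * |Q| ≤ |s| * B := by gcongr
  linarith

lemma norm_vv_aux' {B s R Q : ℝ} (hR : |R| ≤ B) (hQ : |Q| ≤ B) (hs : |s| ≤ 1) :
    ‖(1 + Complex.I * s * R - (s : ℂ) ^ 2 * Q : ℂ)‖ ≤ 1 + 2 * B := by
  have h := norm_vv_aux hR hQ hs
  have hB : 0 ≤ B := (abs_nonneg _).trans hR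
  have h1 := norm_le_norm_add_norm_sub' (1 + Complex.I * s * R - (s : ℂ) ^ 2 * Q : ℂ) 1
  rw [norm_one] at h1
  nlinarith [abs_nonneg s]

lemma taylorA {B F R Q s : ℝ} (hF : |F| ≤ B) (hR : |R| ≤ B) (hQ : |Q| ≤ B) (hs : |s| ≤ 1) :
    ‖Complex.exp (Complex.I * s * F) * (1 + Complex.I * s * R - (s : ℂ) ^ 2 * Q)
      - (1 + Complex.I * s * (F + R) - (s : ℂ) ^ 2 * (F ^ 2 / 2 + F * R + Q))‖
      ≤ (B ^ 3 * exp B * (1 + 2 * B) + 2 * B ^ 2 + 2 * B ^ 3) * |s| ^ 3 := by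
  have hB : 0 ≤ B := (abs_nonneg _).trans hR
  set z : ℂ := Complex.I * s * F with hz
  have hzn : ‖z‖ = |s| * |F| := by
    simp only [hz, norm_mul, Complex.norm_I, Complex.norm_real, Real.norm_eq_abs, one_mul]
  have h1 := taylor_exp2 z
  have hI : Complex.I ^ 2 = -1 := Complex.I_sq
  have e : Complex.exp z * (1 + Complex.I * s * R - (s : ℂ) ^ 2 * Q)
      - (1 + Complex.I * s * (F + R) - (s : ℂ) ^ 2 * (F ^ 2 / 2 + F * R + Q))
      = (Complex.exp z - (1 + z + z ^ 2 / 2)) * (1 + Complex.I * s * R - (s : ℂ) ^ 2 * Q)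
        + (s : ℂ) ^ 3 * (-(Complex.I * F * Q) - Complex.I * F ^ 2 * R / 2)
        + (s : ℂ) ^ 4 * (F ^ 2 * Q / 2) := by
    rw [hz]
    linear_combination (-(s : ℂ) ^ 2 * F * R - 1 / 2 * s ^ 4 * F ^ 2 * (-Q) - (1 / 2) * s ^ 3 * F ^ 2 * R * Complex.I - (1 / 2) * s ^ 2 * F ^ 2 - s ^ 4 * F ^ 2 * Q + s ^ 2 * F ^ 2 + 2 * s ^ 2 * F * R+ s ^ 3 * F ^ 2 * R * Complex.I) * hI
  rw [e]
  refine (norm_add_le _ _).trans ?_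
  refine (add_le_add_left (norm_add_le _ _) _).trans ?_
  have t1 : ‖(Complex.exp z - (1 + z + z ^ 2 / 2)) * (1 + Complex.I * s * R - (s : ℂ) ^ 2 * Q)‖
      ≤ B ^ 3 * exp B * (1 + 2 * B) * |s| ^ 3 := by
    rw [norm_mul]
    have h2 := norm_vv_aux' hR hQ hs
    have h3 : ‖z‖ ^ 3 * exp ‖z‖ ≤ (|s| * B) ^ 3 * exp B := by
      rw [hzn]
      have : |s| * |F| ≤ |s| * B := by gcongr
      have h' : |s| * |F| ≤ B := by nlinarith [abs_nonneg s, abs_nonneg F]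
      gcongr
    calc _ ≤ ((|s| * B) ^ 3 * exp B) * (1 + 2 * B) := by
          gcongr
          exact h1.trans h3
      _ = _ := by ring
  have t2 : ‖(s : ℂ) ^ 3 * (-(Complex.I * F * Q) - Complex.I * F ^ 2 * R / 2)‖
      ≤ |s| ^ 3 * (B ^ 2 + B ^ 3 / 2) := by
    rw [norm_mul, norm_pow, Complex.norm_real, Real.norm_eq_abs]
    gcongr
    refine (norm_sub_le _ _).trans ?_
    simp only [norm_neg, norm_mul, norm_div, Complex.norm_I, Complex.norm_real, norm_pow,
      Real.norm_eq_abs, one_mul]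
    have a1 : |F| * |Q| ≤ B * B := by gcongr
    have a2 : |F| ^ 2 * |R| ≤ B ^ 2 * B := by gcongr
    have a3 : ‖(2 : ℂ)‖ = 2 := by norm_num
    rw [a3]
    nlinarith
  have t3 : ‖(s : ℂ) ^ 4 * (F ^ 2 * Q / 2)‖ ≤ |s| ^ 3 * (B ^ 3 / 2) := by
    rw [norm_mul, norm_pow, Complex.norm_real, Real.norm_eq_abs]
    have := pow_abs_le hs 3 4 (by norm_num)
    simp only [norm_mul, norm_div, Complex.norm_real, norm_pow,
      Real.norm_eq_abs]
    have a3 : ‖(2 : ℂ)‖ = 2 := by norm_num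
    rw [a3]
    have a2 : |F| ^ 2 * |Q| ≤ B ^ 2 * B := by gcongr
    have : |s| ^ 4 * (|F| ^ 2 * |Q| / 2) ≤ |s| ^ 3 * (B ^ 2 * B / 2) := by gcongr
    nlinarith
  have : 0 ≤ B ^ 2 * |s| ^ 3 := by positivity
  have : 0 ≤ B ^ 3 * |s| ^ 3 := by positivity
  nlinarith

lemma taylorB {B A R Q s : ℝ} (hA : |A| ≤ B) (hR : |R| ≤ B) (hQ : |Q| ≤ B) (hs : |s| ≤ 1) :
    ‖Complex.exp (-(A * (s : ℂ) ^ 2)) * (1 + Complex.I * s * R - (s : ℂ) ^ 2 * Q)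
      - (1 + Complex.I * s * R - (s : ℂ) ^ 2 * (Q + A))‖
      ≤ (B ^ 2 * exp B * (1 + 2 * B) + 2 * B ^ 2) * |s| ^ 3 := by
  have hB : 0 ≤ B := (abs_nonneg _).trans hR
  set z : ℂ := -(A * (s : ℂ) ^ 2) with hz
  have hzn : ‖z‖ = |A| * |s| ^ 2 := by
    simp only [hz, norm_mul, norm_neg, norm_pow, Complex.norm_real, Real.norm_eq_abs]
  have h1 := taylor_exp1 z
  have e : Complex.exp z * (1 + Complex.I * s * R - (s : ℂ) ^ 2 * Q)
      - (1 + Complex.I * s * R - (s : ℂ) ^ 2 * (Q + A))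
      = (Complex.exp z - (1 + z)) * (1 + Complex.I * s * R - (s : ℂ) ^ 2 * Q)
        + (s : ℂ) ^ 3 * (-(Complex.I * A * R)) + (s : ℂ) ^ 4 * (A * Q) := by
    rw [hz]; ring
  rw [e]
  refine (norm_add_le _ _).trans ?_
  refine (add_le_add_left (norm_add_le _ _) _).trans ?_
  have hs4 := pow_abs_le hs 3 4 (by norm_num)
  have t1 : ‖(Complex.exp z - (1 + z)) * (1 + Complex.I * s * R - (s : ℂ) ^ 2 * Q)‖
      ≤ B ^ 2 * exp B * (1 + 2 * B) * |s| ^ 3 := by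
    rw [norm_mul]
    have h2 := norm_vv_aux' hR hQ hs
    have h3 : ‖z‖ ^ 2 * exp ‖z‖ ≤ (B * |s| ^ 2) ^ 2 * exp B := by
      rw [hzn]
      have : |A| * |s| ^ 2 ≤ B * |s| ^ 2 := by gcongr
      have h' : |A| * |s| ^ 2 ≤ B := by
        have := pow_abs_le hs 0 2 (by norm_num)
        rw [pow_zero] at this
        nlinarith [abs_nonneg A, sq_nonneg |s|]
      gcongr
    calc _ ≤ ((B * |s| ^ 2) ^ 2 * exp B) * (1 + 2 * B) := by
          gcongr
          exact h1.trans h3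
      _ = B ^ 2 * exp B * (1 + 2 * B) * |s| ^ 4 := by ring
      _ ≤ _ := by gcongr
  have t2 : ‖(s : ℂ) ^ 3 * (-(Complex.I * A * R))‖ ≤ |s| ^ 3 * B ^ 2 := by
    rw [norm_mul, norm_pow, Complex.norm_real, Real.norm_eq_abs]
    gcongr
    simp only [norm_neg, norm_mul, Complex.norm_I, Complex.norm_real, Real.norm_eq_abs, one_mul]
    have a1 : |A| * |R| ≤ B * B := by gcongr
    nlinarith
  have t3 : ‖(s : ℂ) ^ 4 * (A * Q)‖ ≤ |s| ^ 3 * B ^ 2 := by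
    simp only [norm_mul, Complex.norm_real, norm_pow, Real.norm_eq_abs]
    have a1 : |A| * |Q| ≤ B * B := by gcongr
    have : |s| ^ 4 * (|A| * |Q|) ≤ |s| ^ 3 * (B * B) := by gcongr
    nlinarith
  nlinarith

set_option linter.unusedSectionVars false

/-! Characteristic operators -/

/-- Perturbed operator. -/
noncomputable def Mop [Fintype X] (P : X → X → ℝ) (f : X → ℝ) (t : ℝ) :
    (X → ℂ) →ₗ[ℂ] (X → ℂ) where
  toFun h x := ∑ x', (P x x' : ℂ) * Complex.exp (Complex.I * t * f x') * h x'
  map_add' a b := by funext x; simp [mul_add, Finset.sum_add_distrib]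
  map_smul' c a := by funext x; simp [Finset.mul_sum, mul_left_comm]

section chf
variable [Fintype X] [DecidableEq X] [Nonempty X] {P : X → X → ℝ} {ν f : X → ℝ}

lemma Mop_apply (t : ℝ) (h : X → ℂ) (x : X) :
    Mop P f t h x = ∑ x', (P x x' : ℂ) * Complex.exp (Complex.I * t * f x') * h x' := rfl

lemma norm_expI (t u : ℝ) : ‖Complex.exp (Complex.I * t * u)‖ = 1 := by
  have : Complex.I * t * u = ((t * u : ℝ) : ℂ) * Complex.I := by push_cast; ring
  rw [this, Complex.norm_exp_ofReal_mul_I]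

lemma Mop_pow_succ (n : ℕ) (t : ℝ) (h : X → ℂ) :
    (Mop P f t ^ (n + 1)) h = Mop P f t ((Mop P f t ^ n) h) := by rw [pow_succ']; rfl

lemma Mop_pow_add (m n : ℕ) (t : ℝ) (h : X → ℂ) :
    (Mop P f t ^ (m + n)) h = (Mop P f t ^ m) ((Mop P f t ^ n) h) := by rw [pow_add]; rfl

lemma norm_avg_le (hS : IsStochastic P ν) (x : X) (g : X → ℂ) {C : ℝ} (h : ∀ x', ‖g x'‖ ≤ C) :
    ‖∑ x', (P x x' : ℂ) * g x'‖ ≤ C := by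
  calc _ ≤ ∑ x', ‖(P x x' : ℂ) * g x'‖ := norm_sum_le _ _
    _ ≤ ∑ x', P x x' * C := by
      refine Finset.sum_le_sum fun x' _ => ?_
      rw [norm_mul, Complex.norm_real, Real.norm_of_nonneg (hS.nonneg _ _)]
      exact mul_le_mul_of_nonneg_left (h x') (hS.nonneg _ _)
    _ = C := by rw [← Finset.sum_mul, hS.rowSum, one_mul]

lemma Mop_norm_le (hS : IsStochastic P ν) (t : ℝ) (h : X → ℂ) : ‖Mop P f t h‖ ≤ ‖h‖ := by
  rw [pi_norm_le_iff_of_nonneg (norm_nonneg _)]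
  intro x
  rw [Mop_apply]
  simp only [mul_assoc]
  refine norm_avg_le hS x _ fun x' => ?_
  rw [norm_mul, ← mul_assoc, norm_expI, one_mul]
  exact norm_le_pi_norm h x'

lemma Mop_pow_norm_le (hS : IsStochastic P ν) (n : ℕ) (t : ℝ) (h : X → ℂ) :
    ‖(Mop P f t ^ n) h‖ ≤ ‖h‖ := by
  induction n with
  | zero => simp
  | succ n ih => rw [Mop_pow_succ]; exact (Mop_norm_le hS t _).trans ih

/-- Iteration of an approximate eigenvector relation. -/
lemma Mop_pow_eig (hS : IsStochastic P ν) (t : ℝ) (v : X → ℂ) (l : ℂ) (hl : ‖l‖ ≤ 1) (E : ℝ)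
    (h : ‖Mop P f t v - l • v‖ ≤ E) (n : ℕ) : ‖(Mop P f t ^ n) v - l ^ n • v‖ ≤ n * E := by
  induction n with
  | zero => simp
  | succ n ih =>
    have e : (Mop P f t ^ (n + 1)) v - l ^ (n + 1) • v =
        Mop P f t ((Mop P f t ^ n) v - l ^ n • v) + l ^ n • (Mop P f t v - l • v) := by
      rw [Mop_pow_succ, map_sub, map_smul, smul_sub, smul_smul, ← pow_succ]; abel
    rw [e]
    refine (norm_add_le _ _).trans ?_
    have h1 := (Mop_norm_le (f := f) hS t ((Mop P f t ^ n) v - l ^ n • v)).trans ih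
    have h2 : ‖l ^ n • (Mop P f t v - l • v)‖ ≤ E := by
      rw [norm_smul, norm_pow]
      have := pow_le_one₀ (n := n) (norm_nonneg l) hl
      nlinarith [norm_nonneg (Mop P f t v - l • v)]
    push_cast; linarith

lemma exists_bound (g : X → ℝ) : ∃ B, 0 ≤ B ∧ ∀ x, |g x| ≤ B :=
  ⟨‖g‖, norm_nonneg _, fun x => norm_le_pi_norm g x⟩

lemma exists_bound3 (f r q : X → ℝ) : ∃ B, 0 ≤ B ∧ (∀ x, |f x| ≤ B) ∧ (∀ x, |r x| ≤ B) ∧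
    ∀ x, |q x| ≤ B := by
  refine ⟨‖f‖ + ‖r‖ + ‖q‖, by positivity, fun x => ?_, fun x => ?_, fun x => ?_⟩
  · have := norm_le_pi_norm f x
    have := norm_nonneg r
    have := norm_nonneg q
    rw [← Real.norm_eq_abs]; linarith
  · have := norm_le_pi_norm r x
    have := norm_nonneg f
    have := norm_nonneg q
    rw [← Real.norm_eq_abs]; linarith
  · have := norm_le_pi_norm q x
    have := norm_nonneg f
    have := norm_nonneg r
    rw [← Real.norm_eq_abs]; linarith

/-- Taylor expansion of the perturbed operator. -/
lemma Mop_taylor (hS : IsStochastic P ν) (r q : X → ℝ) (s2 : ℝ)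
    (hr : ∀ x, ∑ x', P x x' * (f x' + r x') = r x)
    (hq : ∀ x, ∑ x', P x x' * (f x' ^ 2 / 2 + f x' * r x' + q x') = q x + s2 / 2) :
    ∃ C, 0 ≤ C ∧ ∀ s : ℝ, |s| ≤ 1 →
      ‖Mop P f s (vv r q s) - (exp (-(s2 * s ^ 2 / 2)) : ℂ) • vv r q s‖ ≤ C * |s| ^ 3 := by
  obtain ⟨B0, hB0, hf, hr', hq'⟩ := exists_bound3 f r q
  set B := B0 + |s2 / 2| with hB
  have hBB : B0 ≤ B := by rw [hB]; linarith [abs_nonneg (s2 / 2)]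
  have hBn : 0 ≤ B := hB0.trans hBB
  refine ⟨(B ^ 3 * exp B * (1 + 2 * B) + 2 * B ^ 2 + 2 * B ^ 3) +
    (B ^ 2 * exp B * (1 + 2 * B) + 2 * B ^ 2), by positivity, fun s hs => ?_⟩
  rw [pi_norm_le_iff_of_nonneg (by positivity)]
  intro x
  have hR := hr x
  have hQ := hq x
  have hA := hS.rowSum x
  have eq1 : (1 + Complex.I * s * r x - (s : ℂ) ^ 2 * (q x + (s2 / 2 : ℝ)) : ℂ)
      = ∑ x', (P x x' : ℂ) * (1 + Complex.I * s * (f x' + r x') -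
        (s : ℂ) ^ 2 * (f x' ^ 2 / 2 + f x' * r x' + q x')) := by
    simp only [mul_sub, mul_add, Finset.sum_sub_distrib, Finset.sum_add_distrib, mul_one] at *
    have hR' : (∑ x', (P x x' : ℂ) * f x') + ∑ x', (P x x' : ℂ) * r x' = r x := by
      rw [← hR]; push_cast; rfl
    have hQ' : (∑ x', (P x x' : ℂ) * (f x' ^ 2 / 2)) + (∑ x', (P x x' : ℂ) * (f x' * r x')) +
        ∑ x', (P x x' : ℂ) * q x' = q x + (s2 / 2 : ℝ) := by
      rw [← Complex.ofReal_add, ← hQ]; push_cast; rfl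
    have hA' : (∑ x', (P x x' : ℂ)) = 1 := by rw [← Complex.ofReal_sum, hA, Complex.ofReal_one]
    have pull : ∀ (c : ℂ) (g : X → ℂ), ∑ x', (P x x' : ℂ) * (c * g x') =
        c * ∑ x', (P x x' : ℂ) * g x' := fun c g => by
      rw [Finset.mul_sum]; exact Finset.sum_congr rfl fun _ _ => by ring
    simp only [pull]
    rw [hA']
    linear_combination (-(Complex.I * s)) * hR' + ((s : ℂ) ^ 2) * hQ'
  have t2 := taylorB (B := B) (A := s2 / 2) (R := r x) (Q := q x) (s := s)
    (by rw [hB]; linarith) ((hr' x).trans hBB) ((hq' x).trans hBB) hs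
  have e : (Mop P f s (vv r q s) - (exp (-(s2 * s ^ 2 / 2)) : ℂ) • vv r q s) x =
      (∑ x', (P x x' : ℂ) * (Complex.exp (Complex.I * s * f x') * vv r q s x' -
        (1 + Complex.I * s * (f x' + r x') -
        (s : ℂ) ^ 2 * (f x' ^ 2 / 2 + f x' * r x' + q x')))) -
      (Complex.exp (-((s2 / 2 : ℝ) * (s : ℂ) ^ 2)) * vv r q s x -
        (1 + Complex.I * s * r x - (s : ℂ) ^ 2 * (q x + (s2 / 2 : ℝ)))) := by
    rw [eq1]
    simp only [Pi.sub_apply, Pi.smul_apply, smul_eq_mul, Mop_apply, mul_sub,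
      Finset.sum_sub_distrib, mul_assoc]
    have : Complex.exp (-((s2 / 2 : ℝ) * (s : ℂ) ^ 2)) =
        ((exp (-(s2 * s ^ 2 / 2)) : ℝ) : ℂ) := by
      rw [Complex.ofReal_exp]; congr 1; push_cast; ring
    rw [this]
    ring
  rw [e]
  refine (norm_sub_le _ _).trans ?_
  rw [add_mul]
  refine add_le_add ?_ t2
  refine norm_avg_le hS x _ fun x' => ?_
  exact taylorA ((hf x').trans hBB) ((hr' x').trans hBB) ((hq' x').trans hBB) hs

lemma Mop_diff (hS : IsStochastic P ν) : ∃ C, 0 ≤ C ∧ ∀ s : ℝ, |s| ≤ 1 → ∀ h : X → ℂ,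
    ‖Mop P f s h - Mop P f 0 h‖ ≤ C * |s| * ‖h‖ := by
  obtain ⟨B, hB, hf⟩ := exists_bound f
  refine ⟨B * exp B, by positivity, fun s hs h => ?_⟩
  rw [pi_norm_le_iff_of_nonneg (by positivity)]
  intro x
  have e : (Mop P f s h - Mop P f 0 h) x =
      ∑ x', (P x x' : ℂ) * ((Complex.exp (Complex.I * s * f x') - 1) * h x') := by
    simp only [Pi.sub_apply, Mop_apply, Complex.ofReal_zero, mul_zero, zero_mul, Complex.exp_zero,
      mul_one, ← Finset.sum_sub_distrib]
    exact Finset.sum_congr rfl fun _ _ => by ring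
  rw [e]
  refine norm_avg_le hS x _ fun x' => ?_
  rw [norm_mul]
  have h1 := taylor_exp0 (Complex.I * s * f x')
  have h2 : ‖(Complex.I * s * f x' : ℂ)‖ = |s| * |f x'| := by
    simp only [norm_mul, Complex.norm_I, Complex.norm_real, Real.norm_eq_abs, one_mul]
  rw [h2] at h1
  have h3 : |s| * |f x'| ≤ |s| * B := by gcongr; exact hf x'
  have h4 : |s| * |f x'| ≤ B := by nlinarith [hf x', abs_nonneg (f x')]
  have h5 : |s| * |f x'| * exp (|s| * |f x'|) ≤ |s| * B * exp B := by gcongr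
  have := norm_le_pi_norm h x'
  calc _ ≤ (|s| * B * exp B) * ‖h‖ := by gcongr; exact h1.trans h5
    _ = _ := by ring

lemma Mop_pow_diff (hS : IsStochastic P ν) : ∃ C, 0 ≤ C ∧ ∀ s : ℝ, |s| ≤ 1 → ∀ (L : ℕ) (h : X → ℂ),
    ‖(Mop P f s ^ L) h - (Mop P f 0 ^ L) h‖ ≤ C * |s| * L * ‖h‖ := by
  obtain ⟨C, hC, H⟩ := Mop_diff (f := f) hS
  refine ⟨C, hC, fun s hs L h => ?_⟩
  induction L with
  | zero => simp
  | succ n ih =>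
    have e : (Mop P f s ^ (n + 1)) h - (Mop P f 0 ^ (n + 1)) h =
        (Mop P f s ((Mop P f s ^ n) h) - Mop P f 0 ((Mop P f s ^ n) h)) +
        Mop P f 0 ((Mop P f s ^ n) h - (Mop P f 0 ^ n) h) := by
      rw [Mop_pow_succ, Mop_pow_succ, map_sub]; abel
    rw [e]
    refine (norm_add_le _ _).trans ?_
    have h1 := H s hs ((Mop P f s ^ n) h)
    have h2 := (Mop_norm_le (f := f) hS 0 ((Mop P f s ^ n) h - (Mop P f 0 ^ n) h)).trans ih
    have h3 : C * |s| * ‖(Mop P f s ^ n) h‖ ≤ C * |s| * ‖h‖ := by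
      gcongr; exact Mop_pow_norm_le hS n s h
    push_cast
    nlinarith

/-- Mean of a complex function. -/
noncomputable def nuC (ν : X → ℝ) (h : X → ℂ) : ℂ := ∑ x, h x * ν x

lemma Mop_zero_pow_apply (n : ℕ) (h : X → ℂ) (x : X) :
    (Mop P f 0 ^ n) h x = (((Pop P)^[n] (fun x => (h x).re)) x : ℂ) +
      (((Pop P)^[n] (fun x => (h x).im)) x : ℂ) * Complex.I := by
  induction n generalizing x with
  | zero => simp [Complex.re_add_im]
  | succ n ih =>
    rw [Mop_pow_succ, Mop_apply, Function.iterate_succ_apply', Function.iterate_succ_apply']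
    simp only [ih, Pop, Complex.ofReal_zero, mul_zero, zero_mul, Complex.exp_zero, mul_one,
      mul_add, Finset.sum_add_distrib]
    push_cast
    rw [Finset.sum_mul]
    simp only [mul_assoc]

lemma nuC_norm_le (hS : IsStochastic P ν) (h : X → ℂ) : ‖nuC ν h‖ ≤ ‖h‖ := by
  unfold nuC
  calc _ ≤ ∑ x', ‖h x' * (ν x' : ℂ)‖ := norm_sum_le _ _
    _ ≤ ∑ x', ‖h‖ * ν x' := by
      refine Finset.sum_le_sum fun x' _ => ?_
      rw [norm_mul, Complex.norm_real, Real.norm_of_nonneg (hS.nuPos _).le]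
      exact mul_le_mul_of_nonneg_right (norm_le_pi_norm h x') (hS.nuPos _).le
    _ = ‖h‖ := by rw [← Finset.mul_sum, hS.nuSum, mul_one]

lemma Mop_zero_one (hS : IsStochastic P ν) (n : ℕ) :
    (Mop P f 0 ^ n) (fun _ => (1 : ℂ)) = fun _ => 1 := by
  induction n with
  | zero => rfl
  | succ n ih =>
    rw [Mop_pow_succ, ih]; funext x
    simp only [Mop_apply, Complex.ofReal_zero, mul_zero, zero_mul, Complex.exp_zero, mul_one]
    rw [← Complex.ofReal_sum, hS.rowSum, Complex.ofReal_one]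

lemma Mop_zero_ergodic (hS : IsStochastic P ν) (hp : Primitive P) :
    ∃ C ρ : ℝ, 0 ≤ C ∧ 0 ≤ ρ ∧ ρ < 1 ∧ ∀ (h : X → ℂ) (n : ℕ),
      ‖(Mop P f 0 ^ n) h - nuC ν h • (fun _ => (1 : ℂ))‖ ≤ C * ρ ^ n * ‖h‖ := by
  obtain ⟨C, ρ, hC, h0, h1, H⟩ := ergodic (ν := ν) hS hp
  refine ⟨4 * C, ρ, by positivity, h0, h1, fun h n => ?_⟩
  set g : X → ℂ := h - nuC ν h • (fun _ => (1 : ℂ)) with hg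
  have hgn : ‖g‖ ≤ 2 * ‖h‖ := by
    refine (norm_sub_le _ _).trans ?_
    have : ‖nuC ν h • (fun _ : X => (1 : ℂ))‖ ≤ ‖h‖ := by
      rw [norm_smul]
      have : ‖(fun _ : X => (1 : ℂ))‖ = 1 := by simp
      rw [this, mul_one]; exact nuC_norm_le hS h
    linarith
  have e : (Mop P f 0 ^ n) h - nuC ν h • (fun _ => (1 : ℂ)) = (Mop P f 0 ^ n) g := by
    rw [hg, map_sub, map_smul, Mop_zero_one hS]
  have hz : ∑ x, g x * (ν x : ℂ) = 0 := by
    simp only [hg, Pi.sub_apply, Pi.smul_apply, smul_eq_mul, mul_one, sub_mul,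
      Finset.sum_sub_distrib, ← Finset.mul_sum]
    rw [← Complex.ofReal_sum, hS.nuSum]; simp [nuC]
  have hre : ∑ x, (g x).re * ν x = 0 := by
    have := congrArg Complex.re hz
    simpa using this
  have him : ∑ x, (g x).im * ν x = 0 := by
    have := congrArg Complex.im hz
    simpa using this
  have hren : ‖fun x => (g x).re‖ ≤ ‖g‖ := by
    rw [pi_norm_le_iff_of_nonneg (norm_nonneg _)]
    exact fun x => (Complex.abs_re_le_norm _).trans (norm_le_pi_norm g x)
  have himn : ‖fun x => (g x).im‖ ≤ ‖g‖ := by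
    rw [pi_norm_le_iff_of_nonneg (norm_nonneg _)]
    exact fun x => (Complex.abs_im_le_norm _).trans (norm_le_pi_norm g x)
  rw [e, pi_norm_le_iff_of_nonneg (by positivity)]
  intro x
  rw [Mop_zero_pow_apply]
  refine (norm_add_le _ _).trans ?_
  rw [norm_mul, Complex.norm_I, mul_one, Complex.norm_real, Complex.norm_real]
  have a1 := (norm_le_pi_norm ((Pop P)^[n] (fun x => (g x).re)) x).trans (H _ hre n)
  have a2 := (norm_le_pi_norm ((Pop P)^[n] (fun x => (g x).im)) x).trans (H _ him n)
  have a3 : C * ρ ^ n * ‖fun x => (g x).re‖ ≤ C * ρ ^ n * (2 * ‖h‖) := by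
    gcongr; exact hren.trans hgn
  have a4 : C * ρ ^ n * ‖fun x => (g x).im‖ ≤ C * ρ ^ n * (2 * ‖h‖) := by
    gcongr; exact himn.trans hgn
  linarith

/-- Main approximation of powers of the perturbed operator for small parameter. -/
lemma Mop_approx (hG : Good P ν f) : ∃ C ρ : ℝ, 0 ≤ C ∧ 0 ≤ ρ ∧ ρ < 1 ∧
    ∀ s : ℝ, |s| ≤ 1 → ∀ (n L : ℕ) (h : X → ℂ),
    ‖(Mop P f s ^ (n + L)) h -
      (nuC ν h * (exp (-(sigma2 P ν f * s ^ 2 / 2)) : ℂ) ^ n) • (fun _ => (1 : ℂ))‖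
      ≤ C * (ρ ^ L + (L + 1) * |s| + n * |s| ^ 3) * ‖h‖ := by
  obtain ⟨r, q, hr, hq⟩ := exists_correctors hG
  obtain ⟨C1, hC1, H1⟩ := Mop_taylor (f := f) hG.st r q _ hr hq
  obtain ⟨C2, hC2, H2⟩ := Mop_pow_diff (f := f) hG.st
  obtain ⟨C3, ρ, hC3, h0, h1, H3⟩ := Mop_zero_ergodic (f := f) hG.st hG.pr
  obtain ⟨B, hB, hf, hr', hq'⟩ := exists_bound3 f r q
  refine ⟨C1 + C2 + C3 + 4 * B, ρ, by positivity, h0, h1, fun s hs n L h => ?_⟩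
  set l : ℂ := (exp (-(sigma2 P ν f * s ^ 2 / 2)) : ℂ) with hl
  set one : X → ℂ := fun _ => 1 with hone
  set c := nuC ν h with hc
  have hcn : ‖c‖ ≤ ‖h‖ := nuC_norm_le hG.st h
  have hln : ‖l‖ ≤ 1 := by
    rw [hl]
    have e1 : ∀ a : ℝ, ‖((exp a : ℝ) : ℂ)‖ = exp a := fun a => by
      rw [Complex.norm_real, Real.norm_of_nonneg (exp_pos _).le]
    rw [e1, exp_le_one_iff]
    have := sigma2_pos hG
    have : 0 ≤ sigma2 P ν f * s ^ 2 := by positivity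
    linarith
  have hvv : ‖vv r q s - one‖ ≤ 2 * B * |s| := by
    rw [pi_norm_le_iff_of_nonneg (by positivity)]
    exact fun x => norm_vv_aux (hr' x) (hq' x) hs
  have e : (Mop P f s ^ (n + L)) h - (c * l ^ n) • one =
      (Mop P f s ^ n) ((Mop P f s ^ L) h - (Mop P f 0 ^ L) h)
      + (Mop P f s ^ n) ((Mop P f 0 ^ L) h - c • one)
      - c • (Mop P f s ^ n) (vv r q s - one)
      + c • ((Mop P f s ^ n) (vv r q s) - l ^ n • vv r q s)
      + (c * l ^ n) • (vv r q s - one) := by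
    rw [Mop_pow_add]
    simp only [map_sub, map_smul, smul_sub, smul_smul]
    abel
  rw [e]
  have b1 : ‖(Mop P f s ^ n) ((Mop P f s ^ L) h - (Mop P f 0 ^ L) h)‖ ≤ C2 * |s| * L * ‖h‖ :=
    (Mop_pow_norm_le hG.st _ _ _).trans (H2 s hs L h)
  have b2 : ‖(Mop P f s ^ n) ((Mop P f 0 ^ L) h - c • one)‖ ≤ C3 * ρ ^ L * ‖h‖ :=
    (Mop_pow_norm_le hG.st _ _ _).trans (H3 h L)
  have b3 : ‖c • (Mop P f s ^ n) (vv r q s - one)‖ ≤ ‖h‖ * (2 * B * |s|) := by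
    rw [norm_smul]
    gcongr
    exact (Mop_pow_norm_le hG.st _ _ _).trans hvv
  have b4 : ‖c • ((Mop P f s ^ n) (vv r q s) - l ^ n • vv r q s)‖ ≤ ‖h‖ * (n * (C1 * |s| ^ 3)) := by
    rw [norm_smul]
    gcongr
    exact Mop_pow_eig hG.st s _ l hln _ (H1 s hs) n
  have b5 : ‖(c * l ^ n) • (vv r q s - one)‖ ≤ ‖h‖ * (2 * B * |s|) := by
    rw [norm_smul, norm_mul, norm_pow]
    have : ‖c‖ * ‖l‖ ^ n ≤ ‖h‖ := by
      have := pow_le_one₀ (n := n) (norm_nonneg l) hln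
      nlinarith [norm_nonneg c]
    gcongr
  refine (norm_add_le _ _).trans ?_
  refine (add_le_add_left (norm_add_le _ _) _).trans ?_
  have n3 := norm_sub_le ((Mop P f s ^ n) ((Mop P f s ^ L) h - (Mop P f 0 ^ L) h)
      + (Mop P f s ^ n) ((Mop P f 0 ^ L) h - c • one)) (c • (Mop P f s ^ n) (vv r q s - one))
  have n4 := norm_add_le ((Mop P f s ^ n) ((Mop P f s ^ L) h - (Mop P f 0 ^ L) h))
    ((Mop P f s ^ n) ((Mop P f 0 ^ L) h - c • one))
  have tot : C2 * |s| * L * ‖h‖ + C3 * ρ ^ L * ‖h‖ + ‖h‖ * (2 * B * |s|) +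
      ‖h‖ * (n * (C1 * |s| ^ 3)) + ‖h‖ * (2 * B * |s|) ≤
      (C1 + C2 + C3 + 4 * B) * (ρ ^ L + (L + 1) * |s| + n * |s| ^ 3) * ‖h‖ := by
    have hρ : 0 ≤ ρ ^ L := by positivity
    have hL : 0 ≤ (L : ℝ) * |s| := by positivity
    have hn3 : 0 ≤ (n : ℝ) * |s| ^ 3 := by positivity
    have hss := abs_nonneg s
    have key : C2 * |s| * L + C3 * ρ ^ L + (2 * B * |s|) + (n * (C1 * |s| ^ 3)) + (2 * B * |s|) ≤
      (C1 + C2 + C3 + 4 * B) * (ρ ^ L + (L + 1) * |s| + n * |s| ^ 3) := by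
      set a := ρ ^ L
      set b := (L : ℝ) * |s|
      set d := (n : ℝ) * |s| ^ 3
      have : (C1 + C2 + C3 + 4 * B) * (a + (L + 1) * |s| + d) -
        (C2 * |s| * L + C3 * a + (2 * B * |s|) + (n * (C1 * |s| ^ 3)) + (2 * B * |s|)) =
        (C1 + C2 + 4 * B) * a + (C1 + C3 + 4 * B) * b + (C1 + C2 + C3) * |s| +
        (C2 + C3 + 4 * B) * d := by simp only [a, b, d]; ring
      have : 0 ≤ (C1 + C2 + 4 * B) * a + (C1 + C3 + 4 * B) * b + (C1 + C2 + C3) * |s| +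
        (C2 + C3 + 4 * B) * d := by positivity
      linarith
    nlinarith [norm_nonneg h]
  linarith

end chf

set_option linter.unusedSectionVars false

section chf2
variable [Fintype X] [DecidableEq X] [Nonempty X] {P : X → X → ℝ} {ν f : X → ℝ}

lemma Mop_decay_small (hG : Good P ν f) : ∃ δ c : ℝ, 0 < δ ∧ δ ≤ 1 ∧ 0 < c ∧
    ∀ s : ℝ, |s| ≤ δ → ∀ (n : ℕ) (h : X → ℂ),
      ‖(Mop P f s ^ n) h‖ ≤ 2 * exp (-c * s ^ 2 * n) * ‖h‖ := by
  obtain ⟨C, ρ, hC, h0, h1, H⟩ := Mop_approx hG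
  have hσ := sigma2_pos hG
  set σ2 := sigma2 P ν f with hσ2
  obtain ⟨L, hL⟩ : ∃ L : ℕ, C * ρ ^ L ≤ 1 / 8 := by
    have : Tendsto (fun L : ℕ => C * ρ ^ L) atTop (𝓝 (C * 0)) :=
      (tendsto_pow_atTop_nhds_zero_of_lt_one h0 h1).const_mul C
    rw [mul_zero] at this
    exact ((this.eventually_le_const (by norm_num : (0:ℝ) < 1 / 8))).exists
  set B : ℝ := 2 * Real.log 8 / σ2 with hB
  have hlog8 : 0 < Real.log 8 := Real.log_pos (by norm_num)
  have hBpos : 0 < B := by positivity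
  set D : ℝ := C * (L + B + 2) with hD
  have hDn : 0 ≤ D := by positivity
  set δ : ℝ := min 1 (1 / (4 * (D + 1))) with hδ
  have hlog2 : 0 < Real.log 2 := Real.log_pos (by norm_num)
  have hδpos : 0 < δ := lt_min one_pos (by positivity)
  refine ⟨δ, Real.log 2 / (B + 1 + L), hδpos, min_le_left _ _, by positivity, ?_⟩
  intro s hs n h
  by_cases hs0 : s = 0
  · subst hs0
    have := Mop_pow_norm_le (f := f) hG.st n 0 h
    simp only [ne_eq, OfNat.ofNat_ne_zero, not_false_eq_true, zero_pow, mul_zero, zero_mul, exp_zero]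
    linarith [norm_nonneg h]
  have hs1 : |s| ≤ 1 := hs.trans (min_le_left _ _)
  have hsp : 0 < s ^ 2 := by positivity
  have hs2 : s ^ 2 ≤ 1 := by rw [← sq_abs]; nlinarith [abs_nonneg s]
  set k : ℕ := ⌈B / s ^ 2⌉₊ with hk
  have hk1 : B ≤ k * s ^ 2 := by
    have := Nat.le_ceil (B / s ^ 2)
    rwa [div_le_iff₀ hsp] at this
  have hk2 : k * s ^ 2 ≤ B + 1 := by
    have := (Nat.ceil_lt_add_one (a := B / s ^ 2) (by positivity)).le
    have h2 : (k : ℝ) * s ^ 2 ≤ (B / s ^ 2 + 1) * s ^ 2 := by gcongr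
    rw [add_mul, div_mul_cancel₀ _ hsp.ne'] at h2
    linarith
  have hkpos : 1 ≤ k := by
    rw [hk, Nat.one_le_ceil_iff]; positivity
  have hstep : ∀ g : X → ℂ, ‖(Mop P f s ^ (k + L)) g‖ ≤ exp (-Real.log 2) * ‖g‖ := by
    intro g
    have h2 := H s hs1 k L g
    set w := (nuC ν g * ((exp (-(σ2 * s ^ 2 / 2)) : ℝ) : ℂ) ^ k) with hw
    have hwn : ‖w‖ ≤ 1 / 8 * ‖g‖ := by
      rw [hw, norm_mul, norm_pow, Complex.norm_real, Real.norm_of_nonneg (exp_pos _).le,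
        ← Real.exp_nat_mul, mul_comm]
      have : exp (k * -(σ2 * s ^ 2 / 2)) ≤ 1 / 8 := by
        rw [← Real.exp_log (by norm_num : (0:ℝ) < 1 / 8)]
        apply Real.exp_le_exp.2
        rw [one_div, Real.log_inv]
        have : σ2 * B / 2 = Real.log 8 := by rw [hB]; field_simp
        nlinarith
      gcongr
      exact nuC_norm_le hG.st g
    have hone : ‖(fun _ : X => (1 : ℂ))‖ = 1 := by simp
    have h3 : ‖w • (fun _ : X => (1 : ℂ))‖ ≤ 1 / 8 * ‖g‖ := by
      rw [norm_smul, hone, mul_one]; exact hwn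
    have h4 := norm_le_norm_add_norm_sub' ((Mop P f s ^ (k + L)) g) (w • (fun _ : X => (1 : ℂ)))
    have h5 : C * (ρ ^ L + (L + 1) * |s| + k * |s| ^ 3) ≤ 3 / 8 := by
      have : k * |s| ^ 3 ≤ (B + 1) * |s| := by
        have : (k : ℝ) * |s| ^ 3 = (k * s ^ 2) * |s| := by rw [← sq_abs]; ring
        rw [this]; gcongr
      have h6 : C * (ρ ^ L + (L + 1) * |s| + k * |s| ^ 3) ≤ C * ρ ^ L + D * |s| := by
        have : C * (ρ ^ L + (L + 1) * |s| + k * |s| ^ 3) ≤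
          C * (ρ ^ L + (L + 1) * |s| + (B + 1) * |s|) := by gcongr
        rw [hD]; nlinarith
      have h7 : D * |s| ≤ 1 / 4 := by
        have h8 : |s| ≤ 1 / (4 * (D + 1)) := hs.trans (min_le_right _ _)
        rw [le_div_iff₀ (by positivity)] at h8
        nlinarith [abs_nonneg s]
      linarith
    have h6 : ‖(Mop P f s ^ (k + L)) g‖ ≤ 1 / 2 * ‖g‖ := by
      have : C * (ρ ^ L + (L + 1) * |s| + k * |s| ^ 3) * ‖g‖ ≤ 3 / 8 * ‖g‖ := by gcongr
      linarith
    rw [Real.exp_neg, Real.exp_log (by norm_num)]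
    linarith
  have hN : 1 ≤ k + L := by omega
  have := decay_of_step (fun n => ‖(Mop P f s ^ n) h‖) (fun n => norm_nonneg _)
    (fun n => by
      show ‖(Mop P f s ^ (n + 1)) h‖ ≤ _
      rw [Mop_pow_succ]; exact Mop_norm_le hG.st _ _) (k + L) hN (Real.log 2) hlog2.le
      (fun n => by
        show ‖(Mop P f s ^ (n + (k + L))) h‖ ≤ _
        rw [add_comm, Mop_pow_add]; exact hstep _) n
  simp only [pow_zero] at this
  rw [Real.exp_log (by norm_num)] at this
  refine this.trans ?_
  have hfin : -Real.log 2 * n / ((k + L : ℕ) : ℝ) ≤ -(Real.log 2 / (B + 1 + L)) * s ^ 2 * n := by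
    have hNs : ((k + L : ℕ) : ℝ) * s ^ 2 ≤ B + 1 + L := by
      push_cast; nlinarith
    have hNp : (0 : ℝ) < ((k + L : ℕ) : ℝ) := by exact_mod_cast hN
    have : s ^ 2 / (B + 1 + L) ≤ 1 / ((k + L : ℕ) : ℝ) := by
      rw [div_le_div_iff₀ (by positivity) hNp]; linarith
    have h9 : (Real.log 2 * n) * (s ^ 2 / (B + 1 + L)) ≤ (Real.log 2 * n) * (1 / ((k + L : ℕ) : ℝ)) := by
      gcongr
    have e1 : -Real.log 2 * n / ((k + L : ℕ) : ℝ) = -((Real.log 2 * n) * (1 / ((k + L : ℕ) : ℝ))) := by ring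
    have e2 : -(Real.log 2 / (B + 1 + L)) * s ^ 2 * n = -((Real.log 2 * n) * (s ^ 2 / (B + 1 + L))) := by ring
    rw [e1, e2]; linarith
  have := Real.exp_le_exp.2 hfin
  have e3 : ((1 : (X → ℂ) →ₗ[ℂ] (X → ℂ)) h) = h := rfl
  rw [e3]
  gcongr

lemma Mop_pow_cont (n : ℕ) : Continuous (fun p : ℝ × (X → ℂ) => (Mop P f p.1 ^ n) p.2) := by
  induction n with
  | zero => exact continuous_snd
  | succ n ih =>
    simp only [Mop_pow_succ]
    refine continuous_pi fun x => ?_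
    simp only [Mop_apply]
    refine continuous_finsetSum _ fun x' _ => ?_
    refine Continuous.mul (by fun_prop) ?_
    exact (continuous_apply x').comp ih

lemma Mop_pow_le_kpow (hS : IsStochastic P ν) (t : ℝ) (n : ℕ) (h : X → ℂ) (x : X) :
    ‖(Mop P f t ^ n) h x‖ ≤ ∑ x', kpow P n x x' * ‖h x'‖ := by
  induction n generalizing x with
  | zero => simp [kpow]
  | succ n ih =>
    rw [Mop_pow_succ, Mop_apply]
    simp only [kpow, Finset.sum_mul]
    rw [Finset.sum_comm]
    refine (norm_sum_le _ _).trans (Finset.sum_le_sum fun y _ => ?_)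
    rw [norm_mul, norm_mul, norm_expI, mul_one, Complex.norm_real,
      Real.norm_of_nonneg (hS.nonneg _ _)]
    simp only [mul_assoc, ← Finset.mul_sum]
    exact mul_le_mul_of_nonneg_left (ih y) (hS.nonneg _ _)

/-- Rigidity: no unimodular orbit for `t ≠ 0`. -/
lemma Mop_rigid (hG : Good P ν f) (t : ℝ) (ht : t ≠ 0) (h : X → ℂ) (hh : ‖h‖ ≤ 1)
    (hN : ∀ N, 1 ≤ ‖(Mop P f t ^ N) h‖) : False := by
  obtain ⟨k, hk, hpos⟩ := hG.pr
  set u : ℕ → X → ℂ := fun N => (Mop P f t ^ N) h with hu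
  have hle : ∀ N x, ‖u N x‖ ≤ 1 := fun N x =>
    (norm_le_pi_norm (u N) x).trans ((Mop_pow_norm_le hG.st _ _ _).trans hh)
  -- moduli are one
  have habs : ∀ N x, ‖u N x‖ = 1 := by
    intro N x'
    obtain ⟨x, hx⟩ : ∃ x, 1 ≤ ‖u (k + N) x‖ := by
      by_contra hcon
      push Not at hcon
      have := (pi_norm_lt_iff (x := u (k + N)) one_pos).2 hcon
      exact absurd (hN (k + N)) (not_le.2 this)
    have h1 : ‖u (k + N) x‖ ≤ ∑ x', kpow P k x x' * ‖u N x'‖ := by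
      simp only [hu, Mop_pow_add]; exact Mop_pow_le_kpow hG.st t k _ x
    by_contra hne
    have hlt : ‖u N x'‖ < 1 := lt_of_le_of_ne (hle N x') hne
    have h2 : ∑ x', kpow P k x x' * ‖u N x'‖ < ∑ x', kpow P k x x' := by
      refine Finset.sum_lt_sum (fun y _ => ?_) ⟨x', Finset.mem_univ _, ?_⟩
      · have := hpos x y
        have := hle N y
        nlinarith
      · have := hpos x x'
        nlinarith
    rw [kpow_sum hG.st] at h2
    linarith
  have hne0 : ∀ N x, u N x ≠ 0 := fun N x h0 => by
    have := habs N x; rw [h0, norm_zero] at this; norm_num at this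
  -- edge relation
  have hedge : ∀ N x x', 0 < P x x' → u (N + 1) x = Complex.exp (Complex.I * t * f x') * u N x' := by
    intro N x x' hp
    set w := u (N + 1) x with hw
    have hwn : ‖w‖ = 1 := habs _ _
    set z : X → ℂ := fun x' => Complex.exp (Complex.I * t * f x') * u N x' with hz
    have hzn : ∀ x', ‖z x'‖ = 1 := fun x' => by
      simp only [hz]; rw [norm_mul, norm_expI, one_mul]; exact habs _ _
    have hsum : w = ∑ x', (P x x' : ℂ) * z x' := by
      rw [hw]
      simp only [hu, Mop_pow_succ, Mop_apply, hz, mul_assoc]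
    have hww : (starRingEnd ℂ) w * w = 1 := by
      rw [mul_comm, Complex.mul_conj, Complex.normSq_eq_norm_sq, hwn]; simp
    have hre : ∑ x', P x x' * ((starRingEnd ℂ) w * z x').re = 1 := by
      have h3 : (starRingEnd ℂ) w * w = ∑ x', (P x x' : ℂ) * ((starRingEnd ℂ) w * z x') := by
        have h4 : (starRingEnd ℂ) w * w = (starRingEnd ℂ) w * ∑ x', (P x x' : ℂ) * z x' :=
          congrArg _ hsum
        rw [h4, Finset.mul_sum]
        exact Finset.sum_congr rfl fun _ _ => by ring
      rw [hww] at h3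
      have := congrArg Complex.re h3
      simp only [Complex.one_re, Complex.re_sum, Complex.re_ofReal_mul] at this
      exact this.symm
    have hle1 : ∀ y, ((starRingEnd ℂ) w * z y).re ≤ 1 := fun y => by
      refine (Complex.re_le_norm _).trans ?_
      rw [norm_mul, RCLike.norm_conj, hwn, hzn, mul_one]
    have hre1 : ((starRingEnd ℂ) w * z x').re = 1 := by
      by_contra hne
      have hlt := lt_of_le_of_ne (hle1 x') hne
      have h2 : ∑ x', P x x' * ((starRingEnd ℂ) w * z x').re < ∑ x', P x x' := by
        refine Finset.sum_lt_sum (fun y _ => ?_) ⟨x', Finset.mem_univ _, ?_⟩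
        · have := hG.st.nonneg x y
          have := hle1 y
          nlinarith
        · nlinarith
      rw [hre, hG.st.rowSum] at h2
      exact lt_irrefl _ h2
    have hone : (starRingEnd ℂ) w * z x' = 1 := by
      have hn : ‖(starRingEnd ℂ) w * z x'‖ = 1 := by
        rw [norm_mul, RCLike.norm_conj, hwn, hzn, mul_one]
      have h4 : ((starRingEnd ℂ) w * z x').im = 0 := by
        have := Complex.sq_norm ((starRingEnd ℂ) w * z x')
        rw [hn, Complex.normSq_apply, hre1] at this
        nlinarith
      exact Complex.ext (by simpa using hre1) (by simpa using h4)
    calc w = w * ((starRingEnd ℂ) w * z x') := by rw [hone, mul_one]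
      _ = ((starRingEnd ℂ) w * w) * z x' := by ring
      _ = z x' := by rw [hww, one_mul]
  -- ratios
  set d : ℕ → X → ℂ := fun N x => u (N + 1) x / u N x with hd
  have hdedge : ∀ N x x', 0 < P x x' → d (N + 1) x = d N x' := by
    intro N x x' hp
    simp only [hd]
    rw [hedge (N + 1) x x' hp, hedge N x x' hp, mul_div_mul_left _ _ (Complex.exp_ne_zero _)]
  have hdk : ∀ j N x x', 0 < kpow P j x x' → d (j + N) x = d N x' := by
    intro j
    induction j with
    | zero =>
      intro N x x' hp
      simp only [kpow] at hp
      split_ifs at hp with he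
      · subst he; simp
      · exact absurd hp (lt_irrefl _)
    | succ j ih =>
      intro N x x' hp
      simp only [kpow] at hp
      obtain ⟨y, -, hy⟩ := Finset.exists_lt_of_sum_lt (s := Finset.univ) (f := fun _ : X => (0:ℝ))
        (g := fun y => P x y * kpow P j y x') (by simpa using hp)
      have hp1 : 0 < P x y := lt_of_le_of_ne (hG.st.nonneg _ _) fun h0 => by
        rw [← h0, zero_mul] at hy; exact lt_irrefl _ hy
      have hp2 : 0 < kpow P j y x' := lt_of_le_of_ne (kpow_nonneg hG.st _ _ _) fun h0 => by
        rw [← h0, mul_zero] at hy; exact lt_irrefl _ hy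
      rw [show j + 1 + N = (j + N) + 1 by ring, hdedge _ x y hp1, ih N y x' hp2]
  obtain ⟨x0⟩ := ‹Nonempty X›
  have hconst : ∀ N x, d N x = d N x0 := fun N x => by
    rw [← hdk k N x0 x (hpos _ _), ← hdk k N x0 x0 (hpos _ _)]
  set l := d 0 x0 with hl
  have hrel : ∀ x x', 0 < P x x' → l * u 0 x = Complex.exp (Complex.I * t * f x') * u 0 x' := by
    intro x x' hp
    rw [← hedge 0 x x' hp, hl, ← hconst 0 x]
    simp only [hd]
    rw [div_mul_cancel₀ _ (hne0 0 x)]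
  have hln : ‖l‖ = 1 := by
    simp only [hl, hd]; rw [norm_div, habs, habs, div_one]
  obtain ⟨θ, hθ⟩ : ∃ θ : ℝ, l = Complex.exp (θ * Complex.I) := by
    refine ⟨Complex.arg l, ?_⟩
    have := Complex.norm_mul_exp_arg_mul_I l
    rw [hln] at this
    simpa using this.symm
  obtain ⟨n, g, hg, hne⟩ := hG.nl (θ / t) (2 * π / t)
  have hp : ∀ i, 0 < P (g i) (g (i + 1)) := by
    intro i
    refine lt_of_le_of_ne (hG.st.nonneg _ _) fun h0 => hg.ne' ?_
    exact Finset.prod_eq_zero (Finset.mem_univ i) h0.symm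
  have h5 : ∑ i, f (g (i + 1)) = ∑ i, f (g i) :=
    (Equiv.sum_comp (Equiv.addRight (1 : Fin (n + 1))) (fun i => f (g i)))
  have h6 : ∏ i, u 0 (g (i + 1)) = ∏ i, u 0 (g i) :=
    (Equiv.prod_comp (Equiv.addRight (1 : Fin (n + 1))) (fun i => u 0 (g i)))
  have h7 : ∏ i, (l * u 0 (g i)) = ∏ i, (Complex.exp (Complex.I * t * f (g (i + 1))) * u 0 (g (i + 1))) :=
    Finset.prod_congr rfl fun i _ => hrel _ _ (hp i)
  rw [Finset.prod_mul_distrib, Finset.prod_mul_distrib, h6] at h7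
  have h8 := mul_right_cancel₀ (Finset.prod_ne_zero_iff.2 fun i _ => hne0 0 (g i)) h7
  rw [Finset.prod_const, Finset.card_univ, Fintype.card_fin, ← Complex.exp_sum,
    ← Finset.mul_sum, ← Complex.ofReal_sum, h5, hθ, ← Complex.exp_nat_mul, Complex.exp_eq_exp_iff_exists_int] at h8
  obtain ⟨m, hm⟩ := h8
  have h9 : ((n + 1 : ℕ) : ℝ) * θ = t * (∑ i, f (g i)) + m * (2 * π) := by
    have h10 : (((n + 1 : ℕ) : ℝ) * θ : ℂ) * Complex.I = ((t * (∑ i, f (g i)) + m * (2 * π) : ℝ) : ℂ) * Complex.I := by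
      push_cast at hm ⊢
      linear_combination hm
    have := mul_right_cancel₀ Complex.I_ne_zero h10
    exact_mod_cast this
  apply hne (-m)
  field_simp
  push_cast at h9 ⊢
  linarith

lemma Mop_decay_large (hG : Good P ν f) (δ T : ℝ) (hδ : 0 < δ) : ∃ (N : ℕ) (c : ℝ), 1 ≤ N ∧ 0 < c ∧
    ∀ t : ℝ, δ ≤ |t| → |t| ≤ T → ∀ h : X → ℂ, ‖(Mop P f t ^ N) h‖ ≤ exp (-c) * ‖h‖ := by
  set K : Set (ℝ × (X → ℂ)) := {t : ℝ | δ ≤ |t| ∧ |t| ≤ T} ×ˢ Metric.closedBall 0 1 with hK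
  have hKt : IsCompact {t : ℝ | δ ≤ |t| ∧ |t| ≤ T} := by
    refine (isCompact_Icc (a := -T) (b := T)).of_isClosed_subset ?_ ?_
    · exact (isClosed_le continuous_const continuous_abs).inter (isClosed_le continuous_abs continuous_const)
    · rintro t ⟨_, h⟩; exact abs_le.1 h
  have hKc : IsCompact K := hKt.prod (isCompact_closedBall _ _)
  have hcont : ∀ N, Continuous (fun p : ℝ × (X → ℂ) => ‖(Mop P f p.1 ^ N) p.2‖) := fun N =>
    (Mop_pow_cont N).norm
  have hex : ∃ N, 1 ≤ N ∧ ∀ p ∈ K, ‖(Mop P f p.1 ^ N) p.2‖ < 1 := by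
    by_contra hcon
    push Not at hcon
    set B : ℕ → Set (ℝ × (X → ℂ)) := fun N => K ∩ {p | 1 ≤ ‖(Mop P f p.1 ^ (N + 1)) p.2‖} with hB
    have hcl : ∀ N, IsClosed (B N) := fun N =>
      hKc.isClosed.inter (isClosed_le continuous_const (hcont _))
    have hne : (⋂ N, B N).Nonempty := by
      refine IsCompact.nonempty_iInter_of_sequence_nonempty_isCompact_isClosed B ?_ ?_ ?_ hcl
      · rintro N p ⟨hp, hp2⟩
        refine ⟨hp, ?_⟩
        simp only [Set.mem_ofPred_eq] at hp2 ⊢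
        refine hp2.trans ?_
        rw [Mop_pow_succ (N + 1)]; exact Mop_norm_le hG.st _ _
      · intro N
        obtain ⟨p, hp, hp2⟩ := hcon (N + 1) (by omega)
        exact ⟨p, hp, hp2⟩
      · exact hKc.inter_right (isClosed_le continuous_const (hcont _))
    obtain ⟨⟨t, h⟩, hp⟩ := hne
    simp only [Set.mem_iInter, hB, hK, Set.mem_inter_iff, Set.mem_prod, Set.mem_ofPred_eq,
      mem_closedBall_zero_iff] at hp
    have h0 := hp 0
    refine Mop_rigid hG t ?_ h h0.1.2 ?_
    · intro ht; have := h0.1.1.1; rw [ht, abs_zero] at this; linarith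
    · intro N
      cases N with
      | zero =>
        refine (hp 0).2.trans ?_
        exact Mop_pow_norm_le hG.st _ _ _
      | succ N => exact (hp N).2
  obtain ⟨N, hN, hlt⟩ := hex
  obtain ⟨c, hc, hcle⟩ : ∃ c : ℝ, 0 < c ∧ ∀ p ∈ K, ‖(Mop P f p.1 ^ N) p.2‖ ≤ exp (-c) := by
    by_cases hKe : K.Nonempty
    · obtain ⟨p, hp, hmax⟩ := hKc.exists_isMaxOn hKe (hcont N).continuousOn
      set a := ‖(Mop P f p.1 ^ N) p.2‖ with ha
      have ha1 : a < 1 := hlt p hp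
      refine ⟨1 - a, by linarith, fun p' hp' => (hmax hp').trans ?_⟩
      have := Real.add_one_le_exp (-(1 - a)); simp only; linarith
    · exact ⟨1, one_pos, fun p hp => absurd ⟨p, hp⟩ hKe⟩
  refine ⟨N, c, hN, hc, fun t h1 h2 h => ?_⟩
  by_cases hz : h = 0
  · subst hz; simp
  have hn : 0 < ‖h‖ := norm_pos_iff.2 hz
  have := hcle (t, ((‖h‖⁻¹ : ℝ) : ℂ) • h) ⟨⟨h1, h2⟩, by
    rw [mem_closedBall_zero_iff, norm_smul, Complex.norm_real, norm_inv, norm_norm,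
      inv_mul_cancel₀ hn.ne']⟩
  simp only [map_smul] at this
  rw [norm_smul, Complex.norm_real, norm_inv, norm_norm, inv_mul_le_iff₀ hn] at this
  linarith

/-- Uniform Gaussian decay on compact frequency sets. -/
lemma Mop_decay (hG : Good P ν f) (T : ℝ) : ∃ C c : ℝ, 0 ≤ C ∧ 0 < c ∧
    ∀ t : ℝ, |t| ≤ T → ∀ (n : ℕ) (h : X → ℂ),
      ‖(Mop P f t ^ n) h‖ ≤ C * exp (-c * t ^ 2 * n) * ‖h‖ := by
  obtain ⟨δ, c1, hδ, -, hc1, H1⟩ := Mop_decay_small hG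
  obtain ⟨N, c2, hN, hc2, H2⟩ := Mop_decay_large hG δ T hδ
  have hNp : (0 : ℝ) < N := by exact_mod_cast hN
  set c := min c1 (c2 / (N * (T ^ 2 + 1))) with hc
  have hcp : 0 < c := lt_min hc1 (by positivity)
  refine ⟨2 + exp c2, c, by positivity, hcp, fun t ht n h => ?_⟩
  by_cases htδ : |t| ≤ δ
  · refine (H1 t htδ n h).trans ?_
    have e1 : exp (-c1 * t ^ 2 * n) ≤ exp (-c * t ^ 2 * n) := by
      apply Real.exp_le_exp.2
      have : c ≤ c1 := min_le_left _ _
      have h3 : 0 ≤ t ^ 2 * (n : ℝ) := by positivity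
      nlinarith
    have : 2 * exp (-c1 * t ^ 2 * n) ≤ (2 + exp c2) * exp (-c * t ^ 2 * n) := by
      have := exp_pos c2
      have := exp_pos (-c * t ^ 2 * n)
      nlinarith
    gcongr
  · push Not at htδ
    have := decay_of_step (fun n => ‖(Mop P f t ^ n) h‖) (fun n => norm_nonneg _)
      (fun n => by
        show ‖(Mop P f t ^ (n + 1)) h‖ ≤ _
        rw [Mop_pow_succ]; exact Mop_norm_le hG.st _ _) N hN c2 hc2.le
      (fun n => by
        show ‖(Mop P f t ^ (n + N)) h‖ ≤ _
        rw [add_comm, Mop_pow_add]; exact H2 t htδ.le ht _) n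
    simp only [pow_zero] at this
    refine this.trans ?_
    have e3 : ((1 : (X → ℂ) →ₗ[ℂ] (X → ℂ)) h) = h := rfl
    rw [e3]
    have e1 : exp (-c2 * n / N) ≤ exp (-c * t ^ 2 * n) := by
      apply Real.exp_le_exp.2
      have h1 : c ≤ c2 / (N * (T ^ 2 + 1)) := min_le_right _ _
      rw [le_div_iff₀ (by positivity)] at h1
      have h2 : t ^ 2 ≤ T ^ 2 + 1 := by
        have : |t| ^ 2 ≤ T ^ 2 := by gcongr
        rw [sq_abs] at this; linarith
      have h3 : c * t ^ 2 ≤ c2 / N := by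
        rw [le_div_iff₀ hNp]
        have : c * t ^ 2 * N ≤ c * (T ^ 2 + 1) * N := by gcongr
        linarith
      have h4 : c * t ^ 2 * n ≤ c2 / N * n := by gcongr
      have e5 : -c2 * n / N = -(c2 / N * n) := by ring
      rw [e5]; linarith
    have : exp c2 * exp (-c2 * n / N) ≤ (2 + exp c2) * exp (-c * t ^ 2 * n) := by
      have := exp_pos c2
      have := exp_pos (-c * t ^ 2 * n)
      nlinarith
    gcongr

/-- Pointwise limit of the normalised characteristic operators. -/
lemma Mop_limit (hG : Good P ν f) (θ : ℝ) (h : X → ℂ) (x : X) :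
    Tendsto (fun n : ℕ => (Mop P f (θ / √n) ^ n) h x) atTop
      (𝓝 (nuC ν h * ((exp (-(sigma2 P ν f * θ ^ 2 / 2)) : ℝ) : ℂ))) := by
  obtain ⟨C, ρ, hC, h0, h1, H⟩ := Mop_approx hG
  have hσ := sigma2_pos hG
  set σ2 := sigma2 P ν f with hσ2
  rw [Metric.tendsto_atTop]
  intro ε hε
  obtain ⟨L, hL⟩ : ∃ L : ℕ, C * ρ ^ L * ‖h‖ < ε / 2 := by
    have : Tendsto (fun L : ℕ => C * ρ ^ L * ‖h‖) atTop (𝓝 (C * 0 * ‖h‖)) :=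
      ((tendsto_pow_atTop_nhds_zero_of_lt_one h0 h1).const_mul C).mul_const _
    rw [mul_zero, zero_mul] at this
    exact ((this.eventually_lt_const (by positivity : (0:ℝ) < ε / 2))).exists
  have hs : Tendsto (fun n : ℕ => |θ / √n|) atTop (𝓝 0) := by
    have h3 : Tendsto (fun n : ℕ => √(n : ℝ)) atTop atTop :=
      Real.tendsto_sqrt_atTop.comp tendsto_natCast_atTop_atTop
    have := (h3.const_div_atTop θ).abs
    simpa using this
  have hbd : Tendsto (fun n : ℕ => C * (ρ ^ L + (L + 1) * |θ / √n| + θ ^ 2 * |θ / √n|) * ‖h‖ +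
      ‖nuC ν h‖ * |exp (-(σ2 * θ ^ 2 / 2)) ^ (((n - L : ℕ) : ℝ) / n) - exp (-(σ2 * θ ^ 2 / 2))|) atTop
      (𝓝 (C * (ρ ^ L + (L + 1) * 0 + θ ^ 2 * 0) * ‖h‖ + ‖nuC ν h‖ * |exp (-(σ2 * θ ^ 2 / 2)) ^ (1 : ℝ) - exp (-(σ2 * θ ^ 2 / 2))|)) := by
    have hr : Tendsto (fun n : ℕ => ((n - L : ℕ) : ℝ) / n) atTop (𝓝 1) := by
      have h4 : Tendsto (fun n : ℕ => 1 - (L : ℝ) / n) atTop (𝓝 (1 - 0)) :=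
        tendsto_const_nhds.sub (tendsto_const_div_atTop_nhds_zero_nat (L : ℝ))
      rw [sub_zero] at h4
      refine h4.congr' ?_
      filter_upwards [eventually_ge_atTop (L + 1)] with n hn
      have : (n : ℝ) ≠ 0 := by
        have : 0 < n := by omega
        exact_mod_cast this.ne'
      rw [Nat.cast_sub (by omega)]; field_simp
    have hpow : Tendsto (fun n : ℕ => exp (-(σ2 * θ ^ 2 / 2)) ^ (((n - L : ℕ) : ℝ) / n)) atTop
        (𝓝 (exp (-(σ2 * θ ^ 2 / 2)) ^ (1 : ℝ))) :=
      (Real.continuousAt_const_rpow (exp_pos _).ne').tendsto.comp hr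
    refine Tendsto.add ?_ ((hpow.sub_const _).abs.const_mul _)
    exact ((((tendsto_const_nhds.add (hs.const_mul _)).add (hs.const_mul _)).const_mul C).mul_const _)
  simp only [mul_zero, add_zero, Real.rpow_one, sub_self, abs_zero] at hbd
  have hev := hbd.eventually_lt_const (show C * ρ ^ L * ‖h‖ < ε by linarith)
  have hs1 := hs.eventually_le_const (show (0:ℝ) < 1 by norm_num)
  obtain ⟨N0, hN0⟩ := eventually_atTop.1 (hev.and (hs1.and (eventually_ge_atTop (L + 1))))
  refine ⟨N0, fun n hn => ?_⟩
  obtain ⟨e1, e2, e3⟩ := hN0 n hn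
  have hnp : (0 : ℝ) < n := by
    have : 0 < n := by omega
    exact_mod_cast this
  set s := θ / √n with hsdef
  have hss : s ^ 2 = θ ^ 2 / n := by rw [hsdef, div_pow, Real.sq_sqrt hnp.le]
  have hH := H s e2 (n - L) L h
  rw [Nat.sub_add_cancel (by omega)] at hH
  have hpt := (norm_le_pi_norm _ x).trans hH
  simp only [Pi.sub_apply, Pi.smul_apply, smul_eq_mul, mul_one] at hpt
  have hlam : ((exp (-(σ2 * s ^ 2 / 2)) : ℝ) : ℂ) ^ (n - L) =
      ((exp (-(σ2 * θ ^ 2 / 2)) ^ (((n - L : ℕ) : ℝ) / n) : ℝ) : ℂ) := by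
    rw [← Complex.ofReal_pow, ← Real.exp_nat_mul, ← Real.exp_mul, hss]
    congr 2
    field_simp
  rw [hlam] at hpt
  refine lt_of_le_of_lt ?_ e1
  rw [dist_eq_norm]
  have htri := norm_sub_le_norm_sub_add_norm_sub ((Mop P f s ^ n) h x)
    (nuC ν h * ((exp (-(σ2 * θ ^ 2 / 2)) ^ (((n - L : ℕ) : ℝ) / n) : ℝ) : ℂ))
    (nuC ν h * ((exp (-(σ2 * θ ^ 2 / 2)) : ℝ) : ℂ))
  refine htri.trans ?_
  refine add_le_add (hpt.trans ?_) ?_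
  · have : ((n - L : ℕ) : ℝ) * |s| ^ 3 ≤ θ ^ 2 * |s| := by
      have h5 : ((n - L : ℕ) : ℝ) ≤ n := by exact_mod_cast Nat.sub_le _ _
      have h6 : |s| ^ 3 = s ^ 2 * |s| := by rw [← sq_abs]; ring
      rw [h6, hss]
      calc ((n - L : ℕ) : ℝ) * (θ ^ 2 / n * |s|) ≤ n * (θ ^ 2 / n * |s|) := by gcongr
        _ = _ := by field_simp
    gcongr
  · rw [← mul_sub, norm_mul, ← Complex.ofReal_sub, Complex.norm_real, Real.norm_eq_abs]

end chf2

set_option linter.unusedSectionVars false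

/-! The Fejer kernel -/

/-- Triangle function. -/
noncomputable def tri (t : ℝ) : ℝ := max 0 (1 - |t|) / (2 * π)

/-- Fejer kernel. -/
noncomputable def fj (u : ℝ) : ℝ := ∫ t, tri t * cos (t * u)

lemma tri_cont : Continuous tri := by unfold tri; fun_prop
lemma tri_nonneg (t : ℝ) : 0 ≤ tri t := by unfold tri; positivity
lemma tri_le (t : ℝ) : tri t ≤ 1 / (2 * π) := by
  unfold tri
  gcongr
  exact max_le zero_le_one (by linarith [abs_nonneg t])
lemma tri_le_one (t : ℝ) : tri t ≤ 1 := by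
  refine (tri_le t).trans ?_
  rw [div_le_one (by positivity)]
  linarith [Real.pi_gt_three]
lemma tri_supp {t : ℝ} (h : 1 ≤ |t|) : tri t = 0 := by
  unfold tri; rw [max_eq_left (by linarith)]; simp
lemma tri_neg (t : ℝ) : tri (-t) = tri t := by unfold tri; rw [abs_neg]
lemma tri_zero : tri 0 = 1 / (2 * π) := by unfold tri; simp
lemma tri_hcs : HasCompactSupport tri := by
  refine HasCompactSupport.intro (isCompact_Icc (a := (-1 : ℝ)) (b := 1)) fun t ht => ?_
  apply tri_supp
  by_contra hh
  push Not at hh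
  exact ht ⟨(abs_lt.1 hh).1.le, (abs_lt.1 hh).2.le⟩
lemma tri_integrable : Integrable tri := tri_cont.integrable_of_hasCompactSupport tri_hcs

lemma tri_cos_integrable (u : ℝ) : Integrable (fun t => tri t * cos (t * u)) := by
  refine tri_integrable.mono' ((tri_cont.mul (by fun_prop)).aestronglyMeasurable) ?_
  refine ae_of_all _ fun t => ?_
  rw [norm_mul, Real.norm_of_nonneg (tri_nonneg t)]
  exact mul_le_of_le_one_right (tri_nonneg t) (Real.abs_cos_le_one _)

lemma fj_cont : Continuous fj := by
  unfold fj
  refine continuous_of_dominated (bound := tri) (fun u => (tri_cos_integrable u).aestronglyMeasurable)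
    (fun u => ae_of_all _ fun t => ?_) tri_integrable (ae_of_all _ fun t => by fun_prop)
  rw [norm_mul, Real.norm_of_nonneg (tri_nonneg t)]
  exact mul_le_of_le_one_right (tri_nonneg t) (Real.abs_cos_le_one _)

lemma fj_sq (u : ℝ) : u ^ 2 * fj u = (1 - cos u) / π := by
  have h1 : fj u = 2 * ∫ t in Set.Ioi (0:ℝ), max 0 (1 - t) / (2 * π) * cos (t * u) := by
    rw [← integral_comp_abs (f := fun t => max 0 (1 - t) / (2 * π) * cos (t * u))]
    unfold fj
    refine integral_congr_ae (ae_of_all _ fun t => ?_)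
    simp only [tri]
    congr 1
    rcases abs_choice t with h | h <;> rw [h]
    rw [neg_mul, cos_neg]
  have h2 : ∫ t in Set.Ioi (0:ℝ), max 0 (1 - t) / (2 * π) * cos (t * u) =
      ∫ t in Set.Ioc (0:ℝ) 1, (1 - t) / (2 * π) * cos (t * u) := by
    rw [← integral_indicator measurableSet_Ioi, ← integral_indicator measurableSet_Ioc]
    refine integral_congr_ae (ae_of_all _ fun t => ?_)
    simp only [Set.indicator, Set.mem_Ioi, Set.mem_Ioc]
    by_cases ht : 0 < t
    · by_cases ht1 : t ≤ 1
      · simp [ht, ht1]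
      · simp only [ht, ht1, and_false, if_true, if_false]
        rw [max_eq_left (by linarith)]; simp
    · simp [ht]
  rw [h1, h2, ← intervalIntegral.integral_of_le zero_le_one]
  by_cases hu : u = 0
  · subst hu; simp
  have h3 : ∫ t in (0:ℝ)..1, (1 - t) / (2 * π) * cos (t * u) =
      (((1 - 1) * sin (1 * u) / u - cos (1 * u) / u ^ 2) / (2 * π)) -
      (((1 - 0) * sin (0 * u) / u - cos (0 * u) / u ^ 2) / (2 * π)) := by
    refine intervalIntegral.integral_eq_sub_of_hasDerivAt
      (f := fun t => ((1 - t) * sin (t * u) / u - cos (t * u) / u ^ 2) / (2 * π)) (fun t _ => ?_) ?_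
    · have d1 : HasDerivAt (fun t => t * u) u t := by simpa using (hasDerivAt_id t).mul_const u
      have d2 := d1.sin
      have d3 := d1.cos
      have d4 : HasDerivAt (fun t : ℝ => 1 - t) (-1) t := by simpa using (hasDerivAt_id t).const_sub 1
      have := ((((d4.mul d2).div_const u).sub (d3.div_const (u ^ 2))).div_const (2 * π))
      refine this.congr_deriv ?_
      field_simp
      ring
    · exact (Continuous.intervalIntegrable (by fun_prop) _ _)
  rw [h3]
  simp only [sub_self, zero_mul, sin_zero, cos_zero, mul_zero, zero_div, one_mul, sub_zero]
  field_simp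
  ring

lemma fj_zero_nonneg (u : ℝ) : 0 ≤ fj u := by
  by_cases hu : u = 0
  · subst hu
    unfold fj
    refine integral_nonneg fun t => ?_
    simp [tri_nonneg]
  · have h1 := fj_sq u
    have h2 : 0 < u ^ 2 := by positivity
    have h3 : 0 ≤ (1 - cos u) / π := div_nonneg (by linarith [cos_le_one u]) pi_pos.le
    rw [← h1] at h3
    exact nonneg_of_mul_nonneg_right h3 h2

lemma integral_tri_le : ∫ t, tri t ≤ 1 := by
  have : ∫ t, tri t = ∫ t in Set.Ioc (-1:ℝ) 1, tri t := by
    rw [← integral_indicator measurableSet_Ioc]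
    refine integral_congr_ae (ae_of_all _ fun t => ?_)
    by_cases ht : t ∈ Set.Ioc (-1:ℝ) 1
    · rw [Set.indicator_of_mem ht]
    · rw [Set.indicator_of_notMem ht]
      apply tri_supp
      by_contra hh
      push Not at hh
      exact ht ⟨(abs_lt.1 hh).1, (abs_lt.1 hh).2.le⟩
  rw [this]
  have h2 : ∫ t in Set.Ioc (-1:ℝ) 1, tri t ≤ ∫ t in Set.Ioc (-1:ℝ) 1, 1 / (2 * π) := by
    refine integral_mono tri_integrable.integrableOn (integrable_const _) fun t => tri_le t
  refine h2.trans ?_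
  simp
  have := Real.pi_gt_three
  norm_num
  have h3 : π⁻¹ ≤ 1 := inv_le_one_of_one_le₀ (by linarith)
  linarith

lemma fj_le (u : ℝ) : fj u ≤ 3 * (1 + u ^ 2)⁻¹ := by
  have h1 : fj u ≤ 1 := by
    refine le_trans ?_ integral_tri_le
    unfold fj
    refine integral_mono (tri_cos_integrable u) tri_integrable fun t => ?_
    exact mul_le_of_le_one_right (tri_nonneg t) (cos_le_one _)
  have h2 := fj_sq u
  have h3 : (1 - cos u) / π ≤ 1 := by
    rw [div_le_one pi_pos]
    linarith [neg_one_le_cos u, Real.pi_gt_three]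
  rw [← div_eq_mul_inv, le_div_iff₀ (by positivity)]
  linarith

lemma fj_integrable : Integrable fj := by
  refine (integrable_inv_one_add_sq.const_mul 3).mono' fj_cont.aestronglyMeasurable ?_
  refine ae_of_all _ fun u => ?_
  rw [Real.norm_of_nonneg (fj_zero_nonneg u)]
  exact fj_le u

lemma tri_sin_integral (u : ℝ) : ∫ t, tri t * sin (t * u) = 0 := by
  have h := integral_neg_eq_self (fun t => tri t * sin (t * u)) volume
  have h2 : ∫ t, tri (-t) * sin (-t * u) = - ∫ t, tri t * sin (t * u) := by
    rw [← integral_neg]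
    refine integral_congr_ae (ae_of_all _ fun t => ?_)
    simp only [tri_neg, neg_mul, sin_neg, mul_neg]
  rw [h2] at h
  linarith

lemma fj_integral : ∫ u, fj u = 1 := by
  set F : ℝ → ℂ := fun t => (tri t : ℂ) with hF
  have hFT : ∀ w : ℝ, FourierTransform.fourier F w = ((fj (2 * π * w) : ℝ) : ℂ) := by
    intro w
    rw [Real.fourier_real_eq_integral_exp_smul]
    have e : ∀ v : ℝ, Complex.exp (((-2 * π * v * w : ℝ) : ℂ) * Complex.I) • F v =
        ((tri v * cos (v * (2 * π * w)) : ℝ) : ℂ) -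
          ((tri v * sin (v * (2 * π * w)) : ℝ) : ℂ) * Complex.I := by
      intro v
      rw [Complex.exp_mul_I, ← Complex.ofReal_cos, ← Complex.ofReal_sin]
      have : (-2 * π * v * w) = -(v * (2 * π * w)) := by ring
      rw [this, cos_neg, sin_neg, smul_eq_mul, hF]
      push_cast; ring
    simp only [e]
    have hsin : Integrable (fun v => tri v * sin (v * (2 * π * w))) := by
      refine tri_integrable.mono' ((tri_cont.mul (by fun_prop)).aestronglyMeasurable) ?_
      refine ae_of_all _ fun t => ?_
      rw [norm_mul, Real.norm_of_nonneg (tri_nonneg t)]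
      exact mul_le_of_le_one_right (tri_nonneg t) (Real.abs_sin_le_one _)
    rw [integral_sub (tri_cos_integrable _).ofReal (hsin.ofReal.mul_const _),
      integral_mul_const, integral_complex_ofReal, integral_complex_ofReal, tri_sin_integral]
    simp [fj]
  have hFc : Continuous F := Complex.continuous_ofReal.comp tri_cont
  have hFi : Integrable F := tri_integrable.ofReal
  have hFTi : Integrable (FourierTransform.fourier F) := by
    have : FourierTransform.fourier F = fun w : ℝ => ((fj (2 * π * w) : ℝ) : ℂ) := funext hFT
    rw [this]
    exact (fj_integrable.comp_mul_left' (by positivity : (2 * π) ≠ 0)).ofReal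
  have hinv := congrFun (hFc.fourierInv_fourier_eq hFi hFTi) 0
  rw [Real.fourierInv_eq'] at hinv
  simp only [inner_zero_right, mul_zero, Complex.ofReal_zero, zero_mul, Complex.exp_zero,
    one_smul, hFT, integral_complex_ofReal] at hinv
  have h3 : ∫ w : ℝ, fj (2 * π * w) = |(2 * π)⁻¹| • ∫ u, fj u := Measure.integral_comp_mul_left fj (2 * π)
  rw [h3, hF] at hinv
  simp only [tri_zero] at hinv
  have h4 : |(2 * π)⁻¹| • ∫ u, fj u = 1 / (2 * π) := by exact_mod_cast hinv
  rw [abs_of_pos (by positivity), smul_eq_mul] at h4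
  field_simp at h4
  linarith

/-- Lower bound of the sum of two shifted Fejer kernels. -/
lemma fj_shift (u : ℝ) : (1 + u ^ 2)⁻¹ ≤ π ^ 3 * (fj u + fj (u + π)) := by
  have h1 := fj_sq u
  have h2 := fj_sq (u + π)
  rw [cos_add_pi] at h2
  have a1 := fj_zero_nonneg u
  have a2 := fj_zero_nonneg (u + π)
  have hπ := Real.pi_gt_three
  have b1 : u ^ 2 ≤ 2 * (u ^ 2 + π ^ 2) := by nlinarith
  have b2 : (u + π) ^ 2 ≤ 2 * (u ^ 2 + π ^ 2) := by nlinarith [sq_nonneg (u - π)]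
  have c1 : 2 / π ≤ 2 * (u ^ 2 + π ^ 2) * (fj u + fj (u + π)) := by
    have : u ^ 2 * fj u + (u + π) ^ 2 * fj (u + π) = 2 / π := by rw [h1, h2]; field_simp; ring
    rw [← this]
    nlinarith
  have c2 : u ^ 2 + π ^ 2 ≤ π ^ 2 * (1 + u ^ 2) := by
    nlinarith [mul_nonneg (sq_nonneg u) (show 0 ≤ π ^ 2 - 1 by nlinarith)]
  rw [inv_le_iff_one_le_mul₀ (by positivity)]
  have c3 : 2 / π ≤ 2 * (π ^ 2 * (1 + u ^ 2)) * (fj u + fj (u + π)) := by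
    refine c1.trans ?_
    gcongr
  rw [div_le_iff₀ pi_pos] at c3
  nlinarith

/-- Scaled kernel. -/
noncomputable def fjd (δ u : ℝ) : ℝ := ∫ t, tri (δ * t) * cos (t * u)

lemma fjd_eq {δ : ℝ} (hδ : 0 < δ) (u : ℝ) : fjd δ u = fj (u / δ) / δ := by
  have h := Measure.integral_comp_mul_left (fun t => tri t * cos (t * (u / δ))) δ
  rw [abs_of_pos (inv_pos.2 hδ), smul_eq_mul] at h
  unfold fjd fj
  rw [div_eq_inv_mul, ← h]
  refine integral_congr_ae (ae_of_all _ fun t => ?_)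
  simp only
  congr 2
  field_simp

lemma fjd_cont {δ : ℝ} (hδ : 0 < δ) : Continuous (fjd δ) := by
  have : fjd δ = fun u => fj (u / δ) / δ := funext (fjd_eq hδ)
  rw [this]
  exact (fj_cont.comp (continuous_id.div_const δ)).div_const δ

lemma fjd_nonneg {δ : ℝ} (hδ : 0 < δ) (u : ℝ) : 0 ≤ fjd δ u := by
  rw [fjd_eq hδ]; exact div_nonneg (fj_zero_nonneg _) hδ.le

lemma fjd_integrable {δ : ℝ} (hδ : 0 < δ) : Integrable (fjd δ) := by
  have : fjd δ = fun u => fj (u / δ) / δ := funext (fjd_eq hδ)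
  rw [this]
  exact (fj_integrable.comp_div hδ.ne').div_const δ

lemma fjd_integral {δ : ℝ} (hδ : 0 < δ) : ∫ u, fjd δ u = 1 := by
  simp only [fjd_eq hδ, integral_div]
  rw [Measure.integral_comp_div, fj_integral, abs_of_pos hδ, smul_eq_mul, mul_one, div_self hδ.ne']

lemma fjd_tail {δ d u : ℝ} (hδ : 0 < δ) (hd : 0 < d) (hu : d ≤ |u|) :
    fjd δ u ≤ δ * (1 + 1 / d ^ 2) * (1 + u ^ 2)⁻¹ := by
  have hu0 : u ≠ 0 := fun h => by rw [h, abs_zero] at hu; linarith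
  have h1 := fj_sq (u / δ)
  have h3 : (1 - cos (u / δ)) / π ≤ 1 := by
    rw [div_le_one pi_pos]
    linarith [neg_one_le_cos (u / δ), Real.pi_gt_three]
  have hup : 0 < u ^ 2 := by positivity
  have h2 : fjd δ u ≤ δ / u ^ 2 := by
    rw [fjd_eq hδ, le_div_iff₀ hup]
    have e : u ^ 2 = δ ^ 2 * (u / δ) ^ 2 := by field_simp
    have : fj (u / δ) / δ * u ^ 2 = δ * ((u / δ) ^ 2 * fj (u / δ)) := by
      rw [e]; field_simp
    rw [this, h1]
    nlinarith
  refine h2.trans ?_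
  have hd2 : d ^ 2 ≤ u ^ 2 := by rw [← sq_abs u]; gcongr
  rw [div_le_iff₀ hup, mul_assoc, mul_assoc]
  refine le_mul_of_one_le_right hδ.le ?_
  rw [inv_mul_eq_div, mul_div_assoc', le_div_iff₀ (by positivity)]
  have : 1 ≤ 1 / d ^ 2 * u ^ 2 := by
    rw [one_div, inv_mul_eq_div, le_div_iff₀ (by positivity)]; linarith
  nlinarith

/-- Concentration. -/
lemma fjd_conc (d η : ℝ) (hd : 0 < d) (hη : 0 < η) : ∃ δ0 > 0, ∀ δ, 0 < δ → δ ≤ δ0 →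
    1 - η ≤ ∫ u in (-d)..d, fjd δ u := by
  have hlim : Tendsto (fun R : ℝ => ∫ u in (-R)..R, fj u) atTop (𝓝 (∫ u, fj u)) :=
    intervalIntegral_tendsto_integral fj_integrable tendsto_neg_atTop_atBot tendsto_id
  rw [fj_integral] at hlim
  obtain ⟨R, hR⟩ := eventually_atTop.1 ((tendsto_order.1 hlim).1 (1 - η) (by linarith))
  set R' := max R 1 with hR'
  have hRp : 0 < R' := lt_of_lt_of_le one_pos (le_max_right _ _)
  refine ⟨d / R', by positivity, fun δ hδ hle => ?_⟩
  have h1 : R ≤ d / δ := by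
    rw [le_div_iff₀ hδ]
    rw [le_div_iff₀ hRp] at hle
    have : R ≤ R' := le_max_left _ _
    nlinarith
  have h2 := hR _ h1
  have h3 : ∫ u in (-d)..d, fjd δ u = ∫ u in (-(d / δ))..(d / δ), fj u := by
    simp only [fjd_eq hδ]
    rw [intervalIntegral.integral_div, intervalIntegral.integral_comp_div _ hδ.ne', smul_eq_mul,
      mul_div_assoc, mul_comm, div_mul_cancel₀ _ hδ.ne', neg_div]
  rw [h3]; exact h2.le

/-- Gaussian density of variance `v`. -/
noncomputable def pg (v u : ℝ) : ℝ := exp (-u ^ 2 / (2 * v)) / √(2 * π * v)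

lemma gauss_integrable {v : ℝ} (hv : 0 < v) : Integrable (fun θ : ℝ => exp (-(v * θ ^ 2 / 2))) := by
  have := integrable_exp_neg_mul_sq (b := v / 2) (by positivity)
  refine this.congr (ae_of_all _ fun θ => ?_)
  simp only; congr 1; ring

lemma gauss_cos_integrable {v : ℝ} (hv : 0 < v) (a : ℝ) :
    Integrable (fun θ : ℝ => exp (-(v * θ ^ 2 / 2)) * cos (θ * a)) := by
  refine (gauss_integrable hv).mono' (by fun_prop) (ae_of_all _ fun t => ?_)
  rw [norm_mul, Real.norm_of_nonneg (exp_pos _).le]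
  exact mul_le_of_le_one_right (exp_pos _).le (Real.abs_cos_le_one _)

lemma pg_fourier {v : ℝ} (hv : 0 < v) (a : ℝ) :
    ∫ θ : ℝ, exp (-(v * θ ^ 2 / 2)) * cos (θ * a) = 2 * π * pg v a := by
  have h := fourierIntegral_gaussian (b := ((v / 2 : ℝ) : ℂ)) (by simpa using by positivity) (a : ℂ)
  have hi : Integrable (fun x : ℝ => Complex.exp (Complex.I * a * x) *
      Complex.exp (-((v / 2 : ℝ) : ℂ) * (x : ℂ) ^ 2)) := by
    have := (gauss_integrable hv).ofReal (𝕜 := ℂ)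
    refine this.mono (by fun_prop) (ae_of_all _ fun x => ?_)
    rw [norm_mul, norm_expI, one_mul]
    apply le_of_eq
    have : -((v / 2 : ℝ) : ℂ) * (x : ℂ) ^ 2 = ((-(v * x ^ 2 / 2) : ℝ) : ℂ) := by push_cast; ring
    rw [this, ← Complex.ofReal_exp]; simp
  have h2 := congrArg Complex.re h
  have h3 := integral_re hi
  simp only [RCLike.re_eq_complex_re] at h3
  rw [← h3] at h2
  have e1 : ∀ x : ℝ, (Complex.exp (Complex.I * a * x) *
      Complex.exp (-((v / 2 : ℝ) : ℂ) * (x : ℂ) ^ 2)).re = exp (-(v * x ^ 2 / 2)) * cos (x * a) := by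
    intro x
    have : -((v / 2 : ℝ) : ℂ) * (x : ℂ) ^ 2 = ((-(v * x ^ 2 / 2) : ℝ) : ℂ) := by push_cast; ring
    have t2 : Complex.I * a * x = ((x * a : ℝ) : ℂ) * Complex.I := by push_cast; ring
    rw [this, t2, ← Complex.ofReal_exp, mul_comm, Complex.re_ofReal_mul, Complex.exp_ofReal_mul_I_re]
  simp only [e1] at h2
  rw [h2]
  have e2 : ((π : ℂ) / ((v / 2 : ℝ) : ℂ)) ^ (1 / 2 : ℂ) * Complex.exp (-(a : ℂ) ^ 2 / (4 * ((v / 2 : ℝ) : ℂ)))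
      = ((√(2 * π / v) * exp (-a ^ 2 / (2 * v)) : ℝ) : ℂ) := by
    rw [Real.sqrt_eq_rpow, Complex.ofReal_mul, Complex.ofReal_exp, Complex.ofReal_cpow (by positivity)]
    congr 1
    · congr 1
      · push_cast; field_simp
      · push_cast; rfl
    · congr 1; push_cast; field_simp; ring
  rw [e2, Complex.ofReal_re]
  unfold pg
  have e3 : √(2 * π / v) * √(2 * π * v) = 2 * π := by
    rw [← Real.sqrt_mul (by positivity)]
    rw [show 2 * π / v * (2 * π * v) = (2 * π) ^ 2 by field_simp]
    exact Real.sqrt_sq (by positivity)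
  have e4 : √(2 * π * v) ≠ 0 := by positivity
  rw [mul_div_assoc', eq_div_iff e4, mul_right_comm, e3]

lemma pg_nonneg (v u : ℝ) : 0 ≤ pg v u := by unfold pg; positivity
lemma pg_le (v u : ℝ) (hv : 0 ≤ v) : pg v u ≤ 1 / √(2 * π * v) := by
  unfold pg
  gcongr
  rw [exp_le_one_iff]
  exact div_nonpos_of_nonpos_of_nonneg (by nlinarith [sq_nonneg u]) (by positivity)
lemma pg_cont (v : ℝ) : Continuous (pg v) := by unfold pg; fun_prop

lemma pg_scale {v : ℝ} (n : ℝ) (hn : 0 < n) (u : ℝ) : √n * pg (v * n) u = pg v (u / √n) := by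
  unfold pg
  have h1 : √(2 * π * (v * n)) = √(2 * π * v) * √n := by
    rw [← Real.sqrt_mul' _ hn.le]; congr 1; ring
  have h2 : (u / √n) ^ 2 = u ^ 2 / n := by rw [div_pow, Real.sq_sqrt hn.le]
  have h3 : √n ≠ 0 := by positivity
  rw [h1, h2]
  have : -u ^ 2 / (2 * (v * n)) = -(u ^ 2 / n) / (2 * v) := by
    rw [neg_div, neg_div, div_div]; congr 2; ring
  rw [this, mul_div_assoc', mul_comm (√(2 * π * v)), mul_div_mul_left _ _ h3]

set_option linter.unusedSectionVars false

/-! Finite representations of the iterated operators -/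

section repr
variable [Fintype X] {P : X → X → ℝ} {f : X → ℝ}

lemma UL_repr (hP : ∀ x x', 0 ≤ P x x') (n : ℕ) (x : X) (y : ℝ) :
    ∃ (s : Finset (X × ℝ)) (c : X × ℝ → ℝ), (∀ p, 0 ≤ c p) ∧
      ∀ φ : X → ℝ → ℝ, (UL P f ^ n) φ x y = ∑ p ∈ s, c p * φ p.1 p.2 := by
  classical
  suffices h : ∃ w : (X × ℝ) →₀ ℝ, (∀ p, 0 ≤ w p) ∧ ∀ φ : X → ℝ → ℝ,
      (UL P f ^ n) φ x y = Finsupp.linearCombination ℝ (fun p : X × ℝ => φ p.1 p.2) w by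
    obtain ⟨w, h1, h2⟩ := h
    refine ⟨w.support, w, h1, fun φ => ?_⟩
    rw [h2, Finsupp.linearCombination_apply, Finsupp.sum]
    simp
  induction n generalizing x y with
  | zero =>
    refine ⟨Finsupp.single (x, y) 1, fun p => ?_, fun φ => by simp⟩
    rw [Finsupp.single_apply]; split_ifs <;> norm_num
  | succ n ih =>
    choose w h1 h2 using fun x' => ih x' (y + f x')
    refine ⟨∑ x', P x x' • w x', fun p => ?_, fun φ => ?_⟩
    · rw [Finsupp.finsetSum_apply]
      exact Finset.sum_nonneg fun x' _ => by
        simpa using mul_nonneg (hP _ _) (h1 x' p)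
    · rw [UL_pow_succ, UL_apply, map_sum]
      refine Finset.sum_congr rfl fun x' _ => ?_
      rw [map_smul, h2, smul_eq_mul]

lemma KL_repr (hP : ∀ x x', 0 ≤ P x x') (n : ℕ) (x : X) (y : ℝ) (hy : 0 < y) :
    ∃ (s : Finset (X × ℝ)) (c : X × ℝ → ℝ), (∀ p, 0 ≤ c p) ∧ (∀ p ∈ s, 0 < p.2) ∧
      ∀ φ : X → ℝ → ℝ, (KL P f ^ n) φ x y = ∑ p ∈ s, c p * φ p.1 p.2 := by
  classical
  suffices h : ∃ w : (X × ℝ) →₀ ℝ, (∀ p, 0 ≤ w p) ∧ (∀ p, w p ≠ 0 → 0 < p.2) ∧ ∀ φ : X → ℝ → ℝ,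
      (KL P f ^ n) φ x y = Finsupp.linearCombination ℝ (fun p : X × ℝ => φ p.1 p.2) w by
    obtain ⟨w, h1, h3, h2⟩ := h
    refine ⟨w.support, w, h1, fun p hp => h3 p (by simpa using hp), fun φ => ?_⟩
    rw [h2, Finsupp.linearCombination_apply, Finsupp.sum]
    simp
  induction n generalizing x y with
  | zero =>
    refine ⟨Finsupp.single (x, y) 1, fun p => ?_, fun p hp => ?_, fun φ => by simp⟩
    · rw [Finsupp.single_apply]; split_ifs <;> norm_num
    · rw [Finsupp.single_apply] at hp
      by_cases h : (x, y) = p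
      · rw [← h]; exact hy
      · simp [h] at hp
  | succ n ih =>
    have ih' : ∀ x', ∃ w : (X × ℝ) →₀ ℝ, (∀ p, 0 ≤ w p) ∧ (∀ p, w p ≠ 0 → 0 < p.2) ∧
        ∀ φ : X → ℝ → ℝ, (if 0 < y + f x' then (KL P f ^ n) φ x' (y + f x') else 0) =
          Finsupp.linearCombination ℝ (fun p : X × ℝ => φ p.1 p.2) w := by
      intro x'
      by_cases h : 0 < y + f x'
      · simpa [h] using ih x' (y + f x') h
      · exact ⟨0, by simp, by simp, by simp [h]⟩
    choose w h1 h3 h2 using ih'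
    refine ⟨∑ x', P x x' • w x', fun p => ?_, fun p hp => ?_, fun φ => ?_⟩
    · rw [Finsupp.finsetSum_apply]
      exact Finset.sum_nonneg fun x' _ => by
        simpa using mul_nonneg (hP _ _) (h1 x' p)
    · rw [Finsupp.finsetSum_apply] at hp
      obtain ⟨x', _, hx'⟩ := Finset.exists_ne_zero_of_sum_ne_zero hp
      refine h3 x' p fun h => hx' (by simp [h])
    · rw [KL_pow_succ, KL_apply, map_sum]
      refine Finset.sum_congr rfl fun x' _ => ?_
      rw [map_smul, h2, smul_eq_mul]

lemma UL_pow_integral {Y : Type*} [MeasurableSpace Y] {μ : Measure Y}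
    (hP : ∀ x x', 0 ≤ P x x') (n : ℕ) (x : X) (y : ℝ)
    (Φ : Y → X → ℝ → ℝ) (hΦ : ∀ x s, Integrable (fun t => Φ t x s) μ) :
    Integrable (fun t => (UL P f ^ n) (Φ t) x y) μ ∧
    (UL P f ^ n) (fun x s => ∫ t, Φ t x s ∂μ) x y = ∫ t, (UL P f ^ n) (Φ t) x y ∂μ := by
  obtain ⟨s, c, -, H⟩ := UL_repr (f := f) hP n x y
  simp only [H]
  refine ⟨integrable_finsetSum _ fun p _ => (hΦ _ _).const_mul _, ?_⟩
  rw [integral_finsetSum _ fun p _ => (hΦ _ _).const_mul _]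
  simp only [integral_const_mul]

lemma KL_pow_integral {Y : Type*} [MeasurableSpace Y] {μ : Measure Y}
    (hP : ∀ x x', 0 ≤ P x x') (n : ℕ) (x : X) (y : ℝ) (hy : 0 < y)
    (Φ : Y → X → ℝ → ℝ) (hΦ : ∀ x s, 0 < s → Integrable (fun t => Φ t x s) μ) :
    Integrable (fun t => (KL P f ^ n) (Φ t) x y) μ ∧
    (KL P f ^ n) (fun x s => ∫ t, Φ t x s ∂μ) x y = ∫ t, (KL P f ^ n) (Φ t) x y ∂μ := by
  obtain ⟨s, c, -, hs, H⟩ := KL_repr (f := f) hP n x y hy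
  simp only [H]
  refine ⟨integrable_finsetSum _ fun p hp => (hΦ _ _ (hs p hp)).const_mul _, ?_⟩
  rw [integral_finsetSum _ fun p hp => (hΦ _ _ (hs p hp)).const_mul _]
  simp only [integral_const_mul]

/-- Action of the free operator on characters. -/
lemma UL_pow_re [DecidableEq X] [Nonempty X] (n : ℕ) (t : ℝ) (z : ℂ) (ψ : X → ℂ) (x : X) (w : ℝ) :
    (UL P f ^ n) (fun x' s => (z * Complex.exp (Complex.I * t * s) * ψ x').re) x w =
      (z * Complex.exp (Complex.I * t * w) * (Mop P f t ^ n) ψ x).re := by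
  induction n generalizing x w with
  | zero => rfl
  | succ n ih =>
    rw [UL_pow_succ, UL_apply, Mop_pow_succ, Mop_apply, Finset.mul_sum, Complex.re_sum]
    refine Finset.sum_congr rfl fun x' _ => ?_
    rw [ih, ← Complex.re_ofReal_mul]
    congr 1
    push_cast
    rw [mul_add, Complex.exp_add]; ring

end repr

section llt
variable [Fintype X] [DecidableEq X] [Nonempty X] {P : X → X → ℝ} {ν f : X → ℝ}

lemma fjd_free (hG : Good P ν f) {δ : ℝ} (hδ : 0 < δ) (ψ : X → ℝ) (i : ℕ) (x : X) (w v : ℝ) :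
    (UL P f ^ i) (fun x' s => ψ x' * fjd δ (s - v)) x w =
      ∫ t, tri (δ * t) * (Complex.exp (Complex.I * t * ((w - v : ℝ) : ℂ)) *
        (Mop P f t ^ i) (fun x => (ψ x : ℂ)) x).re := by
  have key : ∀ (t : ℝ) (x' : X) (s : ℝ), tri (δ * t) * (ψ x' * cos (t * (s - v))) =
      ((tri (δ * t) * Complex.exp (-(Complex.I * t * v))) * Complex.exp (Complex.I * t * s) *
        (ψ x' : ℂ)).re := by
    intro t x' s
    rw [mul_assoc (tri (δ * t) : ℂ), ← Complex.exp_add, mul_assoc, Complex.re_ofReal_mul, mul_comm _ (ψ x' : ℂ),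
      Complex.re_ofReal_mul]
    have : -(Complex.I * t * v) + Complex.I * t * s = ((t * (s - v) : ℝ) : ℂ) * Complex.I := by
      push_cast; ring
    rw [this, Complex.exp_ofReal_mul_I_re]
  have e1 : (fun (x' : X) (s : ℝ) => ψ x' * fjd δ (s - v)) = fun x' s =>
      ∫ t, tri (δ * t) * (ψ x' * cos (t * (s - v))) := by
    funext x' s
    rw [fjd, ← integral_const_mul]
    refine integral_congr_ae (ae_of_all _ fun t => ?_)
    simp only; ring
  have hintg : ∀ (x' : X) (s : ℝ), Integrable (fun t => tri (δ * t) * (ψ x' * cos (t * (s - v)))) := by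
    intro x' s
    have h1 : Integrable (fun t => tri (δ * t)) := tri_integrable.comp_mul_left' hδ.ne'
    refine (h1.mul_const |ψ x'|).mono' (by have := tri_cont; fun_prop) (ae_of_all _ fun t => ?_)
    rw [norm_mul, norm_mul, Real.norm_of_nonneg (tri_nonneg _), Real.norm_eq_abs, Real.norm_eq_abs]
    exact mul_le_mul_of_nonneg_left (mul_le_of_le_one_right (abs_nonneg _) (Real.abs_cos_le_one _))
      (tri_nonneg _)
  rw [e1, (UL_pow_integral hG.st.nonneg i x w _ hintg).2]
  refine integral_congr_ae (ae_of_all _ fun t => ?_)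
  simp only [key]
  rw [UL_pow_re, mul_assoc (tri (δ * t) : ℂ), ← Complex.exp_add, mul_assoc, Complex.re_ofReal_mul]
  have : -(Complex.I * t * v) + Complex.I * t * w = Complex.I * t * ((w - v : ℝ) : ℂ) := by
    push_cast; ring
  rw [this]

lemma Mop_cont_t (i : ℕ) (ψ : X → ℂ) (x : X) : Continuous fun t : ℝ => (Mop P f t ^ i) ψ x := by
  induction i generalizing x with
  | zero => simpa using continuous_const
  | succ i ih =>
    simp only [Mop_pow_succ, Mop_apply]
    exact continuous_finsetSum _ fun x' _ => (by fun_prop : Continuous _).mul (ih x')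

lemma llt_fj (hG : Good P ν f) {δ : ℝ} (hδ : 0 < δ) (ψ : X → ℝ) (ε : ℝ) (hε : 0 < ε) :
    ∃ N : ℕ, ∀ i : ℕ, N ≤ i → ∀ x w v,
      |√i * (UL P f ^ i) (fun x' s => ψ x' * fjd δ (s - v)) x w -
        (∑ x, ψ x * ν x) * pg (sigma2 P ν f) ((v - w) / √i)| ≤ ε := by
  have hσ := sigma2_pos hG
  set σ2 := sigma2 P ν f with hσ2
  set m : ℝ := ∑ x, ψ x * ν x with hm
  have hnuC : nuC ν (fun x => (ψ x : ℂ)) = (m : ℂ) := by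
    rw [hm]; unfold nuC; push_cast; rfl
  obtain ⟨C, c, hC, hc, hdec⟩ := Mop_decay hG (1 / δ)
  set D : ℕ → X → ℝ → ℂ := fun i x θ =>
    (tri (δ * (θ / √i)) : ℂ) * (Mop P f (θ / √i) ^ i) (fun x => (ψ x : ℂ)) x with hD
  set E : ℝ → ℂ := fun θ => ((m * (1 / (2 * π)) * exp (-(σ2 * θ ^ 2 / 2)) : ℝ) : ℂ) with hE
  have hDc : ∀ i x, Continuous (D i x) := by
    intro i x
    have h1 := Mop_cont_t (P := P) (f := f) i (fun x => (ψ x : ℂ)) x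
    have h2 := tri_cont
    exact (Complex.continuous_ofReal.comp (h2.comp (by fun_prop))).mul (h1.comp (by fun_prop))
  have hEc : Continuous E := by rw [hE]; fun_prop
  set bd : ℝ → ℝ := fun θ => C * ‖(fun x => (ψ x : ℂ))‖ * exp (-c * θ ^ 2) with hbd
  have hbdi : Integrable bd := (integrable_exp_neg_mul_sq hc).const_mul _
  have hDb : ∀ i : ℕ, 1 ≤ i → ∀ x θ, ‖D i x θ‖ ≤ bd θ := by
    intro i hi x θ
    have hip : (0:ℝ) < i := by exact_mod_cast hi
    have hsp : 0 < √(i:ℝ) := Real.sqrt_pos.2 hip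
    simp only [hD, norm_mul]
    by_cases hh : |θ / √i| ≤ 1 / δ
    · have h1 := hdec _ hh i (fun x => (ψ x : ℂ))
      have h2 := (norm_le_pi_norm ((Mop P f (θ / √i) ^ i) (fun x => (ψ x : ℂ))) x).trans h1
      have h3 : -c * (θ / √i) ^ 2 * i = -c * θ ^ 2 := by
        rw [div_pow, Real.sq_sqrt hip.le]; field_simp
      rw [h3] at h2
      have h4 : ‖(tri (δ * (θ / √i)) : ℂ)‖ ≤ 1 := by
        rw [Complex.norm_real, Real.norm_of_nonneg (tri_nonneg _)]; exact tri_le_one _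
      calc _ ≤ 1 * ‖(Mop P f (θ / √i) ^ i) (fun x => (ψ x : ℂ)) x‖ := by gcongr
        _ ≤ _ := by rw [one_mul, hbd]; refine h2.trans (le_of_eq (by ring))
    · have : tri (δ * (θ / √i)) = 0 := by
        apply tri_supp
        rw [abs_mul, abs_of_pos hδ]
        push Not at hh
        rw [div_lt_iff₀ hδ] at hh
        linarith
      rw [this]; simp [hbd]; positivity
  have hEi : Integrable E := by
    have := ((gauss_integrable hσ).const_mul (m * (1 / (2 * π)))).ofReal (𝕜 := ℂ)
    exact this
  have hDi : ∀ i : ℕ, 1 ≤ i → ∀ x, Integrable (D i x) := fun i hi x =>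
    hbdi.mono' (hDc i x).aestronglyMeasurable (ae_of_all _ (hDb i hi x))
  have hlim : ∀ x, Tendsto (fun i : ℕ => ∫ θ, ‖D i x θ - E θ‖) atTop (𝓝 0) := by
    intro x
    have : (0:ℝ) = ∫ θ : ℝ, (0:ℝ) := by simp
    rw [this]
    refine tendsto_integral_filter_of_dominated_convergence (fun θ => bd θ + ‖E θ‖)
      (Eventually.of_forall fun i => ((hDc i x).sub hEc).norm.aestronglyMeasurable)
      ?_ (hbdi.add hEi.norm) (ae_of_all _ fun θ => ?_)
    · filter_upwards [eventually_ge_atTop 1] with i hi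
      refine ae_of_all _ fun θ => ?_
      rw [norm_norm]
      exact (norm_sub_le _ _).trans (add_le_add (hDb i hi x θ) le_rfl)
    · have h1 := Mop_limit hG θ (fun x => (ψ x : ℂ)) x
      rw [hnuC] at h1
      have h2 : Tendsto (fun i : ℕ => (tri (δ * (θ / √i)) : ℂ)) atTop (𝓝 ((1 / (2 * π) : ℝ) : ℂ)) := by
        have h3 : Tendsto (fun i : ℕ => δ * (θ / √i)) atTop (𝓝 0) := by
          have : Tendsto (fun i : ℕ => √(i:ℝ)) atTop atTop :=
            Real.tendsto_sqrt_atTop.comp tendsto_natCast_atTop_atTop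
          simpa using (this.const_div_atTop θ).const_mul δ
        have h4 := (tri_cont.tendsto 0).comp h3
        rw [tri_zero] at h4
        exact (Complex.continuous_ofReal.tendsto _).comp h4
      have h5 := (h2.mul h1).sub_const (E θ)
      have h6 : ((1 / (2 * π) : ℝ) : ℂ) * ((m : ℂ) * ((exp (-(σ2 * θ ^ 2 / 2)) : ℝ) : ℂ)) - E θ = 0 := by
        rw [hE]; push_cast; ring
      rw [h6] at h5
      simpa using h5.norm
  have hev : ∀ᶠ i : ℕ in atTop, ∀ x, ∫ θ, ‖D i x θ - E θ‖ < ε :=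
    eventually_all.2 fun x => (tendsto_order.1 (hlim x)).2 ε hε
  obtain ⟨N, hN⟩ := eventually_atTop.1 hev
  refine ⟨max N 1, fun i hi x w v => ?_⟩
  have hi1 : 1 ≤ i := (le_max_right _ _).trans hi
  have hip : (0:ℝ) < i := by exact_mod_cast hi1
  have hsp : 0 < √(i:ℝ) := Real.sqrt_pos.2 hip
  refine le_trans ?_ (hN i ((le_max_left _ _).trans hi) x).le
  have e1 : √i * (UL P f ^ i) (fun x' s => ψ x' * fjd δ (s - v)) x w =
      ∫ θ, (Complex.exp (Complex.I * ((θ / √i : ℝ) : ℂ) * ((w - v : ℝ) : ℂ)) * D i x θ).re := by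
    rw [fjd_free hG hδ]
    have := Measure.integral_comp_div (fun t => tri (δ * t) * (Complex.exp (Complex.I * t * ((w - v : ℝ) : ℂ)) *
        (Mop P f t ^ i) (fun x => (ψ x : ℂ)) x).re) (√i)
    rw [abs_of_pos hsp, smul_eq_mul] at this
    rw [← this]
    refine integral_congr_ae (ae_of_all _ fun θ => ?_)
    simp only [hD]
    rw [← Complex.re_ofReal_mul]
    congr 1; ring
  have e2 : m * pg σ2 ((v - w) / √i) =
      ∫ θ, (Complex.exp (Complex.I * ((θ / √i : ℝ) : ℂ) * ((w - v : ℝ) : ℂ)) * E θ).re := by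
    have h1 := pg_fourier hσ ((v - w) / √i)
    have h2 : pg σ2 ((v - w) / √i) = 1 / (2 * π) * ∫ θ : ℝ, exp (-(σ2 * θ ^ 2 / 2)) * cos (θ * ((v - w) / √i)) := by
      rw [h1]; field_simp
    rw [h2, ← mul_assoc, ← integral_const_mul]
    refine integral_congr_ae (ae_of_all _ fun θ => ?_)
    simp only [hE]
    rw [mul_comm (Complex.exp _), Complex.re_ofReal_mul]
    have : Complex.I * ((θ / √i : ℝ) : ℂ) * ((w - v : ℝ) : ℂ) =
        ((-(θ * ((v - w) / √i)) : ℝ) : ℂ) * Complex.I := by push_cast; ring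
    rw [this, Complex.exp_ofReal_mul_I_re, cos_neg]; ring
  have hexp : ∀ θ : ℝ, ‖Complex.exp (Complex.I * ((θ / √i : ℝ) : ℂ) * ((w - v : ℝ) : ℂ))‖ = 1 := by
    intro θ
    rw [norm_expI]
  have i1 : Integrable fun θ => (Complex.exp (Complex.I * ((θ / √i : ℝ) : ℂ) * ((w - v : ℝ) : ℂ)) * D i x θ).re := by
    refine Integrable.re (𝕜 := ℂ) (f := fun θ : ℝ =>
      Complex.exp (Complex.I * ((θ / √i : ℝ) : ℂ) * ((w - v : ℝ) : ℂ)) * D i x θ) ?_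
    refine (hDi i hi1 x).mono (Continuous.aestronglyMeasurable ((by fun_prop : Continuous _).mul (hDc i x)))
      (ae_of_all _ fun θ => ?_)
    rw [norm_mul, hexp, one_mul]
  have i2 : Integrable fun θ => (Complex.exp (Complex.I * ((θ / √i : ℝ) : ℂ) * ((w - v : ℝ) : ℂ)) * E θ).re := by
    refine Integrable.re (𝕜 := ℂ) (f := fun θ : ℝ =>
      Complex.exp (Complex.I * ((θ / √i : ℝ) : ℂ) * ((w - v : ℝ) : ℂ)) * E θ) ?_
    refine hEi.mono (Continuous.aestronglyMeasurable ((by fun_prop : Continuous _).mul hEc))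
      (ae_of_all _ fun θ => ?_)
    rw [norm_mul, hexp, one_mul]
  rw [e1, e2, ← integral_sub i1 i2]
  rw [← Real.norm_eq_abs]
  refine (norm_integral_le_of_norm_le (((hDi i hi1 x).sub hEi).norm) (ae_of_all _ fun θ => ?_))
  rw [Real.norm_eq_abs, ← Complex.sub_re, ← mul_sub]
  refine (Complex.abs_re_le_norm _).trans ?_
  rw [norm_mul, hexp, one_mul]

end llt

set_option linter.unusedSectionVars false

/-! Local limit theorem for the free walk on small intervals -/

/-- Indicator of a half-open interval. -/
noncomputable def iv (α β s : ℝ) : ℝ := if α < s ∧ s ≤ β then 1 else 0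

lemma iv_nonneg (α β s : ℝ) : 0 ≤ iv α β s := by unfold iv; split_ifs <;> norm_num
lemma iv_le_one (α β s : ℝ) : iv α β s ≤ 1 := by unfold iv; split_ifs <;> norm_num

/-- Generators. -/
noncomputable def ee (P : X → X → ℝ) (b : X) (α β : ℝ) : X → ℝ → ℝ := fun x s => P x b * iv α β s

section llt2
variable [Fintype X] [DecidableEq X] [Nonempty X] {P : X → X → ℝ} {ν f : X → ℝ}

lemma P_le_one (hS : IsStochastic P ν) (x b : X) : P x b ≤ 1 := by
  rw [← hS.rowSum x]
  exact Finset.single_le_sum (f := fun b => P x b) (fun b _ => hS.nonneg x b) (Finset.mem_univ b)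

lemma ee_nonneg (hS : IsStochastic P ν) (b : X) (α β : ℝ) (x : X) (s : ℝ) : 0 ≤ ee P b α β x s :=
  mul_nonneg (hS.nonneg _ _) (iv_nonneg _ _ _)

lemma ee_le_iv (hS : IsStochastic P ν) (b : X) (α β : ℝ) (x : X) (s : ℝ) : ee P b α β x s ≤ iv α β s :=
  mul_le_of_le_one_left (iv_nonneg _ _ _) (P_le_one hS _ _)

lemma ee_le_one (hS : IsStochastic P ν) (b : X) (α β : ℝ) (x : X) (s : ℝ) : ee P b α β x s ≤ 1 :=
  (ee_le_iv hS _ _ _ _ _).trans (iv_le_one _ _ _)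

lemma free_tail (hG : Good P ν f) : ∃ C : ℝ, 0 ≤ C ∧ ∀ i : ℕ, 1 ≤ i → ∀ x w v,
    (UL P f ^ i) (fun _ s => (1 + (s - v) ^ 2)⁻¹) x w ≤ C / √i := by
  have hP := hG.st.nonneg
  have h1 := hG.st.rowSum
  obtain ⟨N, hN⟩ := llt_fj hG one_pos (fun _ => 1) 1 one_pos
  have hσ := sigma2_pos hG
  set A := 1 / √(2 * π * sigma2 P ν f) + 1 with hA
  have hA0 : 0 ≤ A := by positivity
  refine ⟨2 * π ^ 3 * A + √N, by positivity, fun i hi x w v => ?_⟩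
  have hip : (0:ℝ) < i := by exact_mod_cast hi
  have hsp : 0 < √(i:ℝ) := Real.sqrt_pos.2 hip
  rw [le_div_iff₀ hsp]
  by_cases hiN : N ≤ i
  · have key : ∀ v', √i * (UL P f ^ i) (fun _ s => fjd 1 (s - v')) x w ≤ A := by
      intro v'
      have h2 := hN i hiN x w v'
      simp only [one_mul, hG.st.nuSum] at h2
      have h3 := pg_le (sigma2 P ν f) ((v' - w) / √i) hσ.le
      have h4 := (abs_le.1 h2).2
      rw [hA]; linarith
    have hle : ∀ (x' : X) (s : ℝ), (1 + (s - v) ^ 2)⁻¹ ≤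
        (π ^ 3 • ((fun (_ : X) s => fjd 1 (s - v)) + (fun (_ : X) s => fjd 1 (s - (v - π))))) x' s := by
      intro x' s
      have := fj_shift (s - v)
      simp only [Pi.smul_apply, Pi.add_apply, fjd_eq one_pos, div_one, smul_eq_mul]
      rwa [show s - (v - π) = s - v + π by ring]
    have h5 := UL_pow_mono (f := f) hP hle i x w
    rw [map_smul, map_add] at h5
    simp only [Pi.smul_apply, Pi.add_apply, smul_eq_mul] at h5
    have k1 := key v
    have k2 := key (v - π)
    have hπ3 : 0 < π ^ 3 := by positivity
    calc _ ≤ π ^ 3 * ((UL P f ^ i) (fun _ s => fjd 1 (s - v)) x w +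
          (UL P f ^ i) (fun _ s => fjd 1 (s - (v - π))) x w) * √i := by gcongr
      _ = π ^ 3 * (√i * (UL P f ^ i) (fun _ s => fjd 1 (s - v)) x w +
          √i * (UL P f ^ i) (fun _ s => fjd 1 (s - (v - π))) x w) := by ring
      _ ≤ π ^ 3 * (A + A) := by gcongr
      _ ≤ _ := by have := Real.sqrt_nonneg (N:ℝ); linarith
  · push Not at hiN
    have h2 : (UL P f ^ i) (fun _ s => (1 + (s - v) ^ 2)⁻¹) x w ≤ 1 := by
      refine (le_abs_self _).trans (UL_pow_abs_le hP h1 (fun x s => ?_) i x w)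
      rw [abs_of_nonneg (by positivity)]
      exact inv_le_one_of_one_le₀ (by nlinarith [sq_nonneg (s - v)])
    have h3 : √(i:ℝ) ≤ √N := Real.sqrt_le_sqrt (by exact_mod_cast hiN.le)
    calc _ ≤ 1 * √(i:ℝ) := by gcongr
      _ ≤ _ := by
        have : 0 ≤ 2 * π ^ 3 * A := by positivity
        linarith

lemma free_iv (hG : Good P ν f) : ∃ C : ℝ, 0 ≤ C ∧ ∀ i : ℕ, 1 ≤ i → ∀ x w α β, β ≤ α + 1 →
    (UL P f ^ i) (fun _ s => iv α β s) x w ≤ C / √i := by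
  obtain ⟨C, hC, H⟩ := free_tail hG
  refine ⟨2 * C, by positivity, fun i hi x w α β hab => ?_⟩
  have h1 := UL_pow_mono (f := f) hG.st.nonneg (φ := fun (_ : X) s => iv α β s)
    (ψ := (2:ℝ) • fun (_ : X) s => (1 + (s - α) ^ 2)⁻¹) (fun x s => ?_) i x w
  · rw [map_smul] at h1
    simp only [Pi.smul_apply, smul_eq_mul] at h1
    have := H i hi x w α
    rw [mul_div_assoc]; linarith
  · simp only [Pi.smul_apply, smul_eq_mul]
    unfold iv
    split_ifs with h
    · rw [← div_eq_mul_inv, le_div_iff₀ (by positivity)]; nlinarith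
    · positivity

lemma free_ee (hG : Good P ν f) : ∃ C : ℝ, 0 ≤ C ∧ ∀ i : ℕ, 1 ≤ i → ∀ x w b α β, β ≤ α + 1 →
    (UL P f ^ i) (ee P b α β) x w ≤ C / √i := by
  obtain ⟨C, hC, H⟩ := free_iv hG
  exact ⟨C, hC, fun i hi x w b α β hab =>
    (UL_pow_mono hG.st.nonneg (fun x s => ee_le_iv hG.st b α β x s) i x w).trans (H i hi x w α β hab)⟩

lemma iv_upper {δ d η α β s : ℝ} (hδ : 0 < δ) (hd : 0 < d) (hab : α ≤ β)
    (hc : 1 - η ≤ ∫ u in (-d)..d, fjd δ u) :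
    (1 - η) * iv α β s ≤ ∫ v in (α - d)..(β + d), fjd δ (s - v) := by
  have hi : ∀ a b, IntervalIntegrable (fun v => fjd δ (s - v)) volume a b := fun a b =>
    Continuous.intervalIntegrable ((fjd_cont hδ).comp (by fun_prop)) _ _
  unfold iv
  split_ifs with h
  · rw [mul_one]
    refine hc.trans ?_
    have e : ∫ u in (-d)..d, fjd δ u = ∫ v in (s - d)..(s + d), fjd δ (s - v) := by
      rw [intervalIntegral.integral_comp_sub_left (fun u => fjd δ u) s]
      congr 1 <;> ring
    rw [e]
    refine intervalIntegral.integral_mono_interval (by linarith) (by linarith) (by linarith)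
      (ae_of_all _ fun v => fjd_nonneg hδ _) (hi _ _)
  · rw [mul_zero]
    exact intervalIntegral.integral_nonneg (by linarith) fun v _ => fjd_nonneg hδ _

lemma iv_lower {δ d α β s : ℝ} (hδ : 0 < δ) (hd : 0 < d) (hab : α + d ≤ β - d) :
    ∫ v in (α + d)..(β - d), fjd δ (s - v) ≤ iv α β s +
      ∫ v in (α + d)..(β - d), δ * (1 + 1 / d ^ 2) * (1 + (s - v) ^ 2)⁻¹ := by
  have hi : ∀ a b, IntervalIntegrable (fun v => fjd δ (s - v)) volume a b := fun a b =>
    Continuous.intervalIntegrable ((fjd_cont hδ).comp (by fun_prop)) _ _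
  have hi2 : ∀ a b, IntervalIntegrable (fun v => δ * (1 + 1 / d ^ 2) * (1 + (s - v) ^ 2)⁻¹) volume a b :=
    fun a b => Continuous.intervalIntegrable (by
      refine Continuous.mul (by fun_prop) (Continuous.inv₀ (by fun_prop) fun v => by positivity)) _ _
  unfold iv
  split_ifs with h
  · have h1 : ∫ v in (α + d)..(β - d), fjd δ (s - v) ≤ 1 := by
      rw [intervalIntegral.integral_comp_sub_left (fun u => fjd δ u) s, ← fjd_integral hδ,
        intervalIntegral.integral_of_le (by linarith)]
      exact setIntegral_le_integral (fjd_integrable hδ) (ae_of_all _ fun u => fjd_nonneg hδ u)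
    have h2 : 0 ≤ ∫ v in (α + d)..(β - d), δ * (1 + 1 / d ^ 2) * (1 + (s - v) ^ 2)⁻¹ :=
      intervalIntegral.integral_nonneg hab fun v _ => by positivity
    linarith
  · rw [zero_add]
    refine intervalIntegral.integral_mono_on hab (hi _ _) (hi2 _ _) fun v hv => ?_
    refine fjd_tail hδ hd ?_
    rcases not_and_or.1 h with h | h
    · push Not at h
      rw [abs_of_nonpos (by linarith [hv.1])]; linarith [hv.1]
    · push Not at h
      exact le_trans (by linarith [hv.2]) (le_abs_self _)

/-- Interchange of free operator and an interval integral. -/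
lemma UL_pow_ii (hG : Good P ν f) (i : ℕ) (x : X) (w a b : ℝ) (hab : a ≤ b) (ψ : X → ℝ) (F : ℝ → ℝ)
    (hF : Continuous F) :
    IntervalIntegrable (fun v => (UL P f ^ i) (fun x' s => ψ x' * F (s - v)) x w) volume a b ∧
    (UL P f ^ i) (fun x' s => ψ x' * ∫ v in a..b, F (s - v)) x w =
      ∫ v in a..b, (UL P f ^ i) (fun x' s => ψ x' * F (s - v)) x w := by
  have hi : ∀ (x' : X) (s : ℝ), Integrable (fun v => ψ x' * F (s - v)) (volume.restrict (Set.Ioc a b)) := by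
    intro x' s
    have : IntervalIntegrable (fun v => ψ x' * F (s - v)) volume a b :=
      Continuous.intervalIntegrable (by fun_prop) _ _
    rwa [intervalIntegrable_iff_integrableOn_Ioc_of_le hab] at this
  have h := UL_pow_integral (f := f) hG.st.nonneg i x w (fun v x' s => ψ x' * F (s - v)) hi
  constructor
  · rw [intervalIntegrable_iff_integrableOn_Ioc_of_le hab]; exact h.1
  · simp only [intervalIntegral.integral_of_le hab, ← integral_const_mul]
    exact h.2

/-- Local limit theorem for the free walk. -/
lemma llt_ee (hG : Good P ν f) (ε : ℝ) (hε : 0 < ε) : ∃ N : ℕ, 1 ≤ N ∧ ∀ i : ℕ, N ≤ i →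
    ∀ x w b α β, α ≤ β → β ≤ α + 1 →
    |(UL P f ^ i) (ee P b α β) x w - ν b * ∫ v in α..β, pg (sigma2 P ν f * i) (v - w)| ≤ ε / √i := by
  have hP := hG.st.nonneg
  have hσ := sigma2_pos hG
  obtain ⟨C1, hC1, H1⟩ := free_ee hG
  obtain ⟨C2, hC2, H2⟩ := free_tail hG
  set σ2 := sigma2 P ν f with hσ2
  set Cp := 1 / √(2 * π * σ2) with hCp
  have hCp0 : 0 ≤ Cp := by positivity
  set C := C1 + C2 + Cp + 1 with hC
  have hCpos : 0 < C := by positivity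
  -- parameters
  set η := min (1 / 2) (ε / (8 * C)) with hη
  have hη0 : 0 < η := by positivity
  have hηC : η * C ≤ ε / 8 := by
    have : η ≤ ε / (8 * C) := min_le_right _ _
    calc η * C ≤ ε / (8 * C) * C := by gcongr
      _ = ε / 8 := by field_simp
  have hη1 : η ≤ 1 / 2 := min_le_left _ _
  set d := η / 2 with hd
  have hd0 : 0 < d := by positivity
  obtain ⟨δ0, hδ0, hconc⟩ := fjd_conc d η hd0 hη0
  set δ := min δ0 (η / (1 + 1 / d ^ 2)) with hδ
  have hδp : 0 < δ := by positivity
  have hδ2 : δ * (1 + 1 / d ^ 2) ≤ η := by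
    have : δ ≤ η / (1 + 1 / d ^ 2) := min_le_right _ _
    rwa [le_div_iff₀ (by positivity)] at this
  have hconc' := hconc δ hδp (min_le_left _ _)
  have hN : ∀ b : X, ∃ N : ℕ, ∀ i : ℕ, N ≤ i → ∀ x w v,
      |√i * (UL P f ^ i) (fun x' s => P x' b * fjd δ (s - v)) x w -
        ν b * pg σ2 ((v - w) / √i)| ≤ ε / 8 := by
    intro b
    obtain ⟨N, hN⟩ := llt_fj hG hδp (fun x' => P x' b) (ε / 8) (by positivity)
    refine ⟨N, fun i hi x w v => ?_⟩
    have := hN i hi x w v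
    have e : ∑ x, P x b * ν x = ν b := by
      rw [← hG.st.nuInv b]; exact Finset.sum_congr rfl fun _ _ => mul_comm _ _
    rwa [e] at this
  choose N0 hN0 using hN
  refine ⟨(∑ b, N0 b) + 1, by omega, fun i hi x w b α β hab hab1 => ?_⟩
  have hiN : N0 b ≤ i := by
    have := Finset.single_le_sum (f := N0) (fun b _ => Nat.zero_le _) (Finset.mem_univ b)
    omega
  have hi1 : 1 ≤ i := by omega
  have hip : (0:ℝ) < i := by exact_mod_cast hi1
  have hsp : 0 < √(i:ℝ) := Real.sqrt_pos.2 hip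
  set p : ℝ → ℝ := fun v => pg (σ2 * i) (v - w) with hp
  have hpc : Continuous p := (pg_cont _).comp (by fun_prop)
  have hpi : ∀ a c, IntervalIntegrable p volume a c := fun a c => hpc.intervalIntegrable _ _
  have hp0 : ∀ v, 0 ≤ p v := fun v => pg_nonneg _ _
  have hple : ∀ v, p v ≤ Cp / √i := by
    intro v
    rw [le_div_iff₀ hsp, mul_comm, hp]
    simp only
    rw [pg_scale _ hip]
    exact pg_le _ _ hσ.le
  have hν0 := hG.st.nuPos b
  have hν1 : ν b ≤ 1 := by
    rw [← hG.st.nuSum]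
    exact Finset.single_le_sum (f := ν) (fun b _ => (hG.st.nuPos b).le) (Finset.mem_univ b)
  have hloc : ∀ v, |(UL P f ^ i) (fun x' s => P x' b * fjd δ (s - v)) x w - ν b * p v| ≤ ε / 8 / √i := by
    intro v
    have h1 := hN0 b i hiN x w v
    rw [← pg_scale _ hip] at h1
    nth_rewrite 1 [le_div_iff₀ hsp, ← abs_of_pos hsp]
    rw [← abs_mul]
    refine le_trans (le_of_eq ?_) h1
    congr 1; ring
  have hint_le : ∀ a c, a ≤ c → ∫ v in a..c, p v ≤ (c - a) * (Cp / √i) := by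
    intro a c hac
    have := intervalIntegral.integral_mono_on hac (hpi a c) (intervalIntegrable_const (c := Cp / √i))
      fun v _ => hple v
    simpa [mul_div_assoc] using this
  have hI0 : ∀ a c, a ≤ c → 0 ≤ ∫ v in a..c, p v := fun a c hac =>
    intervalIntegral.integral_nonneg hac fun v _ => hp0 v
  have hfc := fjd_cont hδp
  rw [abs_le]
  have hdiv : ∀ t : ℝ, t ≤ ε → t / √i ≤ ε / √i := fun t ht => by gcongr
  constructor
  · -- lower bound
    have hU0 : 0 ≤ (UL P f ^ i) (ee P b α β) x w := UL_pow_nonneg hP (fun x s => ee_nonneg hG.st b α β x s) i x w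
    by_cases hcase : α + d ≤ β - d
    · have q1 := UL_pow_ii hG i x w (α + d) (β - d) hcase (fun x' => P x' b) (fjd δ) hfc
      have q2 := UL_pow_ii hG i x w (α + d) (β - d) hcase (fun _ => 1)
        (fun u => δ * (1 + 1 / d ^ 2) * (1 + u ^ 2)⁻¹)
        (Continuous.mul (by fun_prop) (Continuous.inv₀ (by fun_prop) fun v => by positivity))
      have q3 : (UL P f ^ i) (fun x' s => P x' b * ∫ v in (α + d)..(β - d), fjd δ (s - v)) x w ≤
          (UL P f ^ i) (ee P b α β + fun x' s => 1 * ∫ v in (α + d)..(β - d), δ * (1 + 1 / d ^ 2) * (1 + (s - v) ^ 2)⁻¹) x w := by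
        refine UL_pow_mono hP (fun x' s => ?_) i x w
        have h1 := iv_lower (s := s) hδp hd0 hcase
        have h2 : 0 ≤ ∫ v in (α + d)..(β - d), δ * (1 + 1 / d ^ 2) * (1 + (s - v) ^ 2)⁻¹ :=
          intervalIntegral.integral_nonneg hcase fun v _ => by positivity
        simp only [Pi.add_apply, ee, one_mul]
        calc _ ≤ P x' b * (iv α β s + ∫ v in (α + d)..(β - d), δ * (1 + 1 / d ^ 2) * (1 + (s - v) ^ 2)⁻¹) :=
              mul_le_mul_of_nonneg_left h1 (hP _ _)
          _ ≤ _ := by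
            rw [mul_add]
            gcongr
            exact mul_le_of_le_one_left h2 (P_le_one hG.st _ _)
      rw [map_add, Pi.add_apply, Pi.add_apply, q1.2, q2.2] at q3
      have q4 : ∫ v in (α + d)..(β - d), (ν b * p v - ε / 8 / √i) ≤
          ∫ v in (α + d)..(β - d), (UL P f ^ i) (fun x' s => P x' b * fjd δ (s - v)) x w := by
        refine intervalIntegral.integral_mono_on hcase (((hpi _ _).const_mul _).sub intervalIntegrable_const)
          q1.1 fun v _ => ?_
        have := (abs_le.1 (hloc v)).1
        linarith
      have q5 : ∫ v in (α + d)..(β - d), (UL P f ^ i) (fun x' s => 1 * (δ * (1 + 1 / d ^ 2) * (1 + (s - v) ^ 2)⁻¹)) x w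
          ≤ ∫ v in (α + d)..(β - d), η * (C2 / √i) := by
        refine intervalIntegral.integral_mono_on hcase q2.1 intervalIntegrable_const fun v _ => ?_
        have e : (fun (_ : X) s => 1 * (δ * (1 + 1 / d ^ 2) * (1 + (s - v) ^ 2)⁻¹)) =
            (δ * (1 + 1 / d ^ 2)) • fun (_ : X) s => (1 + (s - v) ^ 2)⁻¹ := by
          funext _ s; simp
        rw [e, map_smul]
        simp only [Pi.smul_apply, smul_eq_mul]
        have h3 := H2 i hi1 x w v
        have h4 : 0 ≤ (UL P f ^ i) (fun (_ : X) s => (1 + (s - v) ^ 2)⁻¹) x w :=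
          UL_pow_nonneg hP (fun x s => by positivity) i x w
        gcongr
      rw [intervalIntegral.integral_sub ((hpi _ _).const_mul _) intervalIntegrable_const,
        intervalIntegral.integral_const_mul] at q4
      simp only [intervalIntegral.integral_const, smul_eq_mul] at q4 q5
      have q6 : ∫ v in α..β, p v = (∫ v in α..(α + d), p v) + (∫ v in (α + d)..(β - d), p v) + ∫ v in (β - d)..β, p v := by
        rw [intervalIntegral.integral_add_adjacent_intervals (hpi _ _) (hpi _ _),
          intervalIntegral.integral_add_adjacent_intervals (hpi _ _) (hpi _ _)]
      have q7 := hint_le α (α + d) (by linarith)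
      have q8 := hint_le (β - d) β (by linarith)
      have q9 : ν b * ((∫ v in α..(α + d), p v) + ∫ v in (β - d)..β, p v) ≤ 2 * d * (Cp / √i) := by
        have := hI0 α (α + d) (by linarith)
        have := hI0 (β - d) β (by linarith)
        calc _ ≤ 1 * ((∫ v in α..(α + d), p v) + ∫ v in (β - d)..β, p v) := by gcongr
          _ ≤ _ := by linarith
      have hlen : (β - d - (α + d)) ≤ 1 := by linarith
      have hlen0 : 0 ≤ (β - d - (α + d)) := by linarith
      have q10 : (β - d - (α + d)) * (ε / 8 / √i) ≤ ε / 8 / √i := mul_le_of_le_one_left (by positivity) hlen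
      have q11 : (β - d - (α + d)) * (η * (C2 / √i)) ≤ η * (C2 / √i) := mul_le_of_le_one_left (by positivity) hlen
      have q12 : 2 * d * (Cp / √i) + ε / 8 / √i + η * (C2 / √i) ≤ ε / √i := by
        have : 2 * d * (Cp / √i) + ε / 8 / √i + η * (C2 / √i) = (η * (Cp + C2) + ε / 8) / √i := by
          rw [hd]; field_simp; ring
        rw [this]
        apply hdiv
        have : η * (Cp + C2) ≤ η * C := by gcongr; rw [hC]; linarith
        linarith
      rw [q6]
      linarith
    · push Not at hcase
      have h1 := hint_le α β hab
      have h2 : ν b * ∫ v in α..β, p v ≤ 2 * d * (Cp / √i) := by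
        have := hI0 α β hab
        calc _ ≤ 1 * ∫ v in α..β, p v := by gcongr
          _ ≤ (β - α) * (Cp / √i) := by linarith
          _ ≤ _ := by gcongr; linarith
      have h3 : 2 * d * (Cp / √i) ≤ ε / √i := by
        have : 2 * d * (Cp / √i) = (η * Cp) / √i := by rw [hd]; field_simp
        rw [this]
        apply hdiv
        have : η * Cp ≤ η * C := by gcongr; rw [hC]; linarith
        linarith
      linarith
  · have hcase : α - d ≤ β + d := by linarith
    have q1 := UL_pow_ii hG i x w (α - d) (β + d) hcase (fun x' => P x' b) (fjd δ) hfc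
    have q3 : (UL P f ^ i) ((1 - η) • ee P b α β) x w ≤
        (UL P f ^ i) (fun x' s => P x' b * ∫ v in (α - d)..(β + d), fjd δ (s - v)) x w := by
      refine UL_pow_mono hP (fun x' s => ?_) i x w
      have h1 := iv_upper (s := s) hδp hd0 hab hconc'
      simp only [Pi.smul_apply, smul_eq_mul, ee]
      calc _ = P x' b * ((1 - η) * iv α β s) := by ring
        _ ≤ _ := mul_le_mul_of_nonneg_left h1 (hP _ _)
    rw [map_smul, Pi.smul_apply, Pi.smul_apply, smul_eq_mul, q1.2] at q3
    have q4 : ∫ v in (α - d)..(β + d), (UL P f ^ i) (fun x' s => P x' b * fjd δ (s - v)) x w ≤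
        ∫ v in (α - d)..(β + d), (ν b * p v + ε / 8 / √i) := by
      refine intervalIntegral.integral_mono_on hcase q1.1
        (((hpi _ _).const_mul _).add intervalIntegrable_const) fun v _ => ?_
      have := (abs_le.1 (hloc v)).2
      linarith
    rw [intervalIntegral.integral_add ((hpi _ _).const_mul _) intervalIntegrable_const,
      intervalIntegral.integral_const_mul] at q4
    simp only [intervalIntegral.integral_const, smul_eq_mul] at q4
    have q6 : ∫ v in (α - d)..(β + d), p v = (∫ v in (α - d)..α, p v) + (∫ v in α..β, p v) + ∫ v in β..(β + d), p v := by
      rw [intervalIntegral.integral_add_adjacent_intervals (hpi _ _) (hpi _ _),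
        intervalIntegral.integral_add_adjacent_intervals (hpi _ _) (hpi _ _)]
    have q7 := hint_le (α - d) α (by linarith)
    have q8 := hint_le β (β + d) (by linarith)
    have q9 : ν b * ((∫ v in (α - d)..α, p v) + ∫ v in β..(β + d), p v) ≤ 2 * d * (Cp / √i) := by
      have := hI0 (α - d) α (by linarith)
      have := hI0 β (β + d) (by linarith)
      calc _ ≤ 1 * ((∫ v in (α - d)..α, p v) + ∫ v in β..(β + d), p v) := by gcongr
        _ ≤ _ := by linarith
    have hlen : (β + d - (α - d)) ≤ 2 := by linarith
    have q10 : (β + d - (α - d)) * (ε / 8 / √i) ≤ 2 * (ε / 8 / √i) := by gcongr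
    have q11 : η * (UL P f ^ i) (ee P b α β) x w ≤ η * (C1 / √i) := by
      have := H1 i hi1 x w b α β hab1
      gcongr
    have q12 : 2 * d * (Cp / √i) + 2 * (ε / 8 / √i) + η * (C1 / √i) ≤ ε / √i := by
      have : 2 * d * (Cp / √i) + 2 * (ε / 8 / √i) + η * (C1 / √i) = (η * (Cp + C1) + 2 * ε / 8) / √i := by
        rw [hd]; field_simp; ring
      rw [this]
      apply hdiv
      have : η * (Cp + C1) ≤ η * C := by gcongr; rw [hC]; linarith
      linarith
    rw [q6] at q4
    linarith

end llt2

set_option linter.unusedSectionVars false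

/-! Survival bounds -/

section surv
variable [Fintype X] [DecidableEq X] [Nonempty X] {P : X → X → ℝ} {ν f : X → ℝ}

/-- The function `V` is the limit of normalised survival probabilities. -/
def HasV (P : X → X → ℝ) (ν f : X → ℝ) (V : X → ℝ → ℝ) : Prop :=
  ∀ x y, Tendsto (fun n : ℕ => √(sigma2 P ν f) * √(2 * π * n) / 2 * sv P f n x y) atTop (𝓝 (V x y))

lemma sqrt_const (n : ℕ) : √(sigma2 P ν f) * √(2 * π * n) / 2 = (√(sigma2 P ν f) * √(2 * π) / 2) * √n := by
  rw [Real.sqrt_mul (by positivity)]; ring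

lemma kap_pos (hG : Good P ν f) : 0 < √(sigma2 P ν f) * √(2 * π) / 2 := by
  have := sigma2_pos hG
  positivity

lemma HasV.nonneg (hG : Good P ν f) {V : X → ℝ → ℝ} (hV : HasV P ν f V) (x : X) (y : ℝ) : 0 ≤ V x y :=
  ge_of_tendsto' (hV x y) fun n => mul_nonneg (by positivity) (sv_nonneg hG.st.nonneg _ _ _)

lemma HasV.mono (hG : Good P ν f) {V : X → ℝ → ℝ} (hV : HasV P ν f V) (x : X) : Monotone (V x) :=
  fun y y' h => le_of_tendsto_of_tendsto' (hV x y) (hV x y') fun n =>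
    mul_le_mul_of_nonneg_left (sv_mono_y hG.st.nonneg _ _ h) (by positivity)

/-- Partial sums of survival probabilities. -/
noncomputable def Tn (P : X → X → ℝ) (f : X → ℝ) (n : ℕ) (x : X) (y : ℝ) : ℝ :=
  ∑ k ∈ range n, sv P f k x y

lemma Tn_succ (n : ℕ) (x : X) (y : ℝ) :
    Tn P f (n + 1) x y = 1 + ∑ x', P x x' * (if 0 < y + f x' then Tn P f n x' (y + f x') else 0) := by
  unfold Tn
  rw [Finset.sum_range_succ', sv_zero, add_comm]
  congr 1
  simp only [sv_succ]
  rw [Finset.sum_comm]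
  refine Finset.sum_congr rfl fun x' _ => ?_
  rw [← Finset.mul_sum]
  split_ifs <;> simp

lemma Tn_nonneg (hP : ∀ x x', 0 ≤ P x x') (n : ℕ) (x : X) (y : ℝ) : 0 ≤ Tn P f n x y :=
  Finset.sum_nonneg fun _ _ => sv_nonneg hP _ _ _

lemma Tn_mono (hP : ∀ x x', 0 ≤ P x x') (n : ℕ) (x : X) {y y' : ℝ} (h : y ≤ y') :
    Tn P f n x y ≤ Tn P f n x y' :=
  Finset.sum_le_sum fun _ _ => sv_mono_y hP _ _ h

lemma Tn_mono_n (hP : ∀ x x', 0 ≤ P x x') (n : ℕ) (x : X) (y : ℝ) :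
    Tn P f n x y ≤ Tn P f (n + 1) x y := by
  unfold Tn
  rw [Finset.sum_range_succ]
  linarith [sv_nonneg (f := f) hP n x y]

lemma Tn_subadd (hP : ∀ x x', 0 ≤ P x x') (h1 : ∀ x, ∑ x', P x x' = 1) (n : ℕ) (x : X) (y1 y2 : ℝ)
    (hy2 : 0 ≤ y2) : Tn P f n x (y1 + y2) ≤ Tn P f n x y1 + ∑ a, Tn P f n a y2 := by
  induction n generalizing x y1 with
  | zero => simp [Tn]
  | succ n ih =>
    rw [Tn_succ, Tn_succ]
    have hM : ∑ a, Tn P f n a y2 ≤ ∑ a, Tn P f (n + 1) a y2 :=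
      Finset.sum_le_sum fun a _ => Tn_mono_n hP n a y2
    have hM0 : 0 ≤ ∑ a, Tn P f n a y2 := Finset.sum_nonneg fun a _ => Tn_nonneg hP n a y2
    have key : ∑ x', P x x' * (if 0 < y1 + y2 + f x' then Tn P f n x' (y1 + y2 + f x') else 0) ≤
        ∑ x', P x x' * ((if 0 < y1 + f x' then Tn P f n x' (y1 + f x') else 0) + ∑ a, Tn P f n a y2) := by
      refine Finset.sum_le_sum fun x' _ => mul_le_mul_of_nonneg_left ?_ (hP _ _)
      split_ifs with h2 h3 h3
      · have := ih x' (y1 + f x')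
        rwa [show y1 + f x' + y2 = y1 + y2 + f x' by ring] at this
      · rw [zero_add]
        refine (Tn_mono hP n x' (y' := y2) (by linarith)).trans ?_
        exact Finset.single_le_sum (f := fun a => Tn P f n a y2) (fun a _ => Tn_nonneg hP n a y2) (Finset.mem_univ x')
      · have := Tn_nonneg (f := f) hP n x' (y1 + f x')
        linarith
      · linarith
    simp only [mul_add, Finset.sum_add_distrib, ← Finset.sum_mul, h1, one_mul] at key
    linarith

lemma Tn_linear (hP : ∀ x x', 0 ≤ P x x') (h1 : ∀ x, ∑ x', P x x' = 1) (n : ℕ) (x : X) (y : ℝ) (hy : 0 ≤ y) :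
    Tn P f n x y ≤ (1 + y) * ∑ a, Tn P f n a 1 := by
  have hM0 : 0 ≤ ∑ a, Tn P f n a 1 := Finset.sum_nonneg fun a _ => Tn_nonneg hP n a 1
  have key : ∀ j : ℕ, Tn P f n x ((j : ℝ) + 1) ≤ ((j : ℝ) + 1) * ∑ a, Tn P f n a 1 := by
    intro j
    induction j with
    | zero =>
      simp only [Nat.cast_zero, zero_add, one_mul]
      exact Finset.single_le_sum (f := fun a => Tn P f n a 1) (fun a _ => Tn_nonneg hP n a 1) (Finset.mem_univ x)
    | succ j ih =>
      have := Tn_subadd (f := f) hP h1 n x ((j : ℝ) + 1) 1 zero_le_one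
      push_cast
      linarith
  refine (Tn_mono hP n x (Nat.lt_floor_add_one y).le).trans ((key _).trans ?_)
  have := Nat.floor_le hy
  gcongr ?_ * _
  linarith

lemma sum_inv_sqrt (n : ℕ) : ∑ k ∈ range n, 1 / √((k : ℝ) + 1) ≤ 2 * √n := by
  induction n with
  | zero => simp
  | succ n ih =>
    rw [Finset.sum_range_succ]
    have h1 : 1 / √((n : ℝ) + 1) ≤ 2 * √((n : ℝ) + 1) - 2 * √n := by
      have hp : 0 < √((n : ℝ) + 1) := Real.sqrt_pos.2 (by positivity)
      rw [div_le_iff₀ hp]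
      have e1 : √((n : ℝ) + 1) * √((n : ℝ) + 1) = n + 1 := Real.mul_self_sqrt (by positivity)
      have e2 : √(n : ℝ) * √(n : ℝ) = n := Real.mul_self_sqrt (by positivity)
      nlinarith [sq_nonneg (√((n : ℝ) + 1) - √n)]
    push_cast
    linarith

/-- Survival bound. -/
lemma sv_bound (hG : Good P ν f) {V : X → ℝ → ℝ} (hV : HasV P ν f V) :
    ∃ C : ℝ, 0 ≤ C ∧ ∀ n : ℕ, 1 ≤ n → ∀ x y, 0 ≤ y → sv P f n x y ≤ C * (1 + y) / √n := by
  have hP := hG.st.nonneg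
  have h1 := hG.st.rowSum
  have hκ := kap_pos hG
  set κ := √(sigma2 P ν f) * √(2 * π) / 2 with hκd
  have hb : ∀ x, ∃ B : ℝ, 0 ≤ B ∧ ∀ n : ℕ, κ * √n * sv P f n x 1 ≤ B := by
    intro x
    obtain ⟨B, hB⟩ := (hV x 1).bddAbove_range
    refine ⟨max B 0, le_max_right _ _, fun n => le_trans ?_ (le_max_left _ _)⟩
    rw [hκd, ← sqrt_const]
    exact hB ⟨n, rfl⟩
  choose B hB0 hB using hb
  set C1 := ∑ x, B x / κ with hC1
  have hC10 : 0 ≤ C1 := Finset.sum_nonneg fun x _ => div_nonneg (hB0 x) hκ.le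
  have hs1 : ∀ (n : ℕ) x, sv P f (n + 1) x 1 ≤ C1 * (1 / √((n:ℝ) + 1)) := by
    intro n x
    have h2 := hB x (n + 1)
    have hp : 0 < √((n : ℝ) + 1) := Real.sqrt_pos.2 (by positivity)
    have h3 : B x / κ ≤ C1 := Finset.single_le_sum (f := fun x => B x / κ)
      (fun x _ => div_nonneg (hB0 x) hκ.le) (Finset.mem_univ x)
    push_cast at h2
    rw [mul_one_div, le_div_iff₀ hp]
    refine le_trans ?_ h3
    rw [le_div_iff₀ hκ]
    linarith
  have hT : ∀ n : ℕ, 1 ≤ n → ∀ x, Tn P f n x 1 ≤ (1 + 2 * C1) * √n := by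
    intro n hn x
    obtain ⟨n, rfl⟩ : ∃ j, n = j + 1 := ⟨n - 1, by omega⟩
    unfold Tn
    rw [Finset.sum_range_succ', sv_zero]
    have h2 : ∑ k ∈ range n, sv P f (k + 1) x 1 ≤ C1 * (2 * √n) := by
      refine (Finset.sum_le_sum fun k _ => hs1 k x).trans ?_
      rw [← Finset.mul_sum]
      gcongr
      exact sum_inv_sqrt n
    have h3 : √(n:ℝ) ≤ √((n + 1 : ℕ) : ℝ) := Real.sqrt_le_sqrt (by push_cast; linarith)
    have h4 : 1 ≤ √((n + 1 : ℕ) : ℝ) := by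
      rw [Real.one_le_sqrt]; push_cast; linarith [(Nat.cast_nonneg n : (0:ℝ) ≤ n)]
    nlinarith
  set N : ℝ := ((Fintype.card X : ℕ) : ℝ) with hN
  refine ⟨N * (1 + 2 * C1), by positivity, fun n hn x y hy => ?_⟩
  have hnp : (0:ℝ) < n := by exact_mod_cast hn
  have hsp : 0 < √(n:ℝ) := Real.sqrt_pos.2 hnp
  have h2 : (n:ℝ) * sv P f n x y ≤ Tn P f n x y := by
    have hanti : ∀ k ∈ range n, sv P f n x y ≤ sv P f k x y := by
      intro k hk
      have : Antitone fun n => sv P f n x y := antitone_nat_of_succ_le fun n => sv_succ_le hP h1 n x y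
      exact this (Finset.mem_range.1 hk).le
    have := Finset.card_nsmul_le_sum (range n) (fun k => sv P f k x y) _ hanti
    simpa [Tn] using this
  have h3 := Tn_linear (f := f) hP h1 n x y hy
  have h4 : ∑ a, Tn P f n a 1 ≤ N * ((1 + 2 * C1) * √n) := by
    refine (Finset.sum_le_sum fun a _ => hT n hn a).trans ?_
    simp [hN]
  rw [le_div_iff₀ hsp]
  have e2 : √(n : ℝ) * √(n : ℝ) = n := Real.mul_self_sqrt (by positivity)
  have h5 : sv P f n x y * √n * √n ≤ N * (1 + 2 * C1) * (1 + y) * √n := by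
    calc sv P f n x y * √n * √n = (n:ℝ) * sv P f n x y := by rw [mul_assoc, e2]; ring
      _ ≤ (1 + y) * (N * ((1 + 2 * C1) * √n)) := h2.trans (h3.trans (by gcongr))
      _ = _ := by ring
  exact le_of_mul_le_mul_right h5 hsp

lemma V_bound (hG : Good P ν f) {V : X → ℝ → ℝ} (hV : HasV P ν f V) :
    ∃ C : ℝ, 0 ≤ C ∧ ∀ x y, 0 ≤ y → V x y ≤ C * (1 + y) := by
  obtain ⟨C, hC, H⟩ := sv_bound hG hV
  have hκ := kap_pos hG
  refine ⟨(√(sigma2 P ν f) * √(2 * π) / 2) * C, by positivity, fun x y hy => ?_⟩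
  refine le_of_tendsto (hV x y) ?_
  filter_upwards [eventually_ge_atTop 1] with n hn
  have hnp : (0:ℝ) < n := by exact_mod_cast hn
  have hsp : 0 < √(n:ℝ) := Real.sqrt_pos.2 hnp
  have := H n hn x y hy
  rw [le_div_iff₀ hsp] at this
  rw [sqrt_const]
  calc _ = (√(sigma2 P ν f) * √(2 * π) / 2) * (sv P f n x y * √n) := by ring
    _ ≤ (√(sigma2 P ν f) * √(2 * π) / 2) * (C * (1 + y)) := by gcongr
    _ = _ := by ring

end surv

/-! The dual chain -/

section dual
variable [Fintype X] [DecidableEq X] [Nonempty X] {P : X → X → ℝ} {ν f : X → ℝ}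

lemma dual_mul (hS : IsStochastic P ν) (b x : X) : P x b * ν x = ν b * dualK P ν b x := by
  unfold dualK
  have := (hS.nuPos b).ne'
  field_simp

lemma dual_st (hS : IsStochastic P ν) : IsStochastic (dualK P ν) ν where
  nonneg x x' := div_nonneg (mul_nonneg (hS.nuPos x').le (hS.nonneg _ _)) (hS.nuPos x).le
  rowSum x := by
    unfold dualK
    rw [← Finset.sum_div, hS.nuInv, div_self (hS.nuPos x).ne']
  nuPos := hS.nuPos
  nuSum := hS.nuSum
  nuInv x' := by
    have : ∀ x, ν x * dualK P ν x x' = ν x' * P x' x := by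
      intro x; rw [← dual_mul hS, mul_comm]
    simp only [this, ← Finset.mul_sum, hS.rowSum, mul_one]

lemma kpow_succ' (P : X → X → ℝ) (n : ℕ) (x x' : X) :
    kpow P (n + 1) x x' = ∑ y, kpow P n x y * P y x' := by
  induction n generalizing x with
  | zero => simp [kpow]
  | succ n ih =>
    rw [kpow]
    simp only [ih]
    rw [kpow]
    simp only [Finset.mul_sum, Finset.sum_mul]
    rw [Finset.sum_comm]
    simp only [mul_assoc]

lemma kpow_dual (hS : IsStochastic P ν) (n : ℕ) (x x' : X) :
    ν x * kpow (dualK P ν) n x x' = ν x' * kpow P n x' x := by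
  induction n generalizing x with
  | zero =>
    by_cases h : x = x'
    · subst h; rfl
    · simp [kpow, h, Ne.symm h]
  | succ n ih =>
    rw [kpow, kpow_succ', Finset.mul_sum, Finset.mul_sum]
    refine Finset.sum_congr rfl fun y _ => ?_
    rw [← mul_assoc, ← dual_mul hS, mul_assoc, ih]; ring

lemma dual_good (hG : Good P ν f) : Good (dualK P ν) ν (fun b => -f b) where
  st := dual_st hG.st
  pr := by
    obtain ⟨k, hk, h⟩ := hG.pr
    refine ⟨k, hk, fun x x' => ?_⟩
    have h1 := kpow_dual hG.st k x x'
    have h2 : 0 < ν x * kpow (dualK P ν) k x x' := by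
      rw [h1]; exact mul_pos (hG.st.nuPos _) (h _ _)
    exact pos_of_mul_pos_right h2 (hG.st.nuPos x).le
  cen := by
    have := hG.cen
    simp only [neg_mul, Finset.sum_neg_distrib, this, neg_zero]
  nl := by
    intro θ a
    obtain ⟨n, g, hpos, hne⟩ := hG.nl (-θ) a
    refine ⟨n, fun i => g (-i), ?_, fun m hm => ?_⟩
    · have hp : ∀ i, 0 < P (g i) (g (i + 1)) := fun i =>
        lt_of_le_of_ne (hG.st.nonneg _ _) fun h => by
          have : ∏ i, P (g i) (g (i + 1)) = 0 := Finset.prod_eq_zero (Finset.mem_univ i) h.symm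
          linarith
      refine Finset.prod_pos fun i _ => ?_
      have h1 := hp (-(i + 1))
      rw [show -(i + 1) + 1 = -i by abel] at h1
      exact div_pos (mul_pos (hG.st.nuPos _) h1) (hG.st.nuPos _)
    · apply hne (-m)
      have e : ∑ i, -f (g (-i)) = -∑ i, f (g i) := by
        rw [Finset.sum_neg_distrib]
        congr 1
        exact Fintype.sum_equiv (Equiv.neg _) _ _ fun i => rfl
      rw [e] at hm
      push_cast
      linarith

lemma Pop_dual (hS : IsStochastic P ν) (g h : X → ℝ) :
    ∑ x, g x * Pop (dualK P ν) h x * ν x = ∑ x, Pop P g x * h x * ν x := by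
  have e1 : ∀ x, g x * Pop (dualK P ν) h x * ν x = ∑ y, g x * h y * (P y x * ν y) := by
    intro x
    unfold Pop
    rw [Finset.mul_sum, Finset.sum_mul]
    refine Finset.sum_congr rfl fun y _ => ?_
    rw [dual_mul hS]; ring
  have e2 : ∀ x, Pop P g x * h x * ν x = ∑ y, g y * h x * (P x y * ν x) := by
    intro x
    unfold Pop
    rw [Finset.sum_mul, Finset.sum_mul]
    refine Finset.sum_congr rfl fun y _ => ?_
    ring
  simp only [e1, e2]
  rw [Finset.sum_comm]

lemma Pop_dual_iter (hS : IsStochastic P ν) (n : ℕ) (g h : X → ℝ) :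
    ∑ x, g x * ((Pop (dualK P ν))^[n] h) x * ν x = ∑ x, ((Pop P)^[n] g) x * h x * ν x := by
  induction n generalizing g h with
  | zero => rfl
  | succ n ih =>
    rw [Function.iterate_succ_apply, ih, Function.iterate_succ_apply', Pop_dual hS]

lemma Pop_neg_iter (n : ℕ) (g : X → ℝ) : (Pop P)^[n] (fun b => -g b) = fun b => -((Pop P)^[n] g) b := by
  induction n generalizing g with
  | zero => rfl
  | succ n ih =>
    rw [Function.iterate_succ_apply, Function.iterate_succ_apply, ← ih]
    congr 1
    funext x
    simp [Pop, Finset.sum_neg_distrib]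

lemma sigma2_dual (hS : IsStochastic P ν) : sigma2 (dualK P ν) ν (fun b => -f b) = sigma2 P ν f := by
  unfold sigma2
  congr 1
  · simp
  · congr 1
    refine tsum_congr fun n => ?_
    simp only [Pop_neg_iter, neg_mul_neg]
    rw [Pop_dual_iter hS]
    exact Finset.sum_congr rfl fun x _ => by ring

end dual

set_option linter.unusedSectionVars false

section duality
variable [Fintype X] [DecidableEq X] [Nonempty X] {P : X → X → ℝ} {ν f : X → ℝ}

/-- Bounded measurable functions. -/
structure BM (φ : X → ℝ → ℝ) : Prop where
  meas : ∀ x, Measurable (φ x)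
  bdd : ∃ C, ∀ x s, |φ x s| ≤ C

lemma BM_KL {φ : X → ℝ → ℝ} (h : BM φ) : BM (KL P f φ) := by
  obtain ⟨C, hC⟩ := h.bdd
  constructor
  · intro x
    have : KL P f φ x = fun y => ∑ x', P x x' * (if 0 < y + f x' then φ x' (y + f x') else 0) := rfl
    rw [this]
    refine Finset.measurable_sum _ fun x' _ => Measurable.const_mul ?_ _
    refine Measurable.ite (measurableSet_lt measurable_const (by fun_prop)) ?_ measurable_const
    exact (h.meas x').comp (by fun_prop)
  · have hC0 : 0 ≤ C := (abs_nonneg _).trans (hC (Classical.arbitrary X) 0)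
    refine ⟨∑ x, ∑ x', |P x x'| * C, fun x s => ?_⟩
    rw [KL_apply]
    have h2 : |∑ x', P x x' * (if 0 < s + f x' then φ x' (s + f x') else 0)| ≤ ∑ x', |P x x'| * C := by
      refine (Finset.abs_sum_le_sum_abs _ _).trans (Finset.sum_le_sum fun x' _ => ?_)
      rw [abs_mul]
      refine mul_le_mul_of_nonneg_left ?_ (abs_nonneg _)
      split_ifs
      · exact hC _ _
      · simpa using hC0
    refine h2.trans (Finset.single_le_sum (f := fun x => ∑ x', |P x x'| * C) (fun i _ => ?_) (Finset.mem_univ x))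
    exact Finset.sum_nonneg fun x' _ => mul_nonneg (abs_nonneg _) hC0

lemma BM_KL_pow {φ : X → ℝ → ℝ} (h : BM φ) (n : ℕ) : BM ((KL P f ^ n) φ) := by
  induction n with
  | zero => exact h
  | succ n ih => rw [KL_pow_succ]; exact BM_KL ih

lemma BM.intOn {φ : X → ℝ → ℝ} (h : BM φ) (x : X) (α β : ℝ) :
    IntegrableOn (φ x) (Set.Ioc α β) := by
  obtain ⟨C, hC⟩ := h.bdd
  exact Measure.integrableOn_of_bounded (M := C) (by simp) (h.meas x).aestronglyMeasurable
    (ae_of_all _ fun s => by simpa using hC x s)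

lemma iv_eq (α β s : ℝ) : iv α β s = if α < s ∧ s ≤ β then 1 else 0 := by
  rfl

lemma ee_empty (b : X) {α β : ℝ} (h : β ≤ α) : ee P b α β = 0 := by
  funext x s
  have : iv α β s = 0 := by
    rw [iv_eq, if_neg]; rintro ⟨h1, h2⟩; linarith
  simp [ee, this]

lemma chi_ee (b : X) {α β : ℝ} (h : 0 ≤ α) : chi (ee P b α β) = ee P b α β := by
  funext x s
  simp only [chi, ee]
  split_ifs with hs
  · rfl
  · rw [iv_eq, if_neg]
    · simp
    · rintro ⟨h1, h2⟩; linarith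

/-- One step of the killed operator on the elementary functions. -/
lemma LL_ee (b : X) (α β : ℝ) :
    LL P f (ee P b α β) = ∑ x', P x' b • ee P x' (max (α - f x') 0) (β - f x') := by
  funext x s
  rw [LL_apply]
  simp only [Finset.sum_apply, Pi.smul_apply, smul_eq_mul, ee, iv_eq]
  split_ifs with hs
  · refine Finset.sum_congr rfl fun x' _ => ?_
    have : (α < s + f x' ∧ s + f x' ≤ β) ↔ (max (α - f x') 0 < s ∧ s ≤ β - f x') := by
      rw [max_lt_iff]
      constructor
      · rintro ⟨h1, h2⟩; exact ⟨⟨by linarith, hs⟩, by linarith⟩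
      · rintro ⟨⟨h1, _⟩, h2⟩; exact ⟨by linarith, by linarith⟩
    simp only [this]; ring
  · symm
    refine Finset.sum_eq_zero fun x' _ => ?_
    rw [if_neg]
    · simp
    · rintro ⟨h1, h2⟩; exact hs ((le_max_right _ _).trans_lt h1)

lemma setIntegral_shift_pos (h : ℝ → ℝ) (α β c : ℝ) :
    ∫ z in Set.Ioc α β, (if 0 < z + c then h (z + c) else 0) =
      ∫ s in Set.Ioc (max (α + c) 0) (β + c), h s := by
  have h1 : ∫ z in Set.Ioc α β, (if 0 < z + c then h (z + c) else 0) =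
      ∫ z, (Set.Ioc (max (α + c) 0) (β + c)).indicator h (z + c) := by
    rw [← integral_indicator measurableSet_Ioc]
    congr 1; funext z
    simp only [Set.indicator, Set.mem_Ioc, max_lt_iff]
    split_ifs with h1 h2 h3 h3 h2
    · rfl
    · exact absurd ⟨⟨by linarith [h1.1], h2⟩, by linarith [h1.2]⟩ h3
    · exact absurd h3.1.2 h2
    · rfl
    · exact absurd ⟨by linarith [h2.1.1], by linarith [h2.2]⟩ h1
    · rfl
  rw [h1, integral_add_right_eq_self (fun z => (Set.Ioc (max (α + c) 0) (β + c)).indicator h z),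
    integral_indicator measurableSet_Ioc]

/-- Key duality statement. -/
lemma duality (hS : IsStochastic P ν) (i : ℕ) (x : X) (w ε : ℝ) (φ : X → ℝ → ℝ) (hφ : BM φ)
    (hbase : ∀ b α β, α ≤ β → β ≤ α + 1 →
      |(UL P f ^ i) (ee P b α β) x w - ν b * ∫ s in Set.Ioc α β, φ b s| ≤ ε * ν b)
    (k : ℕ) (b : X) (α β : ℝ) (hab : α ≤ β) (hab1 : β ≤ α + 1) :
    |(UL P f ^ i) ((LL P f ^ k) (ee P b α β)) x w -
      ν b * ∫ s in Set.Ioc α β, (KL (dualK P ν) (fun b => -f b) ^ k) φ b s| ≤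
      ε * ν b * sv (dualK P ν) (fun b => -f b) k b β := by
  have hSd := dual_st hS
  have hε : 0 ≤ ε := by
    have h1 := (abs_nonneg _).trans (hbase b α β hab hab1)
    have := hS.nuPos b
    by_contra hc
    push Not at hc
    nlinarith
  induction k generalizing b α β with
  | zero => simpa [sv_zero] using hbase b α β hab hab1
  | succ k ih =>
    have hterm : ∀ x' : X, |(UL P f ^ i) ((LL P f ^ k) (ee P x' (max (α - f x') 0) (β - f x'))) x w -
        ν x' * ∫ s in Set.Ioc (max (α - f x') 0) (β - f x'),
          (KL (dualK P ν) (fun b => -f b) ^ k) φ x' s| ≤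
        ε * ν x' * (if 0 < β - f x' then sv (dualK P ν) (fun b => -f b) k x' (β - f x') else 0) := by
      intro x'
      by_cases hc : max (α - f x') 0 < β - f x'
      · rw [if_pos ((le_max_right _ _).trans_lt hc)]
        exact ih x' _ _ hc.le (by have := le_max_left (α - f x') 0; linarith)
      · push Not at hc
        rw [ee_empty _ hc, Set.Ioc_eq_empty (not_lt.2 hc)]
        simp only [map_zero, Pi.zero_apply, Measure.restrict_empty, integral_zero_measure, mul_zero,
          sub_zero, abs_zero]
        refine mul_nonneg (mul_nonneg hε (hS.nuPos _).le) ?_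
        split_ifs
        · exact sv_nonneg hSd.nonneg _ _ _
        · exact le_rfl
    have e1 : (UL P f ^ i) ((LL P f ^ (k + 1)) (ee P b α β)) x w = ∑ x', P x' b *
        (UL P f ^ i) ((LL P f ^ k) (ee P x' (max (α - f x') 0) (β - f x'))) x w := by
      rw [LL_pow_succ', LL_ee, map_sum, map_sum]
      simp [map_smul, Finset.sum_apply]
    have e2 : ν b * ∫ s in Set.Ioc α β, (KL (dualK P ν) (fun b => -f b) ^ (k + 1)) φ b s =
        ∑ x', P x' b * (ν x' * ∫ s in Set.Ioc (max (α - f x') 0) (β - f x'),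
          (KL (dualK P ν) (fun b => -f b) ^ k) φ x' s) := by
      have hBM := BM_KL_pow hφ (P := dualK P ν) (f := fun b => -f b) k
      have hI : ∀ x' : X, IntegrableOn (fun s => if 0 < s + -f x' then
          (KL (dualK P ν) (fun b => -f b) ^ k) φ x' (s + -f x') else 0) (Set.Ioc α β) := by
        intro x'
        obtain ⟨C, hC⟩ := hBM.bdd
        refine Measure.integrableOn_of_bounded (M := C) (by simp) ?_ (ae_of_all _ fun s => ?_)
        · refine Measurable.aestronglyMeasurable ?_
          refine Measurable.ite (measurableSet_lt measurable_const (by fun_prop)) ?_ measurable_const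
          exact (hBM.meas x').comp (by fun_prop)
        · split_ifs
          · simpa using hC _ _
          · simpa using (abs_nonneg _).trans (hC (Classical.arbitrary X) 0)
      simp only [KL_pow_succ, KL_apply]
      rw [integral_finsetSum _ fun x' _ => (hI x').const_mul _, Finset.mul_sum]
      refine Finset.sum_congr rfl fun x' _ => ?_
      rw [integral_const_mul, setIntegral_shift_pos, ← mul_assoc, ← dual_mul hS, mul_assoc]
      simp only [← sub_eq_add_neg]
    have e3 : ε * ν b * sv (dualK P ν) (fun b => -f b) (k + 1) b β = ∑ x', P x' b * (ε * ν x' *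
        (if 0 < β - f x' then sv (dualK P ν) (fun b => -f b) k x' (β - f x') else 0)) := by
      rw [sv_succ, Finset.mul_sum]
      refine Finset.sum_congr rfl fun x' _ => ?_
      simp only [← sub_eq_add_neg]
      have := dual_mul hS b x'
      linear_combination (-ε * (if 0 < β - f x' then sv (dualK P ν) (fun b => -f b) k x' (β - f x') else 0)) * this
    rw [e1, e2, e3, ← Finset.sum_sub_distrib]
    refine (Finset.abs_sum_le_sum_abs _ _).trans (Finset.sum_le_sum fun x' _ => ?_)
    rw [← mul_sub, abs_mul, abs_of_nonneg (hS.nonneg _ _)]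
    exact mul_le_mul_of_nonneg_left (hterm x') (hS.nonneg _ _)

end duality

section bounds
variable [Fintype X] [DecidableEq X] [Nonempty X] {P : X → X → ℝ} {ν f : X → ℝ}

lemma free_ee' (hG : Good P ν f) : ∃ C : ℝ, 0 ≤ C ∧ ∀ i : ℕ, ∀ x w b α β, β ≤ α + 1 →
    (UL P f ^ i) (ee P b α β) x w ≤ C / √((i : ℝ) + 1) := by
  obtain ⟨C, hC, h⟩ := free_ee hG
  refine ⟨2 * C + 1, by positivity, fun i x w b α β hab => ?_⟩
  rcases Nat.eq_zero_or_pos i with rfl | hi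
  · simp only [pow_zero, Nat.cast_zero, zero_add, Real.sqrt_one, div_one]
    exact (ee_le_one hG.st b α β x w).trans (by linarith)
  · refine (h i hi x w b α β hab).trans ?_
    have hi' : (1:ℝ) ≤ i := by exact_mod_cast hi
    have h1 : 0 < √(i:ℝ) := Real.sqrt_pos.2 (by linarith)
    have h2 : √((i:ℝ) + 1) ≤ 2 * √(i:ℝ) := by
      rw [Real.sqrt_le_left (by positivity), mul_pow, Real.sq_sqrt (by linarith)]; linarith
    rw [div_le_div_iff₀ h1 (by positivity)]
    nlinarith

/-- Bound (5a). -/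
lemma five_a (hG : Good P ν f) {Vs : X → ℝ → ℝ} (hVs : HasV (dualK P ν) ν (fun b => -f b) Vs) :
    ∃ C : ℝ, 0 ≤ C ∧ ∀ i k : ℕ, 1 ≤ k → ∀ x w b α β, 0 ≤ β → α ≤ β → β ≤ α + 1 →
    (UL P f ^ i) ((LL P f ^ k) (ee P b α β)) x w ≤ C * (1 + β) / (√((i : ℝ) + 1) * √k) := by
  obtain ⟨C1, hC1, h1⟩ := free_ee' hG
  obtain ⟨C2, hC2, h2⟩ := sv_bound (dual_good hG) hVs
  set M : ℝ := ∑ b, (ν b)⁻¹ with hM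
  have hpos := hG.st.nuPos
  have hMb : ∀ b, 1 ≤ M * ν b := by
    intro b
    have : (ν b)⁻¹ ≤ M := Finset.single_le_sum (f := fun b => (ν b)⁻¹)
      (fun b _ => (inv_pos.2 (hpos b)).le) (Finset.mem_univ b)
    calc (1:ℝ) = (ν b)⁻¹ * ν b := (inv_mul_cancel₀ (hpos b).ne').symm
      _ ≤ _ := mul_le_mul_of_nonneg_right this (hpos b).le
  have hM0 : 0 ≤ M := Finset.sum_nonneg fun b _ => (inv_pos.2 (hpos b)).le
  refine ⟨C1 * M * C2, by positivity, fun i k hk x w b α β hβ hab hab1 => ?_⟩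
  have hsi : 0 < √((i:ℝ) + 1) := Real.sqrt_pos.2 (by positivity)
  have hsk : 0 < √(k:ℝ) := Real.sqrt_pos.2 (by exact_mod_cast hk)
  have hd := duality (f := f) hG.st i x w (C1 / √((i:ℝ) + 1) * M) (fun _ _ => 0)
    ⟨fun _ => measurable_const, ⟨0, by simp⟩⟩ (fun b α β _ hab1 => by
      simp only [integral_zero, mul_zero, sub_zero]
      rw [abs_of_nonneg (UL_pow_nonneg hG.st.nonneg (ee_nonneg hG.st b α β) i x w), mul_assoc]
      refine (h1 i x w b α β hab1).trans (le_mul_of_one_le_right (by positivity) (hMb b))) k b α β hab hab1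
  have hz : (KL (dualK P ν) (fun b => -f b) ^ k) (fun _ _ => (0:ℝ)) = 0 := map_zero _
  rw [hz] at hd
  simp only [Pi.zero_apply, integral_zero, mul_zero, sub_zero] at hd
  refine (le_abs_self _).trans (hd.trans ?_)
  have h3 := h2 k hk b β hβ
  have hν1 : ν b ≤ 1 := by
    rw [← hG.st.nuSum]
    exact Finset.single_le_sum (f := ν) (fun b _ => (hpos b).le) (Finset.mem_univ b)
  calc C1 / √((i:ℝ) + 1) * M * ν b * sv (dualK P ν) (fun b => -f b) k b β
      ≤ C1 / √((i:ℝ) + 1) * M * 1 * (C2 * (1 + β) / √k) := by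
        have := sv_nonneg (f := fun b => -f b) (dual_st hG.st).nonneg k b β
        gcongr
    _ = _ := by field_simp

lemma LL_pow_nonneg (hP : ∀ x x', 0 ≤ P x x') {φ : X → ℝ → ℝ} (h : ∀ x y, 0 ≤ φ x y) (n : ℕ) (x : X) (y : ℝ) :
    0 ≤ (LL P f ^ n) φ x y := by
  induction n generalizing x y with
  | zero => exact h x y
  | succ n ih =>
    rw [LL_pow_succ, LL_apply]
    split_ifs
    · exact Finset.sum_nonneg fun x' _ => mul_nonneg (hP _ _) (ih _ _)
    · exact le_rfl

/-- Bound (5b). -/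
lemma five_b (hG : Good P ν f) {V Vs : X → ℝ → ℝ} (hV : HasV P ν f V)
    (hVs : HasV (dualK P ν) ν (fun b => -f b) Vs) :
    ∃ C : ℝ, 0 ≤ C ∧ ∀ n : ℕ, 1 ≤ n → ∀ x y b α β, 0 < y → 0 ≤ α → α ≤ β → β ≤ α + 1 →
    (KL P f ^ n) (ee P b α β) x y ≤ C * (1 + y) * (1 + β) / (n * √n) := by
  obtain ⟨C1, hC1, h1⟩ := five_a hG hVs
  obtain ⟨C2, hC2, h2⟩ := sv_bound hG hV
  have hP := hG.st.nonneg
  refine ⟨4 + 5 * √5 * C1 * C2, by positivity, fun n hn x y b α β hy hα hab hab1 => ?_⟩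
  have hβ : 0 ≤ β := hα.trans hab
  have hn' : (1:ℝ) ≤ n := by exact_mod_cast hn
  have hsn : 0 < √(n:ℝ) := Real.sqrt_pos.2 (by linarith)
  by_cases h3 : n < 3
  · have hle : (KL P f ^ n) (ee P b α β) x y ≤ 1 := by
      have h4 := KL_pow_le_sv (f := f) hP (φ := ee P b α β) (C := 1) (fun x y _ => by
        rw [abs_of_nonneg (ee_nonneg hG.st b α β x y)]; exact ee_le_one hG.st b α β x y) n x y hy
      have h5 := sv_le_one (f := f) hP hG.st.rowSum n x y
      linarith [le_abs_self ((KL P f ^ n) (ee P b α β) x y)]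
    refine hle.trans ?_
    rw [le_div_iff₀ (by positivity), one_mul]
    have h6 : (n:ℝ) ≤ 2 := by
      have : n ≤ 2 := by omega
      exact_mod_cast this
    have h7 : √(n:ℝ) ≤ 2 := by rw [Real.sqrt_le_left (by norm_num)]; linarith
    have h8 : (n:ℝ) * √n ≤ 4 := by nlinarith
    have h9 : 1 ≤ (1 + y) * (1 + β) := by nlinarith
    have h10 : 0 ≤ 5 * √5 * C1 * C2 := by positivity
    have h11 : 4 + 5 * √5 * C1 * C2 ≤ (4 + 5 * √5 * C1 * C2) * ((1 + y) * (1 + β)) :=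
      le_mul_of_one_le_right (by positivity) h9
    linarith
  · push Not at h3
    set k := n / 3 with hk
    have hk1 : 1 ≤ k := by omega
    obtain ⟨i, hi⟩ : ∃ i, n = k + i + k := ⟨n - 2 * k, by omega⟩
    have hk5 : (n:ℝ) / 5 ≤ k := by
      have : n ≤ 5 * k := by omega
      have : (n:ℝ) ≤ 5 * k := by exact_mod_cast this
      linarith
    have hi5 : (n:ℝ) / 5 ≤ (i:ℝ) + 1 := by
      have : n ≤ 5 * (i + 1) := by omega
      have : (n:ℝ) ≤ 5 * (i + 1) := by exact_mod_cast this
      linarith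
    have hc0 : chi (ee P b α β) = ee P b α β := chi_ee b hα
    have e1 : (KL P f ^ n) (ee P b α β) = (KL P f ^ k) ((KL P f ^ i) ((LL P f ^ k) (ee P b α β))) := by
      rw [← KL_pow_add, ← KL_pow_LL _ _ (by omega) _ hc0, ← hi]
    have hLn : ∀ x s, 0 ≤ (LL P f ^ k) (ee P b α β) x s :=
      LL_pow_nonneg hP (ee_nonneg hG.st b α β) k
    rw [e1]
    set c := C1 * (1 + β) / (√((i : ℝ) + 1) * √k) with hc
    have h4 := KL_pow_le_sv (f := f) hP (φ := (KL P f ^ i) ((LL P f ^ k) (ee P b α β))) (C := c)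
      (fun x s hs => by
        rw [abs_of_nonneg (KL_pow_nonneg hP (fun x s _ => hLn x s) i x s hs)]
        exact (KL_pow_le_UL_pow hP hLn i x s).trans (h1 i k hk1 x s b α β hβ hab hab1)) k x y hy
    have h5 := h2 k hk1 x y hy.le
    have hks : √((n:ℝ) / 5) ≤ √(k:ℝ) := Real.sqrt_le_sqrt hk5
    have his : √((n:ℝ) / 5) ≤ √((i:ℝ) + 1) := Real.sqrt_le_sqrt hi5
    have hs5 : 0 < √((n:ℝ) / 5) := Real.sqrt_pos.2 (by positivity)
    have h55 : (0:ℝ) < √5 := by positivity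
    have hc0 : 0 ≤ c := by positivity
    calc (KL P f ^ k) ((KL P f ^ i) ((LL P f ^ k) (ee P b α β))) x y
        ≤ c * sv P f k x y := (le_abs_self _).trans h4
      _ ≤ c * (C2 * (1 + y) / √k) := by gcongr
      _ ≤ (C1 * (1 + β) / (√((n:ℝ) / 5) * √((n:ℝ) / 5))) * (C2 * (1 + y) / √((n:ℝ) / 5)) := by
          rw [hc]; gcongr
      _ = (5 * √5 * C1 * C2) * (1 + y) * (1 + β) / (n * √n) := by
          rw [Real.mul_self_sqrt (by positivity), Real.sqrt_div (by positivity)]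
          field_simp
      _ ≤ _ := by gcongr; linarith

/-- Lemma 8: weighted bound. -/
lemma eight (hG : Good P ν f) {V Vs : X → ℝ → ℝ} (hV : HasV P ν f V)
    (hVs : HasV (dualK P ν) ν (fun b => -f b) Vs) :
    ∃ C : ℝ, 0 ≤ C ∧ ∀ (φ : X → ℝ → ℝ) (c : ℕ → ℝ) (B : ℝ), (∀ v, 0 ≤ c v) →
      (∀ x s (v : ℕ), (v:ℝ) < s → s ≤ v + 1 → |φ x s| ≤ c v) →
      (∀ N : ℕ, ∑ v ∈ range N, ((v:ℝ) + 2) * c v ≤ B) →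
      ∀ n : ℕ, 1 ≤ n → ∀ x y, 0 < y → |(KL P f ^ n) φ x y| ≤ C * (1 + y) * B / (n * √n) := by
  obtain ⟨C, hC, h⟩ := five_b hG hV hVs
  have hP := hG.st.nonneg
  refine ⟨(Fintype.card X : ℕ) * C, by positivity, fun φ c B hc hφ hB n hn x y hy => ?_⟩
  have hn' : (1:ℝ) ≤ n := by exact_mod_cast hn
  obtain ⟨s, a, ha, hs, hrep⟩ := KL_repr (f := f) hP n x y hy
  obtain ⟨N, hN⟩ : ∃ N : ℕ, ∀ p ∈ s, p.2 ≤ N := by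
    obtain ⟨N, hN⟩ := exists_nat_ge (∑ p ∈ s, p.2)
    exact ⟨N, fun p hp => (Finset.single_le_sum (f := fun p : X × ℝ => p.2) (fun q hq => (hs q hq).le) hp).trans hN⟩
  have hpt : ∀ p ∈ s, |φ p.1 p.2| ≤ (∑ v ∈ range N, c v • ∑ b, ee P b v (v + 1)) p.1 p.2 := by
    intro p hp
    have hp0 := hs p hp
    obtain ⟨v, hv⟩ : ∃ v : ℕ, ⌈p.2⌉₊ = v + 1 := ⟨⌈p.2⌉₊ - 1, by have := Nat.ceil_pos.2 hp0; omega⟩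
    have hv1 : (v:ℝ) < p.2 := by
      have : v < ⌈p.2⌉₊ := by omega
      exact Nat.lt_ceil.1 this
    have hv2 : p.2 ≤ v + 1 := by
      have := Nat.le_ceil p.2
      rw [hv] at this; exact_mod_cast this
    have hvN : v ∈ range N := by
      rw [Finset.mem_range]
      have := hv1.trans_le (hN p hp)
      exact_mod_cast this
    simp only [Finset.sum_apply, Pi.smul_apply, smul_eq_mul]
    refine (hφ p.1 p.2 v hv1 hv2).trans ?_
    have h1 : ∑ b, ee P b v (v + 1) p.1 p.2 = 1 := by
      simp only [ee]
      rw [← Finset.sum_mul, hG.st.rowSum, one_mul, iv_eq, if_pos ⟨hv1, hv2⟩]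
    have h2 := Finset.single_le_sum (f := fun v : ℕ => c v * ∑ b, ee P b v (v + 1) p.1 p.2)
      (fun v _ => mul_nonneg (hc v) (Finset.sum_nonneg fun b _ => ee_nonneg hG.st b _ _ _ _)) hvN
    rw [h1, mul_one] at h2
    exact h2
  have h3 : |(KL P f ^ n) φ x y| ≤ (KL P f ^ n) (∑ v ∈ range N, c v • ∑ b, ee P b v (v + 1)) x y := by
    rw [hrep, hrep]
    refine (Finset.abs_sum_le_sum_abs _ _).trans (Finset.sum_le_sum fun p hp => ?_)
    rw [abs_mul, abs_of_nonneg (ha p)]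
    exact mul_le_mul_of_nonneg_left (hpt p hp) (ha p)
  refine h3.trans ?_
  have h4 : (KL P f ^ n) (∑ v ∈ range N, c v • ∑ b, ee P b v (v + 1)) x y =
      ∑ v ∈ range N, c v * ∑ b, (KL P f ^ n) (ee P b v (v + 1)) x y := by
    simp [map_sum, map_smul, Finset.sum_apply]
  rw [h4]
  calc ∑ v ∈ range N, c v * ∑ b, (KL P f ^ n) (ee P b v (v + 1)) x y
      ≤ ∑ v ∈ range N, c v * ∑ b : X, C * (1 + y) * (1 + ((v:ℝ) + 1)) / (n * √n) := by
        refine Finset.sum_le_sum fun v _ => mul_le_mul_of_nonneg_left ?_ (hc v)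
        exact Finset.sum_le_sum fun b _ => h n hn x y b v (v + 1) hy (by positivity) (by linarith) le_rfl
    _ = (Fintype.card X : ℕ) * C * (1 + y) / (n * √n) * ∑ v ∈ range N, ((v:ℝ) + 2) * c v := by
        rw [Finset.mul_sum]
        refine Finset.sum_congr rfl fun v _ => ?_
        rw [Finset.sum_const, Finset.card_univ, nsmul_eq_mul]; ring
    _ ≤ (Fintype.card X : ℕ) * C * (1 + y) / (n * √n) * B := by
        refine mul_le_mul_of_nonneg_left (hB N) (by positivity)
    _ = _ := by ring

lemma eight_loc (hG : Good P ν f) {V Vs : X → ℝ → ℝ} (hV : HasV P ν f V)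
    (hVs : HasV (dualK P ν) ν (fun b => -f b) Vs) (c0 : ℝ) :
    ∃ C : ℝ, 0 ≤ C ∧ ∀ (φ : X → ℝ → ℝ) (A : ℝ), 0 ≤ A → (∀ x s, 0 < s → s ≤ c0 → |φ x s| ≤ A) →
      (∀ x s, c0 < s → φ x s = 0) →
      ∀ n : ℕ, 1 ≤ n → ∀ x y, 0 < y → |(KL P f ^ n) φ x y| ≤ C * (1 + y) * A / (n * √n) := by
  obtain ⟨C, hC, h⟩ := eight hG hV hVs
  set N0 := ⌈c0⌉₊ with hN0
  refine ⟨C * ∑ v ∈ range N0, ((v:ℝ) + 2), by positivity, fun φ A hA h1 h2 n hn x y hy => ?_⟩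
  have := h φ (fun v => if v < N0 then A else 0) (A * ∑ v ∈ range N0, ((v:ℝ) + 2))
    (fun v => by split_ifs <;> simp [hA]) (fun x s v hv1 hv2 => by
      have hs0 : 0 < s := lt_of_le_of_lt (by positivity) hv1
      by_cases hs : s ≤ c0
      · rw [if_pos]
        · exact h1 x s hs0 hs
        · exact Nat.lt_ceil.2 (hv1.trans_le hs)
      · rw [h2 x s (by linarith), abs_zero]; split_ifs <;> simp [hA]) (fun N => by
      rw [Finset.mul_sum]
      calc ∑ v ∈ range N, ((v:ℝ) + 2) * (if v < N0 then A else 0)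
          = ∑ v ∈ range N with v < N0, A * ((v:ℝ) + 2) := by
            rw [Finset.sum_filter]
            refine Finset.sum_congr rfl fun v _ => ?_
            split_ifs <;> ring
        _ ≤ _ := by
            refine Finset.sum_le_sum_of_subset_of_nonneg (fun v hv => ?_) (fun v _ _ => by positivity)
            rw [Finset.mem_filter] at hv
            exact Finset.mem_range.2 hv.2) n hn x y hy
  refine this.trans (le_of_eq ?_)
  ring

lemma UK_apply (F : X → ℝ → ℝ) (x : X) (s : ℝ) :
    (UL P f F - KL P f F) x s = ∑ x', P x x' * (if 0 < s + f x' then 0 else F x' (s + f x')) := by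
  rw [Pi.sub_apply, Pi.sub_apply, UL_apply, KL_apply, ← Finset.sum_sub_distrib]
  refine Finset.sum_congr rfl fun x' _ => ?_
  split_ifs <;> ring

lemma exists_c0 (f : X → ℝ) : ∃ c0 : ℝ, 0 < c0 ∧ ∀ x, |f x| ≤ c0 :=
  ⟨1 + ∑ x, |f x|, by positivity, fun x => by
    have := Finset.single_le_sum (f := fun x => |f x|) (fun _ _ => abs_nonneg _) (Finset.mem_univ x)
    linarith⟩

/-- Killing error in the middle block. -/
lemma kill_err (hG : Good P ν f) {V Vs : X → ℝ → ℝ} (hV : HasV P ν f V)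
    (hVs : HasV (dualK P ν) ν (fun b => -f b) Vs) :
    ∃ C : ℝ, 0 ≤ C ∧ ∀ k k' i : ℕ, 1 ≤ k → 1 ≤ k' → ∀ x y b α β, 0 < y → 0 ≤ β → α ≤ β → β ≤ α + 1 →
    |(KL P f ^ k) ((UL P f ^ i) ((LL P f ^ k') (ee P b α β))) x y -
      (KL P f ^ k) ((KL P f ^ i) ((LL P f ^ k') (ee P b α β))) x y| ≤
      C * (1 + y) * (1 + β) * √i / (k * √k * √k') := by
  obtain ⟨c0, hc0, hf⟩ := exists_c0 f
  obtain ⟨C1, hC1, h1⟩ := eight_loc hG hV hVs c0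
  obtain ⟨C2, hC2, h2⟩ := five_a hG hVs
  have hP := hG.st.nonneg
  refine ⟨2 * C1 * C2, by positivity, fun k k' i hk hk' x y b α β hy hβ hab hab1 => ?_⟩
  set G := (LL P f ^ k') (ee P b α β) with hGd
  have hsk' : 0 < √(k':ℝ) := Real.sqrt_pos.2 (by exact_mod_cast hk')
  have hGn : ∀ x s, 0 ≤ G x s := LL_pow_nonneg hP (ee_nonneg hG.st b α β) k'
  set A := C1 * C2 * (1 + y) * (1 + β) / √k' with hA
  have hA0 : 0 ≤ A := by positivity
  have key : ∀ i k : ℕ, 1 ≤ k → |(KL P f ^ k) ((UL P f ^ i) G) x y - (KL P f ^ k) ((KL P f ^ i) G) x y| ≤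
      A / (k * √k) * ∑ j ∈ range i, 1 / √((j:ℝ) + 1) := by
    intro i
    induction i with
    | zero => intro k hk; simp
    | succ i ih =>
      intro k hk
      have hk' : (1:ℝ) ≤ k := by exact_mod_cast hk
      have hsk : 0 < √(k:ℝ) := Real.sqrt_pos.2 (by linarith)
      have e1 : (KL P f ^ k) ((UL P f ^ (i + 1)) G) x y - (KL P f ^ k) ((KL P f ^ (i + 1)) G) x y =
          (KL P f ^ k) (UL P f ((UL P f ^ i) G) - KL P f ((UL P f ^ i) G)) x y +
          ((KL P f ^ (k + 1)) ((UL P f ^ i) G) x y - (KL P f ^ (k + 1)) ((KL P f ^ i) G) x y) := by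
        rw [UL_pow_succ, KL_pow_succ, KL_pow_succ', KL_pow_succ', map_sub, Pi.sub_apply, Pi.sub_apply]
        ring
      have h3 := ih (k + 1) (by omega)
      have h4 := h1 (UL P f ((UL P f ^ i) G) - KL P f ((UL P f ^ i) G))
        (C2 * (1 + β) / (√((i : ℝ) + 1) * √k')) (by positivity) (fun x s hs hsc => by
          rw [UK_apply]
          have hb : ∀ x s, |(UL P f ^ i) G x s| ≤ C2 * (1 + β) / (√((i : ℝ) + 1) * √k') := by
            intro x s
            rw [abs_of_nonneg (UL_pow_nonneg hP hGn i x s)]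
            exact h2 i k' (by assumption) x s b α β hβ hab hab1
          calc |∑ x', P x x' * (if 0 < s + f x' then 0 else (UL P f ^ i) G x' (s + f x'))|
              ≤ ∑ x', P x x' * (C2 * (1 + β) / (√((i : ℝ) + 1) * √k')) := by
                refine (Finset.abs_sum_le_sum_abs _ _).trans (Finset.sum_le_sum fun x' _ => ?_)
                rw [abs_mul, abs_of_nonneg (hP _ _)]
                refine mul_le_mul_of_nonneg_left ?_ (hP _ _)
                split_ifs
                · rw [abs_zero]; positivity
                · exact hb _ _
            _ = _ := by rw [← Finset.sum_mul, hG.st.rowSum, one_mul]) (fun x s hs => by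
          rw [UK_apply]
          refine Finset.sum_eq_zero fun x' _ => ?_
          rw [if_pos, mul_zero]
          linarith [(abs_le.1 (hf x')).1]) k hk x y hy
      rw [e1]
      refine (abs_add_le _ _).trans ?_
      rw [Finset.sum_range_succ, mul_add, add_comm]
      refine add_le_add (h3.trans ?_) (h4.trans (le_of_eq ?_))
      · refine mul_le_mul_of_nonneg_right ?_ (Finset.sum_nonneg fun j _ => by positivity)
        push_cast
        gcongr <;> linarith
      · rw [hA]; field_simp
  have hk1 : (1:ℝ) ≤ k := by exact_mod_cast hk
  have hsk : 0 < √(k:ℝ) := Real.sqrt_pos.2 (by linarith)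
  refine (key i k hk).trans ?_
  calc A / (k * √k) * ∑ j ∈ range i, 1 / √((j:ℝ) + 1) ≤ A / (k * √k) * (2 * √i) :=
        mul_le_mul_of_nonneg_left (sum_inv_sqrt i) (by positivity)
    _ = _ := by rw [hA]; field_simp

end bounds

set_option linter.unusedSectionVars false

/-- The sine test function. -/
noncomputable def sn (s : ℝ) : X → ℝ → ℝ := fun _ Y => sin (s * Y)

/-- Corrected sine function. -/
noncomputable def gG (r q : X → ℝ) (s : ℝ) : X → ℝ → ℝ := fun x Y =>
  sin (s * Y) * (1 - s ^ 2 * q x) + s * r x * cos (s * Y)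

section cs
variable [Fintype X] [DecidableEq X] [Nonempty X] {P : X → X → ℝ} {ν f : X → ℝ}

lemma KY_bound (hG : Good P ν f) : ∃ C : ℝ, 0 ≤ C ∧ ∀ (k : ℕ) x y, 0 < y →
    (KL P f ^ k) (fun _ Y => Y) x y ≤ C * (1 + y) := by
  obtain ⟨r, q, hr, -⟩ := exists_correctors hG
  obtain ⟨B, hB, hf, hr', -⟩ := exists_bound3 f r q
  have hP := hG.st.nonneg
  set H : X → ℝ → ℝ := fun x Y => Y + r x + 2 * B with hH
  have hKH : ∀ x y, 0 < y → KL P f H x y ≤ H x y := by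
    intro x y hy
    have h1 : ∑ x', P x x' * H x' (y + f x') = H x y := by
      have : ∀ x', P x x' * H x' (y + f x') = P x x' * (y + 2 * B) + P x x' * (f x' + r x') := by
        intro x'; simp only [hH]; ring
      simp only [this, Finset.sum_add_distrib, hr, ← Finset.sum_mul, hG.st.rowSum]
      simp only [hH]; ring
    rw [← h1, KL_apply]
    refine Finset.sum_le_sum fun x' _ => mul_le_mul_of_nonneg_left ?_ (hP _ _)
    split_ifs with hh
    · exact le_rfl
    · simp only [hH]
      have := (abs_le.1 (hf x')).1
      have := (abs_le.1 (hr' x')).1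
      linarith
  have hk : ∀ k x y, 0 < y → (KL P f ^ k) H x y ≤ H x y := by
    intro k
    induction k with
    | zero => intro x y _; exact le_rfl
    | succ k ih =>
      intro x y hy
      rw [KL_pow_succ']
      exact (KL_pow_mono hP hKH k x y hy).trans (ih x y hy)
  refine ⟨1 + 3 * B, by positivity, fun k x y hy => ?_⟩
  refine (KL_pow_mono hP (ψ := H) (fun x y hy => ?_) k x y hy).trans ((hk k x y hy).trans ?_)
  · simp only [hH]
    have := (abs_le.1 (hr' x)).1
    linarith
  · simp only [hH]
    have := (abs_le.1 (hr' x)).2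
    nlinarith

lemma sn_bound (hG : Good P ν f) : ∃ C : ℝ, 0 ≤ C ∧ ∀ (k : ℕ) (s : ℝ) x y, 0 < y →
    |(KL P f ^ k) (sn s) x y| ≤ |s| * (C * (1 + y)) := by
  obtain ⟨C, hC, h⟩ := KY_bound hG
  refine ⟨C, hC, fun k s x y hy => ?_⟩
  refine (KL_pow_abs_le hG.st.nonneg (ψ := |s| • (fun _ Y => Y)) (fun x y hy => ?_) k x y hy).trans ?_
  · simp only [sn, Pi.smul_apply, smul_eq_mul]
    refine (Real.abs_sin_le_abs).trans ?_
    rw [abs_mul, abs_of_pos hy]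
  · rw [map_smul, Pi.smul_apply, Pi.smul_apply, smul_eq_mul]
    exact mul_le_mul_of_nonneg_left (h k x y hy) (abs_nonneg _)

lemma gG_re (r q : X → ℝ) (s : ℝ) :
    gG r q s = fun x' (Y : ℝ) => ((-Complex.I) * Complex.exp (Complex.I * s * Y) * vv r q s x').re := by
  funext x Y
  have : Complex.I * s * Y = ((s * Y : ℝ) : ℂ) * Complex.I := by push_cast; ring
  rw [this, Complex.exp_mul_I, ← Complex.ofReal_cos, ← Complex.ofReal_sin]
  have e : vv r q s x = ((1 - s ^ 2 * q x : ℝ) : ℂ) + ((s * r x : ℝ) : ℂ) * Complex.I := by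
    unfold vv; push_cast; ring
  rw [e]
  simp only [gG, Complex.mul_re, Complex.mul_im, Complex.add_re, Complex.add_im, Complex.ofReal_re,
    Complex.ofReal_im, Complex.I_re, Complex.I_im, Complex.neg_re, Complex.neg_im]
  ring

lemma gG_taylor (hG : Good P ν f) (r q : X → ℝ)
    (hr : ∀ x, ∑ x', P x x' * (f x' + r x') = r x)
    (hq : ∀ x, ∑ x', P x x' * (f x' ^ 2 / 2 + f x' * r x' + q x') = q x + sigma2 P ν f / 2) :
    ∃ C, 0 ≤ C ∧ ∀ s : ℝ, |s| ≤ 1 → ∀ x Y,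
      |UL P f (gG r q s) x Y - exp (-(sigma2 P ν f * s ^ 2 / 2)) * gG r q s x Y| ≤ C * |s| ^ 3 := by
  obtain ⟨C, hC, h⟩ := Mop_taylor hG.st r q (sigma2 P ν f) hr hq
  refine ⟨C, hC, fun s hs x Y => ?_⟩
  have h1 := UL_pow_re (P := P) (f := f) 1 s (-Complex.I) (vv r q s) x Y
  rw [pow_one, pow_one] at h1
  rw [gG_re, h1]
  have e : (-Complex.I * Complex.exp (Complex.I * s * Y) * Mop P f s (vv r q s) x).re -
      exp (-(sigma2 P ν f * s ^ 2 / 2)) * (-Complex.I * Complex.exp (Complex.I * s * Y) * vv r q s x).re =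
      (-Complex.I * Complex.exp (Complex.I * s * Y) *
        (Mop P f s (vv r q s) - (exp (-(sigma2 P ν f * s ^ 2 / 2)) : ℂ) • vv r q s) x).re := by
    rw [← Complex.re_ofReal_mul, ← Complex.sub_re]
    congr 1
    simp only [Pi.sub_apply, Pi.smul_apply, smul_eq_mul]
    ring
  rw [e]
  refine (Complex.abs_re_le_norm _).trans ?_
  rw [norm_mul, norm_mul, norm_neg, Complex.norm_I, one_mul]
  have : Complex.I * s * Y = ((s * Y : ℝ) : ℂ) * Complex.I := by push_cast; ring
  rw [this, Complex.norm_exp_ofReal_mul_I, one_mul]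
  exact (norm_le_pi_norm _ x).trans (h s hs)

lemma K_iter (φ : X → ℝ → ℝ) (lam : ℝ) (k : ℕ) :
    (KL P f ^ k) φ = lam ^ k • φ + ∑ j ∈ range k, lam ^ (k - 1 - j) •
      (KL P f ^ j) ((UL P f φ - lam • φ) - (UL P f φ - KL P f φ)) := by
  induction k with
  | zero => simp
  | succ k ih =>
    have e1 : (KL P f ^ (k + 1)) φ = lam • (KL P f ^ k) φ +
        (KL P f ^ k) ((UL P f φ - lam • φ) - (UL P f φ - KL P f φ)) := by
      rw [KL_pow_succ', ← map_smul, ← map_add]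
      congr 1; abel
    rw [e1, ih, Finset.sum_range_succ, smul_add, Finset.smul_sum, smul_smul, ← pow_succ', add_assoc]
    congr 1
    congr 1
    · refine Finset.sum_congr rfl fun j hj => ?_
      rw [Finset.mem_range] at hj
      rw [smul_smul, ← pow_succ']
      congr 2; omega
    · simp

lemma KE (hG : Good P ν f) (j : ℕ) (x : X) (y : ℝ) :
    (KL P f ^ j) (fun x s => ∑ x', P x x' * (if 0 < s + f x' then 0 else 1)) x y =
      sv P f j x y - sv P f (j + 1) x y := by
  have e : (fun (x : X) (s : ℝ) => ∑ x', P x x' * (if 0 < s + f x' then (0:ℝ) else 1)) =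
      (fun _ _ => 1) - KL P f (fun _ _ => 1) := by
    funext x s
    rw [Pi.sub_apply, Pi.sub_apply, KL_apply]
    nth_rewrite 2 [← hG.st.rowSum x]
    rw [← Finset.sum_sub_distrib]
    refine Finset.sum_congr rfl fun x' _ => ?_
    split_ifs <;> ring
  rw [e, map_sub, ← KL_pow_succ']; rfl

lemma sinc_lim {s : ℕ → ℝ} (hs0 : ∀ n, s n ≠ 0) (hs : Tendsto s atTop (𝓝 0)) (y : ℝ) :
    Tendsto (fun n => (s n)⁻¹ * sin (s n * y)) atTop (𝓝 y) := by
  have h : ∀ n, (s n)⁻¹ * sin (s n * y) = y * Real.sinc (s n * y) := by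
    intro n
    by_cases hy : y = 0
    · simp [hy]
    · rw [Real.sinc_of_ne_zero (mul_ne_zero (hs0 n) hy)]
      have := hs0 n
      field_simp
  simp only [h]
  have h2 : Tendsto (fun n => y * Real.sinc (s n * y)) atTop (𝓝 (y * Real.sinc (0 * y))) :=
    (Real.continuous_sinc.tendsto _).comp (hs.mul_const y) |>.const_mul y
  simpa using h2

lemma gG_lim {s : ℕ → ℝ} (hs0 : ∀ n, s n ≠ 0) (hs : Tendsto s atTop (𝓝 0)) (r q : X → ℝ) (x : X) (y : ℝ) :
    Tendsto (fun n => (s n)⁻¹ * gG r q (s n) x y) atTop (𝓝 (y + r x)) := by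
  have h : ∀ n, (s n)⁻¹ * gG r q (s n) x y =
      (s n)⁻¹ * sin (s n * y) * (1 - s n ^ 2 * q x) + r x * cos (s n * y) := by
    intro n
    unfold gG
    have := hs0 n
    field_simp
  simp only [h]
  have h1 : Tendsto (fun n => 1 - s n ^ 2 * q x) atTop (𝓝 (1 - 0 ^ 2 * q x)) :=
    tendsto_const_nhds.sub ((hs.pow 2).mul_const _)
  have h2 : Tendsto (fun n => r x * cos (s n * y)) atTop (𝓝 (r x * cos (0 * y))) :=
    ((Real.continuous_cos.tendsto _).comp (hs.mul_const y)).const_mul _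
  have := ((sinc_lim hs0 hs y).mul h1).add h2
  simpa using this

lemma gG_bound {r q : X → ℝ} {B s : ℝ} (hB : 0 ≤ B) (hr : ∀ x, |r x| ≤ B) (hq : ∀ x, |q x| ≤ B)
    (hs : |s| ≤ 1) (x : X) (Y : ℝ) : |gG r q s x Y| ≤ |s| * (|Y| * (1 + B) + B) := by
  unfold gG
  have h1 : |sin (s * Y)| ≤ |s| * |Y| := by rw [← abs_mul]; exact Real.abs_sin_le_abs
  have h2 : |1 - s ^ 2 * q x| ≤ 1 + B := by
    refine (abs_sub _ _).trans ?_
    rw [abs_one, abs_mul, abs_of_nonneg (sq_nonneg s)]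
    have : s ^ 2 ≤ 1 := by rw [← sq_abs]; nlinarith [abs_nonneg s]
    nlinarith [hq x, abs_nonneg (q x)]
  have h3 : |s * r x * cos (s * Y)| ≤ |s| * B := by
    rw [abs_mul, abs_mul]
    calc |s| * |r x| * |cos (s * Y)| ≤ |s| * B * 1 := by
          gcongr
          · exact hr x
          · exact Real.abs_cos_le_one _
      _ = _ := by ring
  calc _ ≤ |sin (s * Y) * (1 - s ^ 2 * q x)| + |s * r x * cos (s * Y)| := abs_add_le _ _
    _ ≤ |s| * |Y| * (1 + B) + |s| * B := by
        rw [abs_mul]; gcongr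
    _ = _ := by ring

lemma gG_sub {r q : X → ℝ} {B s : ℝ} (hB : 0 ≤ B) (hr : ∀ x, |r x| ≤ B) (hq : ∀ x, |q x| ≤ B)
    (hs : |s| ≤ 1) (x : X) (Y : ℝ) : |sn s x Y - gG r q s x Y| ≤ |s| * (2 * B) := by
  have e : sn s x Y - gG r q s x Y = s * (s * (sin (s * Y) * q x) - r x * cos (s * Y)) := by
    unfold sn gG; ring
  rw [e, abs_mul]
  refine mul_le_mul_of_nonneg_left ?_ (abs_nonneg _)
  refine (abs_sub _ _).trans ?_
  rw [abs_mul, abs_mul, abs_mul]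
  have h1 : |s| * (|sin (s * Y)| * |q x|) ≤ 1 * (1 * B) := by
    gcongr
    · exact Real.abs_sin_le_one _
    · exact hq x
  have h2 : |r x| * |cos (s * Y)| ≤ B * 1 := by
    gcongr
    · exact hr x
    · exact Real.abs_cos_le_one _
  linarith

/-- Scaling limit of the killed operator on sines. -/
lemma cs_lim (hG : Good P ν f) {V : X → ℝ → ℝ} (hV : HasV P ν f V) : ∃ W : X → ℝ → ℝ,
    ∀ (s : ℕ → ℝ) (k : ℕ → ℕ) (T : ℝ), (∀ n, s n ≠ 0) → Tendsto s atTop (𝓝 0) → Tendsto k atTop atTop →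
      Tendsto (fun n => s n ^ 2 * k n) atTop (𝓝 T) → ∀ x y, 0 < y →
      Tendsto (fun n => (s n)⁻¹ * (KL P f ^ k n) (sn (s n)) x y) atTop
        (𝓝 (exp (-(sigma2 P ν f * T / 2)) * W x y)) := by
  obtain ⟨r, q, hr, hq⟩ := exists_correctors hG
  obtain ⟨B, hB, hfB, hrB, hqB⟩ := exists_bound3 f r q
  obtain ⟨C1, hC1, hT⟩ := gG_taylor hG r q hr hq
  obtain ⟨C2, hC2, hsv⟩ := sv_bound hG hV
  have hP := hG.st.nonneg
  have hσ : 0 < sigma2 P ν f := sigma2_pos hG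
  set σ2 := sigma2 P ν f with hσ2
  set D : ℝ → X → ℝ → ℝ := fun s => UL P f (gG r q s) - KL P f (gG r q s) with hD
  set D0 : X → ℝ → ℝ := fun x y => ∑ x', P x x' * (if 0 < y + f x' then 0 else y + f x' + r x') with hD0
  refine ⟨fun x y => y + r x - ∑' j, (KL P f ^ j) D0 x y, fun s k T hs0 hs hk hT2 x y hy => ?_⟩
  have hs1 : ∀ᶠ n in atTop, |s n| ≤ 1 := by
    have := hs.abs
    rw [abs_zero] at this
    exact (this.eventually_lt_const one_pos).mono fun n h => h.le
  set lam : ℕ → ℝ := fun n => exp (-(σ2 * s n ^ 2 / 2)) with hlam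
  have hlam1 : ∀ n, lam n ≤ 1 := fun n => by
    rw [hlam]; simp only [exp_le_one_iff]; have := sq_nonneg (s n); nlinarith
  have hlam0 : ∀ n, 0 < lam n := fun n => exp_pos _
  have hss : Tendsto (fun n => s n ^ 2) atTop (𝓝 0) := by simpa using hs.pow 2
  have hkR : Tendsto (fun n => (k n : ℝ)) atTop atTop := tendsto_natCast_atTop_atTop.comp hk
  have hlamk : Tendsto (fun n => lam n ^ k n) atTop (𝓝 (exp (-(σ2 * T / 2)))) := by
    have e : ∀ n, lam n ^ k n = exp (-(σ2 * (s n ^ 2 * k n) / 2)) := by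
      intro n; simp only [hlam]; rw [← Real.exp_nat_mul]; congr 1; ring
    simp only [e]
    exact (Real.continuous_exp.tendsto _).comp (((hT2.const_mul σ2).div_const 2).neg)
  have hlamj : ∀ j : ℕ, Tendsto (fun n => lam n ^ (k n - 1 - j)) atTop (𝓝 (exp (-(σ2 * T / 2)))) := by
    intro j
    have e : ∀ᶠ n in atTop, exp (-(σ2 * (s n ^ 2 * k n - s n ^ 2 * (1 + j)) / 2)) = lam n ^ (k n - 1 - j) := by
      filter_upwards [hk.eventually_ge_atTop (1 + j)] with n hn
      simp only [hlam]
      rw [← Real.exp_nat_mul, Nat.sub_sub, Nat.cast_sub hn]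
      congr 1; push_cast; ring
    refine Tendsto.congr' e ?_
    have : Tendsto (fun n => s n ^ 2 * k n - s n ^ 2 * (1 + j)) atTop (𝓝 (T - 0 * (1 + j))) :=
      hT2.sub (hss.mul_const _)
    rw [zero_mul, sub_zero] at this
    exact (Real.continuous_exp.tendsto _).comp (((this.const_mul σ2).div_const 2).neg)
  -- survival goes to zero
  have hsvk : Tendsto (fun n => sv P f (k n) x y) atTop (𝓝 0) := by
    have h1 : Tendsto (fun n => C2 * (1 + y) / √(k n : ℝ)) atTop (𝓝 0) :=
      tendsto_const_nhds.div_atTop (Real.tendsto_sqrt_atTop.comp hkR)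
    refine squeeze_zero' (Eventually.of_forall fun n => sv_nonneg hP _ _ _) ?_ h1
    filter_upwards [hk.eventually_ge_atTop 1] with n hn
    exact hsv (k n) hn x y hy.le
  -- first term
  have hA : Tendsto (fun n => lam n ^ k n * ((s n)⁻¹ * gG r q (s n) x y)) atTop
      (𝓝 (exp (-(σ2 * T / 2)) * (y + r x))) := hlamk.mul (gG_lim hs0 hs r q x y)
  -- second term
  have hBt : Tendsto (fun n => ∑ j ∈ range (k n), lam n ^ (k n - 1 - j) *
      ((s n)⁻¹ * (KL P f ^ j) (UL P f (gG r q (s n)) - lam n • gG r q (s n)) x y)) atTop (𝓝 0) := by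
    have hlim : Tendsto (fun n => C1 * (2 * (C2 + 1) * (1 + y)) * 2 * (|s n| * √(s n ^ 2 * k n))) atTop (𝓝 0) := by
      have h1 : Tendsto (fun n => |s n| * √(s n ^ 2 * k n)) atTop (𝓝 (|0| * √T)) :=
        hs.abs.mul ((Real.continuous_sqrt.tendsto _).comp hT2)
      rw [abs_zero, zero_mul] at h1
      simpa using h1.const_mul (C1 * (2 * (C2 + 1) * (1 + y)) * 2)
    refine squeeze_zero_norm' ?_ hlim
    filter_upwards [hs1] with n hn
    have hspos : 0 < |s n| := abs_pos.2 (hs0 n)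
    have hsvj : ∀ j : ℕ, sv P f j x y ≤ (2 * (C2 + 1) * (1 + y)) * (1 / √((j:ℝ) + 1)) := by
      intro j
      rcases Nat.eq_zero_or_pos j with rfl | hj
      · simp only [sv_zero, Nat.cast_zero, zero_add, Real.sqrt_one, div_one, mul_one]; nlinarith
      · refine (hsv j hj x y hy.le).trans ?_
        have hi' : (1:ℝ) ≤ j := by exact_mod_cast hj
        have h1 : 0 < √(j:ℝ) := Real.sqrt_pos.2 (by linarith)
        have h2 : √((j:ℝ) + 1) ≤ 2 * √(j:ℝ) := by
          rw [Real.sqrt_le_left (by positivity), mul_pow, Real.sq_sqrt (by linarith)]; linarith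
        rw [mul_one_div, div_le_div_iff₀ h1 (by positivity)]
        calc C2 * (1 + y) * √((j:ℝ) + 1) ≤ (C2 + 1) * (1 + y) * (2 * √(j:ℝ)) := by
              gcongr; linarith
          _ = _ := by ring
    have hterm : ∀ j, |lam n ^ (k n - 1 - j) *
        ((s n)⁻¹ * (KL P f ^ j) (UL P f (gG r q (s n)) - lam n • gG r q (s n)) x y)| ≤
        C1 * |s n| ^ 2 * (2 * (C2 + 1) * (1 + y)) * (1 / √((j:ℝ) + 1)) := by
      intro j
      have h1 := KL_pow_le_sv (f := f) hP (φ := UL P f (gG r q (s n)) - lam n • gG r q (s n))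
        (C := C1 * |s n| ^ 3) (fun x y _ => hT (s n) hn x y) j x y hy
      rw [abs_mul, abs_mul, abs_inv]
      have h2 : |lam n ^ (k n - 1 - j)| ≤ 1 := by
        rw [abs_of_pos (pow_pos (hlam0 n) _)]; exact pow_le_one₀ (hlam0 n).le (hlam1 n)
      calc |lam n ^ (k n - 1 - j)| * (|s n|⁻¹ *
            |(KL P f ^ j) (UL P f (gG r q (s n)) - lam n • gG r q (s n)) x y|)
          ≤ 1 * (|s n|⁻¹ * (C1 * |s n| ^ 3 * ((2 * (C2 + 1) * (1 + y)) * (1 / √((j:ℝ) + 1))))) := by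
            gcongr
            exact h1.trans (mul_le_mul_of_nonneg_left (hsvj j) (by positivity))
        _ = _ := by field_simp
    rw [Real.norm_eq_abs]
    calc _ ≤ ∑ j ∈ range (k n), C1 * |s n| ^ 2 * (2 * (C2 + 1) * (1 + y)) * (1 / √((j:ℝ) + 1)) :=
          (Finset.abs_sum_le_sum_abs _ _).trans (Finset.sum_le_sum fun j _ => hterm j)
      _ ≤ C1 * |s n| ^ 2 * (2 * (C2 + 1) * (1 + y)) * (2 * √(k n : ℝ)) := by
          rw [← Finset.mul_sum]
          exact mul_le_mul_of_nonneg_left (sum_inv_sqrt _) (by positivity)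
      _ = _ := by
          rw [Real.sqrt_mul (sq_nonneg _), Real.sqrt_sq_eq_abs]; ring
  -- third term
  have hDb : ∀ s : ℝ, s ≠ 0 → |s| ≤ 1 → ∀ j, |s⁻¹ * (KL P f ^ j) (D s) x y| ≤
      (B * (1 + B) + B) * (sv P f j x y - sv P f (j + 1) x y) := by
    intro s hs0 hs1 j
    have hspos : 0 < |s| := abs_pos.2 hs0
    have h1 := KL_pow_abs_le (f := f) hP (φ := D s)
      (ψ := (|s| * (B * (1 + B) + B)) • (fun x y => ∑ x', P x x' * (if 0 < y + f x' then (0:ℝ) else 1)))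
      (fun x y hy => by
        simp only [hD, UK_apply, Pi.smul_apply, smul_eq_mul, Finset.mul_sum]
        refine (Finset.abs_sum_le_sum_abs _ _).trans (Finset.sum_le_sum fun x' _ => ?_)
        split_ifs with hh
        · simp
        · rw [abs_mul, abs_of_nonneg (hP _ _), mul_one, mul_comm]
          refine mul_le_mul_of_nonneg_right ((gG_bound hB hrB hqB hs1 _ _).trans ?_) (hP _ _)
          have : |y + f x'| ≤ B := by
            rw [abs_le]; have := (abs_le.1 (hfB x')).1
            constructor <;> linarith
          gcongr) j x y hy
    rw [map_smul, Pi.smul_apply, Pi.smul_apply, KE hG, smul_eq_mul] at h1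
    rw [abs_mul, abs_inv]
    calc |s|⁻¹ * |(KL P f ^ j) (D s) x y| ≤ |s|⁻¹ * (|s| * (B * (1 + B) + B) *
          (sv P f j x y - sv P f (j + 1) x y)) := by gcongr
      _ = _ := by field_simp
  have hDl : ∀ j, Tendsto (fun n => (s n)⁻¹ * (KL P f ^ j) (D (s n)) x y) atTop
      (𝓝 ((KL P f ^ j) D0 x y)) := by
    intro j
    obtain ⟨S, c, hc, hS, hrep⟩ := KL_repr (f := f) hP j x y hy
    have e : ∀ n, (s n)⁻¹ * (KL P f ^ j) (D (s n)) x y =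
        ∑ p ∈ S, c p * ∑ x', P p.1 x' * (if 0 < p.2 + f x' then 0 else (s n)⁻¹ * gG r q (s n) x' (p.2 + f x')) := by
      intro n
      rw [hrep, Finset.mul_sum]
      refine Finset.sum_congr rfl fun p _ => ?_
      simp only [hD]
      rw [UK_apply, mul_left_comm, Finset.mul_sum]
      congr 1
      refine Finset.sum_congr rfl fun x' _ => ?_
      split_ifs <;> ring
    simp only [e]
    rw [hrep]
    refine tendsto_finsetSum _ fun p _ => Tendsto.const_mul _ ?_
    refine tendsto_finsetSum _ fun x' _ => Tendsto.const_mul _ ?_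
    split_ifs
    · exact tendsto_const_nhds
    · exact gG_lim hs0 hs r q x' _
  have hsum : Summable fun j => (B * (1 + B) + B) * (sv P f j x y - sv P f (j + 1) x y) := by
    refine Summable.mul_left _ ?_
    refine summable_of_sum_range_le (c := 1) (fun j => sub_nonneg.2 (sv_succ_le hP hG.st.rowSum j x y)) fun n => ?_
    rw [Finset.sum_range_sub', sv_zero]
    have := sv_nonneg (f := f) hP n x y
    linarith
  have hC : Tendsto (fun n => ∑ j ∈ range (k n), lam n ^ (k n - 1 - j) *
      ((s n)⁻¹ * (KL P f ^ j) (D (s n)) x y)) atTop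
      (𝓝 (exp (-(σ2 * T / 2)) * ∑' j, (KL P f ^ j) D0 x y)) := by
    rw [← tsum_mul_left]
    have e : ∀ n, ∑ j ∈ range (k n), lam n ^ (k n - 1 - j) * ((s n)⁻¹ * (KL P f ^ j) (D (s n)) x y) =
        ∑' j, if j < k n then lam n ^ (k n - 1 - j) * ((s n)⁻¹ * (KL P f ^ j) (D (s n)) x y) else 0 := by
      intro n
      rw [tsum_eq_sum (s := range (k n)) (fun j hj => by
        rw [Finset.mem_range] at hj; rw [if_neg hj])]
      refine Finset.sum_congr rfl fun j hj => ?_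
      rw [Finset.mem_range] at hj; rw [if_pos hj]
    simp only [e]
    refine tendsto_tsum_of_dominated_convergence hsum (fun j => ?_) ?_
    · refine ((hlamj j).mul (hDl j)).congr' ?_
      filter_upwards [hk.eventually_gt_atTop j] with n hn
      rw [if_pos hn]
    · filter_upwards [hs1] with n hn j
      have hb := hDb (s n) (hs0 n) hn j
      split_ifs
      · rw [norm_mul, Real.norm_eq_abs, Real.norm_eq_abs]
        have h2 : |lam n ^ (k n - 1 - j)| ≤ 1 := by
          rw [abs_of_pos (pow_pos (hlam0 n) _)]; exact pow_le_one₀ (hlam0 n).le (hlam1 n)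
        calc _ ≤ 1 * |(s n)⁻¹ * (KL P f ^ j) (D (s n)) x y| := by gcongr
          _ ≤ _ := by rw [one_mul]; exact hb
      · rw [norm_zero]; exact (abs_nonneg _).trans hb
  -- fourth term
  have hE : Tendsto (fun n => (s n)⁻¹ * (KL P f ^ k n) (sn (s n) - gG r q (s n)) x y) atTop (𝓝 0) := by
    have h1 : Tendsto (fun n => 2 * B * sv P f (k n) x y) atTop (𝓝 0) := by
      simpa using hsvk.const_mul (2 * B)
    refine squeeze_zero_norm' ?_ h1
    filter_upwards [hs1] with n hn
    have hspos : 0 < |s n| := abs_pos.2 (hs0 n)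
    have h2 := KL_pow_le_sv (f := f) hP (φ := sn (s n) - gG r q (s n)) (C := |s n| * (2 * B))
      (fun x y _ => gG_sub hB hrB hqB hn x y) (k n) x y hy
    rw [norm_mul, norm_inv, Real.norm_eq_abs, Real.norm_eq_abs]
    calc |s n|⁻¹ * |(KL P f ^ k n) (sn (s n) - gG r q (s n)) x y| ≤
          |s n|⁻¹ * (|s n| * (2 * B) * sv P f (k n) x y) := by gcongr
      _ = _ := by field_simp
  have hfin := ((hA.add hBt).sub hC).add hE
  have e2 : exp (-(σ2 * T / 2)) * (y + r x) + 0 - exp (-(σ2 * T / 2)) * ∑' j, (KL P f ^ j) D0 x y + 0 =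
      exp (-(σ2 * T / 2)) * (y + r x - ∑' j, (KL P f ^ j) D0 x y) := by ring
  rw [e2] at hfin
  refine hfin.congr fun n => ?_
  have h1 := congrFun (congrFun (K_iter (P := P) (f := f) (gG r q (s n)) (lam n) (k n)) x) y
  have h2 : (KL P f ^ k n) (sn (s n)) x y = (KL P f ^ k n) (sn (s n) - gG r q (s n)) x y +
      (KL P f ^ k n) (gG r q (s n)) x y := by
    rw [map_sub, Pi.sub_apply, Pi.sub_apply]; ring
  rw [h2, h1]
  simp only [map_sub (KL P f ^ _) (_ - _) (_ - _)]
  simp only [Pi.add_apply, Finset.sum_apply, Pi.smul_apply, smul_eq_mul, Pi.sub_apply, mul_sub, mul_add,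
    Finset.sum_sub_distrib, Finset.mul_sum, hD]
  have h3 : ∀ (F : ℕ → ℝ), ∑ j ∈ range (k n), (s n)⁻¹ * (lam n ^ (k n - 1 - j) * F j) =
      ∑ j ∈ range (k n), lam n ^ (k n - 1 - j) * ((s n)⁻¹ * F j) := fun F =>
    Finset.sum_congr rfl fun j _ => by ring
  rw [h3, h3]
  ring

end cs

set_option linter.unusedSectionVars false

lemma gsum {s : ℝ} (hs : 1 ≤ s) (N : ℕ) :
    ∑ v ∈ range N, ((v:ℝ) + 2) * exp (-((v:ℝ) ^ 2 / (2 * s))) ≤ 16 * s := by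
  set a : ℕ → ℝ := fun v => 16 * s / (1 + (v:ℝ) ^ 2 / (4 * s)) with ha
  have hstep : ∀ v : ℕ, ((v:ℝ) + 2) * exp (-((v:ℝ) ^ 2 / (2 * s))) ≤ a v - a (v + 1) := by
    intro v
    have hv : (0:ℝ) ≤ v := by positivity
    set w : ℝ := 1 + (v:ℝ) ^ 2 / (4 * s) with hw
    have hw1 : 1 ≤ w := by rw [hw]; linarith [show 0 ≤ (v:ℝ) ^ 2 / (4 * s) by positivity]
    set w' : ℝ := 1 + ((v + 1 : ℕ):ℝ) ^ 2 / (4 * s) with hw'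
    have hw0 : 0 < w' := by positivity
    have hww : w' ≤ 2 * w := by
      have : 2 * w - w' = (4 * s + (v:ℝ) ^ 2 - 2 * v - 1) / (4 * s) := by
        rw [hw, hw']; push_cast; field_simp; ring
      have h2 : 0 ≤ (4 * s + (v:ℝ) ^ 2 - 2 * v - 1) / (4 * s) := by
        apply div_nonneg _ (by positivity)
        nlinarith [sq_nonneg ((v:ℝ) - 1)]
      linarith
    have hd : w' - w = (2 * v + 1) / (4 * s) := by rw [hw, hw']; push_cast; field_simp; ring
    have hexp : exp (-((v:ℝ) ^ 2 / (2 * s))) ≤ 1 / w ^ 2 := by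
      have h1 : w ≤ exp ((v:ℝ) ^ 2 / (4 * s)) := by rw [hw, add_comm]; exact add_one_le_exp _
      have h2 : exp (-((v:ℝ) ^ 2 / (2 * s))) = 1 / exp ((v:ℝ) ^ 2 / (4 * s)) ^ 2 := by
        rw [← Real.exp_nat_mul, one_div, ← Real.exp_neg]; congr 1; push_cast; field_simp; ring
      rw [h2]
      gcongr
    have he : a v - a (v + 1) = 4 * (2 * v + 1) / (w * w') := by
      simp only [ha]
      rw [← hw, ← hw', div_sub_div _ _ (by positivity) (by positivity)]
      congr 1
      rw [mul_comm w, ← mul_sub, hd]; field_simp; ring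
    rw [he]
    calc ((v:ℝ) + 2) * exp (-((v:ℝ) ^ 2 / (2 * s))) ≤ (2 * (2 * v + 1)) * (1 / w ^ 2) := by
          gcongr; linarith
      _ = 4 * (2 * v + 1) / (w * (2 * w)) := by field_simp; ring
      _ ≤ _ := by gcongr
  calc _ ≤ ∑ v ∈ range N, (a v - a (v + 1)) := Finset.sum_le_sum fun v _ => hstep v
    _ = a 0 - a N := Finset.sum_range_sub' _ _
    _ ≤ a 0 := by
        have : 0 ≤ a N := by simp only [ha]; positivity
        linarith
    _ = 16 * s := by simp [ha]

/-- Smoothed sign function. -/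
noncomputable def er (δ a : ℝ) : ℝ := (1 / π) * ∫ θ : ℝ, exp (-(δ * θ ^ 2 / 2)) * (sin (θ * a) / θ)

lemma ae_ne_zero : ∀ᵐ θ : ℝ, θ ≠ 0 := compl_mem_ae_iff.2 (measure_singleton (0:ℝ))

lemma sin_div_eq (a θ : ℝ) (hθ : θ ≠ 0) : sin (θ * a) / θ = ∫ u in (0:ℝ)..a, cos (u * θ) := by
  rw [intervalIntegral.integral_comp_mul_right (fun u => cos u) hθ, integral_cos]
  simp [div_eq_inv_mul, mul_comm]

lemma sin_div_le (a θ : ℝ) : |sin (θ * a) / θ| ≤ |a| := by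
  by_cases hθ : θ = 0
  · simp [hθ]
  · rw [abs_div, div_le_iff₀ (abs_pos.2 hθ), mul_comm, ← abs_mul]
    exact Real.abs_sin_le_abs

lemma er_integrable {δ : ℝ} (hδ : 0 < δ) (a : ℝ) :
    Integrable fun θ : ℝ => exp (-(δ * θ ^ 2 / 2)) * (sin (θ * a) / θ) := by
  refine ((gauss_integrable hδ).mul_const |a|).mono' ?_ (ae_of_all _ fun θ => ?_)
  · exact Measurable.aestronglyMeasurable (by fun_prop)
  · rw [norm_mul, Real.norm_of_nonneg (exp_pos _).le]
    exact mul_le_mul_of_nonneg_left (sin_div_le a θ) (exp_pos _).le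

lemma er_eq {δ : ℝ} (hδ : 0 < δ) {a : ℝ} (ha : 0 ≤ a) : er δ a = 2 * ∫ u in Set.Ioc 0 a, pg δ u := by
  unfold er
  have h1 : ∫ θ : ℝ, exp (-(δ * θ ^ 2 / 2)) * (sin (θ * a) / θ) =
      ∫ θ : ℝ, ∫ u in Set.Ioc 0 a, exp (-(δ * θ ^ 2 / 2)) * cos (θ * u) := by
    refine integral_congr_ae ?_
    filter_upwards [ae_ne_zero] with θ hθ
    rw [sin_div_eq a θ hθ, intervalIntegral.integral_of_le ha, integral_const_mul]
    simp only [mul_comm]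
  have hintg : Integrable (Function.uncurry fun (θ u : ℝ) => exp (-(δ * θ ^ 2 / 2)) * cos (θ * u))
      (volume.prod (volume.restrict (Set.Ioc 0 a))) := by
    have h2 : Integrable (fun p : ℝ × ℝ => exp (-(δ * p.1 ^ 2 / 2)) * (1:ℝ))
        (volume.prod (volume.restrict (Set.Ioc 0 a))) :=
      Integrable.mul_prod (f := fun θ : ℝ => exp (-(δ * θ ^ 2 / 2))) (g := fun _ : ℝ => (1:ℝ)) (gauss_integrable hδ) (integrable_const _)
    refine h2.mono' (Continuous.aestronglyMeasurable (by unfold Function.uncurry; fun_prop)) (ae_of_all _ fun p => ?_)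
    simp only [Function.uncurry]
    rw [norm_mul, Real.norm_of_nonneg (exp_pos _).le]
    exact mul_le_mul_of_nonneg_left (Real.abs_cos_le_one _) (exp_pos _).le
  rw [h1, integral_integral_swap hintg]
  simp only [pg_fourier hδ]
  rw [integral_const_mul]
  field_simp

lemma pg_integrable {δ : ℝ} (hδ : 0 < δ) : Integrable (pg δ) := by
  have h := integrable_exp_neg_mul_sq (b := 1 / (2 * δ)) (by positivity)
  have e : pg δ = fun u => exp (-(1 / (2 * δ)) * u ^ 2) / √(2 * π * δ) := by
    funext u; unfold pg; congr 2; ring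
  rw [e]; exact h.div_const _

lemma pg_half {δ : ℝ} (hδ : 0 < δ) : ∫ u in Set.Ioi (0:ℝ), pg δ u = 1 / 2 := by
  have e : pg δ = fun u => exp (-(1 / (2 * δ)) * u ^ 2) / √(2 * π * δ) := by
    funext u; unfold pg; congr 2; ring
  rw [e]
  simp only [integral_div]
  rw [integral_gaussian_Ioi]
  have : π / (1 / (2 * δ)) = 2 * π * δ := by field_simp
  rw [this]
  have : 0 < √(2 * π * δ) := Real.sqrt_pos.2 (by positivity)
  field_simp

lemma er_bound {δ : ℝ} (hδ : 0 < δ) {a : ℝ} (ha : 0 ≤ a) : |1 - er δ a| ≤ exp (-(a ^ 2 / (2 * δ))) := by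
  have h1 : ∫ u in Set.Ioi (0:ℝ), pg δ u = (∫ u in Set.Ioc 0 a, pg δ u) + ∫ u in Set.Ioi a, pg δ u := by
    rw [← Set.Ioc_union_Ioi_eq_Ioi ha]
    exact setIntegral_union Set.Ioc_disjoint_Ioi_same measurableSet_Ioi
      (pg_integrable hδ).integrableOn (pg_integrable hδ).integrableOn
  rw [pg_half hδ] at h1
  have h2 : ∫ u in Set.Ioi a, pg δ u = ∫ u in Set.Ioi (0:ℝ), pg δ (u + a) := by
    rw [← integral_indicator measurableSet_Ioi, ← integral_indicator measurableSet_Ioi,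
      ← integral_add_right_eq_self _ a]
    congr 1; funext u
    simp only [Set.indicator, Set.mem_Ioi]
    by_cases hu : 0 < u
    · rw [if_pos hu, if_pos (by linarith)]
    · rw [if_neg hu, if_neg (by linarith)]
  have h3 : ∫ u in Set.Ioi (0:ℝ), pg δ (u + a) ≤ exp (-(a ^ 2 / (2 * δ))) * (1 / 2) := by
    rw [← pg_half hδ, ← integral_const_mul]
    refine setIntegral_mono_on ((pg_integrable hδ).comp_add_right a).integrableOn
      ((pg_integrable hδ).const_mul _).integrableOn measurableSet_Ioi fun u hu => ?_
    rw [Set.mem_Ioi] at hu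
    unfold pg
    rw [← mul_div_assoc, ← Real.exp_add]
    gcongr
    have e : -(a ^ 2 / (2 * δ)) + -u ^ 2 / (2 * δ) - -(u + a) ^ 2 / (2 * δ) = u * a / δ := by
      field_simp; ring
    have h0 : 0 ≤ u * a / δ := by positivity
    linarith
  have h4 : 0 ≤ ∫ u in Set.Ioi (0:ℝ), pg δ (u + a) := integral_nonneg fun u => pg_nonneg _ _
  rw [er_eq hδ ha, abs_le]
  constructor <;> linarith [exp_pos (-(a ^ 2 / (2 * δ)))]

section vw
variable [Fintype X] [DecidableEq X] [Nonempty X] {P : X → X → ℝ} {ν f : X → ℝ}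

lemma eight_gauss (hG : Good P ν f) {V Vs : X → ℝ → ℝ} (hV : HasV P ν f V)
    (hVs : HasV (dualK P ν) ν (fun b => -f b) Vs) :
    ∃ C : ℝ, 0 ≤ C ∧ ∀ (φ : X → ℝ → ℝ) (A s : ℝ), 0 ≤ A → 1 ≤ s →
      (∀ x Y, 0 < Y → |φ x Y| ≤ A * exp (-(Y ^ 2 / (2 * s)))) →
      ∀ n : ℕ, 1 ≤ n → ∀ x y, 0 < y → |(KL P f ^ n) φ x y| ≤ C * (1 + y) * A * s / (n * √n) := by
  obtain ⟨C, hC, h⟩ := eight hG hV hVs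
  refine ⟨C * 16, by positivity, fun φ A s hA hs hφ n hn x y hy => ?_⟩
  have := h φ (fun v => A * exp (-((v:ℝ) ^ 2 / (2 * s)))) (A * (16 * s)) (fun v => by positivity)
    (fun x Y v hv1 hv2 => by
      have hv : (0:ℝ) ≤ v := by positivity
      refine (hφ x Y (by linarith)).trans ?_
      gcongr) (fun N => by
      have h2 := mul_le_mul_of_nonneg_left (gsum hs N) hA
      rw [Finset.mul_sum] at h2
      refine le_trans (le_of_eq ?_) h2
      exact Finset.sum_congr rfl fun v _ => by ring) n hn x y hy
  refine this.trans (le_of_eq (by ring))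

lemma V_eq_aux (hG : Good P ν f) {V Vs : X → ℝ → ℝ} (hV : HasV P ν f V)
    (hVs : HasV (dualK P ν) ν (fun b => -f b) Vs) (W : X → ℝ → ℝ)
    (hW : ∀ (s : ℕ → ℝ) (k : ℕ → ℕ) (T : ℝ), (∀ n, s n ≠ 0) → Tendsto s atTop (𝓝 0) → Tendsto k atTop atTop →
      Tendsto (fun n => s n ^ 2 * k n) atTop (𝓝 T) → ∀ x y, 0 < y →
      Tendsto (fun n => (s n)⁻¹ * (KL P f ^ k n) (sn (s n)) x y) atTop
        (𝓝 (exp (-(sigma2 P ν f * T / 2)) * W x y))) (x : X) (y : ℝ) (hy : 0 < y) : V x y = W x y := by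
  obtain ⟨C, hC, hg⟩ := eight_gauss hG hV hVs
  obtain ⟨C2, hC2, hsn⟩ := sn_bound hG
  have hP := hG.st.nonneg
  have hσ : 0 < sigma2 P ν f := sigma2_pos hG
  set σ2 := sigma2 P ν f with hσ2
  set κ := √σ2 * √(2 * π) / 2 with hκ
  have hκ0 : 0 < κ := kap_pos hG
  have hsq : ∀ n : ℕ, 0 < √((n + 1 : ℕ) : ℝ) := fun n => Real.sqrt_pos.2 (by positivity)
  have hsqt : Tendsto (fun n : ℕ => √((n + 1 : ℕ) : ℝ)) atTop atTop :=
    Real.tendsto_sqrt_atTop.comp (tendsto_natCast_atTop_atTop.comp (tendsto_add_atTop_nat 1))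
  have hVl : Tendsto (fun n : ℕ => √((n + 1 : ℕ) : ℝ) * sv P f (n + 1) x y) atTop (𝓝 (V x y / κ)) := by
    have h1 := ((hV x y).comp (tendsto_add_atTop_nat 1)).div_const κ
    refine h1.congr fun n => ?_
    simp only [Function.comp]
    rw [sqrt_const, ← hσ2, ← hκ, mul_assoc, mul_div_cancel_left₀ _ hκ0.ne']
  -- the smoothed limit
  have hE : ∀ δ : ℝ, 0 < δ → Tendsto (fun n : ℕ => √((n + 1 : ℕ) : ℝ) *
      (KL P f ^ (n + 1)) (fun _ Y => er δ (Y / √((n + 1 : ℕ) : ℝ))) x y) atTop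
      (𝓝 ((1 / π) * (√(2 * π / (σ2 + δ)) * W x y))) := by
    intro δ hδ
    have e1 : ∀ n : ℕ, Integrable (fun θ : ℝ => exp (-(δ * θ ^ 2 / 2)) * ((θ / √((n + 1 : ℕ) : ℝ))⁻¹ *
          (KL P f ^ (n + 1)) (sn (θ / √((n + 1 : ℕ) : ℝ))) x y)) ∧ √((n + 1 : ℕ) : ℝ) *
      (KL P f ^ (n + 1)) (fun _ Y => er δ (Y / √((n + 1 : ℕ) : ℝ))) x y =
        (1 / π) * ∫ θ : ℝ, exp (-(δ * θ ^ 2 / 2)) * ((θ / √((n + 1 : ℕ) : ℝ))⁻¹ *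
          (KL P f ^ (n + 1)) (sn (θ / √((n + 1 : ℕ) : ℝ))) x y) := by
      intro n
      set R := √((n + 1 : ℕ) : ℝ) with hR
      have hR0 : 0 < R := hsq n
      have h1 := KL_pow_integral (f := f) (μ := volume) hP (n + 1) x y hy
        (fun θ _ Y => exp (-(δ * θ ^ 2 / 2)) * (sin (θ * (Y / R)) / θ))
        (fun x s _ => er_integrable hδ (s / R))
      have e2 : ∀ θ : ℝ, (KL P f ^ (n + 1)) (fun _ Y => exp (-(δ * θ ^ 2 / 2)) * (sin (θ * (Y / R)) / θ)) x y =
          R⁻¹ * (exp (-(δ * θ ^ 2 / 2)) * ((θ / R)⁻¹ * (KL P f ^ (n + 1)) (sn (θ / R)) x y)) := by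
        intro θ
        have e3 : (fun (_ : X) Y => exp (-(δ * θ ^ 2 / 2)) * (sin (θ * (Y / R)) / θ)) =
            (R⁻¹ * (exp (-(δ * θ ^ 2 / 2)) * (θ / R)⁻¹)) • sn (θ / R) := by
          funext _ Y
          simp only [sn, Pi.smul_apply, smul_eq_mul, inv_div]
          have : θ * (Y / R) = θ / R * Y := by ring
          rw [this]; field_simp
        rw [e3, map_smul, Pi.smul_apply, Pi.smul_apply, smul_eq_mul]; ring
      simp only [e2] at h1
      constructor
      · have := h1.1.const_mul R
        refine this.congr (ae_of_all _ fun θ => ?_)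
        simp only
        rw [← mul_assoc, mul_inv_cancel₀ hR0.ne', one_mul]
      · have e4 : (fun (_ : X) Y => er δ (Y / R)) = (1 / π) • (fun (_ : X) (Y : ℝ) =>
            ∫ θ : ℝ, exp (-(δ * θ ^ 2 / 2)) * (sin (θ * (Y / R)) / θ)) := by
          funext _ Y; rfl
        rw [e4, map_smul, Pi.smul_apply, Pi.smul_apply, smul_eq_mul, h1.2, integral_const_mul]
        field_simp
    have e5 : ∀ n : ℕ, √((n + 1 : ℕ) : ℝ) *
      (KL P f ^ (n + 1)) (fun _ Y => er δ (Y / √((n + 1 : ℕ) : ℝ))) x y =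
        (1 / π) * ∫ θ : ℝ, exp (-(δ * θ ^ 2 / 2)) * ((θ / √((n + 1 : ℕ) : ℝ))⁻¹ *
          (KL P f ^ (n + 1)) (sn (θ / √((n + 1 : ℕ) : ℝ))) x y) := fun n => (e1 n).2
    simp only [e5]
    refine Tendsto.const_mul _ ?_
    have e6 : √(2 * π / (σ2 + δ)) * W x y =
        ∫ θ : ℝ, exp (-(δ * θ ^ 2 / 2)) * (exp (-(σ2 * θ ^ 2 / 2)) * W x y) := by
      have : ∀ θ : ℝ, exp (-(δ * θ ^ 2 / 2)) * (exp (-(σ2 * θ ^ 2 / 2)) * W x y) =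
          exp (-((σ2 + δ) / 2) * θ ^ 2) * W x y := by
        intro θ; rw [← mul_assoc, ← Real.exp_add]; congr 2; ring
      simp only [this]
      rw [integral_mul_const, integral_gaussian]
      congr 2; field_simp
    rw [e6]
    refine tendsto_integral_of_dominated_convergence
      (fun θ => exp (-(δ * θ ^ 2 / 2)) * (C2 * (1 + y))) (fun n => (e1 n).1.aestronglyMeasurable)
      ((gauss_integrable hδ).mul_const _) (fun n => ae_of_all _ fun θ => ?_) ?_
    · rw [norm_mul, Real.norm_of_nonneg (exp_pos _).le]
      refine mul_le_mul_of_nonneg_left ?_ (exp_pos _).le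
      rw [norm_mul, norm_inv, Real.norm_eq_abs, Real.norm_eq_abs]
      have h2 := hsn (n + 1) (θ / √((n + 1 : ℕ) : ℝ)) x y hy
      by_cases h0 : |θ / √((n + 1 : ℕ) : ℝ)| = 0
      · rw [h0]; simp; positivity
      · rw [inv_mul_le_iff₀ (lt_of_le_of_ne (abs_nonneg _) (Ne.symm h0))]; exact h2
    · filter_upwards [ae_ne_zero] with θ hθ
      refine Tendsto.const_mul _ ?_
      refine hW (fun n => θ / √((n + 1 : ℕ) : ℝ)) (fun n => n + 1) (θ ^ 2)
        (fun n => div_ne_zero hθ (hsq n).ne') (tendsto_const_nhds.div_atTop hsqt) (tendsto_add_atTop_nat 1) ?_ x y hy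
      refine tendsto_const_nhds.congr fun n => ?_
      rw [div_pow, Real.sq_sqrt (by positivity)]
      field_simp
  -- comparison
  have hcmp : ∀ δ : ℝ, 0 < δ → |V x y / κ - (1 / π) * (√(2 * π / (σ2 + δ)) * W x y)| ≤ C * (1 + y) * δ := by
    intro δ hδ
    refine le_of_tendsto (hVl.sub (hE δ hδ)).abs ?_
    obtain ⟨N, hN⟩ := exists_nat_ge (1 / δ)
    filter_upwards [eventually_ge_atTop N] with n hn
    set R := √((n + 1 : ℕ) : ℝ) with hR
    have hR0 : 0 < R := hsq n
    have hR2 : R ^ 2 = ((n + 1 : ℕ) : ℝ) := Real.sq_sqrt (by positivity)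
    have hge : 1 ≤ δ * ((n + 1 : ℕ) : ℝ) := by
      have h1 : 1 / δ ≤ ((n + 1 : ℕ) : ℝ) := hN.trans (by exact_mod_cast (by omega : N ≤ n + 1))
      rwa [div_le_iff₀ hδ, mul_comm] at h1
    have h1 := hg ((fun _ _ => 1) - fun _ Y => er δ (Y / R)) 1 (δ * ((n + 1 : ℕ) : ℝ)) zero_le_one hge
      (fun x Y hY => by
        rw [one_mul]
        have := er_bound hδ (a := Y / R) (by positivity)
        rw [div_pow, hR2] at this
        refine this.trans (le_of_eq ?_)
        congr 2; field_simp) (n + 1) (by omega) x y hy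
    rw [map_sub, Pi.sub_apply, Pi.sub_apply] at h1
    rw [← mul_sub, abs_mul, abs_of_pos hR0]
    calc R * |sv P f (n + 1) x y - (KL P f ^ (n + 1)) (fun _ Y => er δ (Y / R)) x y|
        ≤ R * (C * (1 + y) * 1 * (δ * ((n + 1 : ℕ) : ℝ)) / (((n + 1 : ℕ) : ℝ) * R)) :=
          mul_le_mul_of_nonneg_left h1 hR0.le
      _ = _ := by field_simp
  have hl1 : Tendsto (fun δ : ℝ => (1 / π) * (√(2 * π / (σ2 + δ)) * W x y)) (𝓝[>] 0)
      (𝓝 ((1 / π) * (√(2 * π / (σ2 + 0)) * W x y))) := by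
    refine Tendsto.const_mul _ (Tendsto.mul_const _ ?_)
    refine (Real.continuous_sqrt.tendsto _).comp ?_
    refine Tendsto.div tendsto_const_nhds ?_ (by linarith)
    exact tendsto_const_nhds.add (tendsto_id.mono_left nhdsWithin_le_nhds)
  have hl2 : Tendsto (fun δ : ℝ => (1 / π) * (√(2 * π / (σ2 + δ)) * W x y)) (𝓝[>] 0) (𝓝 (V x y / κ)) := by
    rw [tendsto_iff_norm_sub_tendsto_zero]
    have h0 : Tendsto (fun δ : ℝ => C * (1 + y) * δ) (𝓝[>] 0) (𝓝 0) := by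
      have : Tendsto (fun δ : ℝ => C * (1 + y) * δ) (𝓝[>] 0) (𝓝 (C * (1 + y) * 0)) :=
        (tendsto_id.mono_left nhdsWithin_le_nhds).const_mul _
      simpa using this
    refine squeeze_zero' (Eventually.of_forall fun _ => norm_nonneg _) ?_ h0
    filter_upwards [self_mem_nhdsWithin] with δ hδ
    rw [norm_sub_rev]; exact hcmp δ hδ
  have heq := tendsto_nhds_unique hl2 hl1
  rw [add_zero, div_eq_iff hκ0.ne', Real.sqrt_div (by positivity)] at heq
  rw [heq, hκ]
  have h1 : √σ2 ≠ 0 := (Real.sqrt_pos.2 hσ).ne'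
  have h2 : √(2 * π) * √(2 * π) = 2 * π := Real.mul_self_sqrt (by positivity)
  field_simp
  rw [pow_two, Real.mul_self_sqrt (by positivity)]

/-- Scaling limit with the harmonic function `V`. -/
lemma cs_V (hG : Good P ν f) {V Vs : X → ℝ → ℝ} (hV : HasV P ν f V)
    (hVs : HasV (dualK P ν) ν (fun b => -f b) Vs)
    (s : ℕ → ℝ) (k : ℕ → ℕ) (T : ℝ) (hs0 : ∀ n, s n ≠ 0) (hs : Tendsto s atTop (𝓝 0))
    (hk : Tendsto k atTop atTop)
    (hT : Tendsto (fun n => s n ^ 2 * k n) atTop (𝓝 T)) (x : X) (y : ℝ) (hy : 0 < y) :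
      Tendsto (fun n => (s n)⁻¹ * (KL P f ^ k n) (sn (s n)) x y) atTop
        (𝓝 (exp (-(sigma2 P ν f * T / 2)) * V x y)) := by
  obtain ⟨W, hW⟩ := cs_lim hG hV
  rw [V_eq_aux hG hV hVs W hW x y hy]
  exact hW s k T hs0 hs hk hT x y hy

end vw

set_option linter.unusedSectionVars false

lemma gauss_second {a : ℝ} (ha : 0 < a) :
    ∫ t : ℝ, t ^ 2 * exp (-(a * t ^ 2 / 2)) = √(2 * π) / √a ^ 3 := by
  have h0 : ∀ t : ℝ, t ^ 2 * exp (-(a * t ^ 2 / 2)) = (fun u : ℝ => u ^ 2 * exp (-(a * u ^ 2 / 2))) |t| := by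
    intro t; simp only [sq_abs]
  have h1 : ∫ t : ℝ, t ^ 2 * exp (-(a * t ^ 2 / 2)) =
      2 * ∫ t in Set.Ioi (0:ℝ), t ^ 2 * exp (-(a * t ^ 2 / 2)) := by
    rw [← integral_comp_abs (f := fun u : ℝ => u ^ 2 * exp (-(a * u ^ 2 / 2)))]
    exact integral_congr_ae (Eventually.of_forall h0)
  have h2 : ∫ t in Set.Ioi (0:ℝ), t ^ 2 * exp (-(a * t ^ 2 / 2)) =
      ∫ t in Set.Ioi (0:ℝ), t ^ (2:ℝ) * exp (-(a / 2) * t ^ (2:ℝ)) := by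
    refine integral_congr_ae (Eventually.of_forall fun t => ?_)
    simp only [Real.rpow_two]
    congr 2; ring
  rw [h1, h2, integral_rpow_mul_exp_neg_mul_rpow (by norm_num) (by norm_num) (by positivity)]
  have h3 : ((2:ℝ) + 1) / 2 = 1 / 2 + 1 := by norm_num
  rw [h3, Real.Gamma_add_one (by norm_num), Real.Gamma_one_half_eq]
  have h4 : (a / 2) ^ (-((2:ℝ) + 1) / 2) = (√(a / 2) ^ 3)⁻¹ := by
    rw [Real.sqrt_eq_rpow, ← Real.rpow_natCast, ← Real.rpow_mul (by positivity), ← Real.rpow_neg (by positivity)]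
    norm_num
  rw [h4, Real.sqrt_div ha.le, Real.sqrt_mul (by norm_num)]
  have h5 : √2 * √2 = 2 := Real.mul_self_sqrt (by norm_num)
  have h6 : 0 < √a := Real.sqrt_pos.2 ha
  field_simp
  rw [show √2 ^ 2 = 2 by rw [pow_two, h5]]

lemma gauss_second_integrable {a : ℝ} (ha : 0 < a) :
    Integrable fun t : ℝ => t ^ 2 * exp (-(a * t ^ 2 / 2)) := by
  have := integrable_rpow_mul_exp_neg_mul_sq (b := a / 2) (by positivity) (s := 2) (by norm_num)
  refine this.congr (Eventually.of_forall fun t => ?_)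
  simp only [Real.rpow_two]
  congr 2; ring

lemma refl_fourier {v : ℝ} (hv : 0 < v) (z w : ℝ) :
    Integrable (fun θ : ℝ => exp (-(v * θ ^ 2 / 2)) * (sin (θ * z) * sin (θ * w))) ∧
    pg v (z - w) - pg v (z + w) = (1 / π) * ∫ θ : ℝ, exp (-(v * θ ^ 2 / 2)) * (sin (θ * z) * sin (θ * w)) := by
  have e : (fun θ : ℝ => exp (-(v * θ ^ 2 / 2)) * (sin (θ * z) * sin (θ * w))) =
      fun θ : ℝ => (1 / 2) * (exp (-(v * θ ^ 2 / 2)) * cos (θ * (z - w)) -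
        exp (-(v * θ ^ 2 / 2)) * cos (θ * (z + w))) := by
    funext θ
    rw [mul_sub θ, mul_add θ, cos_sub, cos_add]; ring
  have i1 := gauss_cos_integrable hv (z - w)
  have i2 := gauss_cos_integrable hv (z + w)
  rw [e]
  refine ⟨(i1.sub i2).const_mul _, ?_⟩
  rw [integral_const_mul, integral_sub i1 i2, pg_fourier hv, pg_fourier hv]
  field_simp

lemma pg_refl_le {v : ℝ} (hv : 0 < v) {z w : ℝ} (hz : 0 < z) (hw : 0 < w) :
    |pg v (z + w)| ≤ (1 / √(2 * π * v) * exp (-(w ^ 2 / (2 * v)))) * exp (-(z ^ 2 / (2 * v))) := by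
  rw [abs_of_nonneg (pg_nonneg _ _), mul_assoc, ← Real.exp_add]
  unfold pg
  rw [div_mul_eq_mul_div, one_mul]
  gcongr
  have e : -(w ^ 2 / (2 * v)) + -(z ^ 2 / (2 * v)) - -(z + w) ^ 2 / (2 * v) = z * w / v := by
    field_simp; ring
  have : 0 ≤ z * w / v := by positivity
  linarith

lemma split_seq {ρ : ℝ} (h0 : 0 < ρ) (h1 : ρ < 1 / 2) : ∃ k i : ℕ → ℕ, (∀ n, 2 * k n + i n = n) ∧
    Tendsto (fun n : ℕ => (k n : ℝ) / n) atTop (𝓝 ρ) ∧ Tendsto (fun n : ℕ => (i n : ℝ) / n) atTop (𝓝 (1 - 2 * ρ)) ∧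
    Tendsto k atTop atTop ∧ Tendsto i atTop atTop := by
  have hle : ∀ n : ℕ, 2 * ⌊ρ * (n:ℝ)⌋₊ ≤ n := by
    intro n
    have := Nat.floor_le (show 0 ≤ ρ * (n:ℝ) by positivity)
    have hn : (0:ℝ) ≤ n := by positivity
    have : (2 : ℝ) * ⌊ρ * (n:ℝ)⌋₊ ≤ n := by nlinarith
    exact_mod_cast this
  have hk := (tendsto_nat_floor_mul_div_atTop h0.le).comp (tendsto_natCast_atTop_atTop (R := ℝ))
  have hi : Tendsto (fun n : ℕ => ((n - 2 * ⌊ρ * (n:ℝ)⌋₊ : ℕ) : ℝ) / n) atTop (𝓝 (1 - 2 * ρ)) := by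
    have := (tendsto_const_nhds (x := (1:ℝ))).sub (hk.const_mul 2)
    refine this.congr' ?_
    filter_upwards [eventually_ge_atTop 1] with n hn
    have hn : (0:ℝ) < n := by exact_mod_cast hn
    rw [Nat.cast_sub (hle n)]
    simp only [Function.comp]
    push_cast
    field_simp
  have aux : ∀ (u : ℕ → ℕ) (c : ℝ), 0 < c → Tendsto (fun n : ℕ => (u n : ℝ) / n) atTop (𝓝 c) → Tendsto u atTop atTop := by
    intro u c hc hu
    rw [← tendsto_natCast_atTop_iff (R := ℝ)]
    refine (hu.pos_mul_atTop hc (tendsto_natCast_atTop_atTop (R := ℝ))).congr' ?_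
    filter_upwards [eventually_ge_atTop 1] with n hn
    have hn : (0:ℝ) < n := by exact_mod_cast hn
    field_simp
  refine ⟨fun n => ⌊ρ * (n:ℝ)⌋₊, fun n => n - 2 * ⌊ρ * (n:ℝ)⌋₊, fun n => ?_, hk, hi, aux _ _ h0 hk, aux _ _ (by linarith) hi⟩
  have := hle n
  show 2 * ⌊ρ * (n:ℝ)⌋₊ + (n - 2 * ⌊ρ * (n:ℝ)⌋₊) = n
  omega

section main
variable [Fintype X] [DecidableEq X] [Nonempty X] {P : X → X → ℝ} {ν f : X → ℝ}

lemma dual_dual (hS : IsStochastic P ν) : dualK (dualK P ν) ν = P := by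
  funext x y
  unfold dualK
  have h1 := (hS.nuPos x).ne'
  have h2 := (hS.nuPos y).ne'
  field_simp

lemma HasV_dd (hS : IsStochastic P ν) {V : X → ℝ → ℝ} (hV : HasV P ν f V) :
    HasV (dualK (dualK P ν) ν) ν (fun b => -(fun b => -f b) b) V := by
  rw [dual_dual hS]
  simpa using hV

/-- double killed expectation of a two variable kernel -/
noncomputable def dbl (P : X → X → ℝ) (ν f : X → ℝ) (k : ℕ) (R : ℝ → ℝ → ℝ) (x : X) (y : ℝ) (b : X) (z : ℝ) : ℝ :=
  (KL P f ^ k) (fun _ w => (KL (dualK P ν) (fun b => -f b) ^ k) (fun _ z' => R z' w) b z) x y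

lemma dbl_add (k : ℕ) (R R' : ℝ → ℝ → ℝ) (x : X) (y : ℝ) (b : X) (z : ℝ) :
    dbl P ν f k (fun a c => R a c + R' a c) x y b z = dbl P ν f k R x y b z + dbl P ν f k R' x y b z := by
  unfold dbl
  have : ∀ w, (KL (dualK P ν) (fun b => -f b) ^ k) (fun _ z' => R z' w + R' z' w) b z =
      (KL (dualK P ν) (fun b => -f b) ^ k) (fun _ z' => R z' w) b z +
      (KL (dualK P ν) (fun b => -f b) ^ k) (fun _ z' => R' z' w) b z := by
    intro w
    have := congrFun (congrFun (map_add (KL (dualK P ν) (fun b => -f b) ^ k)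
      (fun (_ : X) z' => R z' w) (fun _ z' => R' z' w)) b) z
    exact this
  simp only [this]
  exact congrFun (congrFun (map_add (KL P f ^ k)
      (fun (_ : X) w => (KL (dualK P ν) (fun b => -f b) ^ k) (fun _ z' => R z' w) b z) (fun _ w => 
      (KL (dualK P ν) (fun b => -f b) ^ k) (fun _ z' => R' z' w) b z)) x) y

lemma KL_pow_cmul (k : ℕ) (c : ℝ) (φ : X → ℝ → ℝ) (x : X) (y : ℝ) :
    (KL P f ^ k) (fun x s => c * φ x s) x y = c * (KL P f ^ k) φ x y :=
  congrFun (congrFun (map_smul (KL P f ^ k) c φ) x) y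

lemma dbl_refl (hG : Good P ν f) (k : ℕ) {v : ℝ} (hv : 0 < v) (x : X) {y : ℝ} (hy : 0 < y) (b : X) {z : ℝ} (hz : 0 < z) :
    dbl P ν f k (fun a c => pg v (a - c) - pg v (a + c)) x y b z =
      (1 / π) * ∫ θ : ℝ, exp (-(v * θ ^ 2 / 2)) *
        ((KL (dualK P ν) (fun b => -f b) ^ k) (sn θ) b z * (KL P f ^ k) (sn θ) x y) := by
  unfold dbl
  have hQ := (dual_st hG.st).nonneg
  have h1 : ∀ w, (KL (dualK P ν) (fun b => -f b) ^ k) (fun _ z' => pg v (z' - w) - pg v (z' + w)) b z =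
      (1 / π) * ∫ θ : ℝ, exp (-(v * θ ^ 2 / 2)) * sin (θ * w) * (KL (dualK P ν) (fun b => -f b) ^ k) (sn θ) b z := by
    intro w
    have e : (fun (_ : X) z' => pg v (z' - w) - pg v (z' + w)) = fun (_ : X) z' =>
        (1 / π) * ∫ θ : ℝ, exp (-(v * θ ^ 2 / 2)) * sin (θ * w) * sn θ b z' := by
      funext _ z'
      rw [(refl_fourier hv z' w).2]
      congr 2; funext θ; unfold sn; ring
    rw [e, KL_pow_cmul]
    congr 1
    have := (KL_pow_integral (μ := volume) (f := fun b => -f b) hQ k b z hz (fun (θ : ℝ) (_ : X) z' => exp (-(v * θ ^ 2 / 2)) * sin (θ * w) * sn θ b z')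
      (fun _ s _ => by
        refine (refl_fourier hv s w).1.congr (Eventually.of_forall fun θ => ?_)
        simp only [sn]; ring)).2
    rw [this]
    congr 1; funext θ
    exact KL_pow_cmul (P := dualK P ν) (f := fun b => -f b) k _ (sn θ) b z
  have hintg : ∀ w : ℝ, 0 < w → Integrable (fun θ : ℝ => exp (-(v * θ ^ 2 / 2)) * sin (θ * w) * (KL (dualK P ν) (fun b => -f b) ^ k) (sn θ) b z) := by
    intro w hw
    have := (KL_pow_integral (μ := volume) (f := fun b => -f b) hQ k b z hz (fun (θ : ℝ) (_ : X) z' => exp (-(v * θ ^ 2 / 2)) * sin (θ * w) * sn θ b z')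
      (fun _ s _ => by
        refine (refl_fourier hv s w).1.congr (Eventually.of_forall fun θ => ?_)
        simp only [sn]; ring)).1
    refine this.congr (Eventually.of_forall fun θ => ?_)
    exact KL_pow_cmul (P := dualK P ν) (f := fun b => -f b) k _ (sn θ) b z
  simp only [h1]
  rw [KL_pow_cmul]
  congr 1
  have := (KL_pow_integral (μ := volume) (f := f) hG.st.nonneg k x y hy (fun (θ : ℝ) (_ : X) w =>
    exp (-(v * θ ^ 2 / 2)) * sin (θ * w) * (KL (dualK P ν) (fun b => -f b) ^ k) (sn θ) b z) (fun _ s hs => hintg s hs)).2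
  rw [this]
  congr 1; funext θ
  rw [← mul_assoc, ← KL_pow_cmul]
  refine congrFun (congrFun (congrArg _ ?_) x) y
  funext _ w; unfold sn; ring

lemma dbl_refl_scale (hG : Good P ν f) (k : ℕ) {v : ℝ} (hv : 0 < v) (x : X) {y : ℝ} (hy : 0 < y) (b : X) {z : ℝ} (hz : 0 < z)
    {R : ℝ} (hR : 0 < R) :
    R ^ 3 * dbl P ν f k (fun a c => pg v (a - c) - pg v (a + c)) x y b z =
      (1 / π) * ∫ t : ℝ, exp (-(v / R ^ 2 * t ^ 2 / 2)) *
        (R * (KL (dualK P ν) (fun b => -f b) ^ k) (sn (t / R)) b z * (R * (KL P f ^ k) (sn (t / R)) x y)) := by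
  rw [dbl_refl hG k hv x hy b hz]
  have := Measure.integral_comp_div (fun θ : ℝ => exp (-(v * θ ^ 2 / 2)) *
        ((KL (dualK P ν) (fun b => -f b) ^ k) (sn θ) b z * (KL P f ^ k) (sn θ) x y)) R
  rw [abs_of_pos hR, smul_eq_mul] at this
  calc _ = (1 / π) * (R ^ 2 * (R * ∫ θ : ℝ, exp (-(v * θ ^ 2 / 2)) *
        ((KL (dualK P ν) (fun b => -f b) ^ k) (sn θ) b z * (KL P f ^ k) (sn θ) x y))) := by ring
    _ = _ := by
      rw [← this, ← integral_const_mul]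
      congr 2; funext t
      rw [show v / R ^ 2 * t ^ 2 / 2 = v * (t / R) ^ 2 / 2 by field_simp]
      ring

end main

set_option linter.unusedSectionVars false

section mainb
variable [Fintype X] [DecidableEq X] [Nonempty X] {P : X → X → ℝ} {ν f : X → ℝ}

lemma sn_cont (hP : ∀ x x', 0 ≤ P x x') (k : ℕ) (x : X) {y : ℝ} (hy : 0 < y) :
    Continuous fun s : ℝ => (KL P f ^ k) (sn s) x y := by
  obtain ⟨S, c, -, -, h⟩ := KL_repr (f := f) hP k x y hy
  simp only [h, sn]
  refine continuous_finsetSum _ fun p _ => ?_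
  fun_prop

/-- integrand after rescaling -/
noncomputable def FF (P : X → X → ℝ) (ν f : X → ℝ) (k : ℕ) (a R : ℝ) (x : X) (y : ℝ) (b : X) (z t : ℝ) : ℝ :=
  exp (-(a * t ^ 2 / 2)) *
        (R * (KL (dualK P ν) (fun b => -f b) ^ k) (sn (t / R)) b z * (R * (KL P f ^ k) (sn (t / R)) x y))

lemma FF_cont (hG : Good P ν f) (k : ℕ) (a R : ℝ) (x : X) {y : ℝ} (hy : 0 < y) (b : X) {z : ℝ} (hz : 0 < z) :
    Continuous (FF P ν f k a R x y b z) := by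
  unfold FF
  have h1 := (sn_cont (f := f) hG.st.nonneg k x hy).comp (continuous_id.div_const R)
  have h2 := (sn_cont (f := fun b => -f b) (dual_st hG.st).nonneg k b hz).comp (continuous_id.div_const R)
  refine Continuous.mul ?_ ((continuous_const.mul h2).mul (continuous_const.mul h1))
  fun_prop

lemma FF_bound (hG : Good P ν f) : ∃ C : ℝ, 0 ≤ C ∧ ∀ (k : ℕ) (a c R : ℝ) (x : X) (y : ℝ) (b : X) (z t : ℝ),
    0 < R → c ≤ a → 0 < y → 0 < z →
    ‖FF P ν f k a R x y b z t‖ ≤ C * (1 + y) * (1 + z) * (t ^ 2 * exp (-(c * t ^ 2 / 2))) := by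
  obtain ⟨C1, hC1, h1⟩ := sn_bound hG
  obtain ⟨C2, hC2, h2⟩ := sn_bound (dual_good hG)
  refine ⟨C1 * C2, by positivity, fun k a c R x y b z t hR hca hy hz => ?_⟩
  have e1 := h1 k (t / R) x y hy
  have e2 := h2 k (t / R) b z hz
  rw [abs_div, abs_of_pos hR] at e1 e2
  unfold FF
  rw [Real.norm_eq_abs, abs_mul, abs_mul, abs_mul, abs_mul, abs_of_pos hR, abs_of_pos (exp_pos _)]
  have e1' : R * |(KL P f ^ k) (sn (t / R)) x y| ≤ |t| * (C1 * (1 + y)) := by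
    calc _ ≤ R * (|t| / R * (C1 * (1 + y))) := mul_le_mul_of_nonneg_left e1 hR.le
      _ = _ := by field_simp
  have e2' : R * |(KL (dualK P ν) (fun b => -f b) ^ k) (sn (t / R)) b z| ≤ |t| * (C2 * (1 + z)) := by
    calc _ ≤ R * (|t| / R * (C2 * (1 + z))) := mul_le_mul_of_nonneg_left e2 hR.le
      _ = _ := by field_simp
  have e3 : exp (-(a * t ^ 2 / 2)) ≤ exp (-(c * t ^ 2 / 2)) := by
    gcongr
  calc _ ≤ exp (-(c * t ^ 2 / 2)) * ((|t| * (C2 * (1 + z))) * (|t| * (C1 * (1 + y)))) := by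
        gcongr
    _ = C1 * C2 * (1 + y) * (1 + z) * (|t| ^ 2 * exp (-(c * t ^ 2 / 2))) := by ring
    _ = _ := by rw [sq_abs]

lemma snV (hG : Good P ν f) {V Vs : X → ℝ → ℝ} (hV : HasV P ν f V)
    (hVs : HasV (dualK P ν) ν (fun b => -f b) Vs) {k : ℕ → ℕ} {ρ : ℝ}
    (hk : Tendsto k atTop atTop) (hkn : Tendsto (fun n : ℕ => (k n : ℝ) / n) atTop (𝓝 ρ)) (x : X) {y : ℝ} (hy : 0 < y) (t : ℝ) :
    Tendsto (fun n : ℕ => √(n:ℝ) * (KL P f ^ k n) (sn (t / √n)) x y) atTop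
      (𝓝 (t * (exp (-(sigma2 P ν f * (t ^ 2 * ρ) / 2)) * V x y))) := by
  by_cases ht : t = 0
  · subst ht
    have : (sn 0 : X → ℝ → ℝ) = 0 := by funext _ _; simp [sn]
    simp [this]
  rw [← tendsto_add_atTop_iff_nat 1]
  have hpos : ∀ n : ℕ, 0 < √((n + 1 : ℕ) : ℝ) := fun n => Real.sqrt_pos.2 (by positivity)
  have hsq : Tendsto (fun n : ℕ => √((n + 1 : ℕ) : ℝ)) atTop atTop :=
    Real.tendsto_sqrt_atTop.comp (tendsto_natCast_atTop_atTop.comp (tendsto_add_atTop_nat 1))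
  have := cs_V hG hV hVs (fun n => t / √((n + 1 : ℕ) : ℝ)) (fun n => k (n + 1)) (t ^ 2 * ρ)
    (fun n => div_ne_zero ht (hpos n).ne') (hsq.const_div_atTop t) (hk.comp (tendsto_add_atTop_nat 1))
    (by
      have h := ((tendsto_add_atTop_iff_nat 1).2 hkn).const_mul (t ^ 2)
      refine h.congr fun n => ?_
      rw [div_pow, Real.sq_sqrt (by positivity)]
      ring) x y hy
  refine (this.const_mul t).congr fun n => ?_
  have := hpos n
  field_simp

lemma refl_pt (hG : Good P ν f) {V Vs : X → ℝ → ℝ} (hV : HasV P ν f V)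
    (hVs : HasV (dualK P ν) ν (fun b => -f b) Vs) {k i : ℕ → ℕ} {ρ : ℝ} (hρ : ρ < 1 / 2)
    (hk : Tendsto k atTop atTop) (hkn : Tendsto (fun n : ℕ => (k n : ℝ) / n) atTop (𝓝 ρ))
    (hin : Tendsto (fun n : ℕ => (i n : ℝ) / n) atTop (𝓝 (1 - 2 * ρ))) (x : X) {y : ℝ} (hy : 0 < y) (b : X) {z : ℝ} (hz : 0 < z) :
    Tendsto (fun n : ℕ => ∫ t : ℝ, FF P ν f (k n) (sigma2 P ν f * ((i n : ℝ) / n)) (√n) x y b z t) atTop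
      (𝓝 (√(2 * π) / √(sigma2 P ν f) ^ 3 * (V x y * Vs b z))) := by
  have hσ := sigma2_pos hG
  obtain ⟨C, hC, hb⟩ := FF_bound hG
  set c := sigma2 P ν f * ((1 - 2 * ρ) / 2) with hc
  have hc0 : 0 < c := by
    have : 0 < 1 - 2 * ρ := by linarith
    positivity
  have hlim : √(2 * π) / √(sigma2 P ν f) ^ 3 * (V x y * Vs b z) =
      ∫ t : ℝ, (t ^ 2 * exp (-(sigma2 P ν f * t ^ 2 / 2))) * (V x y * Vs b z) := by
    rw [integral_mul_const, gauss_second hσ]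
  rw [hlim]
  refine tendsto_integral_filter_of_dominated_convergence
    (fun t => C * (1 + y) * (1 + z) * (t ^ 2 * exp (-(c * t ^ 2 / 2)))) ?_ ?_ ?_ ?_
  · exact Eventually.of_forall fun n => (FF_cont hG _ _ _ x hy b hz).aestronglyMeasurable
  · have h1 : ∀ᶠ n : ℕ in atTop, (1 - 2 * ρ) / 2 < (i n : ℝ) / n := (tendsto_order.1 hin).1 _ (by linarith)
    filter_upwards [h1, eventually_ge_atTop 1] with n hn hn1
    refine Eventually.of_forall fun t => hb _ _ _ _ x y b z t ?_ ?_ hy hz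
    · exact Real.sqrt_pos.2 (by exact_mod_cast hn1)
    · rw [hc]; gcongr
  · exact (gauss_second_integrable hc0).const_mul _
  · refine Eventually.of_forall fun t => ?_
    unfold FF
    have h1 := snV hG hV hVs hk hkn x hy t
    have h2 := snV (dual_good hG) hVs (HasV_dd hG.st hV) hk hkn b hz t
    rw [sigma2_dual hG.st] at h2
    have h3 : Tendsto (fun n : ℕ => exp (-(sigma2 P ν f * ((i n : ℝ) / n) * t ^ 2 / 2))) atTop
        (𝓝 (exp (-(sigma2 P ν f * (1 - 2 * ρ) * t ^ 2 / 2)))) := by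
      refine (Real.continuous_exp.tendsto _).comp ?_
      exact (((hin.const_mul _).mul_const _).div_const _).neg
    have h4 := h3.mul (h2.mul h1)
    have : exp (-(sigma2 P ν f * t ^ 2 / 2)) = exp (-(sigma2 P ν f * (1 - 2 * ρ) * t ^ 2 / 2)) *
        (exp (-(sigma2 P ν f * (t ^ 2 * ρ) / 2)) * exp (-(sigma2 P ν f * (t ^ 2 * ρ) / 2))) := by
      rw [← Real.exp_add, ← Real.exp_add]; congr 1; ring
    have h5 : t ^ 2 * exp (-(sigma2 P ν f * t ^ 2 / 2)) * (V x y * Vs b z) =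
        rexp (-(sigma2 P ν f * (1 - 2 * ρ) * t ^ 2 / 2)) *
          (t * (rexp (-(sigma2 P ν f * (t ^ 2 * ρ) / 2)) * Vs b z) *
            (t * (rexp (-(sigma2 P ν f * (t ^ 2 * ρ) / 2)) * V x y))) := by
      rw [this]; ring
    rw [h5]; exact h4

lemma refl_eq (hG : Good P ν f) (k i n : ℕ) (hn : 1 ≤ n) (hi : 1 ≤ i) (x : X) {y : ℝ} (hy : 0 < y) (b : X) {z : ℝ} (hz : 0 < z) :
    (n * √n) * dbl P ν f k (fun a c => pg (sigma2 P ν f * i) (a - c) - pg (sigma2 P ν f * i) (a + c)) x y b z =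
    (1 / π) * ∫ t : ℝ, FF P ν f k (sigma2 P ν f * ((i : ℝ) / n)) (√n) x y b z t := by
  have hσ := sigma2_pos hG
  have hn0 : (0:ℝ) < n := by exact_mod_cast hn
  have hi0 : (0:ℝ) < i := by exact_mod_cast hi
  have hR : 0 < √(n:ℝ) := Real.sqrt_pos.2 hn0
  have := dbl_refl_scale hG k (v := sigma2 P ν f * i) (by positivity) x hy b hz hR
  rw [Real.sq_sqrt hn0.le] at this
  rw [show (n:ℝ) * √n = √(n:ℝ) ^ 3 by rw [pow_succ, Real.sq_sqrt hn0.le], this]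
  unfold FF
  rw [mul_div_assoc]

lemma pg_BM (v w : ℝ) (hv : 0 ≤ v) : BM (fun (_ : X) z => pg v (z + w)) := by
  refine ⟨fun _ => ((pg_cont v).comp (continuous_id.add continuous_const)).measurable, ?_⟩
  exact ⟨1 / √(2 * π * v), fun _ s => by
    rw [abs_of_nonneg (pg_nonneg _ _)]; exact pg_le v _ hv⟩

lemma dbl_int (hG : Good P ν f) (k : ℕ) (R : ℝ → ℝ → ℝ) (hR : ∀ w, BM (fun (_ : X) z => R z w)) (x : X) {y : ℝ} (hy : 0 < y) (b : X)
    (α β : ℝ) : IntegrableOn (fun z => dbl P ν f k R x y b z) (Set.Ioc α β) ∧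
    ∫ z in Set.Ioc α β, dbl P ν f k R x y b z = (KL P f ^ k) (fun _ w => ∫ z in Set.Ioc α β,
      (KL (dualK P ν) (fun b => -f b) ^ k) (fun _ z' => R z' w) b z) x y := by
  have := KL_pow_integral (μ := volume.restrict (Set.Ioc α β)) (f := f) hG.st.nonneg k x y hy
    (fun z (_ : X) w => (KL (dualK P ν) (fun b => -f b) ^ k) (fun _ z' => R z' w) b z)
    (fun _ w _ => (BM_KL_pow (hR w) k).intOn b α β)
  exact ⟨this.1, this.2.symm⟩

lemma refl_lim (hG : Good P ν f) {V Vs : X → ℝ → ℝ} (hV : HasV P ν f V)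
    (hVs : HasV (dualK P ν) ν (fun b => -f b) Vs) {k i : ℕ → ℕ} {ρ : ℝ} (hρ : ρ < 1 / 2)
    (hk : Tendsto k atTop atTop) (hkn : Tendsto (fun n : ℕ => (k n : ℝ) / n) atTop (𝓝 ρ))
    (hi : Tendsto i atTop atTop)
    (hin : Tendsto (fun n : ℕ => (i n : ℝ) / n) atTop (𝓝 (1 - 2 * ρ))) (x : X) {y : ℝ} (hy : 0 < y) (b : X)
    {α β : ℝ} (hα : 0 ≤ α) (hβ : 0 ≤ β) :
    Tendsto (fun n : ℕ => (n * √n) * ∫ z in Set.Ioc α β, dbl P ν f (k n) (fun a c => pg (sigma2 P ν f * i n) (a - c) -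
        pg (sigma2 P ν f * i n) (a + c)) x y b z) atTop
      (𝓝 (2 / (√(2 * π) * √(sigma2 P ν f) ^ 3) * V x y * ∫ z in Set.Ioc α β, Vs b z)) := by
  have hσ := sigma2_pos hG
  obtain ⟨C, hC, hb⟩ := FF_bound hG
  set c := sigma2 P ν f * ((1 - 2 * ρ) / 2) with hc
  have hc0 : 0 < c := by
    have : 0 < 1 - 2 * ρ := by linarith
    positivity
  have hconst : (1 / π) * (√(2 * π) / √(sigma2 P ν f) ^ 3) = 2 / (√(2 * π) * √(sigma2 P ν f) ^ 3) := by
    have h1 : √(2 * π) * √(2 * π) = 2 * π := Real.mul_self_sqrt (by positivity)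
    have h2 : 0 < √(2 * π) := Real.sqrt_pos.2 (by positivity)
    have h3 : 0 < √(sigma2 P ν f) := Real.sqrt_pos.2 hσ
    rw [eq_div_iff (by positivity)]
    have h4 : (1 / π) * (√(2 * π) / √(sigma2 P ν f) ^ 3) * (√(2 * π) * √(sigma2 P ν f) ^ 3) =
      (1 / π) * (√(2 * π) * √(2 * π)) := by field_simp
    rw [h4, h1]; field_simp
  have hlim : 2 / (√(2 * π) * √(sigma2 P ν f) ^ 3) * V x y * ∫ z in Set.Ioc α β, Vs b z =
      ∫ z in Set.Ioc α β, (1 / π) * (√(2 * π) / √(sigma2 P ν f) ^ 3 * (V x y * Vs b z)) := by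
    rw [← integral_const_mul]
    congr 1; funext z
    rw [← hconst]; ring
  rw [hlim]
  simp only [← integral_const_mul]
  refine tendsto_integral_filter_of_dominated_convergence
    (fun z => (1 / π) * (C * (1 + y) * (1 + β) * ∫ t : ℝ, (t ^ 2 * exp (-(c * t ^ 2 / 2))))) ?_ ?_ ?_ ?_
  · refine Eventually.of_forall fun n => ?_
    refine ((dbl_int hG (k n) _ (fun w => ?_) x hy b α β).1.aestronglyMeasurable).const_mul _
    have h0 : 0 ≤ sigma2 P ν f * i n := by positivity
    obtain ⟨m1, C1, c1⟩ := pg_BM (X := X) (sigma2 P ν f * i n) (-w) h0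
    obtain ⟨m2, C2, c2⟩ := pg_BM (X := X) (sigma2 P ν f * i n) w h0
    refine ⟨fun x => ?_, C1 + C2, fun x s => ?_⟩
    · have := (m1 x).sub (m2 x)
      exact this
    · have h1 := c1 x s
      have h2 := c2 x s
      rw [← sub_eq_add_neg] at h1
      exact (abs_sub _ _).trans (by linarith)
  · have h1 : ∀ᶠ n : ℕ in atTop, (1 - 2 * ρ) / 2 < (i n : ℝ) / n := (tendsto_order.1 hin).1 _ (by linarith)
    filter_upwards [h1, eventually_ge_atTop 1, hi.eventually_ge_atTop 1] with n hn hn1 hi1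
    refine (ae_restrict_iff' measurableSet_Ioc).2 (Eventually.of_forall fun z hz => ?_)
    have hz0 : 0 < z := hα.trans_lt hz.1
    rw [refl_eq hG _ _ _ hn1 hi1 x hy b hz0, norm_mul, Real.norm_of_nonneg (show 0 ≤ 1 / π by positivity)]
    gcongr
    rw [← integral_const_mul]
    refine norm_integral_le_of_norm_le ((gauss_second_integrable hc0).const_mul _) (Eventually.of_forall fun t => ?_)
    refine (hb (k n) _ c _ x y b z t (Real.sqrt_pos.2 (by exact_mod_cast hn1)) ?_ hy hz0).trans ?_
    · rw [hc]; gcongr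
    · have := hz.2
      gcongr
  · exact integrableOn_const (by simp)
  · refine (ae_restrict_iff' measurableSet_Ioc).2 (Eventually.of_forall fun z hz => ?_)
    have hz0 : 0 < z := hα.trans_lt hz.1
    refine ((refl_pt hG hV hVs hρ hk hkn hin x hy b hz0).const_mul (1 / π)).congr' ?_
    filter_upwards [eventually_ge_atTop 1, hi.eventually_ge_atTop 1] with n hn1 hi1
    rw [refl_eq hG _ _ _ hn1 hi1 x hy b hz0]

end mainb

set_option linter.unusedSectionVars false

section mainc
variable [Fintype X] [DecidableEq X] [Nonempty X] {P : X → X → ℝ} {ν f : X → ℝ}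

lemma img_bound (hG : Good P ν f) {V Vs : X → ℝ → ℝ} (hV : HasV P ν f V)
    (hVs : HasV (dualK P ν) ν (fun b => -f b) Vs) : ∃ C : ℝ, 0 ≤ C ∧ ∀ (k : ℕ) (s : ℝ) (x : X) (y : ℝ) (b : X) (z : ℝ),
    1 ≤ k → 1 ≤ s → 0 < y → 0 < z →
    |dbl P ν f k (fun a c => pg s (a + c)) x y b z| ≤ C * (1 + y) * (1 + z) * (s * √s) / (k:ℝ) ^ 3 := by
  obtain ⟨C1, hC1, h1⟩ := eight_gauss hG hV hVs
  obtain ⟨C2, hC2, h2⟩ := eight_gauss (dual_good hG) hVs (HasV_dd hG.st hV)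
  refine ⟨C1 * C2 * (1 / √(2 * π)), by positivity, fun k s x y b z hk hs hy hz => ?_⟩
  have hs0 : 0 < s := by linarith
  have hk0 : (0:ℝ) < k := by exact_mod_cast hk
  have hks : √(k:ℝ) * √(k:ℝ) = k := Real.mul_self_sqrt hk0.le
  have hss : √s * √s = s := Real.mul_self_sqrt hs0.le
  have hp1 : 0 < √(k:ℝ) := Real.sqrt_pos.2 hk0
  have hp2 : 0 < √s := Real.sqrt_pos.2 hs0
  have hp3 : 0 < √(2 * π) := Real.sqrt_pos.2 (by positivity)
  unfold dbl
  have := h1 (fun _ w => (KL (dualK P ν) (fun b => -f b) ^ k) (fun _ z' => pg s (z' + w)) b z)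
    (C2 * (1 + z) * (1 / √(2 * π * s)) * s / (k * √k)) s (by positivity) hs (fun _ w hw => by
      refine (h2 (fun _ z' => pg s (z' + w)) (1 / √(2 * π * s) * exp (-(w ^ 2 / (2 * s)))) s (by positivity) hs
        (fun _ Y hY => pg_refl_le hs0 hY hw) k hk b z hz).trans (le_of_eq ?_)
      ring) k hk x y hy
  refine this.trans (le_of_eq ?_)
  rw [Real.sqrt_mul (by positivity) s]
  have e : C1 * (1 + y) * (C2 * (1 + z) * (1 / (√(2 * π) * √s)) * s / (k * √(k:ℝ))) * s / (k * √(k:ℝ)) =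
      C1 * C2 * (1 / √(2 * π)) * (1 + y) * (1 + z) * (s * (s / √s)) / (k ^ 2 * (√(k:ℝ) * √(k:ℝ))) := by
    field_simp
  rw [e, hks]
  have : s / √s = √s := by rw [div_eq_iff hp2.ne', hss]
  rw [this]
  congr 1

lemma nu_min (hS : IsStochastic P ν) : ∃ c : ℝ, 0 < c ∧ ∀ b, c ≤ ν b := by
  obtain ⟨b0, -, hb⟩ := Finset.exists_min_image Finset.univ ν Finset.univ_nonempty
  exact ⟨ν b0, hS.nuPos b0, fun b => hb b (Finset.mem_univ b)⟩

lemma nu_le_one (hS : IsStochastic P ν) (b : X) : ν b ≤ 1 := by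
  rw [← hS.nuSum]
  exact Finset.single_le_sum (f := ν) (fun i _ => (hS.nuPos i).le) (Finset.mem_univ b)

lemma free_err (hG : Good P ν f) {V Vs : X → ℝ → ℝ} (hV : HasV P ν f V)
    (hVs : HasV (dualK P ν) ν (fun b => -f b) Vs) : ∃ C : ℝ, 0 ≤ C ∧ ∀ ε : ℝ, 0 < ε → ∃ N : ℕ, 1 ≤ N ∧
    ∀ (k i : ℕ), 1 ≤ k → N ≤ i → ∀ (x : X) (y : ℝ) (b : X) (α β : ℝ), 0 < y → 0 ≤ β → α ≤ β → β ≤ α + 1 →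
    |(KL P f ^ k) ((UL P f ^ i) ((LL P f ^ k) (ee P b α β))) x y -
      ν b * ∫ z in Set.Ioc α β, dbl P ν f k (fun a c => pg (sigma2 P ν f * i) (a - c)) x y b z| ≤
      C * ε * (1 + y) * (1 + β) / (k * √i) := by
  obtain ⟨C1, hC1, h1⟩ := sv_bound hG hV
  obtain ⟨C2, hC2, h2⟩ := sv_bound (dual_good hG) hVs
  obtain ⟨c, hc, hcν⟩ := nu_min hG.st
  refine ⟨C1 * C2 / c, by positivity, fun ε hε => ?_⟩
  obtain ⟨N, hN, h⟩ := llt_ee hG ε hε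
  refine ⟨N, hN, fun k i hk hi x y b α β hy hβ hab hab1 => ?_⟩
  have hσ := sigma2_pos hG
  have hi0 : (0:ℝ) < i := by exact_mod_cast (hN.trans hi)
  have hk0 : (0:ℝ) < k := by exact_mod_cast hk
  have hsi : 0 < √(i:ℝ) := Real.sqrt_pos.2 hi0
  have hsk : 0 < √(k:ℝ) := Real.sqrt_pos.2 hk0
  have hBM : ∀ w, BM (fun (_ : X) z => pg (sigma2 P ν f * i) (z - w)) := fun w => by
    simpa [sub_eq_add_neg] using pg_BM (X := X) (sigma2 P ν f * i) (-w) (by positivity)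
  rw [(dbl_int hG k _ hBM x hy b α β).2, ← KL_pow_cmul]
  have hd : ∀ x w, |(UL P f ^ i) ((LL P f ^ k) (ee P b α β)) x w - ν b * ∫ z in Set.Ioc α β,
      (KL (dualK P ν) (fun b => -f b) ^ k) (fun _ z' => pg (sigma2 P ν f * i) (z' - w)) b z| ≤
      ε / (√i * c) * (C2 * (1 + β) / √k) := by
    intro x w
    have := duality (f := f) hG.st i x w (ε / (√i * c)) (fun _ z' => pg (sigma2 P ν f * i) (z' - w)) (hBM w)
      (fun b α β hab hab1 => by
        have e := h i hi x w b α β hab hab1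
        rw [intervalIntegral.integral_of_le hab] at e
        refine e.trans ?_
        rw [div_mul_eq_mul_div, div_le_div_iff₀ hsi (by positivity)]
        have := hcν b
        have : c * (ε * √(i:ℝ)) ≤ ν b * (ε * √(i:ℝ)) := by gcongr
        linarith) k b α β hab hab1
    refine this.trans ?_
    have e1 := h2 k hk b β hβ
    have e2 := nu_le_one hG.st b
    have e3 := (hG.st.nuPos b).le
    have e4 := sv_nonneg (f := fun b => -f b) (dual_st hG.st).nonneg k b β
    calc _ ≤ ε / (√i * c) * 1 * (C2 * (1 + β) / √k) := by gcongr
      _ = _ := by ring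
  have := KL_pow_le_sv (f := f) hG.st.nonneg (φ := (UL P f ^ i) ((LL P f ^ k) (ee P b α β)) - fun _ w => ν b * ∫ z in Set.Ioc α β,
      (KL (dualK P ν) (fun b => -f b) ^ k) (fun _ z' => pg (sigma2 P ν f * i) (z' - w)) b z)
      (C := ε / (√i * c) * (C2 * (1 + β) / √k)) (fun x y _ => hd x y) k x y hy
  rw [map_sub] at this
  refine this.trans ?_
  have e1 := h1 k hk x y hy.le
  calc _ ≤ ε / (√i * c) * (C2 * (1 + β) / √k) * (C1 * (1 + y) / √k) := by gcongr
    _ = C1 * C2 / c * ε * (1 + y) * (1 + β) / ((√k * √k) * √i) := by field_simp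
    _ = _ := by rw [Real.mul_self_sqrt hk0.le]

/-- Main limit for intervals. -/
theorem main_interval (hG : Good P ν f) {V Vs : X → ℝ → ℝ} (hV : HasV P ν f V)
    (hVs : HasV (dualK P ν) ν (fun b => -f b) Vs) (x : X) {y : ℝ} (hy : 0 < y) (b : X) {α β : ℝ} (hα : 0 ≤ α)
    (hab : α ≤ β) (hab1 : β ≤ α + 1) :
    Tendsto (fun n : ℕ => (n * √n) * (KL P f ^ n) (ee P b α β) x y) atTop
      (𝓝 (ν b * (2 / (√(2 * π) * √(sigma2 P ν f) ^ 3) * V x y * ∫ z in Set.Ioc α β, Vs b z))) := by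
  have hσ := sigma2_pos hG
  have hβ : 0 ≤ β := hα.trans hab
  obtain ⟨C1, hC1, h1⟩ := kill_err hG hV hVs
  obtain ⟨C2, hC2, h2⟩ := free_err hG hV hVs
  obtain ⟨C3, hC3, h3⟩ := img_bound hG hV hVs
  set A1 := C1 * (1 + y) * (1 + β) with hA1
  set A2 := C3 * (1 + y) * (1 + β) * (sigma2 P ν f * √(sigma2 P ν f)) with hA2
  have hA10 : 0 ≤ A1 := by positivity
  have hA20 : 0 ≤ A2 := by positivity
  rw [Metric.tendsto_atTop]
  intro η hη
  -- choice of ρ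
  obtain ⟨ρ, hρ, hρ0, hF⟩ : ∃ ρ : ℝ, ρ < 1 / 2 ∧ 0 < ρ ∧
      A1 * √(1 - 2 * ρ) / ρ ^ 2 + A2 * ((1 - 2 * ρ) * √(1 - 2 * ρ)) / ρ ^ 3 < η / 3 := by
    have hcont : ContinuousAt (fun ρ : ℝ => A1 * √(1 - 2 * ρ) / ρ ^ 2 + A2 * ((1 - 2 * ρ) * √(1 - 2 * ρ)) / ρ ^ 3) (1 / 2) := by
      refine ContinuousAt.add (ContinuousAt.div ?_ ?_ (by norm_num)) (ContinuousAt.div ?_ ?_ (by norm_num)) <;> fun_prop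
    have ht : Tendsto (fun ρ : ℝ => A1 * √(1 - 2 * ρ) / ρ ^ 2 + A2 * ((1 - 2 * ρ) * √(1 - 2 * ρ)) / ρ ^ 3) (𝓝[<] (1 / 2)) (𝓝 0) := by
      have := hcont.tendsto.mono_left (nhdsWithin_le_nhds (s := Set.Iio (1 / 2)))
      simpa using this
    have e1 := (tendsto_order.1 ht).2 (η / 3) (by positivity)
    have e2 : ∀ᶠ ρ : ℝ in 𝓝[<] (1 / 2), 0 < ρ :=
      (lt_mem_nhds (by norm_num : (0:ℝ) < 1 / 2)).filter_mono nhdsWithin_le_nhds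
    obtain ⟨ρ, ha, hb, hc⟩ := (e1.and (e2.and self_mem_nhdsWithin)).exists
    exact ⟨ρ, hc, hb, ha⟩
  have hδ0 : 0 < 1 - 2 * ρ := by linarith
  obtain ⟨k, i, hki, hkn, hin, hk, hi⟩ := split_seq hρ0 hρ
  have hsin : Tendsto (fun n : ℕ => √((i n : ℝ) / n)) atTop (𝓝 (√(1 - 2 * ρ))) :=
    (Real.continuous_sqrt.tendsto _).comp hin
  have hE : Tendsto (fun n : ℕ => A1 * √((i n : ℝ) / n) / ((k n : ℝ) / n) ^ 2 +
      A2 * ((i n : ℝ) / n * √((i n : ℝ) / n)) / ((k n : ℝ) / n) ^ 3) atTop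
      (𝓝 (A1 * √(1 - 2 * ρ) / ρ ^ 2 + A2 * ((1 - 2 * ρ) * √(1 - 2 * ρ)) / ρ ^ 3)) :=
    ((hsin.const_mul _).div (hkn.pow 2) (by positivity)).add
      (((hin.mul hsin).const_mul _).div (hkn.pow 3) (by positivity))
  have hD : Tendsto (fun n : ℕ => 1 / ((k n : ℝ) / n * √((i n : ℝ) / n))) atTop (𝓝 (1 / (ρ * √(1 - 2 * ρ)))) := by
    refine tendsto_const_nhds.div (hkn.mul hsin) ?_
    have : 0 < √(1 - 2 * ρ) := Real.sqrt_pos.2 hδ0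
    positivity
  set D := 1 / (ρ * √(1 - 2 * ρ)) + 1 with hDD
  have hD0 : 0 < D := by positivity
  set A3 := C2 * (1 + y) * (1 + β) * D + 1 with hA3
  have hA30 : 0 < A3 := by positivity
  obtain ⟨N, hN1, hN⟩ := h2 (η / 3 / A3) (by positivity)
  have hR := refl_lim hG hV hVs hρ hk hkn hi hin x hy b hα hβ
  have hR' := hR.const_mul (ν b)
  rw [Metric.tendsto_atTop] at hR'
  obtain ⟨N', hN'⟩ := hR' (η / 3) (by positivity)
  have hbig : ∀ᶠ n in atTop, 1 ≤ sigma2 P ν f * (i n : ℝ) :=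
    ((tendsto_natCast_atTop_atTop.comp hi).const_mul_atTop hσ).eventually_ge_atTop 1
  obtain ⟨M, hM⟩ := ((((tendsto_order.1 hE).2 _ hF).and ((tendsto_order.1 hD).2 D (by linarith))).and
    ((hk.eventually_ge_atTop 1).and ((hi.eventually_ge_atTop N).and ((eventually_ge_atTop (max N' 1)).and hbig)))).exists_forall_of_atTop
  refine ⟨M, fun n hn => ?_⟩
  obtain ⟨⟨hE', hD'⟩, hk1, hiN, hnN', hbig'⟩ := hM n hn
  have hnn := hN' n (le_trans (le_max_left _ _) hnN')
  have hn1 : 1 ≤ n := le_trans (le_max_right _ _) hnN'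
  have hn0 : (0:ℝ) < n := by exact_mod_cast hn1
  have hk0 : (0:ℝ) < k n := by exact_mod_cast hk1
  have hi0 : (0:ℝ) < i n := by exact_mod_cast (hN1.trans hiN)
  have hsn : 0 < √(n:ℝ) := Real.sqrt_pos.2 hn0
  have hsi : 0 < √(i n:ℝ) := Real.sqrt_pos.2 hi0
  have hsk : 0 < √(k n:ℝ) := Real.sqrt_pos.2 hk0
  have hsn2 : √(n:ℝ) ^ 2 = n := Real.sq_sqrt hn0.le
  have hsi2 : √(i n:ℝ) ^ 2 = i n := Real.sq_sqrt hi0.le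
  have hsk2 : √(k n:ℝ) ^ 2 = k n := Real.sq_sqrt hk0.le
  have eK : (KL P f ^ n) (ee P b α β) = (KL P f ^ k n) ((KL P f ^ i n) ((LL P f ^ k n) (ee P b α β))) := by
    have e0 : n = (k n + i n) + k n := by have := hki n; omega
    conv_lhs => rw [e0]
    rw [KL_pow_LL _ _ (by omega) _ (chi_ee b hα), KL_pow_add]
  have t1 := h1 (k n) (k n) (i n) hk1 hk1 x y b α β hy hβ hab hab1
  have t2 := hN (k n) (i n) hk1 hiN x y b α β hy hβ hab hab1
  rw [Real.dist_eq] at hnn ⊢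
  set s := sigma2 P ν f * (i n : ℝ) with hs
  have hs0 : 0 < s := by positivity
  have hBM1 : ∀ w, BM (fun (_ : X) z => pg s (z + w)) := fun w => pg_BM _ _ hs0.le
  have hBM2 : ∀ w, BM (fun (_ : X) z => pg s (z - w) - pg s (z + w)) := fun w => by
    obtain ⟨m1, C1, c1⟩ := pg_BM (X := X) s (-w) hs0.le
    obtain ⟨m2, C2, c2⟩ := hBM1 w
    refine ⟨fun x => (m1 x).sub (m2 x), C1 + C2, fun x s => ?_⟩
    have h1 := c1 x s
    have h2 := c2 x s
    rw [← sub_eq_add_neg] at h1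
    exact (abs_sub _ _).trans (by linarith)
  have eD : ∫ z in Set.Ioc α β, dbl P ν f (k n) (fun a c => pg s (a - c)) x y b z =
      (∫ z in Set.Ioc α β, dbl P ν f (k n) (fun a c => pg s (a - c) - pg s (a + c)) x y b z) +
      ∫ z in Set.Ioc α β, dbl P ν f (k n) (fun a c => pg s (a + c)) x y b z := by
    rw [← integral_add (dbl_int hG (k n) _ hBM2 x hy b α β).1 (dbl_int hG (k n) _ hBM1 x hy b α β).1]
    congr 1; funext z
    rw [← dbl_add]; congr 1; funext a c; ring
  have t3 : |∫ z in Set.Ioc α β, dbl P ν f (k n) (fun a c => pg s (a + c)) x y b z| ≤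
      C3 * (1 + y) * (1 + β) * (s * √s) / (k n:ℝ) ^ 3 := by
    have := norm_setIntegral_le_of_norm_le_const (μ := volume) (s := Set.Ioc α β)
      (f := fun z => dbl P ν f (k n) (fun a c => pg s (a + c)) x y b z)
      (C := C3 * (1 + y) * (1 + β) * (s * √s) / (k n:ℝ) ^ 3) (by simp) (fun z hz => by
        refine (h3 (k n) s x y b z hk1 hbig' hy (hα.trans_lt hz.1)).trans ?_
        have := hz.2
        gcongr)
    refine this.trans ?_
    have hm : volume.real (Set.Ioc α β) ≤ 1 := by
      rw [Real.volume_real_Ioc_of_le hab]; linarith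
    exact mul_le_of_le_one_right (by positivity) hm
  rw [eD] at t2
  rw [eK]
  set K0 := (KL P f ^ k n) ((KL P f ^ i n) ((LL P f ^ k n) (ee P b α β))) x y
  set K1 := (KL P f ^ k n) ((UL P f ^ i n) ((LL P f ^ k n) (ee P b α β))) x y
  set I1 := ∫ z in Set.Ioc α β, dbl P ν f (k n) (fun a c => pg s (a - c) - pg s (a + c)) x y b z
  set I2 := ∫ z in Set.Ioc α β, dbl P ν f (k n) (fun a c => pg s (a + c)) x y b z
  set LL0 := ν b * (2 / (√(2 * π) * √(sigma2 P ν f) ^ 3) * V x y * ∫ z in Set.Ioc α β, Vs b z)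
  have hdec : (n * √n) * K0 - LL0 = -((n * √n) * (K1 - K0)) + (n * √n) * (K1 - ν b * (I1 + I2)) +
      (ν b * ((n * √n) * I1) - LL0) + ν b * ((n * √n) * I2) := by ring
  have hnn0 : 0 < (n:ℝ) * √n := by positivity
  have b1 : |-((n * √(n:ℝ)) * (K1 - K0))| ≤ A1 * √((i n : ℝ) / n) / ((k n : ℝ) / n) ^ 2 := by
    rw [abs_neg, abs_mul, abs_of_pos hnn0]
    refine (mul_le_mul_of_nonneg_left t1 hnn0.le).trans (le_of_eq ?_)
    rw [Real.sqrt_div hi0.le, mul_assoc (k n : ℝ), ← pow_two, hsk2]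
    rw [← hsn2]
    field_simp
    simp only [hsn2]
    rw [hA1]; ring
  have b2 : |(n * √(n:ℝ)) * (K1 - ν b * (I1 + I2))| < η / 3 := by
    rw [abs_mul, abs_of_pos hnn0]
    refine (mul_le_mul_of_nonneg_left t2 hnn0.le).trans_lt ?_
    have e : (n * √(n:ℝ)) * (C2 * (η / 3 / A3) * (1 + y) * (1 + β) / (k n * √(i n))) =
      (η / 3) * ((C2 * (1 + y) * (1 + β) * (1 / ((k n : ℝ) / n * √((i n : ℝ) / n)))) / A3) := by
      rw [Real.sqrt_div hi0.le]
      field_simp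
    rw [e]
    have : (C2 * (1 + y) * (1 + β) * (1 / ((k n : ℝ) / n * √((i n : ℝ) / n)))) / A3 < 1 := by
      rw [div_lt_one hA30, hA3]
      have : C2 * (1 + y) * (1 + β) * (1 / ((k n : ℝ) / n * √((i n : ℝ) / n))) ≤ C2 * (1 + y) * (1 + β) * D := by
        gcongr
      linarith
    calc _ < (η / 3) * 1 := by gcongr
      _ = _ := by ring
  have b4 : |ν b * ((n * √(n:ℝ)) * I2)| ≤ A2 * ((i n : ℝ) / n * √((i n : ℝ) / n)) / ((k n : ℝ) / n) ^ 3 := by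
    rw [abs_mul, abs_mul, abs_of_pos hnn0, abs_of_pos (hG.st.nuPos b)]
    calc _ ≤ 1 * ((n * √(n:ℝ)) * (C3 * (1 + y) * (1 + β) * (s * √s) / (k n:ℝ) ^ 3)) := by
          gcongr
          exact nu_le_one hG.st b
      _ = _ := by
          rw [Real.sqrt_div hi0.le, hs, Real.sqrt_mul hσ.le, hA2]
          have : (n:ℝ) ^ 3 / (n * √n) = n * √n := by
            rw [div_eq_iff (by positivity)]
            calc (n:ℝ) ^ 3 = n * n * n := by ring
              _ = n * n * √n ^ 2 := by rw [hsn2]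
              _ = _ := by ring
          rw [← this]
          field_simp
  rw [hdec]
  calc _ ≤ |-((n * √n) * (K1 - K0))| + |(n * √n) * (K1 - ν b * (I1 + I2))| +
      |ν b * ((n * √n) * I1) - LL0| + |ν b * ((n * √n) * I2)| := by
        refine (abs_add_le _ _).trans (add_le_add_left ?_ _)
        refine (abs_add_le _ _).trans (add_le_add_left ?_ _)
        exact abs_add_le _ _
    _ < η := by linarith

end mainc

set_option linter.unusedSectionVars false

/-- weighted bound for a function on the positive half line -/
def NW (h : ℝ → ℝ) (B : ℝ) : Prop :=
  ∃ c : ℕ → ℝ, (∀ v, 0 ≤ c v) ∧ (∀ (s : ℝ) (v : ℕ), (v:ℝ) < s → s ≤ v + 1 → |h s| ≤ c v) ∧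
    ∀ N, ∑ v ∈ range N, ((v:ℝ) + 2) * c v ≤ B

lemma iUnion_unit : (⋃ v : ℕ, Set.Ioc (v:ℝ) (v + 1)) = Set.Ioi (0:ℝ) := by
  ext s
  simp only [Set.mem_iUnion, Set.mem_Ioc, Set.mem_Ioi]
  constructor
  · rintro ⟨v, h1, -⟩
    exact lt_of_le_of_lt (by positivity) h1
  · intro hs
    obtain ⟨v, hv⟩ : ∃ v : ℕ, ⌈s⌉₊ = v + 1 := ⟨⌈s⌉₊ - 1, by have := Nat.ceil_pos.2 hs; omega⟩
    refine ⟨v, Nat.lt_ceil.1 (by omega), ?_⟩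
    have := Nat.le_ceil s
    rw [hv] at this; exact_mod_cast this

lemma NW_integral {F h : ℝ → ℝ} {B C : ℝ} (hF : Measurable F) (hh : Measurable h) (hC : 0 ≤ C)
    (hFb : ∀ z, 0 < z → |F z| ≤ C * (1 + z)) (hB : NW h B) :
    IntegrableOn (fun z => F z * h z) (Set.Ioi 0) ∧ |∫ z in Set.Ioi 0, F z * h z| ≤ C * B := by
  obtain ⟨c, hc, hch, hcB⟩ := hB
  have hB0 : 0 ≤ B := by simpa using hcB 0
  have key : ∫⁻ z in Set.Ioi 0, ENNReal.ofReal ‖F z * h z‖ ≤ ENNReal.ofReal (C * B) := by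
    rw [← iUnion_unit]
    refine (lintegral_iUnion_le _ _).trans ?_
    have h1 : ∀ v : ℕ, ∫⁻ z in Set.Ioc (v:ℝ) (v + 1), ENNReal.ofReal ‖F z * h z‖ ≤
        ENNReal.ofReal (C * (((v:ℝ) + 2) * c v)) := by
      intro v
      calc _ ≤ ∫⁻ z in Set.Ioc (v:ℝ) (v + 1), ENNReal.ofReal (C * (((v:ℝ) + 2) * c v)) := by
            refine setLIntegral_mono measurable_const fun z hz => ENNReal.ofReal_le_ofReal ?_
            have hz0 : 0 < z := lt_of_le_of_lt (by positivity) hz.1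
            have e1 := hFb z hz0
            have e2 := hch z v hz.1 hz.2
            rw [Real.norm_eq_abs, abs_mul]
            have e3 : |F z| ≤ C * (v + 2) := e1.trans (by
              have := hz.2
              exact mul_le_mul_of_nonneg_left (by linarith) hC)
            calc _ ≤ (C * (v + 2)) * c v := by
                  have := hc v
                  gcongr
              _ = _ := by ring
        _ = _ := by simp
    refine (ENNReal.tsum_le_tsum h1).trans ?_
    refine ENNReal.tsum_le_of_sum_range_le fun N => ?_
    rw [← ENNReal.ofReal_sum_of_nonneg (fun v _ => by have := hc v; positivity)]
    refine ENNReal.ofReal_le_ofReal ?_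
    rw [← Finset.mul_sum]
    exact mul_le_mul_of_nonneg_left (hcB N) hC
  have hm : AEStronglyMeasurable (fun z => F z * h z) (volume.restrict (Set.Ioi 0)) :=
    (hF.mul hh).aestronglyMeasurable
  have hfin : HasFiniteIntegral (fun z => F z * h z) (volume.restrict (Set.Ioi 0)) := by
    rw [hasFiniteIntegral_iff_norm]
    exact key.trans_lt ENNReal.ofReal_lt_top
  refine ⟨⟨hm, hfin⟩, ?_⟩
  have := norm_integral_le_lintegral_norm (μ := volume.restrict (Set.Ioi 0)) (fun z => F z * h z)
  rw [Real.norm_eq_abs] at this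
  refine this.trans ?_
  exact ENNReal.toReal_le_of_le_ofReal (by positivity) key

lemma iv_add {α β γ : ℝ} (h1 : α ≤ β) (h2 : β ≤ γ) (s : ℝ) : iv α β s + iv β γ s = iv α γ s := by
  unfold iv
  by_cases a1 : α < s <;> by_cases a2 : s ≤ β <;> by_cases a3 : s ≤ γ
  all_goals simp [a1, a2, a3]
  all_goals first | (have := lt_of_not_ge a2; simp_all) | (exfalso; linarith) | skip
  all_goals linarith

lemma iv_sum (a d : ℝ) (hd : 0 ≤ d) (J : ℕ) (s : ℝ) :
    ∑ j ∈ range J, iv (a + j * d) (a + (j + 1) * d) s = iv a (a + J * d) s := by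
  induction J with
  | zero => simp [iv]
  | succ J ih =>
    rw [sum_range_succ, ih]
    push_cast
    exact iv_add (by nlinarith [show (0:ℝ) ≤ J by positivity]) (by nlinarith) s

lemma iv_meas (α β : ℝ) : Measurable (iv α β) := by
  unfold iv
  exact Measurable.ite (measurableSet_Ioc) measurable_const measurable_const

lemma step_approx (φ : ℝ → ℝ) (hφ : Continuous φ) (a : ℝ) (ha : 0 ≤ a) (c : ℕ → ℝ) (hc0 : ∀ v, 0 ≤ c v)
    (hc : ∀ (s : ℝ) (v : ℕ), (v:ℝ) < s → s ≤ v + 1 → |if a < s then φ s else 0| ≤ c v)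
    (hsum : Summable fun v : ℕ => ((v:ℝ) + 2) * c v) (η : ℝ) (hη : 0 < η) :
    ∃ (d : ℝ) (J : ℕ), 0 ≤ d ∧ d ≤ 1 ∧
      NW (fun s => (if a < s then φ s else 0) - ∑ j ∈ range J, φ (a + j * d) * iv (a + j * d) (a + (j + 1) * d) s) η := by
  -- cutoff
  obtain ⟨T, hTa, hT⟩ : ∃ T : ℕ, a < T ∧ ∑' v : ℕ, (((v + T : ℕ) : ℝ) + 2) * c (v + T) < η / 2 := by
    have h1 := tendsto_sum_nat_add fun v : ℕ => ((v:ℝ) + 2) * c v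
    have h2 := (tendsto_order.1 h1).2 (η / 2) (by positivity)
    have h3 := (tendsto_natCast_atTop_atTop (R := ℝ)).eventually_gt_atTop a
    obtain ⟨T, h4, h5⟩ := (h2.and h3).exists
    exact ⟨T, h5, h4⟩
  set D := ∑ v ∈ range T, ((v:ℝ) + 2) with hD
  have hD0 : 0 ≤ D := Finset.sum_nonneg fun v _ => by positivity
  set ω := η / 2 / (D + 1) with hω
  have hω0 : 0 < ω := by positivity
  have huc := (isCompact_Icc (a := a) (b := (T:ℝ))).uniformContinuousOn_of_continuous hφ.continuousOn
  rw [Metric.uniformContinuousOn_iff] at huc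
  obtain ⟨δ, hδ, hu⟩ := huc ω hω0
  obtain ⟨J, hJ⟩ := exists_nat_gt (max ((T - a) / δ) (T - a))
  have hTa' : 0 < (T:ℝ) - a := by linarith
  have hJ1 : (T - a) / δ < J := (le_max_left _ _).trans_lt hJ
  have hJ2 : (T - a) < J := (le_max_right _ _).trans_lt hJ
  have hJ0 : (0:ℝ) < J := hTa'.trans hJ2
  set d := (T - a) / J with hd
  have hd0 : 0 < d := by positivity
  have hdδ : d < δ := by rw [hd, div_lt_comm₀ hJ0 hδ]; exact hJ1
  have hd1 : d ≤ 1 := by rw [hd, div_le_one hJ0]; exact hJ2.le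
  have hJd : a + J * d = T := by rw [hd]; field_simp; ring
  refine ⟨d, J, hd0.le, hd1, fun v => if v < T then ω else c v, fun v => ?_, fun s v hv1 hv2 => ?_, fun N => ?_⟩
  · dsimp only; split_ifs; exacts [hω0.le, hc0 v]
  · have hiv : ∀ j ∈ range J, iv (a + j * d) (a + (j + 1) * d) s ≠ 0 → s ≤ T ∧ |φ s - φ (a + j * d)| ≤ ω := by
      intro j hj hne
      unfold iv at hne
      split_ifs at hne with hcond
      · have hjJ : ((j:ℝ) + 1) ≤ J := by exact_mod_cast (mem_range.1 hj)
        have hsT : s ≤ T := by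
          rw [← hJd]
          exact hcond.2.trans (by gcongr)
        refine ⟨hsT, ?_⟩
        have hj0 : (0:ℝ) ≤ j * d := by positivity
        have := hu s ⟨by linarith [hcond.1], hsT⟩ (a + j * d) ⟨by linarith, by linarith [hcond.1]⟩ (by
          rw [Real.dist_eq, abs_lt]; constructor <;> nlinarith [hcond.1, hcond.2])
        rw [Real.dist_eq] at this
        exact this.le
      · exact absurd rfl hne
    dsimp only
    by_cases hvT : v < T
    · rw [if_pos hvT]
      have hsT : s ≤ T := hv2.trans (by exact_mod_cast hvT)
      have e1 : (if a < s then φ s else 0) = ∑ j ∈ range J, φ s * iv (a + j * d) (a + (j + 1) * d) s := by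
        rw [← Finset.mul_sum, iv_sum a d hd0.le, hJd, iv]
        simp [hsT]
      rw [e1, ← Finset.sum_sub_distrib]
      refine (Finset.abs_sum_le_sum_abs _ _).trans ?_
      calc _ ≤ ∑ j ∈ range J, ω * iv (a + j * d) (a + (j + 1) * d) s := by
            refine Finset.sum_le_sum fun j hj => ?_
            rw [← sub_mul, abs_mul, abs_of_nonneg (iv_nonneg _ _ _)]
            by_cases h0 : iv (a + j * d) (a + (j + 1) * d) s = 0
            · rw [h0, mul_zero, mul_zero]
            · exact mul_le_mul_of_nonneg_right (hiv j hj h0).2 (iv_nonneg _ _ _)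
        _ = ω * iv a T s := by rw [← Finset.mul_sum, iv_sum a d hd0.le, hJd]
        _ ≤ ω * 1 := mul_le_mul_of_nonneg_left (iv_le_one _ _ _) hω0.le
        _ = ω := mul_one _
    · rw [if_neg hvT]
      have hsT : (T:ℝ) < s := lt_of_le_of_lt (by exact_mod_cast (not_lt.1 hvT)) hv1
      rw [Finset.sum_eq_zero (fun j hj => ?_), sub_zero]
      · exact hc s v hv1 hv2
      · by_cases h0 : iv (a + j * d) (a + (j + 1) * d) s = 0
        · rw [h0, mul_zero]
        · exact absurd (hiv j hj h0).1 (not_le.2 hsT)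
  · have hmono : ∑ v ∈ range N, ((v:ℝ) + 2) * (if v < T then ω else c v) ≤
        ∑ v ∈ range (T + N), ((v:ℝ) + 2) * (if v < T then ω else c v) := by
      refine Finset.sum_le_sum_of_subset_of_nonneg (range_mono (by omega)) fun v _ _ => ?_
      have := hc0 v
      split_ifs <;> positivity
    refine hmono.trans ?_
    rw [Finset.sum_range_add]
    have e1 : ∑ v ∈ range T, ((v:ℝ) + 2) * (if v < T then ω else c v) = D * ω := by
      rw [hD, Finset.sum_mul]
      exact Finset.sum_congr rfl fun v hv => by rw [if_pos (mem_range.1 hv)]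
    have e2 : ∑ v ∈ range N, (((T + v : ℕ):ℝ) + 2) * (if T + v < T then ω else c (T + v)) ≤ η / 2 := by
      calc _ = ∑ v ∈ range N, (((v + T : ℕ):ℝ) + 2) * c (v + T) :=
            Finset.sum_congr rfl fun v _ => by rw [if_neg (by omega), add_comm T v]
        _ ≤ ∑' v : ℕ, (((v + T : ℕ) : ℝ) + 2) * c (v + T) :=
            ((summable_nat_add_iff T).2 hsum).sum_le_tsum _ (fun v _ => by have := hc0 (v + T); positivity)
        _ ≤ _ := hT.le
    have e3 : D * ω ≤ η / 2 := by
      rw [hω, mul_div_assoc', div_le_iff₀ (by positivity)]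
      nlinarith
    rw [e1]; linarith

section fun_lim
variable [Fintype X] [DecidableEq X] [Nonempty X] {P : X → X → ℝ} {ν f : X → ℝ}

theorem main_fun (hG : Good P ν f) {V Vs : X → ℝ → ℝ} (hV : HasV P ν f V)
    (hVs : HasV (dualK P ν) ν (fun b => -f b) Vs) (x : X) {y : ℝ} (hy : 0 < y) (b : X)
    (φ : ℝ → ℝ) (hφ : Continuous φ) (a : ℝ) (ha : 0 ≤ a) (c : ℕ → ℝ) (hc0 : ∀ v, 0 ≤ c v)
    (hc : ∀ (s : ℝ) (v : ℕ), (v:ℝ) < s → s ≤ v + 1 → |if a < s then φ s else 0| ≤ c v)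
    (hsum : Summable fun v : ℕ => ((v:ℝ) + 2) * c v) :
    IntegrableOn (fun z => Vs b z * (if a < z then φ z else 0)) (Set.Ioi 0) ∧
    Tendsto (fun n : ℕ => (n * √n) * (KL P f ^ n) (fun x s => P x b * (if a < s then φ s else 0)) x y) atTop
      (𝓝 (ν b * (2 / (√(2 * π) * √(sigma2 P ν f) ^ 3) * V x y *
        ∫ z in Set.Ioi 0, Vs b z * (if a < z then φ z else 0)))) := by
  have hσ := sigma2_pos hG
  obtain ⟨C1, hC1, h1⟩ := eight hG hV hVs
  obtain ⟨C2, hC2, h2⟩ := V_bound (dual_good hG) hVs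
  have hVm : Measurable (Vs b) := (HasV.mono (dual_good hG) hVs b).measurable
  have hVb : ∀ z, 0 < z → |Vs b z| ≤ C2 * (1 + z) := fun z hz => by
    rw [abs_of_nonneg (HasV.nonneg (dual_good hG) hVs b z)]; exact h2 b z hz.le
  set hh : ℝ → ℝ := fun s => if a < s then φ s else 0 with hhh
  have hhm : Measurable hh := Measurable.ite measurableSet_Ioi hφ.measurable measurable_const
  have hNW : NW hh (∑' v : ℕ, ((v:ℝ) + 2) * c v) := ⟨c, hc0, hc, fun N =>
    hsum.sum_le_tsum _ fun v _ => by have := hc0 v; positivity⟩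
  have hintg := (NW_integral hVm hhm hC2 hVb hNW).1
  refine ⟨hintg, ?_⟩
  set κ := ν b * (2 / (√(2 * π) * √(sigma2 P ν f) ^ 3) * V x y) with hκ
  have hκ0 : 0 ≤ κ := by
    have := (hG.st.nuPos b).le
    have := HasV.nonneg hG hV x y
    positivity
  have hLam : ν b * (2 / (√(2 * π) * √(sigma2 P ν f) ^ 3) * V x y * ∫ z in Set.Ioi 0, Vs b z * hh z) =
      κ * ∫ z in Set.Ioi 0, Vs b z * hh z := by rw [hκ]; ring
  show Tendsto (fun n : ℕ => (n * √n) * (KL P f ^ n) (fun x s => P x b * hh s) x y) atTop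
      (𝓝 (ν b * (2 / (√(2 * π) * √(sigma2 P ν f) ^ 3) * V x y * ∫ z in Set.Ioi 0, Vs b z * hh z)))
  rw [hLam, Metric.tendsto_atTop]
  intro η hη
  set A := C1 * (1 + y) + κ * C2 + 1 with hA
  have hA0 : 0 < A := by positivity
  obtain ⟨d, J, hd0, hd1, hap⟩ := step_approx φ hφ a ha c hc0 hc hsum (η / 2 / A) (by positivity)
  set h' : ℝ → ℝ := fun s => ∑ j ∈ range J, φ (a + j * d) * iv (a + j * d) (a + (j + 1) * d) s with hh'
  have hm' : Measurable h' := Finset.measurable_fun_sum _ fun j _ => (iv_meas _ _).const_mul _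
  -- the limit for step functions
  have hstep : Tendsto (fun n : ℕ => (n * √n) * (KL P f ^ n) (fun x s => P x b * h' s) x y) atTop
      (𝓝 (κ * ∫ z in Set.Ioi 0, Vs b z * h' z)) := by
    have e1 : (fun x s => P x b * h' s) = ∑ j ∈ range J, φ (a + j * d) • ee P b (a + j * d) (a + (j + 1) * d) := by
      funext x s
      simp only [hh', Finset.sum_apply, Pi.smul_apply, smul_eq_mul, ee, Finset.mul_sum]
      exact Finset.sum_congr rfl fun j _ => by ring
    have e2 : ∫ z in Set.Ioi 0, Vs b z * h' z = ∑ j ∈ range J, φ (a + j * d) *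
        ∫ z in Set.Ioc (a + j * d) (a + (j + 1) * d), Vs b z := by
      have hloc : ∀ α β : ℝ, IntegrableOn (Vs b) (Set.Ioc α β) := fun α β =>
        ((HasV.mono (dual_good hG) hVs b).locallyIntegrable.integrableOn_isCompact isCompact_Icc).mono_set
          Set.Ioc_subset_Icc_self
      have e3 : ∀ j ∈ range J, IntegrableOn (fun z => φ (a + j * d) * (Vs b z * iv (a + j * d) (a + (j + 1) * d) z)) (Set.Ioi 0) ∧
          ∫ z in Set.Ioi 0, φ (a + j * d) * (Vs b z * iv (a + j * d) (a + (j + 1) * d) z) =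
          φ (a + j * d) * ∫ z in Set.Ioc (a + j * d) (a + (j + 1) * d), Vs b z := by
        intro j _
        have hj0 : (0:ℝ) ≤ j * d := by positivity
        have e4 : (fun z => Vs b z * iv (a + j * d) (a + (j + 1) * d) z) =
            (Set.Ioc (a + j * d) (a + (j + 1) * d)).indicator (Vs b) := by
          funext z
          simp only [Set.indicator, Set.mem_Ioc, iv]
          split_ifs <;> simp
        have e5 : Set.Ioi (0:ℝ) ∩ Set.Ioc (a + j * d) (a + (j + 1) * d) = Set.Ioc (a + j * d) (a + (j + 1) * d) := by
          refine Set.inter_eq_right.2 fun z hz => ?_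
          exact lt_of_le_of_lt (by linarith) hz.1
        constructor
        · refine Integrable.const_mul ?_ _
          rw [e4]
          exact ((integrable_indicator_iff measurableSet_Ioc).2 (hloc _ _)).integrableOn
        · rw [integral_const_mul, e4, setIntegral_indicator measurableSet_Ioc, e5]
      rw [← Finset.sum_congr rfl fun j hj => (e3 j hj).2, ← integral_finsetSum _ fun j hj => (e3 j hj).1]
      congr 1; funext z
      rw [hh']
      simp only [Finset.mul_sum]
      exact Finset.sum_congr rfl fun j _ => by ring
    rw [e1, e2, Finset.mul_sum]
    have e6 : ∀ n : ℕ, (n * √n) * (KL P f ^ n) (∑ j ∈ range J, φ (a + j * d) • ee P b (a + j * d) (a + (j + 1) * d)) x y =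
        ∑ j ∈ range J, φ (a + j * d) * ((n * √n) * (KL P f ^ n) (ee P b (a + j * d) (a + (j + 1) * d)) x y) := by
      intro n
      rw [map_sum, Finset.sum_apply, Finset.sum_apply, Finset.mul_sum]
      refine Finset.sum_congr rfl fun j _ => ?_
      rw [map_smul]
      simp only [Pi.smul_apply, smul_eq_mul]; ring
    simp only [e6]
    refine tendsto_finsetSum _ fun j _ => ?_
    have hj0 : (0:ℝ) ≤ j * d := by positivity
    have := (main_interval hG hV hVs x hy b (α := a + j * d) (β := a + (j + 1) * d) (by linarith) (by nlinarith) (by nlinarith)).const_mul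
      (φ (a + j * d))
    have e7 : κ * (φ (a + j * d) * ∫ z in Set.Ioc (a + j * d) (a + (j + 1) * d), Vs b z) = φ (a + j * d) *
      (ν b * (2 / (√(2 * π) * √(sigma2 P ν f) ^ 3) * V x y * ∫ z in Set.Ioc (a + j * d) (a + (j + 1) * d), Vs b z)) := by
      rw [hκ]; ring
    rw [e7]; exact this
  rw [Metric.tendsto_atTop] at hstep
  obtain ⟨N, hN⟩ := hstep (η / 2) (by positivity)
  have hdiff := NW_integral hVm (hhm.sub hm') hC2 hVb hap
  have hintg' : IntegrableOn (fun z => Vs b z * h' z) (Set.Ioi 0) := by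
    refine (hintg.sub hdiff.1).congr (Eventually.of_forall fun z => ?_)
    simp only [Pi.sub_apply]; ring
  have hd2 : |(∫ z in Set.Ioi 0, Vs b z * hh z) - ∫ z in Set.Ioi 0, Vs b z * h' z| ≤ C2 * (η / 2 / A) := by
    rw [← integral_sub hintg hintg']
    refine le_trans (le_of_eq ?_) hdiff.2
    congr 2; funext z
    simp only [Pi.sub_apply]; ring
  refine ⟨max N 1, fun n hn => ?_⟩
  have hn1 : 1 ≤ n := le_trans (le_max_right _ _) hn
  have hn0 : (0:ℝ) < n := by exact_mod_cast hn1
  have hsn : 0 < √(n:ℝ) := Real.sqrt_pos.2 hn0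
  have hNn := hN n (le_trans (le_max_left _ _) hn)
  obtain ⟨c', hc'0, hc', hc'B⟩ := hap
  have hd1 := h1 (fun x s => P x b * (hh s - h' s)) c' _ hc'0 (fun x s v hv1 hv2 => by
    rw [abs_mul, abs_of_nonneg (hG.st.nonneg x b)]
    exact (mul_le_of_le_one_left (abs_nonneg _) (P_le_one hG.st x b)).trans (hc' s v hv1 hv2)) hc'B n hn1 x y hy
  have e8 : (fun x s => P x b * (hh s - h' s)) = (fun x s => P x b * hh s) - fun x s => P x b * h' s := by
    funext x s; simp only [Pi.sub_apply]; ring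
  rw [e8, map_sub, Pi.sub_apply, Pi.sub_apply] at hd1
  rw [Real.dist_eq] at hNn ⊢
  set K0 := (KL P f ^ n) (fun x s => P x b * hh s) x y
  set K1 := (KL P f ^ n) (fun x s => P x b * h' s) x y
  set I0 := ∫ z in Set.Ioi 0, Vs b z * hh z
  set I1 := ∫ z in Set.Ioi 0, Vs b z * h' z
  have hdec : n * √n * K0 - κ * I0 = n * √n * (K0 - K1) + (n * √n * K1 - κ * I1) - κ * (I0 - I1) := by ring
  have b1 : |n * √(n:ℝ) * (K0 - K1)| ≤ C1 * (1 + y) * (η / 2 / A) := by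
    rw [abs_mul, abs_of_pos (by positivity)]
    refine (mul_le_mul_of_nonneg_left hd1 (by positivity)).trans (le_of_eq ?_)
    field_simp
  have b2 : |κ * (I0 - I1)| ≤ κ * C2 * (η / 2 / A) := by
    rw [abs_mul, abs_of_nonneg hκ0, mul_assoc κ]
    exact mul_le_mul_of_nonneg_left hd2 hκ0
  have b3 : C1 * (1 + y) * (η / 2 / A) + κ * C2 * (η / 2 / A) ≤ η / 2 := by
    rw [← add_mul, mul_div_assoc', div_le_iff₀ hA0, mul_comm]
    gcongr
    linarith
  rw [hdec]
  calc _ ≤ |n * √(n:ℝ) * (K0 - K1)| + |n * √n * K1 - κ * I1| + |κ * (I0 - I1)| :=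
        (abs_sub _ _).trans (add_le_add_left (abs_add_le _ _) _)
    _ < η := by linarith

end fun_lim

set_option linter.unusedSectionVars false

/-- functional depending only on the first `n` coordinates -/
def Adapt (n : ℕ) (F : (ℕ → X) → ℝ) : Prop := ∀ ω ω' : ℕ → X, (∀ k, k ≤ n → ω k = ω' k) → F ω = F ω'

/-- prepend a state -/
def scons (x : X) (ω : ℕ → X) : ℕ → X := fun k => if k = 0 then x else ω (k - 1)

/-- concatenate trajectories at time `p` -/
def cat (p : ℕ) (ω ω' : ℕ → X) : ℕ → X := fun k => if k ≤ p then ω k else ω' (k - p)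

lemma pathExt_cons (x x1 : X) {n : ℕ} (u : Fin n → X) (k : ℕ) (hk : k ≤ n + 1) :
    pathExt x (Fin.cons x1 u : Fin (n + 1) → X) k = scons x (pathExt x1 u) k := by
  unfold pathExt scons
  rcases Nat.eq_zero_or_pos k with rfl | hk0
  · simp
  rw [dif_pos ⟨hk0, hk⟩, if_neg (by omega)]
  rcases Nat.lt_or_ge 1 k with h1 | h1
  · dsimp only
    rw [dif_pos (by omega)]
    have : (⟨k - 1, by omega⟩ : Fin (n + 1)) = Fin.succ ⟨k - 1 - 1, by omega⟩ := by
      ext; simp; omega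
    rw [this, Fin.cons_succ]
  · dsimp only
    rw [dif_neg (by omega)]
    have : (⟨k - 1, by omega⟩ : Fin (n + 1)) = 0 := by
      ext; simp; omega
    rw [this, Fin.cons_zero]

lemma pathExt_base (x x' : X) {n : ℕ} (u : Fin n → X) (k : ℕ) (h1 : 1 ≤ k) (h2 : k ≤ n) :
    pathExt x u k = pathExt x' u k := by
  unfold pathExt
  rw [dif_pos ⟨h1, h2⟩, dif_pos ⟨h1, h2⟩]

lemma pathExt_rev (x x' : X) {n : ℕ} (u : Fin n → X) (k : ℕ) (h1 : 1 ≤ k) (h2 : k ≤ n) :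
    pathExt x (fun i => u i.rev) k = pathExt x' u (n + 1 - k) := by
  unfold pathExt
  rw [dif_pos ⟨h1, h2⟩, dif_pos (by omega)]
  refine congrArg u ?_
  ext; simp [Fin.rev]; omega

section exx
variable [Fintype X] [DecidableEq X] [Nonempty X] {P : X → X → ℝ} {ν f : X → ℝ}

lemma Ex_zero (x : X) (F : (ℕ → X) → ℝ) : Ex P x 0 F = F (fun _ => x) := by
  unfold Ex
  rw [Fintype.sum_unique]
  simp only [List.ofFn_zero, wt, one_mul]
  congr 1; funext k
  unfold pathExt
  rw [dif_neg (by omega)]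

lemma Ex_succ (x : X) (n : ℕ) (F : (ℕ → X) → ℝ) (hF : Adapt (n + 1) F) :
    Ex P x (n + 1) F = ∑ x1, P x x1 * Ex P x1 n (fun ω => F (scons x ω)) := by
  unfold Ex
  rw [← (Fin.consEquiv (fun _ : Fin (n + 1) => X)).sum_comp, Fintype.sum_prod_type]
  refine Finset.sum_congr rfl fun x1 _ => ?_
  rw [Finset.mul_sum]
  refine Finset.sum_congr rfl fun u _ => ?_
  have e1 : (Fin.consEquiv (fun _ : Fin (n + 1) => X)) (x1, u) = (Fin.cons x1 u : Fin (n + 1) → X) := rfl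
  rw [e1, List.ofFn_succ]
  simp only [Fin.cons_zero, Fin.cons_succ, wt]
  rw [hF _ (scons x (pathExt x1 u)) fun k hk => pathExt_cons x x1 u k hk, mul_assoc]

lemma Ex_congr (x : X) (n : ℕ) {F G : (ℕ → X) → ℝ} (h : ∀ ω, ω 0 = x → F ω = G ω) : Ex P x n F = Ex P x n G := by
  unfold Ex
  refine Finset.sum_congr rfl fun u _ => ?_
  rw [h]
  unfold pathExt
  rw [dif_neg (by omega)]

lemma Ex_mul (x : X) (n : ℕ) (c : ℝ) (F : (ℕ → X) → ℝ) : Ex P x n (fun ω => c * F ω) = c * Ex P x n F := by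
  unfold Ex
  rw [Finset.mul_sum]
  exact Finset.sum_congr rfl fun u _ => by ring

lemma Ex_split (p q : ℕ) : ∀ (x : X) (F : (ℕ → X) → ℝ), Adapt (p + q) F →
    Ex P x (p + q) F = Ex P x p (fun ω => Ex P (ω p) q (fun ω' => F (cat p ω ω'))) := by
  induction p with
  | zero =>
    intro x F hF
    rw [Ex_zero, zero_add]
    refine Ex_congr x q fun ω hω => ?_
    congr 1
    funext k
    unfold cat
    split_ifs with hk
    · rw [Nat.le_zero.1 hk, hω]
    · simp
  | succ p ih =>
    intro x F hF
    have e : p + 1 + q = p + q + 1 := by omega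
    rw [e] at hF ⊢
    rw [Ex_succ x _ F hF, Ex_succ]
    · refine Finset.sum_congr rfl fun x1 _ => ?_
      congr 1
      rw [ih]
      · refine Ex_congr x1 p fun ω _ => ?_
        have : scons x ω (p + 1) = ω p := by simp [scons]
        rw [this]
        refine Ex_congr _ q fun ω' _ => ?_
        congr 1; funext k
        unfold cat scons
        by_cases h0 : k = 0
        · simp [h0]
        · by_cases h1 : k ≤ p + 1
          · have h2 : k - 1 ≤ p := by omega
            simp [h0, h1, h2]
          · have h2 : ¬ (k - 1 ≤ p) := by omega
            simp only [h0, h1, h2, if_false]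
            congr 1; omega
      · intro ω ω' h
        refine hF _ _ fun k hk => ?_
        unfold scons
        split_ifs
        · rfl
        · exact h _ (by omega)
    · intro ω ω' h
      dsimp only
      rw [h (p + 1) le_rfl]
      refine Ex_congr _ q fun ω'' _ => ?_
      congr 1; funext k
      unfold cat
      split_ifs with hk
      · exact h _ hk
      · rfl

lemma Spath_scons (x : X) (ω : ℕ → X) (k : ℕ) : Spath f (scons x ω) (k + 1) = f (ω 0) + Spath f ω k := by
  unfold Spath
  induction k with
  | zero => simp [scons]
  | succ k ih =>
    rw [Finset.sum_Icc_succ_top (by omega), ih, Finset.sum_Icc_succ_top (by omega)]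
    simp only [scons]
    rw [if_neg (by omega), add_assoc]
    rfl

lemma Spath_zero (ω : ℕ → X) : Spath f ω 0 = 0 := by simp [Spath]

lemma Spath_adapt (ω ω' : ℕ → X) (k : ℕ) (h : ∀ j, 1 ≤ j → j ≤ k → ω j = ω' j) : Spath f ω k = Spath f ω' k := by
  unfold Spath
  refine Finset.sum_congr rfl fun j hj => ?_
  rw [Finset.mem_Icc] at hj
  rw [h j hj.1 hj.2]

lemma Spath_cat (p : ℕ) (ω ω' : ℕ → X) (k : ℕ) : Spath f (cat p ω ω') (p + k) = Spath f ω p + Spath f ω' k := by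
  induction k with
  | zero =>
    rw [Spath_zero, add_zero, add_zero]
    refine Spath_adapt _ _ _ fun j _ hj => ?_
    simp [cat, hj]
  | succ k ih =>
    have h1 : Spath f (cat p ω ω') (p + (k + 1)) = Spath f (cat p ω ω') (p + k) + f (cat p ω ω' (p + (k + 1))) := by
      unfold Spath
      rw [← add_assoc, Finset.sum_Icc_succ_top (by omega)]
    have h2 : Spath f ω' (k + 1) = Spath f ω' k + f (ω' (k + 1)) := by
      unfold Spath
      rw [Finset.sum_Icc_succ_top (by omega)]
    rw [h1, ih, h2]
    have h3 : cat p ω ω' (p + (k + 1)) = ω' (k + 1) := by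
      unfold cat
      rw [if_neg (by omega)]; congr 1; omega
    rw [h3]; ring

lemma survives_cat (p q : ℕ) (y : ℝ) (ω ω' : ℕ → X) : survives f y (p + q) (cat p ω ω') ↔
    survives f y p ω ∧ survives f (y + Spath f ω p) q ω' := by
  have e1 : ∀ k, k ≤ p → Spath f (cat p ω ω') k = Spath f ω k := fun k hk =>
    Spath_adapt _ _ _ fun j _ hj => by simp [cat, show j ≤ p by omega]
  unfold survives
  constructor
  · intro h
    refine ⟨fun k hk => ?_, fun k hk => ?_⟩
    · rw [Finset.mem_Icc] at hk
      have := h k (Finset.mem_Icc.2 ⟨hk.1, by omega⟩)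
      rwa [e1 k hk.2] at this
    · rw [Finset.mem_Icc] at hk
      have := h (p + k) (Finset.mem_Icc.2 ⟨by omega, by omega⟩)
      rwa [Spath_cat, ← add_assoc] at this
  · rintro ⟨h1, h2⟩ k hk
    rw [Finset.mem_Icc] at hk
    by_cases hkp : k ≤ p
    · rw [e1 k hkp]; exact h1 k (Finset.mem_Icc.2 ⟨hk.1, hkp⟩)
    · obtain ⟨j, rfl⟩ : ∃ j, k = p + j := ⟨k - p, by omega⟩
      rw [Spath_cat, ← add_assoc]
      exact h2 j (Finset.mem_Icc.2 ⟨by omega, by omega⟩)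

lemma survives_scons (x : X) (n : ℕ) (y : ℝ) (ω : ℕ → X) : survives f y (n + 1) (scons x ω) ↔
    0 < y + f (ω 0) ∧ survives f (y + f (ω 0)) n ω := by
  unfold survives
  constructor
  · intro h
    refine ⟨?_, fun k hk => ?_⟩
    · have := h 1 (Finset.mem_Icc.2 ⟨le_rfl, by omega⟩)
      rwa [Spath_scons x ω 0, Spath_zero, add_zero] at this
    · rw [Finset.mem_Icc] at hk
      have := h (k + 1) (Finset.mem_Icc.2 ⟨by omega, by omega⟩)
      rwa [Spath_scons, ← add_assoc] at this
  · rintro ⟨h1, h2⟩ k hk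
    rw [Finset.mem_Icc] at hk
    obtain ⟨j, rfl⟩ : ∃ j, k = j + 1 := ⟨k - 1, by omega⟩
    rw [Spath_scons, ← add_assoc]
    rcases Nat.eq_zero_or_pos j with rfl | hj
    · rwa [Spath_zero, add_zero]
    · exact h2 j (Finset.mem_Icc.2 ⟨hj, by omega⟩)

lemma survives_adapt {n : ℕ} {y : ℝ} {ω ω' : ℕ → X} (h : ∀ j, 1 ≤ j → j ≤ n → ω j = ω' j) :
    survives f y n ω ↔ survives f y n ω' := by
  unfold survives
  refine forall₂_congr fun k hk => ?_
  rw [Finset.mem_Icc] at hk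
  rw [Spath_adapt ω ω' k fun j h1 h2 => h j h1 (by omega)]

lemma ind_and (p q : Prop) : ind (p ∧ q) = ind p * ind q := by
  unfold ind
  by_cases hp : p <;> by_cases hq : q <;> simp [hp, hq]

lemma ind_congr {p q : Prop} (h : p ↔ q) : ind p = ind q := by rw [propext h]

lemma Ex_KL (n : ℕ) (φ : X → ℝ → ℝ) : ∀ (x : X) (y : ℝ),
    Ex P x n (fun ω => φ (ω n) (y + Spath f ω n) * ind (survives f y n ω)) = (KL P f ^ n) φ x y := by
  induction n with
  | zero =>
    intro x y
    rw [Ex_zero]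
    have : ind (survives f y 0 fun _ => x) = 1 := by
      unfold ind
      rw [if_pos]
      intro k hk
      simp at hk
    rw [this, Spath_zero]; simp
  | succ n ih =>
    intro x y
    rw [Ex_succ, KL_pow_succ, KL_apply]
    · refine Finset.sum_congr rfl fun x1 _ => ?_
      congr 1
      have e : Ex P x1 n (fun ω => φ (scons x ω (n + 1)) (y + Spath f (scons x ω) (n + 1)) * ind (survives f y (n + 1) (scons x ω)))
          = Ex P x1 n (fun ω => ind (0 < y + f x1) * (φ (ω n) ((y + f x1) + Spath f ω n) * ind (survives f (y + f x1) n ω))) := by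
        refine Ex_congr x1 n fun ω hω => ?_
        rw [ind_congr (survives_scons x n y ω), ind_and, hω, Spath_scons, hω]
        have : scons x ω (n + 1) = ω n := by simp [scons]
        rw [this, add_assoc]; ring
      rw [e, Ex_mul, ih]
      unfold ind
      split_ifs <;> simp
    · intro ω ω' h
      dsimp only
      rw [h _ le_rfl, Spath_adapt ω ω' (n + 1) fun j _ hj => h j hj,
        ind_congr (survives_adapt fun j _ hj => h j hj)]

lemma Ex_sv (n : ℕ) (x : X) (y : ℝ) : Ex P x n (fun ω => ind (survives f y n ω)) = sv P f n x y := by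
  have := Ex_KL (P := P) (f := f) n (fun _ _ => 1) x y
  simp only [one_mul] at this
  rw [this]; rfl

lemma wt_append_two (L : List X) (x c b : X) : wt P x (L ++ [c] ++ [b]) = wt P x (L ++ [c]) * P c b := by
  induction L generalizing x with
  | nil => simp [wt]
  | cons a L ih =>
    simp only [List.cons_append, wt]
    rw [ih, mul_assoc]

lemma wt_sum_last (hS : IsStochastic P ν) (L : List X) (b : X) : ∑ x, wt P b (L ++ [x]) = wt P b L := by
  induction L generalizing b with
  | nil => simp [wt, hS.rowSum]
  | cons a L ih =>
    simp only [List.cons_append, wt]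
    rw [← Finset.mul_sum, ih]

lemma wt_reverse (hS : IsStochastic P ν) (L : List X) (b x : X) :
    ν x * wt (dualK P ν) x (L.reverse ++ [b]) = ν b * wt P b (L ++ [x]) := by
  induction L generalizing b with
  | nil =>
    simp only [List.reverse_nil, List.nil_append, wt, mul_one]
    have := (hS.nuPos x).ne'
    unfold dualK
    field_simp
  | cons c L ih =>
    rw [List.reverse_cons, wt_append_two, ← mul_assoc, ih]
    simp only [List.cons_append, wt]
    have := (hS.nuPos c).ne'
    unfold dualK
    field_simp

lemma wt_reverse_sum (hS : IsStochastic P ν) (L : List X) (b : X) :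
    ∑ x, ν x * wt (dualK P ν) x ((b :: L).reverse) = ν b * wt P b L := by
  rw [List.reverse_cons]
  simp only [wt_reverse hS]
  rw [← Finset.mul_sum, wt_sum_last hS]

end exx

set_option linter.unusedSectionVars false

section fin
variable [Fintype X] [DecidableEq X] [Nonempty X] {P : X → X → ℝ} {ν f : X → ℝ}

/-- final-block functional -/
noncomputable def hh (f : X → ℝ) (m : ℕ) (τ : ℕ → X) (gg : ℝ → ℝ) (s : ℝ) : ℝ :=
  gg (s + Spath f τ m) * ind (0 < s ∧ survives f s m τ)

lemma hh_cond (m : ℕ) (τ : ℕ → X) : ∃ a : ℝ, 0 ≤ a ∧ ∀ s, (0 < s ∧ survives f s m τ ↔ a < s) := by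
  have hne : (Finset.range (m + 1)).Nonempty := ⟨0, by simp⟩
  refine ⟨(Finset.range (m + 1)).sup' hne (fun j => -Spath f τ j), ?_, fun s => ?_⟩
  · have := Finset.le_sup' (fun j => -Spath f τ j) (show 0 ∈ Finset.range (m + 1) by simp)
    rwa [Spath_zero, neg_zero] at this
  · rw [Finset.sup'_lt_iff]
    unfold survives
    constructor
    · rintro ⟨h0, h⟩ j hj
      rw [Finset.mem_range] at hj
      rcases Nat.eq_zero_or_pos j with rfl | hj0
      · simpa [Spath_zero] using h0
      · have := h j (Finset.mem_Icc.2 ⟨hj0, by omega⟩)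
        linarith
    · intro h
      refine ⟨?_, fun k hk => ?_⟩
      · have := h 0 (by simp)
        simpa [Spath_zero] using this
      · rw [Finset.mem_Icc] at hk
        have := h k (by rw [Finset.mem_range]; omega)
        linarith

lemma sum_cube : Summable fun v : ℕ => ((v : ℝ) + 2) * (1 / ((v : ℝ) + 1) ^ 3) := by
  have h := (summable_nat_add_iff 1).2 (Real.summable_one_div_nat_pow (p := 2).2 (by norm_num))
  refine Summable.of_nonneg_of_le (fun v => by positivity) (fun v => ?_) (h.mul_left 2)
  push_cast
  rw [mul_one_div, mul_one_div, div_le_div_iff₀ (by positivity) (by positivity)]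
  have hv : (0:ℝ) ≤ v := Nat.cast_nonneg v
  nlinarith [pow_pos (show (0:ℝ) < v + 1 by linarith) 2]

lemma hh_main (hG : Good P ν f) {V Vs : X → ℝ → ℝ} (hV : HasV P ν f V)
    (hVs : HasV (dualK P ν) ν (fun b => -f b) Vs) (x : X) {y : ℝ} (hy : 0 < y) (b : X) (m : ℕ) (τ : ℕ → X)
    (gg : ℝ → ℝ) (g0 : ∀ z, 0 ≤ z → 0 ≤ gg z) (gc : ContinuousOn gg (Set.Ici 0)) {ε : ℕ} (hε : 0 < ε) {M : ℝ}
    (gM : ∀ z : ℝ, 0 ≤ z → gg z * (1 + z) ^ (2 + ε) ≤ M) :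
    IntegrableOn (fun z => Vs b z * hh f m τ gg z) (Set.Ioi 0) ∧
    Tendsto (fun n : ℕ => (n * √n) * (KL P f ^ n) (fun x s => P x b * hh f m τ gg s) x y) atTop
      (𝓝 (ν b * (2 / (√(2 * π) * √(sigma2 P ν f) ^ 3) * V x y * ∫ z in Set.Ioi 0, Vs b z * hh f m τ gg z))) := by
  obtain ⟨a, ha, hcond⟩ := hh_cond (f := f) m τ
  set S := Spath f τ m with hSdef
  have key : ∀ s, hh f m τ gg s = if a < s then gg (max (s + S) 0) else 0 := by
    intro s
    unfold hh
    rw [ind_congr (hcond s)]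
    unfold ind
    split_ifs with h
    · have h' : 0 ≤ s + S := by
        have h2 := (hcond s).2 h
        rcases Nat.eq_zero_or_pos m with h0 | h0
        · have : S = 0 := by rw [hSdef, h0, Spath_zero]
          linarith [h2.1]
        · exact (h2.2 m (Finset.mem_Icc.2 ⟨h0, le_rfl⟩)).le
      rw [max_eq_left h', mul_one]
    · simp
  have hpos : ∀ s, a < s → 0 ≤ s + S := by
    intro s h
    have h2 := (hcond s).2 h
    rcases Nat.eq_zero_or_pos m with h0 | h0
    · have : S = 0 := by rw [hSdef, h0, Spath_zero]
      linarith [h2.1]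
    · exact (h2.2 m (Finset.mem_Icc.2 ⟨h0, le_rfl⟩)).le
  simp only [key]
  have hM : 0 ≤ M := by
    have h1 := gM 0 le_rfl
    have h2 := g0 0 le_rfl
    simp at h1; linarith
  refine main_fun hG hV hVs x hy b (fun s => gg (max (s + S) 0)) ?_ a ha
    (fun v : ℕ => M * (1 + |S|) ^ 3 * (1 / ((v : ℝ) + 1) ^ 3)) ?_ ?_ ?_
  · exact gc.comp_continuous (by fun_prop) fun s => Set.mem_Ici.2 (le_max_right _ _)
  · intro v; positivity
  · intro s v h1 h2
    have hv : (0:ℝ) ≤ v := Nat.cast_nonneg v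
    split_ifs with h
    · have hz := hpos s h
      rw [max_eq_left hz, abs_of_nonneg (g0 _ hz)]
      have e1 : (v:ℝ) + 1 ≤ (1 + |S|) * (1 + (s + S)) := by
        nlinarith [abs_nonneg S, neg_abs_le S, mul_nonneg (abs_nonneg S) hz]
      have e2 := pow_le_pow_left₀ (by linarith) e1 3
      have e3 : gg (s + S) * (1 + (s + S)) ^ 3 ≤ M := by
        refine le_trans (mul_le_mul_of_nonneg_left ?_ (g0 _ hz)) (gM _ hz)
        exact pow_le_pow_right₀ (by linarith) (by omega)
      rw [mul_one_div, le_div_iff₀ (by positivity)]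
      calc gg (s + S) * ((v:ℝ) + 1) ^ 3 ≤ gg (s + S) * ((1 + |S|) * (1 + (s + S))) ^ 3 :=
            mul_le_mul_of_nonneg_left e2 (g0 _ hz)
        _ = gg (s + S) * (1 + (s + S)) ^ 3 * (1 + |S|) ^ 3 := by ring
        _ ≤ M * (1 + |S|) ^ 3 := mul_le_mul_of_nonneg_right e3 (by positivity)
    · rw [abs_zero]; positivity
  · have := sum_cube.mul_left (M * (1 + |S|) ^ 3)
    refine this.congr fun v => ?_
    ring

/-- weight of a final block given its first state -/
noncomputable def wu (P : X → X → ℝ) {m : ℕ} (u : Fin (m + 1) → X) : ℝ :=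
  wt P (u 0) (List.ofFn fun i : Fin m => u i.succ)

/-- dependence on the coordinates in `1..m` only -/
def Loc (m : ℕ) (G : (ℕ → X) → ℝ → ℝ) : Prop :=
  ∀ τ τ' : ℕ → X, (∀ k, 1 ≤ k → k ≤ m → τ k = τ' k) → G τ = G τ'

lemma psi_expand (m : ℕ) (G : (ℕ → X) → ℝ → ℝ) (hL : Loc (m + 1) G) (x' : X) (s : ℝ) (hs : 0 < s) :
    Ex P x' (m + 1) (fun τ => G τ (s + Spath f τ (m + 1)) * ind (survives f s (m + 1) τ)) =
      ∑ u : Fin (m + 1) → X, wu P u * (P x' (u 0) * hh f (m + 1) (pathExt (u 0) u) (G (pathExt (u 0) u)) s) := by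
  unfold Ex
  refine Finset.sum_congr rfl fun u _ => ?_
  have hb : ∀ k, 1 ≤ k → k ≤ m + 1 → pathExt x' u k = pathExt (u 0) u k := fun k h1 h2 => pathExt_base _ _ u k h1 h2
  rw [List.ofFn_succ]
  unfold hh wu
  simp only [wt]
  rw [hL _ _ hb, Spath_adapt _ _ (m + 1) hb, ind_congr (survives_adapt hb),
    ind_congr (q := 0 < s ∧ survives f s (m + 1) (pathExt (u 0) u)) ⟨fun h => ⟨hs, h⟩, fun h => h.2⟩]
  ring

lemma psi_lim (hG : Good P ν f) {V Vs : X → ℝ → ℝ} (hV : HasV P ν f V)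
    (hVs : HasV (dualK P ν) ν (fun b => -f b) Vs) (x : X) {y : ℝ} (hy : 0 < y) (m : ℕ)
    (G : (ℕ → X) → ℝ → ℝ) (hL : Loc (m + 1) G) (g0 : ∀ τ z, 0 ≤ z → 0 ≤ G τ z)
    (gc : ∀ τ, ContinuousOn (G τ) (Set.Ici 0)) {ε : ℕ} (hε : 0 < ε) {M : ℝ}
    (gM : ∀ τ, ∀ z : ℝ, 0 ≤ z → G τ z * (1 + z) ^ (2 + ε) ≤ M) :
    Tendsto (fun n : ℕ => (n * √n) * (KL P f ^ n) (fun x' s =>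
        Ex P x' (m + 1) (fun τ => G τ (s + Spath f τ (m + 1)) * ind (survives f s (m + 1) τ))) x y) atTop
      (𝓝 (2 / (√(2 * π) * √(sigma2 P ν f) ^ 3) * V x y * ∑ u : Fin (m + 1) → X, ν (u 0) * wu P u *
        ∫ z in Set.Ioi 0, Vs (u 0) z * hh f (m + 1) (pathExt (u 0) u) (G (pathExt (u 0) u)) z)) := by
  have e : ∀ n : ℕ, (KL P f ^ n) (fun x' s =>
        Ex P x' (m + 1) (fun τ => G τ (s + Spath f τ (m + 1)) * ind (survives f s (m + 1) τ))) x y =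
      ∑ u : Fin (m + 1) → X, wu P u * (KL P f ^ n) (fun x s => P x (u 0) *
        hh f (m + 1) (pathExt (u 0) u) (G (pathExt (u 0) u)) s) x y := by
    intro n
    rw [KL_pow_congr hG.st.nonneg (fun x' s hs => psi_expand m G hL x' s hs) n x y hy]
    have : (fun (x' : X) (s : ℝ) => ∑ u : Fin (m + 1) → X, wu P u * (P x' (u 0) *
        hh f (m + 1) (pathExt (u 0) u) (G (pathExt (u 0) u)) s)) =
        ∑ u : Fin (m + 1) → X, wu P u • (fun (x' : X) (s : ℝ) => P x' (u 0) *
          hh f (m + 1) (pathExt (u 0) u) (G (pathExt (u 0) u)) s) := by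
      funext x' s
      simp [Finset.sum_apply]
    rw [this, map_sum]
    simp only [map_smul, Finset.sum_apply, Pi.smul_apply, smul_eq_mul]
  simp only [e, Finset.mul_sum]
  refine tendsto_finsetSum _ fun u _ => ?_
  have := ((hh_main hG hV hVs x hy (u 0) (m + 1) (pathExt (u 0) u) (G (pathExt (u 0) u)) (g0 _) (gc _) hε
    (gM _)).2).const_mul (wu P u)
  refine (this.congr fun n => by ring).trans_eq ?_
  congr 1; ring

end fin

set_option linter.unusedSectionVars false

section fin2
variable [Fintype X] [DecidableEq X] [Nonempty X] {P : X → X → ℝ} {ν f : X → ℝ}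

lemma ofFn_rev {n : ℕ} (u : Fin n → X) : List.ofFn (fun i => u i.rev) = (List.ofFn u).reverse := by
  apply List.ext_getElem
  · simp
  · intro i h1 h2
    simp only [List.getElem_ofFn, List.getElem_reverse, List.length_ofFn]
    refine congrArg u ?_
    ext
    simp [Fin.rev]
    omega

/-- integrand of the right-hand side for a fixed initial block -/
noncomputable def JJ (P : X → X → ℝ) (ν f : X → ℝ) (Vs : X → ℝ → ℝ) (m : ℕ) (G : (ℕ → X) → ℝ → ℝ) (z : ℝ) : ℝ :=
  ∑ xs, Ex (dualK P ν) xs m (fun ωs => G (fun k => ωs (m + 1 - k)) z *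
    Vs (ωs m) (z + Spath (fun u => -f u) ωs m) * ind (survives (fun u => -f u) z m ωs)) * ν xs

lemma Spath_rev (m : ℕ) (ω τ : ℕ → X) (h : ∀ k, 1 ≤ k → k ≤ m → ω k = τ (m + 1 - k)) (k : ℕ) (hk : k ≤ m) :
    Spath (fun u => -f u) ω k = Spath f τ (m - k) - Spath f τ m := by
  induction k with
  | zero => simp [Spath_zero]
  | succ k ih =>
    have h1 : Spath (fun u => -f u) ω (k + 1) = Spath (fun u => -f u) ω k + (-f (ω (k + 1))) := by
      unfold Spath
      rw [Finset.sum_Icc_succ_top (by omega)]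
    have h2 : Spath f τ (m - k) = Spath f τ (m - (k + 1)) + f (τ (m - k)) := by
      obtain ⟨j, hj⟩ : ∃ j, m - k = j + 1 := ⟨m - k - 1, by omega⟩
      have hj2 : m - (k + 1) = j := by omega
      rw [hj, hj2]
      unfold Spath
      rw [Finset.sum_Icc_succ_top (by omega)]
    rw [h1, ih (by omega), h2, h (k + 1) (by omega) hk]
    have : m + 1 - (k + 1) = m - k := by omega
    rw [this]; ring

lemma JJ_expand (hS : IsStochastic P ν) (Vs : X → ℝ → ℝ) (m : ℕ) (G : (ℕ → X) → ℝ → ℝ) (hL : Loc (m + 1) G) (z : ℝ)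
    (hz : 0 < z) :
    JJ P ν f Vs (m + 1) G z = ∑ u : Fin (m + 1) → X, ν (u 0) * wu P u *
      (Set.Ioi (0:ℝ)).indicator (fun s => Vs (u 0) s * hh f (m + 1) (pathExt (u 0) u) (G (pathExt (u 0) u)) s)
        (z - Spath f (pathExt (u 0) u) (m + 1)) := by
  unfold JJ Ex
  simp only [Finset.sum_mul]
  rw [Finset.sum_comm]
  have hrev : Function.Bijective (fun (u : Fin (m + 1) → X) => fun i : Fin (m + 1) => u i.rev) := by
    refine Function.Involutive.bijective fun u => ?_
    funext i; simp
  rw [← hrev.sum_comp]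
  refine Finset.sum_congr rfl fun u _ => ?_
  set τ := pathExt (u 0) u with hτ
  set T := Spath f τ (m + 1) with hT
  have main : ∀ xs, G (fun k => pathExt xs (fun i => u i.rev) (m + 1 + 1 - k)) z *
      Vs (pathExt xs (fun i => u i.rev) (m + 1)) (z + Spath (fun u => -f u) (pathExt xs (fun i => u i.rev)) (m + 1)) *
      ind (survives (fun u => -f u) z (m + 1) (pathExt xs (fun i => u i.rev))) =
      (Set.Ioi (0:ℝ)).indicator (fun s => Vs (u 0) s * hh f (m + 1) τ (G τ) s) (z - T) := by
    intro xs
    have hr : ∀ k, 1 ≤ k → k ≤ m + 1 → pathExt xs (fun i => u i.rev) k = τ (m + 1 + 1 - k) :=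
      fun k h1 h2 => pathExt_rev xs (u 0) u k h1 h2
    have hSr := Spath_rev (f := f) (m + 1) _ τ hr
    have hGe : G (fun k => pathExt xs (fun i => u i.rev) (m + 1 + 1 - k)) = G τ := by
      refine hL _ _ fun k h1 h2 => ?_
      rw [hr _ (by omega) (by omega)]
      congr 1; omega
    have hend : pathExt xs (fun i => u i.rev) (m + 1) = u 0 := by
      rw [hr _ (by omega) le_rfl, hτ]
      unfold pathExt
      rw [dif_pos (by omega)]
      refine congrArg u ?_
      ext; simp
    rw [hGe, hend, hSr _ le_rfl, Nat.sub_self, Spath_zero, zero_sub, ← sub_eq_add_neg]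
    have hc : survives (fun u => -f u) z (m + 1) (pathExt xs (fun i => u i.rev)) ↔
        (0 < z - T ∧ survives f (z - T) (m + 1) τ) := by
      unfold survives
      constructor
      · intro h
        refine ⟨?_, fun k hk => ?_⟩
        · have := h (m + 1) (Finset.mem_Icc.2 ⟨by omega, le_rfl⟩)
          rw [hSr _ le_rfl, Nat.sub_self, Spath_zero] at this
          linarith
        · rw [Finset.mem_Icc] at hk
          rcases Nat.lt_or_ge k (m + 1) with hlt | hge
          · have := h (m + 1 - k) (Finset.mem_Icc.2 ⟨by omega, by omega⟩)
            rw [hSr _ (by omega), show m + 1 - (m + 1 - k) = k by omega] at this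
            linarith
          · have : k = m + 1 := by omega
            rw [this]; linarith
      · rintro ⟨h0, h⟩ k hk
        rw [Finset.mem_Icc] at hk
        rw [hSr _ hk.2]
        rcases Nat.lt_or_ge k (m + 1) with hlt | hge
        · have := h (m + 1 - k) (Finset.mem_Icc.2 ⟨by omega, by omega⟩)
          linarith
        · have : k = m + 1 := by omega
          rw [this, Nat.sub_self, Spath_zero]; linarith
    rw [ind_congr hc]
    unfold hh
    rw [← hT]
    by_cases h0 : 0 < z - T
    · rw [Set.indicator_of_mem (Set.mem_Ioi.2 h0), sub_add_cancel]; ring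
    · rw [Set.indicator_of_notMem (by simpa using h0)]
      unfold ind
      rw [if_neg fun h => h0 h.1]; simp
  calc _ = ∑ xs, (ν xs * wt (dualK P ν) xs (List.ofFn fun i => u i.rev)) *
        (Set.Ioi (0:ℝ)).indicator (fun s => Vs (u 0) s * hh f (m + 1) τ (G τ) s) (z - T) := by
        refine Finset.sum_congr rfl fun xs _ => ?_
        rw [← main xs]; ring
    _ = _ := by
        rw [← Finset.sum_mul, ofFn_rev, List.ofFn_succ, wt_reverse_sum hS]
        rfl

lemma JJ_int (hG : Good P ν f) {V Vs : X → ℝ → ℝ} (hV : HasV P ν f V)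
    (hVs : HasV (dualK P ν) ν (fun b => -f b) Vs) (m : ℕ)
    (G : (ℕ → X) → ℝ → ℝ) (hL : Loc (m + 1) G) (g0 : ∀ τ z, 0 ≤ z → 0 ≤ G τ z)
    (gc : ∀ τ, ContinuousOn (G τ) (Set.Ici 0)) {ε : ℕ} (hε : 0 < ε) {M : ℝ}
    (gM : ∀ τ, ∀ z : ℝ, 0 ≤ z → G τ z * (1 + z) ^ (2 + ε) ≤ M) :
    IntegrableOn (JJ P ν f Vs (m + 1) G) (Set.Ioi 0) ∧
    ∫ z in Set.Ioi 0, JJ P ν f Vs (m + 1) G z = ∑ u : Fin (m + 1) → X, ν (u 0) * wu P u *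
        ∫ z in Set.Ioi 0, Vs (u 0) z * hh f (m + 1) (pathExt (u 0) u) (G (pathExt (u 0) u)) z := by
  have x : X := Classical.arbitrary X
  set R : (Fin (m + 1) → X) → ℝ → ℝ := fun u => (Set.Ioi (0:ℝ)).indicator
    (fun s => Vs (u 0) s * hh f (m + 1) (pathExt (u 0) u) (G (pathExt (u 0) u)) s) with hR
  have hRi : ∀ u, Integrable (R u) := fun u =>
    (integrable_indicator_iff measurableSet_Ioi).2 (hh_main hG hV hVs x one_pos (u 0) (m + 1) (pathExt (u 0) u)
      (G (pathExt (u 0) u)) (g0 _) (gc _) hε (gM _)).1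
  have hRs : ∀ u, Integrable (fun z => R u (z - Spath f (pathExt (u 0) u) (m + 1))) := fun u =>
    (hRi u).comp_sub_right _
  have hzero : ∀ u z, z ∉ Set.Ioi (0:ℝ) → R u (z - Spath f (pathExt (u 0) u) (m + 1)) = 0 := by
    intro u z hz
    rw [Set.mem_Ioi] at hz
    simp only [hR, Set.indicator_apply]
    split_ifs with h
    · unfold hh ind
      rw [if_neg, mul_zero, mul_zero]
      rintro ⟨_, h2⟩
      have := h2 (m + 1) (Finset.mem_Icc.2 ⟨by omega, le_rfl⟩)
      rw [sub_add_cancel] at this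
      exact hz this
    · rfl
  have hcong : Set.EqOn (JJ P ν f Vs (m + 1) G) (fun z => ∑ u : Fin (m + 1) → X, ν (u 0) * wu P u *
      R u (z - Spath f (pathExt (u 0) u) (m + 1))) (Set.Ioi 0) := fun z hz => JJ_expand hG.st Vs m G hL z hz
  have hintg : ∀ u ∈ (Finset.univ : Finset (Fin (m + 1) → X)), Integrable (fun z => ν (u 0) * wu P u *
      R u (z - Spath f (pathExt (u 0) u) (m + 1))) (volume.restrict (Set.Ioi 0)) := fun u _ =>
    ((hRs u).const_mul _).integrableOn
  refine ⟨?_, ?_⟩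
  · rw [integrableOn_congr_fun hcong measurableSet_Ioi]
    exact integrable_finsetSum _ hintg
  · rw [setIntegral_congr_fun measurableSet_Ioi hcong, integral_finsetSum _ hintg]
    refine Finset.sum_congr rfl fun u _ => ?_
    rw [integral_const_mul]
    congr 1
    rw [setIntegral_eq_integral_of_forall_compl_eq_zero (fun z hz => hzero u z hz), integral_sub_right_eq_self (R u),
      hR, integral_indicator measurableSet_Ioi]

end fin2

set_option linter.unusedSectionVars false

section fin3
variable [Fintype X] [DecidableEq X] [Nonempty X] {P : X → X → ℝ} {ν f : X → ℝ}

/-- `g` as a function of the initial and the final block -/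
def GG (l m : ℕ) (g : (Fin (l + m) → X) → ℝ → ℝ) (ω τ : ℕ → X) : ℝ → ℝ :=
  g (fun i => if i.1 < l then ω (i.1 + 1) else τ (1 + (i.1 - l)))

lemma GG_loc (l m : ℕ) (g : (Fin (l + m) → X) → ℝ → ℝ) (ω : ℕ → X) : Loc m (GG l m g ω) := by
  intro τ τ' h
  unfold GG
  congr 1; funext i
  split_ifs with hi
  · rfl
  · have := i.2
    exact h _ (by omega) (by omega)

lemma Ex_combine (l m N : ℕ) (hl : 1 ≤ l) (hm : 1 ≤ m) (g : (Fin (l + m) → X) → ℝ → ℝ) (x : X) (y : ℝ) :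
    Ex P x (l + (N + m)) (fun ω =>
      g (fun i => if i.1 < l then ω (i.1 + 1) else ω (l + (N + m) - m + 1 + (i.1 - l))) (y + Spath f ω (l + (N + m))) *
        ind (survives f y (l + (N + m)) ω)) =
    Ex P x l (fun ω => ind (survives f y l ω) * (KL P f ^ N) (fun x' s =>
      Ex P x' m (fun τ => GG l m g ω τ (s + Spath f τ m) * ind (survives f s m τ))) (ω l) (y + Spath f ω l)) := by
  rw [Ex_split l (N + m)]
  · refine Ex_congr x l fun ω _ => ?_
    set y' := y + Spath f ω l with hy'
    have e1 : ∀ ω' : ℕ → X, g (fun i => if i.1 < l then cat l ω ω' (i.1 + 1) else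
          cat l ω ω' (l + (N + m) - m + 1 + (i.1 - l))) (y + Spath f (cat l ω ω') (l + (N + m))) *
        ind (survives f y (l + (N + m)) (cat l ω ω')) =
        ind (survives f y l ω) * (g (fun i => if i.1 < l then ω (i.1 + 1) else ω' (N + 1 + (i.1 - l)))
          (y' + Spath f ω' (N + m)) * ind (survives f y' (N + m) ω')) := by
      intro ω'
      rw [ind_congr (survives_cat l (N + m) y ω ω'), ind_and, Spath_cat, ← add_assoc y]
      have : (fun i : Fin (l + m) => if i.1 < l then cat l ω ω' (i.1 + 1) else
          cat l ω ω' (l + (N + m) - m + 1 + (i.1 - l))) =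
          (fun i : Fin (l + m) => if i.1 < l then ω (i.1 + 1) else ω' (N + 1 + (i.1 - l))) := by
        funext i
        split_ifs with hi
        · unfold cat
          rw [if_pos (by omega)]
        · unfold cat
          rw [if_neg (by omega)]
          congr 1; omega
      rw [this]; ring
    simp only [e1]
    rw [Ex_mul]
    congr 1
    rw [Ex_split N m]
    · rw [← Ex_KL]
      refine Ex_congr _ N fun ω' _ => ?_
      rw [mul_comm, ← Ex_mul]
      refine Ex_congr _ m fun ω'' _ => ?_
      rw [ind_congr (survives_cat N m y' ω' ω''), ind_and, Spath_cat, ← add_assoc]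
      have : (fun i : Fin (l + m) => if i.1 < l then ω (i.1 + 1) else
          cat N ω' ω'' (N + 1 + (i.1 - l))) =
          (fun i : Fin (l + m) => if i.1 < l then ω (i.1 + 1) else ω'' (1 + (i.1 - l))) := by
        funext i
        split_ifs with hi
        · rfl
        · unfold cat
          rw [if_neg (by omega)]
          congr 1; omega
      rw [this]
      unfold GG
      ring
    · intro ω1 ω2 h
      dsimp only
      rw [Spath_adapt ω1 ω2 (N + m) fun j _ hj => h j hj, ind_congr (survives_adapt fun j _ hj => h j hj)]
      have : (fun i : Fin (l + m) => if i.1 < l then ω (i.1 + 1) else ω1 (N + 1 + (i.1 - l))) =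
          (fun i : Fin (l + m) => if i.1 < l then ω (i.1 + 1) else ω2 (N + 1 + (i.1 - l))) := by
        funext i
        have := i.2
        split_ifs with hi
        · rfl
        · exact h _ (by omega)
      rw [this]
  · intro ω1 ω2 h
    dsimp only
    rw [Spath_adapt ω1 ω2 (l + (N + m)) fun j _ hj => h j hj, ind_congr (survives_adapt fun j _ hj => h j hj)]
    have : (fun i : Fin (l + m) => if i.1 < l then ω1 (i.1 + 1) else ω1 (l + (N + m) - m + 1 + (i.1 - l))) =
        (fun i : Fin (l + m) => if i.1 < l then ω2 (i.1 + 1) else ω2 (l + (N + m) - m + 1 + (i.1 - l))) := by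
      funext i
      have := i.2
      split_ifs with hi
      · exact h _ (by omega)
      · exact h _ (by omega)
    rw [this]

lemma ratio_lim (q : ℕ) : Tendsto (fun N : ℕ => ((N + q : ℕ) : ℝ) ^ (3 / 2 : ℝ) / (N * √N)) atTop (𝓝 1) := by
  have h1 : Tendsto (fun N : ℕ => 1 + (q : ℝ) / (N : ℝ)) atTop (𝓝 (1 + 0)) :=
    tendsto_const_nhds.add (tendsto_const_div_atTop_nhds_zero_nat _)
  rw [add_zero] at h1
  have h2 := h1.rpow_const (p := (3 / 2 : ℝ)) (Or.inl one_ne_zero)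
  rw [Real.one_rpow] at h2
  refine h2.congr' ?_
  filter_upwards [eventually_gt_atTop 0] with N hN
  have hN' : (0:ℝ) < N := Nat.cast_pos.2 hN
  have e1 : (N:ℝ) * √N = (N:ℝ) ^ (3 / 2 : ℝ) := by
    rw [Real.sqrt_eq_rpow]
    nth_rewrite 1 [← Real.rpow_one (N:ℝ)]
    rw [← Real.rpow_add hN']; norm_num
  rw [e1, ← Real.div_rpow (by positivity) hN'.le]
  congr 1
  push_cast
  field_simp

theorem cfl_aux (hG : Good P ν f) {V Vs : X → ℝ → ℝ} (hV : HasV P ν f V)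
    (hVs : HasV (dualK P ν) ν (fun b => -f b) Vs) (x : X) (y : ℝ) (l m : ℕ) (hl : 1 ≤ l) (hm : 1 ≤ m)
    (g : (Fin (l + m) → X) → ℝ → ℝ) (g0 : ∀ u z, 0 ≤ z → 0 ≤ g u z)
    (gc : ∀ u, ContinuousOn (g u) (Set.Ici 0)) {ε : ℕ} (hε : 0 < ε) {M : ℝ}
    (gM : ∀ u, ∀ z : ℝ, 0 ≤ z → g u z * (1 + z) ^ (2 + ε) ≤ M) :
    Tendsto (fun n : ℕ => (n : ℝ) ^ (3 / 2 : ℝ) *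
            Ex P x n (fun ω =>
              g (fun i => if i.1 < l then ω (i.1 + 1) else ω (n - m + 1 + (i.1 - l)))
                  (y + Spath f ω n) *
                ind (survives f y n ω)))
          atTop
          (nhds (2 / (Real.sqrt (2 * π) * Real.sqrt (sigma2 P ν f) ^ 3) *
            ∫ z in Set.Ioi (0 : ℝ), ∑ xs,
              (Ex P x l (fun ω => Ex (dualK P ν) xs m (fun ωs =>
                  g (fun i => if i.1 < l then ω (i.1 + 1) else ωs (m - (i.1 - l))) z *
                      V (ω l) (y + Spath f ω l) *
                      Vs (ωs m) (z + Spath (fun u => -f u) ωs m) *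
                    ind (survives f y l ω ∧ survives (fun u => -f u) z m ωs)))) *
                ν xs)) := by
  obtain ⟨m, rfl⟩ : ∃ k, m = k + 1 := ⟨m - 1, by omega⟩
  set κ := 2 / (Real.sqrt (2 * π) * Real.sqrt (sigma2 P ν f) ^ 3) with hκ
  -- the integrand
  have hJ : ∀ z, (∑ xs, (Ex P x l (fun ω => Ex (dualK P ν) xs (m + 1) (fun ωs =>
                  g (fun i => if i.1 < l then ω (i.1 + 1) else ωs (m + 1 - (i.1 - l))) z *
                      V (ω l) (y + Spath f ω l) *
                      Vs (ωs (m + 1)) (z + Spath (fun u => -f u) ωs (m + 1)) *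
                    ind (survives f y l ω ∧ survives (fun u => -f u) z (m + 1) ωs)))) *
                ν xs) = Ex P x l (fun ω => (ind (survives f y l ω) * V (ω l) (y + Spath f ω l)) *
                  JJ P ν f Vs (m + 1) (GG l (m + 1) g ω) z) := by
    intro z
    have e : ∀ xs ω, Ex (dualK P ν) xs (m + 1) (fun ωs =>
                  g (fun i => if i.1 < l then ω (i.1 + 1) else ωs (m + 1 - (i.1 - l))) z *
                      V (ω l) (y + Spath f ω l) *
                      Vs (ωs (m + 1)) (z + Spath (fun u => -f u) ωs (m + 1)) *
                    ind (survives f y l ω ∧ survives (fun u => -f u) z (m + 1) ωs)) =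
        (ind (survives f y l ω) * V (ω l) (y + Spath f ω l)) * Ex (dualK P ν) xs (m + 1) (fun ωs =>
          GG l (m + 1) g ω (fun k => ωs (m + 1 + 1 - k)) z *
    Vs (ωs (m + 1)) (z + Spath (fun u => -f u) ωs (m + 1)) * ind (survives (fun u => -f u) z (m + 1) ωs)) := by
      intro xs ω
      rw [← Ex_mul]
      refine Ex_congr xs _ fun ωs _ => ?_
      rw [ind_and]
      unfold GG
      have : (fun i : Fin (l + (m + 1)) => if i.1 < l then ω (i.1 + 1) else ωs (m + 1 - (i.1 - l))) =
          (fun i : Fin (l + (m + 1)) => if i.1 < l then ω (i.1 + 1) else ωs (m + 1 + 1 - (1 + (i.1 - l)))) := by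
        funext i
        split_ifs
        · rfl
        · congr 1; omega
      rw [this]; ring
    simp only [e]
    unfold JJ
    rw [Ex]
    simp only [Finset.mul_sum]
    rw [Finset.sum_comm]
    refine Finset.sum_congr rfl fun xs _ => ?_
    rw [Ex, Finset.sum_mul]
    exact Finset.sum_congr rfl fun _ _ => by ring
  simp only [hJ]
  have hJI := fun ω => JJ_int hG hV hVs m (GG l (m + 1) g ω) (GG_loc l (m + 1) g ω) (fun τ => g0 _)
    (fun τ => gc _) hε (fun τ => gM _)
  have hintg : ∫ z in Set.Ioi (0:ℝ), Ex P x l (fun ω => (ind (survives f y l ω) * V (ω l) (y + Spath f ω l)) *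
      JJ P ν f Vs (m + 1) (GG l (m + 1) g ω) z) =
      Ex P x l (fun ω => (ind (survives f y l ω) * V (ω l) (y + Spath f ω l)) *
        ∫ z in Set.Ioi (0:ℝ), JJ P ν f Vs (m + 1) (GG l (m + 1) g ω) z) := by
    unfold Ex
    rw [integral_finsetSum]
    · refine Finset.sum_congr rfl fun u _ => ?_
      rw [integral_const_mul, integral_const_mul]
    · intro u _
      exact ((hJI _).1.const_mul _).const_mul _
  rw [hintg]
  -- the limit along the shifted sequence
  rw [← tendsto_add_atTop_iff_nat (l + (m + 1))]
  have hcore : Tendsto (fun N : ℕ => (N * √N) * Ex P x l (fun ω => ind (survives f y l ω) * (KL P f ^ N) (fun x' s =>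
      Ex P x' (m + 1) (fun τ => GG l (m + 1) g ω τ (s + Spath f τ (m + 1)) * ind (survives f s (m + 1) τ)))
        (ω l) (y + Spath f ω l))) atTop
      (𝓝 (κ * Ex P x l (fun ω => (ind (survives f y l ω) * V (ω l) (y + Spath f ω l)) *
        ∫ z in Set.Ioi (0:ℝ), JJ P ν f Vs (m + 1) (GG l (m + 1) g ω) z))) := by
    unfold Ex
    simp only [Finset.mul_sum]
    refine tendsto_finsetSum _ fun u _ => ?_
    set ω := pathExt x u with hω
    by_cases hs : survives f y l ω
    · have hy : 0 < y + Spath f ω l := hs l (Finset.mem_Icc.2 ⟨hl, le_rfl⟩)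
      have hi : ind (survives f y l ω) = 1 := by unfold ind; rw [if_pos hs]
      have := (psi_lim hG hV hVs (ω l) hy m (GG l (m + 1) g ω) (GG_loc l (m + 1) g ω) (fun τ => g0 _)
        (fun τ => gc _) hε (fun τ => gM _)).const_mul (wt P x (List.ofFn u))
      rw [← (hJI ω).2] at this
      refine (this.congr fun n => ?_).trans_eq ?_
      · rw [hi]; unfold Ex; ring
      · rw [hi]; congr 1; ring
    · have hi : ind (survives f y l ω) = 0 := by unfold ind; rw [if_neg hs]
      simp only [hi, zero_mul, mul_zero]
      exact tendsto_const_nhds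
  have hr := (ratio_lim (l + (m + 1))).mul hcore
  rw [one_mul] at hr
  refine hr.congr' ?_
  filter_upwards [eventually_gt_atTop 0] with N hN
  have hN' : (0:ℝ) < N := Nat.cast_pos.2 hN
  have hNN : (N:ℝ) * √N ≠ 0 := by positivity
  have en : N + (l + (m + 1)) = l + (N + (m + 1)) := by omega
  rw [← mul_assoc, div_mul_cancel₀ _ hNN, ← Ex_combine l (m + 1) N hl hm g x y, ← en]

end fin3

/-- Theorem 2.7: joint limit for functionals of the beginning and
the end of the trajectory. -/
theorem conditioned_functional_limit [Fintype X] [DecidableEq X] [Nonempty X]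
    (P : X → X → ℝ) (ν f : X → ℝ) (hS : IsStochastic P ν)
    (h1 : Primitive P) (h2 : ∑ x, f x * ν x = 0) (h3 : NonLattice P f)
    (V : X → ℝ → ℝ)
    (hV : ∀ (x : X) (y : ℝ),
      Tendsto (fun n : ℕ =>
          Real.sqrt (sigma2 P ν f) * Real.sqrt (2 * π * n) / 2 *
            Ex P x n (fun ω => ind (survives f y n ω)))
        atTop (nhds (V x y)))
    (Vs : X → ℝ → ℝ)
    (hVs : ∀ (x : X) (z : ℝ),
      Tendsto (fun n : ℕ =>
          Real.sqrt (sigma2 P ν f) * Real.sqrt (2 * π * n) / 2 *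
            Ex (dualK P ν) x n (fun ω => ind (survives (fun b => -f b) z n ω)))
        atTop (nhds (Vs x z))) :
    ∀ (x : X) (y : ℝ) (l m : ℕ), 1 ≤ l → 1 ≤ m →
      ∀ g : (Fin (l + m) → X) → ℝ → ℝ,
        (∀ u z, 0 ≤ z → 0 ≤ g u z) →
        (∀ u, ContinuousOn (g u) (Set.Ici 0)) →
        (∃ ε > 0, ∃ M : ℝ, ∀ u, ∀ z : ℝ, 0 ≤ z → g u z * (1 + z) ^ (2 + ε) ≤ M) →
        Tendsto (fun n : ℕ => (n : ℝ) ^ (3 / 2 : ℝ) *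
            Ex P x n (fun ω =>
              g (fun i => if i.1 < l then ω (i.1 + 1) else ω (n - m + 1 + (i.1 - l)))
                  (y + Spath f ω n) *
                ind (survives f y n ω)))
          atTop
          (nhds (2 / (Real.sqrt (2 * π) * Real.sqrt (sigma2 P ν f) ^ 3) *
            ∫ z in Set.Ioi (0 : ℝ), ∑ xs,
              (Ex P x l (fun ω => Ex (dualK P ν) xs m (fun ωs =>
                  g (fun i => if i.1 < l then ω (i.1 + 1) else ωs (m - (i.1 - l))) z *
                      V (ω l) (y + Spath f ω l) *
                      Vs (ωs m) (z + Spath (fun u => -f u) ωs m) *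
                    ind (survives f y l ω ∧ survives (fun u => -f u) z m ωs)))) *
                ν xs)) := by
  intro x y l m hl hm g g0 gc hgM
  obtain ⟨ε, hε, M, gM⟩ := hgM
  have hG : Good P ν f := ⟨hS, h1, h2, h3⟩
  have hV' : HasV P ν f V := fun x y => (hV x y).congr fun n => by rw [Ex_sv]
  have hVs' : HasV (dualK P ν) ν (fun b => -f b) Vs := fun x z => by
    rw [sigma2_dual hS]
    exact (hVs x z).congr fun n => by rw [Ex_sv]
  exact cfl_aux hG hV' hVs' x y l m hl hm g g0 gc hε gM
end CLLT
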